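/- (Weak structure theorem.) There is an absolute constant C > 0 such that the following holds. Let K ≥ 1 be a real number and let P be a set of n points in the real projective plane ℝP² spanning at most Kn ordinary lines, with n ≥ exp(exp(C·K^C)). Then there is an algebraic curve γ of degree at most 3 in ℝP² such that all but at most C·K^C points of P lie on γ. -/

import Mathlib

/-- The real projective plane: one-dimensional subspaces of `ℝ³`. -/
abbrev RP2 := Projectivization ℝ (Fin 3 → ℝ)

/-- A line in `ℝP²`: the set of points contained in a fixed
two-dimensional linear subspace of `ℝ³`. -/
def IsProjLine (L : Set RP2) : Prop :=
  ∃ W : Submodule ℝ (Fin 3 → ℝ), Module.finrank ℝ W = 2 ∧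
    L = {x : RP2 | x.submodule ≤ W}

/-- The number of ordinary lines of `P`: lines containing exactly two points of `P`. -/
noncomputable def numOrdinaryLines (P : Set RP2) : ℕ :=
  {L : Set RP2 | IsProjLine L ∧ (P ∩ L).ncard = 2}.ncard

/-- An algebraic curve of degree at most `3` in `ℝP²`: the zero set of a nonzero
homogeneous polynomial in three real variables of degree `1`, `2` or `3`. -/
def IsCurveDegLE3 (Z : Set RP2) : Prop :=
  ∃ (p : MvPolynomial (Fin 3) ℝ) (d : ℕ), p ≠ 0 ∧ 1 ≤ d ∧ d ≤ 3 ∧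
    p.IsHomogeneous d ∧ Z = {x : RP2 | MvPolynomial.eval x.rep p = 0}

namespace WS
noncomputable section
open scoped Classical

def nxt (S : Finset ℝ) (x : ℝ) : ℝ :=
  if h : (S.filter (fun y => x < y)).Nonempty then (S.filter (fun y => x < y)).min' h else x
def prv (S : Finset ℝ) (x : ℝ) : ℝ :=
  if h : (S.filter (fun y => y < x)).Nonempty then (S.filter (fun y => y < x)).max' h else x
def lo (S : Finset ℝ) : ℝ := if h : S.Nonempty then S.min' h else 0

lemma nxt_spec {S : Finset ℝ} {x : ℝ} (h : ∃ y ∈ S, x < y) :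
    nxt S x ∈ S ∧ x < nxt S x ∧ ∀ y ∈ S, x < y → nxt S x ≤ y := by
  have hn : (S.filter (fun y => x < y)).Nonempty := by
    obtain ⟨y, hy, hxy⟩ := h
    exact ⟨y, by simp [hy, hxy]⟩
  unfold nxt
  rw [dif_pos hn]
  have h1 := Finset.min'_mem _ hn
  rw [Finset.mem_filter] at h1
  exact ⟨h1.1, h1.2, fun y hy hxy => Finset.min'_le _ _ (by simp [hy, hxy])⟩

lemma prv_spec {S : Finset ℝ} {x : ℝ} (h : ∃ y ∈ S, y < x) :
    prv S x ∈ S ∧ prv S x < x ∧ ∀ y ∈ S, y < x → y ≤ prv S x := by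
  have hn : (S.filter (fun y => y < x)).Nonempty := by
    obtain ⟨y, hy, hxy⟩ := h
    exact ⟨y, by simp [hy, hxy]⟩
  unfold prv
  rw [dif_pos hn]
  have h1 := Finset.max'_mem _ hn
  rw [Finset.mem_filter] at h1
  exact ⟨h1.1, h1.2, fun y hy hxy => Finset.le_max' _ _ (by simp [hy, hxy])⟩

lemma lo_spec {S : Finset ℝ} (h : S.Nonempty) : lo S ∈ S ∧ ∀ y ∈ S, lo S ≤ y := by
  unfold lo
  rw [dif_pos h]
  exact ⟨Finset.min'_mem _ h, fun y hy => Finset.min'_le _ _ hy⟩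

lemma prv_nxt {S : Finset ℝ} {x : ℝ} (hx : x ∈ S) (h : ∃ y ∈ S, x < y) : prv S (nxt S x) = x := by
  obtain ⟨h1, h2, h3⟩ := nxt_spec h
  obtain ⟨h4, h5, h6⟩ := prv_spec (S := S) (x := nxt S x) ⟨x, hx, h2⟩
  apply le_antisymm _ (h6 x hx h2)
  by_contra hc
  push Not at hc
  linarith [h3 _ h4 hc]

lemma nxt_prv {S : Finset ℝ} {x : ℝ} (hx : x ∈ S) (h : ∃ y ∈ S, y < x) : nxt S (prv S x) = x := by
  obtain ⟨h1, h2, h3⟩ := prv_spec h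
  obtain ⟨h4, h5, h6⟩ := nxt_spec (S := S) (x := prv S x) ⟨x, hx, h2⟩
  apply le_antisymm (h6 x hx h2)
  by_contra hc
  push Not at hc
  linarith [h3 _ h4 hc]

/-- dual line -/
def fl (b : ℝ → ℝ) (a x : ℝ) : ℝ := a * x - b a
/-- points of `A` on the line of slope `x` through `a` -/
def Ln (A : Finset ℝ) (b : ℝ → ℝ) (a x : ℝ) : Finset ℝ := A.filter (fun c => fl b c x = fl b a x)
def slp (b : ℝ → ℝ) (a c : ℝ) : ℝ := (b c - b a) / (c - a)
def Ms (A : Finset ℝ) (b : ℝ → ℝ) (a : ℝ) : Finset ℝ := (A.erase a).image (fun c => slp b a c)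

abbrev Dart := ℝ × ℝ × Bool

variable (A : Finset ℝ) (b : ℝ → ℝ)

lemma fl_sub {a c : ℝ} (h : c ≠ a) (x : ℝ) : fl b c x - fl b a x = (c - a) * (x - slp b a c) := by
  unfold fl slp
  have : c - a ≠ 0 := sub_ne_zero.2 h
  field_simp
  ring

lemma fl_eq_iff {a c : ℝ} (h : c ≠ a) (x : ℝ) : fl b c x = fl b a x ↔ x = slp b a c := by
  have h1 := fl_sub b h x
  have : c - a ≠ 0 := sub_ne_zero.2 h
  constructor
  · intro h2
    rw [h2, sub_self] at h1
    have := (mul_eq_zero.1 h1.symm).resolve_left this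
    linarith
  · intro h2
    rw [← h2] at h1
    linarith

lemma slp_comm (a c : ℝ) : slp b a c = slp b c a := by
  unfold slp
  rw [← neg_sub (b c), ← neg_sub c, neg_div_neg_eq]

variable {A b}

lemma mem_Ln {a x c : ℝ} : c ∈ Ln A b a x ↔ c ∈ A ∧ fl b c x = fl b a x := by simp [Ln]

lemma mem_Ms {a x : ℝ} : x ∈ Ms A b a ↔ ∃ c ∈ A, c ≠ a ∧ fl b c x = fl b a x := by
  simp only [Ms, Finset.mem_image, Finset.mem_erase]
  constructor
  · rintro ⟨c, ⟨h1, h2⟩, h3⟩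
    exact ⟨c, h2, h1, (fl_eq_iff b h1 x).2 h3.symm⟩
  · rintro ⟨c, h2, h1, h3⟩
    exact ⟨c, ⟨h1, h2⟩, ((fl_eq_iff b h1 x).1 h3).symm⟩

lemma slp_mem {a c : ℝ} (hc : c ∈ A) (h : c ≠ a) : slp b a c ∈ Ms A b a :=
  mem_Ms.2 ⟨c, hc, h, (fl_eq_iff b h _).2 rfl⟩

lemma mem_Ln_self {a x : ℝ} (ha : a ∈ A) : a ∈ Ln A b a x := mem_Ln.2 ⟨ha, rfl⟩

lemma Ln_eq {a x c : ℝ} (h : c ∈ Ln A b a x) : Ln A b c x = Ln A b a x := by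
  ext e
  rw [mem_Ln, mem_Ln, (mem_Ln.1 h).2]

lemma Ms_of_Ln {a x c : ℝ} (ha : a ∈ A) (hx : x ∈ Ms A b a) (h : c ∈ Ln A b a x) : x ∈ Ms A b c := by
  by_cases hca : c = a
  · subst hca; exact hx
  · exact mem_Ms.2 ⟨a, ha, fun h => hca h.symm, (mem_Ln.1 h).2.symm⟩

lemma two_common {a c x y : ℝ} (h : c ≠ a) (hx : fl b c x = fl b a x) (hy : fl b c y = fl b a y) : x = y := by
  rw [(fl_eq_iff b h x).1 hx, (fl_eq_iff b h y).1 hy]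

variable (A b)

def Dt : Finset Dart :=
  (A ×ˢ ((A.biUnion (Ms A b)) ×ˢ (Finset.univ : Finset Bool))).filter (fun d => d.2.1 ∈ Ms A b d.1)

lemma mem_Dt {a x : ℝ} {e : Bool} : (a, x, e) ∈ Dt A b ↔ a ∈ A ∧ x ∈ Ms A b a := by
  simp only [Dt, Finset.mem_filter, Finset.mem_product, Finset.mem_biUnion, Finset.mem_univ, and_true]
  constructor
  · rintro ⟨⟨h1, _⟩, h2⟩; exact ⟨h1, h2⟩
  · rintro ⟨h1, h2⟩; exact ⟨⟨h1, a, h1, h2⟩, h2⟩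

def Bdd : Dart → Prop
  | (a, x, true) => ∃ y ∈ Ms A b a, x < y
  | (a, x, false) => ∃ y ∈ Ms A b a, y < x

def tau : Dart → Dart
  | (a, x, true) => if ∃ y ∈ Ms A b a, x < y then (a, nxt (Ms A b a) x, false) else (a, x, true)
  | (a, x, false) => if ∃ y ∈ Ms A b a, y < x then (a, prv (Ms A b a) x, true) else (a, x, false)

def rho : Dart → Dart
  | (a, x, e) => if ∃ c ∈ Ln A b a x, a < c then (nxt (Ln A b a x) a, x, e) else (lo (Ln A b a x), x, !e)

variable {A b}

lemma tau_mem {d : Dart} (hd : d ∈ Dt A b) : tau A b d ∈ Dt A b := by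
  obtain ⟨a, x, _ | _⟩ := d
  · rw [tau]; split_ifs with h
    · rw [mem_Dt] at hd ⊢; exact ⟨hd.1, (prv_spec h).1⟩
    · exact hd
  · rw [tau]; split_ifs with h
    · rw [mem_Dt] at hd ⊢; exact ⟨hd.1, (nxt_spec h).1⟩
    · exact hd

lemma tau_tau {d : Dart} (hd : d ∈ Dt A b) : tau A b (tau A b d) = d := by
  obtain ⟨a, x, _ | _⟩ := d
  · rw [tau]; split_ifs with h
    · rw [mem_Dt] at hd
      rw [tau, if_pos ⟨x, hd.2, (prv_spec h).2.1⟩, nxt_prv hd.2 h]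
    · rw [tau, if_neg h]
  · rw [tau]; split_ifs with h
    · rw [mem_Dt] at hd
      rw [tau, if_pos ⟨x, hd.2, (nxt_spec h).2.1⟩, prv_nxt hd.2 h]
    · rw [tau, if_neg h]

lemma tau_fst (d : Dart) : (tau A b d).1 = d.1 := by
  obtain ⟨a, x, _ | _⟩ := d <;> rw [tau] <;> split_ifs <;> rfl

lemma tau_ne {d : Dart} (h : Bdd A b d) : (tau A b d).2.1 ≠ d.2.1 := by
  obtain ⟨a, x, _ | _⟩ := d
  · rw [Bdd] at h; rw [tau, if_pos h]; exact (prv_spec h).2.1.ne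
  · rw [Bdd] at h; rw [tau, if_pos h]; exact (nxt_spec h).2.1.ne'

lemma tau_inj : Set.InjOn (tau A b) (Dt A b) := by
  intro d hd e he h
  rw [← tau_tau hd, ← tau_tau he, h]

lemma rho_snd (d : Dart) : (rho A b d).2.1 = d.2.1 := by
  obtain ⟨a, x, e⟩ := d
  rw [rho]; split_ifs <;> rfl

lemma rho_Ln {d : Dart} (hd : d ∈ Dt A b) : (rho A b d).1 ∈ Ln A b d.1 d.2.1 := by
  obtain ⟨a, x, e⟩ := d
  rw [mem_Dt] at hd
  rw [rho]; split_ifs with h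
  · exact (nxt_spec h).1
  · exact (lo_spec ⟨a, mem_Ln_self hd.1⟩).1

lemma rho_mem {d : Dart} (hd : d ∈ Dt A b) : rho A b d ∈ Dt A b := by
  have h1 := rho_Ln hd
  have h2 := rho_snd (A := A) (b := b) d
  rcases h : rho A b d with ⟨c, y, e'⟩
  obtain ⟨a, x, e⟩ := d
  rw [h] at h1 h2
  simp only at h1 h2
  subst h2
  rw [mem_Dt] at hd ⊢
  exact ⟨(mem_Ln.1 h1).1, Ms_of_Ln hd.1 hd.2 h1⟩

lemma rho_ne {d : Dart} (hd : d ∈ Dt A b) : (rho A b d).1 ≠ d.1 := by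
  obtain ⟨a, x, e⟩ := d
  rw [mem_Dt] at hd
  rw [rho]; split_ifs with h
  · exact (nxt_spec h).2.1.ne'
  · obtain ⟨c, hc, hca, hf⟩ := mem_Ms.1 hd.2
    have hcL : c ∈ Ln A b a x := mem_Ln.2 ⟨hc, hf⟩
    have h1 := (lo_spec ⟨c, hcL⟩).2 c hcL
    push Not at h
    have h2 := lt_of_le_of_ne (h c hcL) hca
    exact (h1.trans_lt h2).ne

lemma rho_inj : Set.InjOn (rho A b) (Dt A b) := by
  rintro ⟨a, x, e⟩ hd ⟨a', x', e'⟩ hd' h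
  have hx : x = x' := by
    have := congrArg (fun d : Dart => d.2.1) h
    simpa only [rho_snd] using this
  subst hx
  have hL : Ln A b a x = Ln A b a' x := by
    have h1 := rho_Ln hd
    have h2 := rho_Ln hd'
    rw [← h] at h2
    simp only at h1 h2
    rw [← Ln_eq h1, ← Ln_eq h2]
  have ha : a ∈ Ln A b a' x := hL ▸ mem_Ln_self (mem_Dt A b |>.1 hd).1
  have ha' : a' ∈ Ln A b a' x := mem_Ln_self (mem_Dt A b |>.1 hd').1
  rw [rho, rho, hL] at h
  split_ifs at h with h1 h2 h2
  · obtain ⟨p1, p2, p3⟩ := nxt_spec h1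
    obtain ⟨q1, q2, q3⟩ := nxt_spec h2
    simp only [Prod.mk.injEq] at h
    have : a = a' := by
      rcases lt_trichotomy a a' with h3 | h3 | h3
      · linarith [p3 a' ha' h3]
      · exact h3
      · linarith [q3 a ha h3]
    rw [this, h.2.2]
  · obtain ⟨p1, p2, p3⟩ := nxt_spec h1
    simp only [Prod.mk.injEq] at h
    have := (lo_spec ⟨_, ha⟩).2 _ ha
    linarith
  · obtain ⟨p1, p2, p3⟩ := nxt_spec h2
    simp only [Prod.mk.injEq] at h
    have := (lo_spec ⟨_, ha'⟩).2 _ ha'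
    linarith
  · push Not at h1 h2
    have : a = a' := le_antisymm (h2 a ha) (h1 a' ha')
    simp only [Prod.mk.injEq] at h
    rw [this]
    have := h.2.2
    revert this
    cases e <;> cases e' <;> simp

/-! ### faces -/

variable (A b) in
def Rt : Dart → Finset ℝ
  | (a, x, true) => A.filter (fun r => fl b a x < fl b r x ∨ (fl b r x = fl b a x ∧ a ≤ r))
  | (a, x, false) => A.filter (fun r => fl b a x < fl b r x ∨ (fl b r x = fl b a x ∧ r < a))

variable (A b) in
def Lf : Dart → Finset ℝ
  | (a, x, true) => A.filter (fun r => fl b a x < fl b r x ∨ (fl b r x = fl b a x ∧ a < r))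
  | (a, x, false) => A.filter (fun r => fl b a x < fl b r x ∨ (fl b r x = fl b a x ∧ r ≤ a))

lemma Lf_eq {d : Dart} (hd : d ∈ Dt A b) : Lf A b d = Rt A b (rho A b d) := by
  obtain ⟨a, x, e⟩ := d
  have hd' := (mem_Dt A b).1 hd
  have hself := mem_Ln_self (b := b) (x := x) hd'.1
  rw [rho]; split_ifs with h
  · obtain ⟨p1, p2, p3⟩ := nxt_spec h
    set c := nxt (Ln A b a x) a
    have hc := (mem_Ln.1 p1).2
    cases e
    · ext r
      simp only [Lf, Rt, Finset.mem_filter, hc]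
      refine and_congr_right fun hr => or_congr_right (and_congr_right fun h4 => ?_)
      constructor
      · intro h5; linarith
      · intro h5
        by_contra h6
        push Not at h6
        linarith [p3 r (mem_Ln.2 ⟨hr, h4⟩) h6]
    · ext r
      simp only [Lf, Rt, Finset.mem_filter, hc]
      refine and_congr_right fun hr => or_congr_right (and_congr_right fun h4 => ?_)
      constructor
      · intro h5; exact p3 r (mem_Ln.2 ⟨hr, h4⟩) h5
      · intro h5; linarith
  · obtain ⟨p1, p2⟩ := lo_spec ⟨_, hself⟩
    set c := lo (Ln A b a x)
    have hc := (mem_Ln.1 p1).2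
    push Not at h
    cases e
    · ext r
      simp only [Lf, Rt, Finset.mem_filter, hc, Bool.not_false]
      refine and_congr_right fun hr => or_congr_right (and_congr_right fun h4 => ?_)
      have := p2 r (mem_Ln.2 ⟨hr, h4⟩)
      have := h r (mem_Ln.2 ⟨hr, h4⟩)
      constructor <;> intro <;> assumption
    · ext r
      simp only [Lf, Rt, Finset.mem_filter, hc, Bool.not_true]
      refine and_congr_right fun hr => or_congr_right (and_congr_right fun h4 => ?_)
      have := p2 r (mem_Ln.2 ⟨hr, h4⟩)
      have := h r (mem_Ln.2 ⟨hr, h4⟩)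
      constructor <;> intro <;> linarith

lemma fl_lt_iff {a r x : ℝ} (h : a < r) : fl b a x < fl b r x ↔ slp b a r < x := by
  have h1 := fl_sub b h.ne' x
  have : 0 < r - a := sub_pos.2 h
  constructor
  · intro h2
    by_contra h3
    push Not at h3
    nlinarith
  · intro h2
    nlinarith

lemma fl_lt_iff' {a r x : ℝ} (h : r < a) : fl b a x < fl b r x ↔ x < slp b a r := by
  have h1 := fl_sub b h.ne x
  have : 0 < a - r := sub_pos.2 h
  constructor
  · intro h2
    by_contra h3
    push Not at h3
    nlinarith
  · intro h2
    nlinarith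

lemma Rt_true_aux (a x r : ℝ) : (fl b a x < fl b r x ∨ (fl b r x = fl b a x ∧ a ≤ r)) ↔
    (r = a ∨ (a < r ∧ slp b a r ≤ x) ∨ (r < a ∧ x < slp b a r)) := by
  rcases lt_trichotomy a r with h | h | h
  · rw [fl_lt_iff h, fl_eq_iff b h.ne', le_iff_lt_or_eq (a := slp b a r), eq_comm (a := x)]
    simp [h, h.ne', h.le, h.not_gt]
  · subst h; simp
  · rw [fl_lt_iff' h]
    simp [h, h.ne, h.not_ge, h.not_gt]

lemma Lf_false_aux (a x r : ℝ) : (fl b a x < fl b r x ∨ (fl b r x = fl b a x ∧ r ≤ a)) ↔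
    (r = a ∨ (a < r ∧ slp b a r < x) ∨ (r < a ∧ x ≤ slp b a r)) := by
  rcases lt_trichotomy a r with h | h | h
  · rw [fl_lt_iff h]
    simp [h, h.ne', h.not_ge, h.not_gt]
  · subst h; simp
  · rw [fl_lt_iff' h, fl_eq_iff b h.ne, le_iff_lt_or_eq (a := x)]
    simp [h, h.ne, h.le, h.not_gt]

lemma Rt_false_aux (a x r : ℝ) : (fl b a x < fl b r x ∨ (fl b r x = fl b a x ∧ r < a)) ↔
    ((a < r ∧ slp b a r < x) ∨ (r < a ∧ x ≤ slp b a r)) := by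
  rcases lt_trichotomy a r with h | h | h
  · rw [fl_lt_iff h]
    simp [h, h.not_gt]
  · subst h; simp
  · rw [fl_lt_iff' h, fl_eq_iff b h.ne, le_iff_lt_or_eq (a := x)]
    simp [h, h.not_gt]

lemma Lf_true_aux (a x r : ℝ) : (fl b a x < fl b r x ∨ (fl b r x = fl b a x ∧ a < r)) ↔
    ((a < r ∧ slp b a r ≤ x) ∨ (r < a ∧ x < slp b a r)) := by
  rcases lt_trichotomy a r with h | h | h
  · rw [fl_lt_iff h, fl_eq_iff b h.ne', le_iff_lt_or_eq]
    simp only [h, h.not_gt, and_true, true_and, false_and, or_false]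
    rw [eq_comm (a := x)]
  · subst h; simp
  · rw [fl_lt_iff' h]
    simp [h, h.not_gt]

lemma Rt_eq {d : Dart} (hd : d ∈ Dt A b) (hb : Bdd A b d) : Rt A b d = Lf A b (tau A b d) := by
  obtain ⟨a, x, _ | _⟩ := d
  · have hd' := (mem_Dt A b).1 hd
    rw [Bdd] at hb
    rw [tau, if_pos hb]
    obtain ⟨p1, p2, p3⟩ := prv_spec hb
    ext r
    simp only [Rt, Lf, Finset.mem_filter]
    refine and_congr_right fun hr => ?_
    rw [Rt_false_aux, Lf_true_aux]
    refine or_congr (and_congr_right fun h => ?_) (and_congr_right fun h => ?_)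
    · have := p3 _ (slp_mem (b := b) hr h.ne')
      exact ⟨this, fun h => by linarith⟩
    · have := p3 _ (slp_mem (b := b) hr h.ne)
      constructor
      · intro; linarith
      · intro h; by_contra h2; push Not at h2; linarith [this h2]
  · have hd' := (mem_Dt A b).1 hd
    rw [Bdd] at hb
    rw [tau, if_pos hb]
    obtain ⟨p1, p2, p3⟩ := nxt_spec hb
    ext r
    simp only [Rt, Lf, Finset.mem_filter]
    refine and_congr_right fun hr => ?_
    rw [Rt_true_aux, Lf_false_aux]
    refine or_congr_right (or_congr (and_congr_right fun h => ?_) (and_congr_right fun h => ?_))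
    · have := p3 _ (slp_mem (b := b) hr h.ne')
      constructor
      · intro; linarith
      · intro h; by_contra h2; push Not at h2; linarith [this h2]
    · have := p3 _ (slp_mem (b := b) hr h.ne)
      exact ⟨this, fun h => by linarith⟩

variable (A b) in
def sig (d : Dart) : Dart := rho A b (tau A b d)

lemma sig_mem {d : Dart} (hd : d ∈ Dt A b) : sig A b d ∈ Dt A b := rho_mem (tau_mem hd)
lemma sig_inj : Set.InjOn (sig A b) (Dt A b) := by
  intro d hd e he h
  exact tau_inj hd he (rho_inj (tau_mem hd) (tau_mem he) h)

lemma Rt_sig {d : Dart} (hd : d ∈ Dt A b) (hb : Bdd A b d) : Rt A b (sig A b d) = Rt A b d := by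
  rw [Rt_eq hd hb, Lf_eq (tau_mem hd), sig]

lemma sig_ne {d : Dart} (hd : d ∈ Dt A b) : (sig A b d).1 ≠ d.1 := by
  have := rho_ne (tau_mem hd)
  rw [tau_fst] at this
  exact this

lemma sig_fl {d : Dart} (hd : d ∈ Dt A b) :
    fl b (sig A b d).1 (tau A b d).2.1 = fl b d.1 (tau A b d).2.1 := by
  have := (mem_Ln.1 (rho_Ln (tau_mem hd))).2
  rw [tau_fst] at this
  exact this

lemma sig_snd (d : Dart) : (sig A b d).2.1 = (tau A b d).2.1 := rho_snd _

lemma sig_sig_ne {d : Dart} (hd : d ∈ Dt A b) (hb : Bdd A b d) : sig A b (sig A b d) ≠ d := by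
  intro h
  have h1 := sig_fl hd
  have h2 := sig_fl (sig_mem hd)
  rw [← sig_snd (sig A b d), h] at h2
  exact tau_ne hb (two_common (sig_ne hd) h1 h2.symm)

lemma three_le {F : Finset ℝ} (hF : ∀ d ∈ Dt A b, Rt A b d = F → Bdd A b d) {d : Dart}
    (hd : d ∈ Dt A b) (hdF : Rt A b d = F) : 3 ≤ ((Dt A b).filter (fun e => Rt A b e = F)).card ∧
    (((Dt A b).filter (fun e => Rt A b e = F)).card = 3 → sig A b (sig A b (sig A b d)) = d) := by
  have m1 := sig_mem hd
  have m2 := sig_mem m1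
  have m3 := sig_mem m2
  have b0 := hF _ hd hdF
  have f1 := (Rt_sig hd b0).trans hdF
  have b1 := hF _ m1 f1
  have f2 := (Rt_sig m1 b1).trans f1
  have b2 := hF _ m2 f2
  have f3 := (Rt_sig m2 b2).trans f2
  have n1 : sig A b d ≠ d := fun h => sig_ne hd (congrArg Prod.fst h)
  have n2 : sig A b (sig A b d) ≠ sig A b d := fun h => sig_ne m1 (congrArg Prod.fst h)
  have n3 := sig_sig_ne hd b0
  have hc : ({d, sig A b d, sig A b (sig A b d)} : Finset Dart).card = 3 :=
    Finset.card_eq_three.2 ⟨_, _, _, n1.symm, n3.symm, n2.symm, rfl⟩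
  have hsub : ({d, sig A b d, sig A b (sig A b d)} : Finset Dart) ⊆
      (Dt A b).filter (fun e => Rt A b e = F) := by
    intro e he
    simp only [Finset.mem_insert, Finset.mem_singleton] at he
    rw [Finset.mem_filter]
    rcases he with rfl | rfl | rfl
    · exact ⟨hd, hdF⟩
    · exact ⟨m1, f1⟩
    · exact ⟨m2, f2⟩
  refine ⟨hc ▸ Finset.card_le_card hsub, fun h => ?_⟩
  have heq := Finset.eq_of_subset_of_card_le hsub (by rw [hc, h])
  have h3 : sig A b (sig A b (sig A b d)) ∈ (Dt A b).filter (fun e => Rt A b e = F) := by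
    rw [Finset.mem_filter]; exact ⟨m3, f3⟩
  rw [← heq] at h3
  simp only [Finset.mem_insert, Finset.mem_singleton] at h3
  rcases h3 with h | h | h
  · exact h
  · exact absurd (sig_inj m2 hd h) n3
  · exact absurd (sig_inj m2 m1 h) n2

end
end WS

namespace WS
noncomputable section
open scoped Classical
variable (A : Finset ℝ) (b : ℝ → ℝ)

def DR : Finset Dart := (Dt A b).filter (fun d => d.2.2 = true)
def Vm : Finset Dart := (DR A b).filter (fun d => ∀ c ∈ Ln A b d.1 d.2.1, d.1 ≤ c)
def kk (d : Dart) : ℕ := (Ln A b d.1 d.2.1).card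
def sF (F : Finset ℝ) : ℕ := ((Dt A b).filter (fun e => Rt A b e = F)).card
def Bad0 (d : Dart) : Prop :=
  kk A b d ≠ 3 ∨ (∃ e ∈ Dt A b, Rt A b e = Rt A b d ∧ ¬ Bdd A b e) ∨ sF A b (Rt A b d) ≠ 3
def N2 : ℕ := ((Vm A b).filter (fun d => kk A b d = 2)).card

variable {A b}

lemma mem_DR {a x : ℝ} {e : Bool} : (a, x, e) ∈ DR A b ↔ a ∈ A ∧ x ∈ Ms A b a ∧ e = true := by
  rw [DR, Finset.mem_filter, mem_Dt, and_assoc]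

lemma mem_Rt_le {q x r : ℝ} (h : r ∈ Rt A b (q, x, true)) : fl b q x ≤ fl b r x := by
  simp only [Rt, Finset.mem_filter] at h
  rcases h.2 with h | h
  · exact h.le
  · exact h.1.ge

lemma not_mem_Rt_le {q x r : ℝ} (hr : r ∈ A) (h : r ∉ Rt A b (q, x, true)) : fl b r x ≤ fl b q x := by
  simp only [Rt, Finset.mem_filter, hr, true_and, not_or, not_lt] at h
  exact h.1

lemma Rt_inj_aux {q x q' x' p : ℝ} (hp : p ∈ Ln A b q x) (hpq : p < q) (hq : q ∈ A)
    (h : Rt A b (q, x, true) = Rt A b (q', x', true)) : x ≤ x' ∧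
      fl b p x' ≤ fl b q' x' ∧ fl b q' x' ≤ fl b q x' := by
  have h1 : q ∈ Rt A b (q, x, true) := by simp [Rt, hq]
  have h2 : p ∉ Rt A b (q, x, true) := by
    simp only [Rt, Finset.mem_filter, not_and, not_or, not_lt, not_le]
    exact fun _ => ⟨(mem_Ln.1 hp).2.le, fun _ => hpq⟩
  rw [h] at h1 h2
  have h3 := mem_Rt_le h1
  have h4 := not_mem_Rt_le (mem_Ln.1 hp).1 h2
  refine ⟨?_, h4, h3⟩
  have h5 := fl_sub b hpq.ne x'
  have h6 := (fl_eq_iff b hpq.ne x).1 (mem_Ln.1 hp).2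
  rw [← h6] at h5
  by_contra h7
  push Not at h7
  nlinarith

lemma Rt_inj : Set.InjOn (Rt A b) ((DR A b).filter (fun d => ¬ ∀ c ∈ Ln A b d.1 d.2.1, d.1 ≤ c)) := by
  rintro ⟨q, x, e⟩ hd ⟨q', x', e'⟩ hd' h
  simp only [Finset.coe_filter, Set.mem_ofPred_eq, mem_DR] at hd hd'
  obtain ⟨⟨hq, hx, rfl⟩, h1⟩ := hd
  obtain ⟨⟨hq', hx', rfl⟩, h1'⟩ := hd'
  push Not at h1 h1'
  obtain ⟨p, hp, hpq⟩ := h1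
  obtain ⟨p', hp', hpq'⟩ := h1'
  obtain ⟨u1, u2, u3⟩ := Rt_inj_aux hp hpq hq h
  obtain ⟨v1, v2, v3⟩ := Rt_inj_aux hp' hpq' hq' h.symm
  obtain rfl := le_antisymm u1 v1
  have e1 := (mem_Ln.1 hp).2
  have e2 := (mem_Ln.1 hp').2
  have e3 : fl b q' x = fl b q x := by linarith
  have w1 : q ≤ q' := by
    have : q' ∈ Rt A b (q, x, true) := by rw [h]; simp [Rt, hq']
    simp only [Rt, Finset.mem_filter, e3, lt_irrefl, false_or, true_and] at this
    exact this.2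
  have w2 : q' ≤ q := by
    have : q ∈ Rt A b (q', x, true) := by rw [← h]; simp [Rt, hq]
    simp only [Rt, Finset.mem_filter, e3, lt_irrefl, false_or, true_and] at this
    exact this.2
  rw [le_antisymm w1 w2]

lemma card_faces : (DR A b).card ≤ (Vm A b).card + ((Dt A b).image (Rt A b)).card := by
  rw [← Finset.card_filter_add_card_filter_not (s := DR A b) (p := fun d => ∀ c ∈ Ln A b d.1 d.2.1, d.1 ≤ c)]
  refine Nat.add_le_add le_rfl ?_
  rw [← Finset.card_image_of_injOn Rt_inj]
  apply Finset.card_le_card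
  apply Finset.image_subset_image
  exact (Finset.filter_subset _ _).trans (Finset.filter_subset _ _)

lemma card_kk_Dt (Q : ℕ → Prop) : ((Dt A b).filter (fun d => Q (kk A b d))).card =
    2 * ((DR A b).filter (fun d => Q (kk A b d))).card := by
  rw [← Finset.card_filter_add_card_filter_not (p := fun d => d.2.2 = true), two_mul]
  congr 1
  · congr 1
    ext d; simp only [DR, Finset.mem_filter]; tauto
  · refine Finset.card_bij' (fun d _ => (d.1, d.2.1, true)) (fun d _ => (d.1, d.2.1, false)) ?_ ?_ ?_ ?_
    · rintro ⟨a, x, e⟩ h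
      simp only [Finset.mem_filter, mem_Dt, mem_DR] at h ⊢
      exact ⟨⟨h.1.1.1, h.1.1.2, trivial⟩, h.1.2⟩
    · rintro ⟨a, x, e⟩ h
      simp only [Finset.mem_filter, mem_Dt, mem_DR] at h ⊢
      exact ⟨⟨⟨h.1.1, h.1.2.1⟩, h.2⟩, by simp⟩
    · rintro ⟨a, x, e⟩ h
      simp only [Finset.mem_filter] at h
      have := h.2
      simp at this
      simp [this]
    · rintro ⟨a, x, e⟩ h
      simp only [Finset.mem_filter, mem_DR] at h
      simp [h.1.2.2]

lemma card_kk_DR (Q : ℕ → Prop) : ((DR A b).filter (fun d => Q (kk A b d))).card =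
    ∑ d ∈ (Vm A b).filter (fun d => Q (kk A b d)), kk A b d := by
  rw [Finset.card_eq_sum_card_fiberwise (f := fun d => (lo (Ln A b d.1 d.2.1), d.2.1, true))
    (t := (Vm A b).filter (fun d => Q (kk A b d)))]
  · refine Finset.sum_congr rfl ?_
    rintro ⟨a, x, e⟩ h
    simp only [Vm, Finset.mem_filter, mem_DR] at h
    obtain ⟨⟨⟨ha, hx, rfl⟩, hmin⟩, hQ⟩ := h
    rw [kk]
    rw [← Finset.card_image_of_injective (Ln A b a x) (f := fun c => ((c, x, true) : Dart))]
    · congr 1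
      ext ⟨c, y, e⟩
      simp only [Finset.mem_filter, mem_DR, Finset.mem_image, Prod.mk.injEq]
      constructor
      · rintro ⟨⟨⟨hc, hy, rfl⟩, hQ'⟩, h1, rfl, -⟩
        refine ⟨c, ?_, rfl, rfl, rfl⟩
        have := (lo_spec ⟨_, mem_Ln_self (b := b) (x := y) hc⟩).1
        rw [h1] at this
        rw [Ln_eq this]
        exact mem_Ln_self hc
      · rintro ⟨c', hc', rfl, rfl, rfl⟩
        have h1 : Ln A b c' x = Ln A b a x := Ln_eq hc'
        refine ⟨⟨⟨(mem_Ln.1 hc').1, Ms_of_Ln ha hx hc', rfl⟩, ?_⟩, ?_, rfl, trivial⟩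
        · simpa [kk, h1] using hQ
        · rw [h1]
          have := lo_spec ⟨_, mem_Ln_self (b := b) (x := x) ha⟩
          exact le_antisymm (this.2 _ (mem_Ln_self ha)) (hmin _ this.1)
    · intro c c' h
      simpa using h
  · rintro ⟨a, x, e⟩ h
    simp only [Finset.coe_filter, Set.mem_ofPred_eq, mem_DR, Vm, Finset.mem_filter] at h ⊢
    obtain ⟨⟨ha, hx, rfl⟩, hQ⟩ := h
    have h2 := lo_spec ⟨_, mem_Ln_self (b := b) (x := x) ha⟩
    have h1 := Ln_eq h2.1
    refine ⟨⟨⟨(mem_Ln.1 h2.1).1, Ms_of_Ln ha hx h2.1, trivial⟩, ?_⟩, ?_⟩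
    · rw [h1]; exact h2.2
    · simpa [kk, h1] using hQ

lemma two_le_kk {d : Dart} (hd : d ∈ Dt A b) : 2 ≤ kk A b d := by
  obtain ⟨a, x, e⟩ := d
  rw [mem_Dt] at hd
  obtain ⟨c, hc, hca, hf⟩ := mem_Ms.1 hd.2
  rw [kk, ← Finset.card_pair hca]
  apply Finset.card_le_card
  intro r hr
  simp only [Finset.mem_insert, Finset.mem_singleton] at hr
  rcases hr with rfl | rfl
  · exact mem_Ln.2 ⟨hc, hf⟩
  · exact mem_Ln_self hd.1

lemma card_unb : ((Dt A b).filter (fun d => ¬ Bdd A b d)).card ≤ 2 * A.card := by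
  have : (A ×ˢ (Finset.univ : Finset Bool)).card = 2 * A.card := by simp [mul_comm]
  rw [← this]
  refine Finset.card_le_card_of_injOn (fun d => (d.1, d.2.2)) ?_ ?_
  · rintro ⟨a, x, e⟩ h
    simp only [Finset.coe_filter, Set.mem_ofPred_eq, mem_Dt] at h
    simp [h.1.1]
  · rintro ⟨a, x, e⟩ h ⟨a', x', e'⟩ h' heq
    simp only [Prod.mk.injEq] at heq
    obtain ⟨rfl, rfl⟩ := heq
    simp only [Finset.coe_filter, Set.mem_ofPred_eq, mem_Dt] at h h'
    have : x = x' := by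
      cases e
      · simp only [Bdd] at h h'
        push Not at h h'
        exact le_antisymm (h.2 _ h'.1.2) (h'.2 _ h.1.2)
      · simp only [Bdd] at h h'
        push Not at h h'
        exact le_antisymm (h'.2 _ h.1.2) (h.2 _ h'.1.2)
    rw [this]

lemma card_Bad0 : ((Dt A b).filter (fun d => Bad0 A b d)).card ≤ 12 * N2 A b + 48 * A.card := by
  -- kk part
  have hDR := card_kk_DR (A := A) (b := b) (fun _ => True)
  have hD := card_kk_Dt (A := A) (b := b) (fun _ => True)
  simp only [Finset.filter_true] at hDR hD
  have hk1 : ((DR A b).filter (fun d => kk A b d ≠ 3)).card =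
      ∑ d ∈ (Vm A b).filter (fun d => kk A b d ≠ 3), kk A b d := by
    convert card_kk_DR (A := A) (b := b) (fun k => k ≠ 3)
  have hk2 : ((Dt A b).filter (fun d => kk A b d ≠ 3)).card =
      2 * ((DR A b).filter (fun d => kk A b d ≠ 3)).card := by
    convert card_kk_Dt (A := A) (b := b) (fun k => k ≠ 3)
  have hk : (((Dt A b).filter (fun d => kk A b d ≠ 3)).card : ℤ) ≤
      8 * ((DR A b).card - 3 * (Vm A b).card) + 12 * N2 A b := by
    rw [hk2, hk1, hDR, N2, Finset.sum_filter, Finset.card_filter, Finset.card_eq_sum_ones]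
    push_cast
    simp only [Finset.mul_sum, ← Finset.sum_sub_distrib, ← Finset.sum_add_distrib]
    refine Finset.sum_le_sum fun d hd => ?_
    have h2 : 2 ≤ kk A b d := two_le_kk (Finset.filter_subset _ _ (Finset.filter_subset _ _ hd))
    have h2' : (2 : ℤ) ≤ kk A b d := by exact_mod_cast h2
    split_ifs with h3 h4 h4
    · rw [h4]; norm_num
    · have : 4 ≤ kk A b d := by omega
      have : (4 : ℤ) ≤ kk A b d := by exact_mod_cast this
      push_cast; linarith
    · omega
    · push Not at h3; rw [h3]; norm_num
  -- faces
  set U := ((Dt A b).filter (fun d => ¬ Bdd A b d)).image (Rt A b) with hU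
  have hUc : U.card ≤ 2 * A.card := Finset.card_image_le.trans card_unb
  set W := (Dt A b).image (Rt A b) with hW
  have hWc : (DR A b).card ≤ (Vm A b).card + W.card := card_faces
  have hUW : U ⊆ W := Finset.image_subset_image (Finset.filter_subset _ _)
  have hsum : (Dt A b).card = ∑ F ∈ W, sF A b F := by
    rw [Finset.card_eq_sum_card_image (Rt A b)]; rfl
  have hs3 : ∀ F ∈ W, F ∉ U → 3 ≤ sF A b F := by
    intro F hF hFU
    rw [hW, Finset.mem_image] at hF
    obtain ⟨d, hd, hdF⟩ := hF
    refine (three_le ?_ hd hdF).1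
    intro e he heF
    by_contra hb
    exact hFU (Finset.mem_image.2 ⟨e, Finset.mem_filter.2 ⟨he, hb⟩, heF⟩)
  have hE : ∑ F ∈ W, (if F ∈ U then (sF A b F : ℤ) else (sF A b F : ℤ) - 3) ≤
      3 * (Vm A b).card - (DR A b).card + 6 * A.card := by
    have h1 : ∑ F ∈ W, (if F ∈ U then (sF A b F : ℤ) else (sF A b F : ℤ) - 3) =
        ∑ F ∈ W, ((sF A b F : ℤ) - 3 + if F ∈ U then 3 else 0) := by
      refine Finset.sum_congr rfl fun F _ => ?_
      split_ifs <;> ring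
    rw [h1, Finset.sum_add_distrib, Finset.sum_sub_distrib, Finset.sum_ite_mem,
      Finset.inter_eq_right.2 hUW, Finset.sum_const, Finset.sum_const, ← Nat.cast_sum, ← hsum, hD]
    simp only [nsmul_eq_mul]
    push_cast
    zify at hUc hWc
    linarith
  have hE0 : 0 ≤ ∑ F ∈ W, (if F ∈ U then (sF A b F : ℤ) else (sF A b F : ℤ) - 3) := by
    refine Finset.sum_nonneg fun F hF => ?_
    split_ifs with h
    · positivity
    · have := hs3 F hF h; zify at this; linarith
  have hf : (((Dt A b).filter (fun d => Rt A b d ∈ U ∨ sF A b (Rt A b d) ≠ 3)).card : ℤ) ≤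
      4 * ∑ F ∈ W, (if F ∈ U then (sF A b F : ℤ) else (sF A b F : ℤ) - 3) := by
    rw [Finset.card_eq_sum_card_fiberwise (f := Rt A b) (t := W), Finset.mul_sum]
    · push_cast
      refine Finset.sum_le_sum fun F hF => ?_
      have hle : (((Dt A b).filter (fun d => Rt A b d ∈ U ∨ sF A b (Rt A b d) ≠ 3)).filter
          (fun d => Rt A b d = F)).card ≤ sF A b F := by
        apply Finset.card_le_card
        apply Finset.filter_subset_filter
        exact Finset.filter_subset _ _
      have hle' : ((((Dt A b).filter (fun d => Rt A b d ∈ U ∨ sF A b (Rt A b d) ≠ 3)).filter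
          (fun d => Rt A b d = F)).card : ℤ) ≤ sF A b F := by exact_mod_cast hle
      split_ifs with h
      · have : (0 : ℤ) ≤ sF A b F := by positivity
        linarith
      · have h3 := hs3 F hF h
        rcases h3.eq_or_lt with h4 | h4
        · rw [Finset.card_eq_zero.2, ← h4]
          · norm_num
          · rw [Finset.filter_eq_empty_iff]
            intro d hd hdF
            rw [Finset.mem_filter, hdF, ← h4] at hd
            exact hd.2.elim h (fun h => h rfl)
        · zify at h4
          linarith
    · intro d hd
      exact Finset.mem_image_of_mem _ (Finset.filter_subset _ _ hd)
  have hsub : (Dt A b).filter (fun d => Bad0 A b d) ⊆ (Dt A b).filter (fun d => kk A b d ≠ 3) ∪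
      (Dt A b).filter (fun d => Rt A b d ∈ U ∨ sF A b (Rt A b d) ≠ 3) := by
    intro d hd
    rw [Finset.mem_filter] at hd
    rw [Finset.mem_union, Finset.mem_filter, Finset.mem_filter]
    rcases hd.2 with h | h | h
    · exact Or.inl ⟨hd.1, h⟩
    · right
      obtain ⟨e, he, h1, h2⟩ := h
      exact ⟨hd.1, Or.inl (Finset.mem_image.2 ⟨e, Finset.mem_filter.2 ⟨he, h2⟩, h1⟩)⟩
    · exact Or.inr ⟨hd.1, Or.inr h⟩
  have := (Finset.card_le_card hsub).trans (Finset.card_union_le _ _)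
  rw [← Nat.cast_le (α := ℤ)] at this ⊢
  rw [Nat.cast_add] at this
  push_cast
  linarith

/-! ### good darts -/
variable (A b) in
def Good : ℕ → Dart → Prop
  | 0, d => d ∈ Dt A b ∧ ¬ Bad0 A b d
  | k+1, d => Good k d ∧ Good k (rho A b d) ∧ Good k (tau A b d)

lemma Good.mono {k : ℕ} {d : Dart} (h : Good A b (k+1) d) : Good A b k d := h.1
lemma Good.rho {k : ℕ} {d : Dart} (h : Good A b (k+1) d) : Good A b k (rho A b d) := h.2.1
lemma Good.tau {k : ℕ} {d : Dart} (h : Good A b (k+1) d) : Good A b k (tau A b d) := h.2.2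
lemma Good.le {k l : ℕ} {d : Dart} (h : Good A b l d) (hkl : k ≤ l) : Good A b k d := by
  induction hkl with
  | refl => exact h
  | step _ ih => exact ih h.mono
lemma Good.mem {k : ℕ} {d : Dart} (h : Good A b k d) : d ∈ Dt A b := (h.le (Nat.zero_le _)).1

lemma card_not_Good (k : ℕ) : ((Dt A b).filter (fun d => ¬ Good A b k d)).card ≤
    3 ^ k * (12 * N2 A b + 48 * A.card) := by
  induction k with
  | zero =>
    rw [pow_zero, one_mul]
    refine le_trans (Finset.card_le_card ?_) card_Bad0
    intro d hd
    rw [Finset.mem_filter, Good] at hd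
    rw [Finset.mem_filter]
    exact ⟨hd.1, by_contra fun h => hd.2 ⟨hd.1, h⟩⟩
  | succ k ih =>
    have hsub : (Dt A b).filter (fun d => ¬ Good A b (k+1) d) ⊆ (Dt A b).filter (fun d => ¬ Good A b k d)
        ∪ ((Dt A b).filter (fun d => ¬ Good A b k (rho A b d)) ∪
          (Dt A b).filter (fun d => ¬ Good A b k (tau A b d))) := by
      intro d hd
      rw [Finset.mem_filter, Good] at hd
      simp only [Finset.mem_filter, Finset.mem_union]
      by_cases h1 : Good A b k d
      · by_cases h2 : Good A b k (WS.rho A b d)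
        · exact Or.inr (Or.inr ⟨hd.1, fun h3 => hd.2 ⟨h1, h2, h3⟩⟩)
        · exact Or.inr (Or.inl ⟨hd.1, h2⟩)
      · exact Or.inl ⟨hd.1, h1⟩
    have h1 : ((Dt A b).filter (fun d => ¬ Good A b k (rho A b d))).card ≤
        ((Dt A b).filter (fun d => ¬ Good A b k d)).card := by
      refine Finset.card_le_card_of_injOn (rho A b) ?_ (rho_inj.mono ?_)
      · intro d hd
        simp only [Finset.coe_filter, Set.mem_ofPred_eq] at hd ⊢
        exact ⟨rho_mem hd.1, hd.2⟩
      · intro d hd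
        exact Finset.filter_subset _ _ hd
    have h2 : ((Dt A b).filter (fun d => ¬ Good A b k (tau A b d))).card ≤
        ((Dt A b).filter (fun d => ¬ Good A b k d)).card := by
      refine Finset.card_le_card_of_injOn (tau A b) ?_ (tau_inj.mono ?_)
      · intro d hd
        simp only [Finset.coe_filter, Set.mem_ofPred_eq] at hd ⊢
        exact ⟨tau_mem hd.1, hd.2⟩
      · intro d hd
        exact Finset.filter_subset _ _ hd
    have h3 := (Finset.card_le_card hsub).trans (Finset.card_union_le _ _)
    have h4 := Finset.card_union_le ((Dt A b).filter (fun d => ¬ Good A b k (rho A b d)))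
      ((Dt A b).filter (fun d => ¬ Good A b k (tau A b d)))
    rw [pow_succ]
    linarith

end
end WS

namespace WS
noncomputable section
open scoped Classical
variable {A : Finset ℝ} {b : ℝ → ℝ}

def flip : Dart → Dart | (a, x, e) => (a, x, !e)

lemma flip_flip (d : Dart) : flip (flip d) = d := by
  obtain ⟨a, x, e⟩ := d; simp [flip]
@[simp] lemma flip_fst (d : Dart) : (flip d).1 = d.1 := rfl
@[simp] lemma flip_snd (d : Dart) : (flip d).2.1 = d.2.1 := rfl
lemma flip_mem {d : Dart} (hd : d ∈ Dt A b) : flip d ∈ Dt A b := by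
  obtain ⟨a, x, e⟩ := d
  rw [flip]
  rw [mem_Dt] at *
  exact hd

lemma rho_flip (d : Dart) : rho A b (flip d) = flip (rho A b d) := by
  obtain ⟨a, x, e⟩ := d
  by_cases h : ∃ c ∈ Ln A b a x, a < c
  · rw [flip, rho, if_pos h, rho, if_pos h, flip]
  · rw [flip, rho, if_neg h, rho, if_neg h, flip]

lemma exists_sorted {S : Finset ℝ} (h : S.card = 3) : ∃ l1 l2 l3, l1 < l2 ∧ l2 < l3 ∧ S = {l1, l2, l3} := by
  refine ⟨S.orderEmbOfFin h 0, S.orderEmbOfFin h 1, S.orderEmbOfFin h 2, ?_, ?_, ?_⟩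
  · exact (S.orderEmbOfFin h).strictMono (by decide)
  · exact (S.orderEmbOfFin h).strictMono (by decide)
  · have := Finset.range_orderEmbOfFin S h
    ext c
    rw [← Finset.mem_coe, ← this]
    simp only [Set.mem_range, Fin.exists_fin_succ, Finset.mem_insert, Finset.mem_singleton]
    simp [eq_comm]

lemma nxt_eq {S : Finset ℝ} {x y : ℝ} (hy : y ∈ S) (hxy : x < y) (h : ∀ z ∈ S, x < z → y ≤ z) : nxt S x = y := by
  obtain ⟨h1, h2, h3⟩ := nxt_spec (S := S) (x := x) ⟨y, hy, hxy⟩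
  exact le_antisymm (h3 y hy hxy) (h _ h1 h2)

lemma lo_eq {S : Finset ℝ} {y : ℝ} (hy : y ∈ S) (h : ∀ z ∈ S, y ≤ z) : lo S = y := by
  obtain ⟨h1, h3⟩ := lo_spec (S := S) ⟨y, hy⟩
  exact le_antisymm (h3 y hy) (h _ h1)

lemma rho_sorted {x l1 l2 l3 : ℝ} (h12 : l1 < l2) (h23 : l2 < l3) {c : ℝ} (hc : Ln A b c x = {l1, l2, l3})
    (hcA : c ∈ A) (e : Bool) :
    rho A b (l1, x, e) = (l2, x, e) ∧ rho A b (l2, x, e) = (l3, x, e) ∧ rho A b (l3, x, e) = (l1, x, !e) := by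
  have hl1 : Ln A b l1 x = {l1, l2, l3} := by rw [Ln_eq, hc]; rw [hc]; simp
  have hl2 : Ln A b l2 x = {l1, l2, l3} := by rw [Ln_eq, hc]; rw [hc]; simp
  have hl3 : Ln A b l3 x = {l1, l2, l3} := by rw [Ln_eq, hc]; rw [hc]; simp
  refine ⟨?_, ?_, ?_⟩
  · rw [rho, hl1, if_pos ⟨l2, by simp, h12⟩, nxt_eq (y := l2)]
    · simp
    · exact h12
    · intro z hz; simp only [Finset.mem_insert, Finset.mem_singleton] at hz
      rcases hz with rfl | rfl | rfl <;> intro <;> linarith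
  · rw [rho, hl2, if_pos ⟨l3, by simp, h23⟩, nxt_eq (y := l3)]
    · simp
    · exact h23
    · intro z hz; simp only [Finset.mem_insert, Finset.mem_singleton] at hz
      rcases hz with rfl | rfl | rfl <;> intro <;> linarith
  · rw [rho, hl3, if_neg, lo_eq (y := l1)]
    · simp
    · intro z hz; simp only [Finset.mem_insert, Finset.mem_singleton] at hz
      rcases hz with rfl | rfl | rfl <;> linarith
    · push Not
      intro z hz; simp only [Finset.mem_insert, Finset.mem_singleton] at hz
      rcases hz with rfl | rfl | rfl <;> linarith

variable (A b) in
/-- exact collinear triple -/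
def Tri (u v w : ℝ) : Prop := u ∈ A ∧ v ∈ A ∧ w ∈ A ∧ u ≠ v ∧ u ≠ w ∧ v ≠ w ∧
  ∃ x y, ∀ c ∈ A, fl b c x = y ↔ (c = u ∨ c = v ∨ c = w)

lemma rho3 {d : Dart} (hd : d ∈ Dt A b) (hk : kk A b d = 3) :
    rho A b (rho A b (rho A b d)) = flip d ∧ Tri A b d.1 (rho A b d).1 (rho A b (rho A b d)).1 := by
  obtain ⟨a, x, e⟩ := d
  rw [mem_Dt] at hd
  obtain ⟨l1, l2, l3, h12, h23, hS⟩ := exists_sorted hk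
  simp only at hS
  have ha := mem_Ln_self (b := b) (x := x) hd.1
  have hmem : ∀ c, (c = l1 ∨ c = l2 ∨ c = l3) ↔ c ∈ A ∧ fl b c x = fl b a x := by
    intro c; rw [← mem_Ln, hS]; simp
  rw [hS] at ha
  simp only [Finset.mem_insert, Finset.mem_singleton] at ha
  obtain ⟨r1, r2, r3⟩ := rho_sorted h12 h23 hS hd.1 e
  obtain ⟨s1, s2, s3⟩ := rho_sorted h12 h23 hS hd.1 (!e)
  have hl1 := ((hmem l1).1 (by simp)).1
  have hl2 := ((hmem l2).1 (by simp)).1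
  have hl3 := ((hmem l3).1 (by simp)).1
  rcases ha with rfl | rfl | rfl
  · rw [r1, r2, r3]
    refine ⟨rfl, hl1, hl2, hl3, h12.ne, (h12.trans h23).ne, h23.ne, x, fl b a x, fun c hc => ?_⟩
    simp only [hmem, hc, true_and]
  · rw [r2, r3, s1]
    refine ⟨rfl, hl2, hl3, hl1, h23.ne, h12.ne', (h12.trans h23).ne', x, fl b a x, fun c hc => ?_⟩
    have := hmem c
    simp only [hc, true_and] at this
    rw [← this]; simp only; tauto
  · rw [r3, s1, s2]
    refine ⟨rfl, hl3, hl1, hl2, (h12.trans h23).ne', h23.ne', h12.ne, x, fl b a x, fun c hc => ?_⟩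
    have := hmem c
    simp only [hc, true_and] at this
    rw [← this]; simp only; tauto

lemma Good.kk3 {d : Dart} {k : ℕ} (h : Good A b k d) : kk A b d = 3 := by
  have := (h.le (Nat.zero_le _)).2
  by_contra h1
  exact this (Or.inl h1)
lemma Good.bdd {d : Dart} {k : ℕ} (h : Good A b k d) : Bdd A b d := by
  have := (h.le (Nat.zero_le _)).2
  by_contra h1
  exact this (Or.inr (Or.inl ⟨d, h.mem, rfl, h1⟩))
lemma Good.rho3 {d : Dart} {k : ℕ} (h : Good A b k d) :
    WS.rho A b (WS.rho A b (WS.rho A b d)) = flip d := (WS.rho3 h.mem h.kk3).1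
lemma Good.tri {d : Dart} {k : ℕ} (h : Good A b k d) :
    Tri A b d.1 (WS.rho A b d).1 (WS.rho A b (WS.rho A b d)).1 := (WS.rho3 h.mem h.kk3).2
lemma Good.flip {d : Dart} {k : ℕ} (h : Good A b (k+3) d) : Good A b k (flip d) := by
  rw [← h.rho3]; exact h.rho.rho.rho
lemma Good.sig3 {d : Dart} {k : ℕ} (h : Good A b k d) : sig A b (sig A b (sig A b d)) = d := by
  have h0 := (h.le (Nat.zero_le _)).2
  have hs : sF A b (Rt A b d) = 3 := by
    by_contra h1
    exact h0 (Or.inr (Or.inr h1))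
  refine (three_le (F := Rt A b d) ?_ h.mem rfl).2 hs
  intro e he heq
  by_contra h1
  exact h0 (Or.inr (Or.inl ⟨e, he, heq, h1⟩))

/-- `ρτρ = τ flip ρρ τ`. -/
lemma Good.rel {d : Dart} {k : ℕ} (h : Good A b (k+3) d) :
    WS.rho A b (WS.tau A b (WS.rho A b d)) =
      WS.tau A b (WS.flip (WS.rho A b (WS.rho A b (WS.tau A b d)))) := by
  have h1 := h.tau.sig3
  simp only [sig, tau_tau h.mem] at h1
  set w := WS.tau A b (WS.rho A b (WS.tau A b (WS.rho A b d))) with hw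
  have hwg : w ∈ Dt A b := tau_mem (rho_mem (tau_mem (rho_mem h.mem)))
  have hgt := h.tau
  have e1 : WS.rho A b (WS.rho A b (WS.rho A b w)) = WS.flip w := by
    refine (WS.rho3 hwg ?_).1
    have hk := hgt.kk3
    have e2 := rho_Ln hwg
    have e3 := rho_snd (A := A) (b := b) w
    rw [h1] at e2 e3
    rw [kk] at hk ⊢
    rw [e3, Ln_eq e2] at hk
    exact hk
  rw [h1] at e1
  have e4 : WS.flip w = WS.flip (WS.flip (WS.rho A b (WS.rho A b (WS.tau A b d)))) := by
    rw [e1, flip_flip]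
  have e5 : w = WS.flip (WS.rho A b (WS.rho A b (WS.tau A b d))) := by
    rw [← flip_flip w, e4, flip_flip]
  rw [← e5, hw, tau_tau]
  exact rho_mem (tau_mem (rho_mem h.mem))

variable (A b) in
def str (d : Dart) : Dart := flip (tau A b d)
variable (A b) in
def UU (d : Dart) : Dart := rho A b (rho A b (tau A b (rho A b d)))

lemma Good.str {d : Dart} {k : ℕ} (h : Good A b (k+4) d) : Good A b k (str A b d) := h.tau.flip
lemma Good.UU {d : Dart} {k : ℕ} (h : Good A b (k+4) d) : Good A b k (UU A b d) := h.rho.tau.rho.rho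

lemma str_fst (d : Dart) : (str A b d).1 = d.1 := by rw [str, flip_fst, tau_fst]

lemma str_UU {d : Dart} (h : Good A b 10 d) : str A b (UU A b d) = UU A b (str A b d) := by
  have r1 := h.rel (k := 7)
  have h2 : Good A b 5 (WS.flip (WS.rho A b (WS.tau A b d))) := h.tau.rho.flip
  have r2 := h2.rel (k := 2)
  simp only [str, UU]
  rw [r1]
  have e1 : WS.rho A b (WS.flip (WS.rho A b (WS.tau A b d))) =
    WS.flip (WS.rho A b (WS.rho A b (WS.tau A b d))) := rho_flip _
  rw [← e1, r2, tau_tau, flip_flip, rho_flip]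
  exact flip_mem (rho_mem (rho_mem (tau_mem h2.mem)))

lemma rho_UU {d : Dart} {k : ℕ} (h : Good A b (k+4) d) : rho A b (UU A b d) = str A b (rho A b d) := by
  rw [UU, str, h.rho.tau.rho3]

lemma X_UU {d : Dart} {k : ℕ} (h : Good A b (k+4) d) : (rho A b (UU A b d)).1 = (rho A b d).1 := by
  rw [rho_UU h, str_fst]

lemma Y_UU {d : Dart} {k : ℕ} (h : Good A b (k+4) d) :
    (rho A b (rho A b (UU A b d))).1 = (rho A b (rho A b (str A b d))).1 := by
  rw [rho_UU h, str, rho_flip, flip_fst, h.rel (k := k+1), tau_fst, flip_fst, str, rho_flip, rho_flip, flip_fst]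

lemma str_true {a x : ℝ} (h : Bdd A b (a, x, true)) : str A b (a, x, true) = (a, nxt (Ms A b a) x, true) := by
  rw [Bdd] at h
  rw [str, tau, if_pos h, flip]; rfl

lemma str_false {a x : ℝ} (h : Bdd A b (a, x, false)) : str A b (a, x, false) = (a, prv (Ms A b a) x, false) := by
  rw [Bdd] at h
  rw [str, tau, if_pos h, flip]; rfl

variable (A b) in
structure Run (n : ℕ) (X Y Z : ℕ → ℝ) : Prop where
  tri : ∀ i < n, ∀ j < 4, Tri A b (Z j) (X i) (Y (i + j))
  Xinj : ∀ i < n, ∀ j < n, X i = X j → i = j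
  Yinj : ∀ i < n, ∀ j < n, Y i = Y j → i = j
  XY : ∀ i < n, ∀ j < n, X i ≠ Y j
  Zinj : ∀ i < 4, ∀ j < 4, Z i = Z j → i = j
  cons : ∀ i, i + 1 < n → slp b (Z 0) (X (i+1)) = nxt (Ms A b (Z 0)) (slp b (Z 0) (X i)) ∧
    slp b (Z 0) (X i) < slp b (Z 0) (X (i+1))
  slpY : ∀ i < n, slp b (Z 0) (Y i) = slp b (Z 0) (X i)

lemma Good.UUn {d : Dart} {k : ℕ} (j : ℕ) (h : Good A b (k + 4*j) d) : Good A b k ((WS.UU A b)^[j] d) := by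
  induction j generalizing k with
  | zero => exact h
  | succ j ih =>
    rw [Function.iterate_succ_apply']
    apply Good.UU
    apply ih
    convert h using 1
    ring

lemma str_UUn {d : Dart} (j : ℕ) (h : Good A b (10 + 4*j) d) :
    str A b ((UU A b)^[j] d) = (UU A b)^[j] (str A b d) := by
  induction j with
  | zero => rfl
  | succ j ih =>
    rw [Function.iterate_succ_apply', Function.iterate_succ_apply', str_UU, ih]
    · exact h.le (by omega)
    · exact Good.UUn j (h.le (by omega))

lemma X_UUn {d : Dart} (j : ℕ) (h : Good A b (4 + 4*j) d) :
    (rho A b ((UU A b)^[j] d)).1 = (rho A b d).1 := by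
  induction j with
  | zero => rfl
  | succ j ih =>
    rw [Function.iterate_succ_apply', X_UU (k := 0), ih]
    · exact h.le (by omega)
    · exact Good.UUn j (h.le (by omega))

lemma Y_UUn {d : Dart} (j : ℕ) (h : Good A b (10 + 8*j) d) :
    (rho A b (rho A b ((UU A b)^[j] d))).1 = (rho A b (rho A b ((str A b)^[j] d))).1 := by
  induction j generalizing d with
  | zero => rfl
  | succ j ih =>
    rw [Function.iterate_succ_apply', Y_UU (k := 0), str_UUn, ih, ← Function.iterate_succ_apply]
    · apply Good.str
      exact h.le (by omega)
    · exact h.le (by omega)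
    · exact Good.UUn j (h.le (by omega))

lemma rho_UUn {d : Dart} (j : ℕ) (h : Good A b (4 + 4*j) d) :
    rho A b ((UU A b)^[j] d) = (str A b)^[j] (rho A b d) := by
  induction j with
  | zero => rfl
  | succ j ih =>
    rw [Function.iterate_succ_apply', Function.iterate_succ_apply', rho_UU (k := 0), ih]
    · exact h.le (by omega)
    · exact Good.UUn j (h.le (by omega))

lemma str_snd_mono {d : Dart} {k : ℕ} (h : Good A b k d) :
    (str A b d).2.2 = d.2.2 ∧ (d.2.2 = true → d.2.1 < (str A b d).2.1) ∧
      (d.2.2 = false → (str A b d).2.1 < d.2.1) := by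
  obtain ⟨a, x, _ | _⟩ := d
  · have hb := h.bdd
    rw [str_false hb]
    rw [Bdd] at hb
    exact ⟨rfl, by simp, fun _ => (prv_spec hb).2.1⟩
  · have hb := h.bdd
    rw [str_true hb]
    rw [Bdd] at hb
    exact ⟨rfl, fun _ => (nxt_spec hb).2.1, by simp⟩

lemma strn_snd {d : Dart} (n : ℕ) (h : ∀ i < n, Good A b 0 ((str A b)^[i] d)) :
    ∀ i j, i < j → j ≤ n → ((str A b)^[j] d).2.2 = d.2.2 ∧
      (d.2.2 = true → ((str A b)^[i] d).2.1 < ((str A b)^[j] d).2.1) ∧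
      (d.2.2 = false → ((str A b)^[j] d).2.1 < ((str A b)^[i] d).2.1) := by
  have h0 : ∀ i ≤ n, ((str A b)^[i] d).2.2 = d.2.2 := by
    intro i
    induction i with
    | zero => intro; rfl
    | succ i ih =>
      intro hi
      rw [Function.iterate_succ_apply', (str_snd_mono (h i (by omega))).1]
      exact ih (by omega)
  intro i j hij
  induction j, hij using Nat.le_induction with
  | base =>
    intro hj
    refine ⟨h0 _ hj, fun ht => ?_, fun ht => ?_⟩
    · rw [Function.iterate_succ_apply']
      exact (str_snd_mono (h i (by omega))).2.1 (by rw [h0 i (by omega), ht])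
    · rw [Function.iterate_succ_apply']
      exact (str_snd_mono (h i (by omega))).2.2 (by rw [h0 i (by omega), ht])
  | succ j hij ih =>
    intro hj
    have ih' := ih (by omega)
    refine ⟨h0 _ hj, fun ht => ?_, fun ht => ?_⟩
    · rw [Function.iterate_succ_apply']
      exact (ih'.2.1 ht).trans ((str_snd_mono (h j (by omega))).2.1 (by rw [h0 j (by omega), ht]))
    · rw [Function.iterate_succ_apply']
      exact ((str_snd_mono (h j (by omega))).2.2 (by rw [h0 j (by omega), ht])).trans (ih'.2.2 ht)

lemma Good.slpX {d : Dart} {k : ℕ} (h : Good A b k d) : slp b d.1 (WS.rho A b d).1 = d.2.1 := by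
  have := (mem_Ln.1 (rho_Ln h.mem)).2
  exact ((fl_eq_iff b (rho_ne h.mem) _).1 this).symm

lemma Good.slpY {d : Dart} {k : ℕ} (h : Good A b k d) : slp b d.1 (WS.rho A b (WS.rho A b d)).1 = d.2.1 := by
  have h1 := (mem_Ln.1 (rho_Ln h.mem)).2
  have h2 := (mem_Ln.1 (rho_Ln (rho_mem h.mem))).2
  rw [rho_snd, h1] at h2
  exact ((fl_eq_iff b h.tri.2.2.2.2.1.symm _).1 h2).symm

theorem run_of_good {d : Dart} (hd : d.2.2 = true) (n : ℕ) (hn : 0 < n) (h : ∀ i < n, Good A b 40 ((str A b)^[i] d)) :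
    Run A b n (fun i => (rho A b ((str A b)^[i] d)).1) (fun i => (rho A b (rho A b ((str A b)^[i] d))).1)
      (fun j => ((UU A b)^[j] d).1) := by
  have hfst : ∀ i, ((str A b)^[i] d).1 = d.1 := by
    intro i
    induction i with
    | zero => rfl
    | succ i ih => rw [Function.iterate_succ_apply', str_fst, ih]
  have hmono : ∀ i < n, ∀ j < n, ((str A b)^[i] d).2.1 = ((str A b)^[j] d).2.1 → i = j := by
    intro i hi j hj hij
    have := strn_snd n (fun i hi => (h i hi).le (by omega))
    rcases lt_trichotomy i j with h1 | h1 | h1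
    · exact absurd hij ((this i j h1 hj.le).2.1 hd).ne
    · exact h1
    · exact absurd hij ((this j i h1 hi.le).2.1 hd).ne'
  have hslp : ∀ i < n, slp b d.1 (rho A b ((str A b)^[i] d)).1 = ((str A b)^[i] d).2.1 := by
    intro i hi
    have := (h i hi).slpX
    rwa [hfst] at this
  have hslpY : ∀ i < n, slp b d.1 (rho A b (rho A b ((str A b)^[i] d))).1 = ((str A b)^[i] d).2.1 := by
    intro i hi
    have := (h i hi).slpY
    rwa [hfst] at this
  have hZ : ∀ i ≤ n, ∀ j < 4, ((UU A b)^[j] ((str A b)^[i] d)).1 = ((UU A b)^[j] d).1 := by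
    intro i
    induction i with
    | zero => intro _ j _; rfl
    | succ i ih =>
      intro hi j hj
      rw [Function.iterate_succ_apply', ← str_UUn, str_fst, ih (by omega) j hj]
      exact (h i (by omega)).le (by omega)
  constructor
  · intro i hi j hj
    have hg := h i hi
    have hu : Good A b 0 ((UU A b)^[j] ((str A b)^[i] d)) := Good.UUn j (hg.le (by omega))
    have ht := hu.tri
    rw [hZ i hi.le j hj, X_UUn j (hg.le (by omega)), Y_UUn j (hg.le (by omega)),
      ← Function.iterate_add_apply, add_comm j i] at ht
    exact ht
  · intro i hi j hj hij
    apply hmono i hi j hj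
    rw [← hslp i hi, ← hslp j hj]
    exact congrArg _ hij
  · intro i hi j hj hij
    apply hmono i hi j hj
    rw [← hslpY i hi, ← hslpY j hj]
    exact congrArg _ hij
  · intro i hi j hj hij
    have : i = j := by
      apply hmono i hi j hj
      rw [← hslp i hi, ← hslpY j hj]
      exact congrArg _ hij
    subst this
    exact (h i hi).tri.2.2.2.2.2.1 hij
  · intro i hi j hj hij
    have hg := h 0 (by omega)
    simp only [Function.iterate_zero, id] at hg
    have hslope : ∀ j < 4, ((UU A b)^[j] d).2.1 = ((str A b)^[j] (rho A b d)).2.1 := by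
      intro j hj
      rw [← rho_UUn j (hg.le (by omega)), rho_snd]
    have hfl : ∀ j < 4, (rho A b d).1 ≠ ((UU A b)^[j] d).1 ∧
        fl b (rho A b d).1 ((str A b)^[j] (rho A b d)).2.1 =
        fl b ((UU A b)^[j] d).1 ((str A b)^[j] (rho A b d)).2.1 := by
      intro j hj
      have hu : Good A b 0 ((UU A b)^[j] d) := Good.UUn j (hg.le (by omega))
      have := (mem_Ln.1 (rho_Ln hu.mem)).2
      have h2 := rho_ne hu.mem
      rw [X_UUn j (hg.le (by omega))] at this h2
      rw [hslope j hj] at this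
      exact ⟨h2, this⟩
    have hgs : ∀ j < 4, Good A b 0 ((str A b)^[j] (rho A b d)) := by
      intro j hj
      rw [← rho_UUn j (hg.le (by omega))]
      exact (Good.UUn (k := 1) j (hg.le (by omega))).rho
    have hss := strn_snd 4 hgs
    have key : ∀ i j, i < j → j < 4 → ((UU A b)^[i] d).1 ≠ ((UU A b)^[j] d).1 := by
      intro i j hij hj heq
      have h1 := hfl i (by omega)
      have h2 := hfl j hj
      rw [← heq] at h2
      have h3 := two_common h1.1 h1.2 h2.2
      have h4 := hss i j hij (by omega)
      cases h5 : (rho A b d).2.2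
      · exact (h4.2.2 h5).ne' h3
      · exact (h4.2.1 h5).ne h3
    rcases lt_trichotomy i j with h1 | h1 | h1
    · exact absurd hij (key i j h1 hj)
    · exact h1
    · exact absurd hij.symm (key j i h1 hi)
  · intro i hi
    simp only [Function.iterate_zero, id]
    rw [hslp i (by omega), hslp (i+1) hi]
    refine ⟨?_, (strn_snd n (fun i hi => (h i hi).le (by omega)) i (i+1) (by omega) hi.le).2.1 hd⟩
    have h1 : ((str A b)^[i] d).2.2 = true := by
      rcases Nat.eq_zero_or_pos i with h0 | h0
      · subst h0; exact hd
      · rw [(strn_snd n (fun i hi => (h i hi).le (by omega)) 0 i h0 (by omega)).1, hd]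
    have hb := (h i (by omega)).bdd
    have h2 := hfst i
    rw [Function.iterate_succ_apply']
    rcases hw : (str A b)^[i] d with ⟨a, x, e⟩
    rw [hw] at hb h1 h2
    simp only at h1 h2
    subst h1
    rw [str_true hb, h2]
  · intro i hi
    simp only [Function.iterate_zero, id]
    rw [hslp i hi, hslpY i hi]

end
end WS

namespace WS
noncomputable section
open scoped Classical
variable (A : Finset ℝ) (b : ℝ → ℝ)

def badS (a : ℝ) : Finset ℝ := (Ms A b a).filter (fun x => ¬ Good A b 100 (a, x, true))
def cnt (a x : ℝ) : ℕ := ((badS A b a).filter (fun y => y < x)).card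
def InRun (a : ℝ) (k : ℕ) (q : ℝ) : Prop :=
  q ∈ A ∧ q ≠ a ∧ slp b a q ∉ badS A b a ∧ cnt A b a (slp b a q) = k

variable {A b}

lemma cnt_le (a x : ℝ) : cnt A b a x ≤ (badS A b a).card := Finset.card_le_card (Finset.filter_subset _ _)

lemma sum_badS : ∑ a ∈ A, (badS A b a).card ≤ 3 ^ 100 * (12 * N2 A b + 48 * A.card) := by
  refine le_trans ?_ (card_not_Good (A := A) (b := b) 100)
  rw [← Finset.card_sigma]
  refine Finset.card_le_card_of_injOn (fun s => ((s.1, s.2, true) : Dart)) ?_ ?_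
  · rintro ⟨a, x⟩ h
    simp only [Finset.coe_sigma, Set.mem_sigma_iff, Finset.mem_coe, badS, Finset.mem_filter] at h
    simp only [Finset.coe_filter, Set.mem_ofPred_eq, mem_Dt]
    exact ⟨⟨h.1, h.2.1⟩, h.2.2⟩
  · rintro ⟨a, x⟩ _ ⟨a', x'⟩ _ h
    simp only [Prod.mk.injEq] at h
    obtain ⟨rfl, rfl, -⟩ := h
    rfl

lemma good_of_not_bad {a x : ℝ} (hx : x ∈ Ms A b a) (h : x ∉ badS A b a) : Good A b 100 (a, x, true) := by
  by_contra h1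
  exact h (Finset.mem_filter.2 ⟨hx, h1⟩)

lemma Good.mem_Ln {d : Dart} {k : ℕ} (h : Good A b k d) {c : ℝ} (hc : c ∈ Ln A b d.1 d.2.1) :
    c = d.1 ∨ c = (WS.rho A b d).1 ∨ c = (WS.rho A b (WS.rho A b d)).1 := by
  obtain ⟨h1, h2, h3, h4, h5, h6, x, y, hxy⟩ := h.tri
  have e1 := (hxy _ h1).2 (Or.inl rfl)
  have e2 := (hxy _ h2).2 (Or.inr (Or.inl rfl))
  have e3 := (fl_eq_iff b h4.symm x).1 (e2.trans e1.symm)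
  rw [h.slpX] at e3
  rw [WS.mem_Ln, ← e3, e1] at hc
  exact (hxy _ hc.1).1 hc.2

lemma str_reach {a m0 : ℝ} (ha : a ∈ A) (hm0 : m0 ∈ Ms A b a) (N : ℕ) :
    ∀ m ∈ Ms A b a, m0 ≤ m → ((Ms A b a).filter (fun y => y < m)).card ≤ N →
    (∀ x ∈ Ms A b a, m0 ≤ x → x ≤ m → Good A b 100 (a, x, true)) →
    ∃ T, (∀ s ≤ T, Good A b 100 ((str A b)^[s] (a, m0, true))) ∧ (str A b)^[T] (a, m0, true) = (a, m, true) := by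
  induction N with
  | zero =>
    intro m hm hle hc hg
    have : m0 = m := by
      by_contra hne
      have hlt := lt_of_le_of_ne hle hne
      have : m0 ∈ (Ms A b a).filter (fun y => y < m) := Finset.mem_filter.2 ⟨hm0, hlt⟩
      rw [Nat.le_zero, Finset.card_eq_zero] at hc
      rw [hc] at this
      simp at this
    subst this
    refine ⟨0, ?_, rfl⟩
    intro s hs
    rw [Nat.le_zero.1 hs]
    exact hg m0 hm0 le_rfl le_rfl
  | succ N ih =>
    intro m hm hle hc hg
    rcases hle.eq_or_lt with rfl | hlt
    · refine ⟨0, ?_, rfl⟩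
      intro s hs
      rw [Nat.le_zero.1 hs]
      exact hg m0 hm0 le_rfl le_rfl
    · have hex : ∃ y ∈ Ms A b a, y < m := ⟨m0, hm0, hlt⟩
      obtain ⟨p1, p2, p3⟩ := prv_spec hex
      obtain ⟨T, hT, hT2⟩ := ih (prv (Ms A b a) m) p1 (p3 m0 hm0 hlt) (by
        have : ((Ms A b a).filter (fun y => y < prv (Ms A b a) m)) ⊂ ((Ms A b a).filter (fun y => y < m)) := by
          rw [Finset.ssubset_iff_of_subset]
          · exact ⟨prv (Ms A b a) m, Finset.mem_filter.2 ⟨p1, p2⟩, by simp⟩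
          · intro y hy
            rw [Finset.mem_filter] at hy ⊢
            exact ⟨hy.1, hy.2.trans p2⟩
        have := Finset.card_lt_card this
        omega) (fun x hx h1 h2 => hg x hx h1 (h2.trans p2.le))
      have hend : (str A b)^[T+1] (a, m0, true) = (a, m, true) := by
        rw [Function.iterate_succ_apply', hT2, str_true, nxt_prv hm hex]
        rw [Bdd]
        exact ⟨m, hm, p2⟩
      refine ⟨T+1, ?_, hend⟩
      intro s hs
      rcases Nat.le_succ_iff.1 hs with h | h
      · exact hT s h
      · rw [h, hend]; exact hg m hm hle le_rfl

lemma str_between {a m0 m : ℝ} (hm : m ∈ Ms A b a) (hle : m0 ≤ m) (T : ℕ) :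
    ∀ m1, (∀ s ≤ T, Good A b 100 ((str A b)^[s] (a, m0, true))) → (str A b)^[T] (a, m0, true) = (a, m1, true) →
    m ≤ m1 → ∃ t ≤ T, (str A b)^[t] (a, m0, true) = (a, m, true) := by
  induction T with
  | zero =>
    intro m1 hg h1 h2
    simp only [Function.iterate_zero, id, Prod.mk.injEq] at h1
    refine ⟨0, le_rfl, ?_⟩
    simp only [Function.iterate_zero, id, Prod.mk.injEq, and_true, true_and]
    linarith
  | succ T ih =>
    intro m1 hg h1 h2
    rcases h2.eq_or_lt with rfl | hlt
    · exact ⟨T+1, le_rfl, h1⟩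
    · have hgT := hg T (by omega)
      rw [Function.iterate_succ_apply'] at h1
      rcases hw : (str A b)^[T] (a, m0, true) with ⟨a', m', e'⟩
      rw [hw] at h1 hgT
      have hs := str_snd_mono hgT
      have hf := str_fst (A := A) (b := b) (a', m', e')
      rw [h1] at hs hf
      simp only at hs hf
      obtain ⟨rfl, -⟩ := hs
      subst hf
      have hb := hgT.bdd
      rw [str_true hb] at h1
      rw [Bdd] at hb
      simp only [Prod.mk.injEq] at h1
      obtain ⟨t, ht, ht2⟩ := ih m' (fun s hs => hg s (by omega)) hw (by
        by_contra hc
        push Not at hc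
        have := (nxt_spec hb).2.2 m hm hc
        linarith)
      exact ⟨t, by omega, ht2⟩

lemma Good.strinv {d : Dart} {k : ℕ} (h : Good A b (k+4) d) : Good A b k (WS.tau A b (WS.flip d)) := h.flip.tau
lemma str_strinv {d : Dart} (hd : d ∈ Dt A b) : WS.str A b (WS.tau A b (WS.flip d)) = d := by
  rw [WS.str, tau_tau (flip_mem hd), flip_flip]
lemma Good.strn {d : Dart} {k : ℕ} (j : ℕ) (h : Good A b (k + 4*j) d) : Good A b k ((WS.str A b)^[j] d) := by
  induction j generalizing k with
  | zero => exact h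
  | succ j ih =>
    rw [Function.iterate_succ_apply']
    apply Good.str
    apply ih
    convert h using 1
    ring

theorem run_exists {a : ℝ} (ha : a ∈ A) {k : ℕ} (hne : ∃ q, InRun A b a k q) :
    ∃ n X Y Z, Run A b n X Y Z ∧ Z 0 = a ∧
      ∀ q, InRun A b a k q → ∃ i, 4 ≤ i ∧ i + 9 ≤ n ∧ (q = X i ∨ q = Y i) := by
  set R := A.filter (fun q => InRun A b a k q) with hR
  have hRne : R.Nonempty := by
    obtain ⟨q, hq⟩ := hne
    exact ⟨q, Finset.mem_filter.2 ⟨hq.1, hq⟩⟩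
  obtain ⟨q0, hq0, hmin⟩ := R.exists_min_image (fun q => slp b a q) hRne
  obtain ⟨q1, hq1, hmax⟩ := R.exists_max_image (fun q => slp b a q) hRne
  have hq0' := (Finset.mem_filter.1 hq0).2
  have hq1' := (Finset.mem_filter.1 hq1).2
  have hm0 : slp b a q0 ∈ Ms A b a := slp_mem hq0'.1 hq0'.2.1
  have hm1 : slp b a q1 ∈ Ms A b a := slp_mem hq1'.1 hq1'.2.1
  have hnb : ∀ x ∈ Ms A b a, slp b a q0 ≤ x → x ≤ slp b a q1 → Good A b 100 (a, x, true) := by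
    intro x hx h0 h1
    apply good_of_not_bad hx
    intro hbad
    have hx1 : x < slp b a q1 := by
      refine lt_of_le_of_ne h1 ?_
      rintro rfl
      exact hq1'.2.2.1 hbad
    have hlt : cnt A b a (slp b a q0) < cnt A b a (slp b a q1) := by
      apply Finset.card_lt_card
      rw [Finset.ssubset_iff_of_subset]
      · refine ⟨x, Finset.mem_filter.2 ⟨hbad, hx1⟩, ?_⟩
        simp only [Finset.mem_filter, not_and, not_lt]
        exact fun _ => h0
      · intro y hy
        rw [Finset.mem_filter] at hy ⊢
        exact ⟨hy.1, by linarith⟩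
    rw [hq0'.2.2.2, hq1'.2.2.2] at hlt
    exact lt_irrefl _ hlt
  obtain ⟨T, hT, hT2⟩ := str_reach ha hm0 _ _ hm1 (hmin _ hq1) le_rfl hnb
  set d0 : Dart := (a, slp b a q0, true) with hd0
  have hg0 : Good A b 100 d0 := hT 0 (Nat.zero_le _)
  let inv : Dart → Dart := fun d => tau A b (flip d)
  set e := inv (inv (inv (inv d0))) with he
  have i1 : Good A b 96 (inv d0) := hg0.strinv
  have i2 : Good A b 92 (inv (inv d0)) := i1.strinv
  have i3 : Good A b 88 (inv (inv (inv d0))) := i2.strinv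
  have i4 : Good A b 84 e := i3.strinv
  have hse : (str A b)^[4] e = d0 := by
    simp only [Function.iterate_succ_apply, Function.iterate_zero, id]
    have s3 : str A b e = inv (inv (inv d0)) := str_strinv i3.mem
    have s2 : str A b (inv (inv (inv d0))) = inv (inv d0) := str_strinv i2.mem
    have s1 : str A b (inv (inv d0)) = inv d0 := str_strinv i1.mem
    have s0 : str A b (inv d0) = d0 := str_strinv hg0.mem
    rw [s3, s2, s1, s0]
  have hgood : ∀ i < T + 13, Good A b 40 ((str A b)^[i] e) := by
    intro i hi
    by_cases h4 : i < 4
    · exact Good.strn i (i4.le (by omega))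
    · obtain ⟨s, rfl⟩ : ∃ s, i = s + 4 := ⟨i - 4, by omega⟩
      rw [Function.iterate_add_apply, hse]
      by_cases hs : s ≤ T
      · exact (hT s hs).le (by omega)
      · obtain ⟨r, rfl⟩ : ∃ r, s = r + T := ⟨s - T, by omega⟩
        rw [Function.iterate_add_apply]
        exact Good.strn r ((hT T le_rfl).le (by omega))
  have hfste : ∀ d : Dart, (inv d).1 = d.1 := fun d => by
    change (tau A b (flip d)).1 = d.1
    rw [tau_fst, flip_fst]
  have hsgn : e.2.2 = true := by
    have h1 := strn_snd (d := e) 4 (fun i hi => (hgood i (by omega)).le (by omega)) 0 4 (by omega) le_rfl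
    rw [hse] at h1
    exact h1.1.symm
  refine ⟨T + 13, _, _, _, run_of_good hsgn (T+13) (by omega) hgood, ?_, ?_⟩
  · simp only [Function.iterate_zero, id]
    rw [he, hfste, hfste, hfste, hfste]
  · intro q hq
    have hqR : q ∈ R := Finset.mem_filter.2 ⟨hq.1, hq⟩
    obtain ⟨t, ht, ht2⟩ := str_between (slp_mem hq.1 hq.2.1) (hmin _ hqR) T _ hT hT2 (hmax _ hqR)
    refine ⟨t + 4, by omega, by omega, ?_⟩
    have hgt : Good A b 40 ((str A b)^[t+4] e) := hgood _ (by omega)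
    have hs : (str A b)^[t+4] e = (a, slp b a q, true) := by
      rw [Function.iterate_add_apply, hse, ht2]
    have hmem : q ∈ Ln A b ((str A b)^[t+4] e).1 ((str A b)^[t+4] e).2.1 := by
      rw [hs, mem_Ln]
      exact ⟨hq.1, (fl_eq_iff b hq.2.1 _).2 rfl⟩
    have := hgt.mem_Ln hmem
    rcases this with h | h
    · rw [hs] at h
      exact absurd h hq.2.1
    · exact h

end
end WS

namespace WS
noncomputable section
open scoped Classical
open MvPolynomial

abbrev Po := MvPolynomial (Fin 2) ℝ
abbrev HH (t : ℕ) : Submodule ℝ Po := restrictTotalDegree (Fin 2) ℝ t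

lemma mem_HH {t : ℕ} {p : Po} : p ∈ HH t ↔ p.totalDegree ≤ t := mem_restrictTotalDegree _ _ _

lemma sum_tri (t : ℕ) : 2 * ∑ i ∈ Finset.range (t+1), (t+1-i) = (t+1)*(t+2) := by
  induction t with
  | zero => simp
  | succ t ih =>
    rw [Finset.sum_range_succ']
    simp only [Nat.add_sub_add_right, mul_add]
    rw [ih]
    simp
    ring

lemma card_exps (t : ℕ) : 2 * Nat.card {n : Fin 2 →₀ ℕ | (n.sum fun _ e => e) ≤ t} = (t+1)*(t+2) := by
  have e : {n : Fin 2 →₀ ℕ | (n.sum fun _ e => e) ≤ t} ≃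
      ((Finset.range (t+1)).sigma (fun i => Finset.range (t+1-i)) : Finset (Σ _ : ℕ, ℕ)) := by
    refine ⟨fun n => ⟨⟨n.1 0, n.1 1⟩, ?_⟩, fun s => ⟨Finsupp.equivFunOnFinite.symm ![s.1.1, s.1.2], ?_⟩, ?_, ?_⟩
    · have := n.2
      simp [Finsupp.sum_fintype] at this
      simp; omega
    · have := s.2
      simp only [Finset.mem_sigma, Finset.mem_range] at this
      simp [Finsupp.sum_fintype]
      omega
    · rintro ⟨n, hn⟩
      simp
      ext i
      fin_cases i <;> simp
    · rintro ⟨⟨i, j⟩, hs⟩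
      simp
  rw [Nat.card_congr e, Nat.card_eq_fintype_card, Fintype.card_coe, Finset.card_sigma]
  simp only [Finset.card_range]
  exact sum_tri t

lemma finrank_HH (t : ℕ) : 2 * Module.finrank ℝ (HH t) = (t+1)*(t+2) := by
  rw [← card_exps t]
  congr 1
  exact Module.finrank_eq_nat_card_basis (basisRestrictSupport ℝ _)

/-- separating polynomial -/
lemma exists_sep (S : Finset (Fin 2 → ℝ)) (v : Fin 2 → ℝ) (hv : v ∉ S) :
    ∃ p : Po, p.totalDegree ≤ S.card ∧ eval v p ≠ 0 ∧ ∀ w ∈ S, eval w p = 0 := by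
  induction S using Finset.induction_on with
  | empty => exact ⟨1, by simp, by simp, by simp⟩
  | insert w S hw ih =>
    obtain ⟨p, h1, h2, h3⟩ := ih (fun h => hv (Finset.mem_insert_of_mem h))
    have hvw : v ≠ w := fun h => hv (h ▸ Finset.mem_insert_self _ _)
    obtain ⟨i, hi⟩ : ∃ i, v i ≠ w i := by
      by_contra h; push Not at h; exact hvw (funext h)
    refine ⟨p * (X i - C (w i)), ?_, ?_, ?_⟩
    · rw [Finset.card_insert_of_notMem hw]
      refine (totalDegree_mul _ _).trans (add_le_add h1 ?_)
      refine (totalDegree_sub _ _).trans ?_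
      simp
    · simp [h2, sub_ne_zero, hi]
    · intro u hu
      rcases Finset.mem_insert.1 hu with rfl | hu
      · simp
      · simp [h3 u hu]

def evS (S : Finset (Fin 2 → ℝ)) (t : ℕ) : HH t →ₗ[ℝ] (S → ℝ) where
  toFun p := fun s => eval s.1 p.1
  map_add' p q := by ext; simp
  map_smul' c p := by ext; simp

lemma evS_surj (S : Finset (Fin 2 → ℝ)) (t : ℕ) (ht : S.card ≤ t) : Function.Surjective (evS S t) := by
  rw [← LinearMap.range_eq_top, eq_top_iff]
  have : (⊤ : Submodule ℝ (S → ℝ)) = Submodule.span ℝ (Set.range (Pi.basisFun ℝ S)) :=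
    (Pi.basisFun ℝ S).span_eq.symm
  rw [this, Submodule.span_le]
  rintro _ ⟨s, rfl⟩
  obtain ⟨p, h1, h2, h3⟩ := exists_sep (S.erase s.1) s.1 (Finset.notMem_erase _ _)
  refine ⟨⟨(eval s.1 p)⁻¹ • p, ?_⟩, ?_⟩
  · apply Submodule.smul_mem
    rw [mem_HH]
    exact h1.trans ((Finset.card_erase_le).trans ht)
  · ext u
    simp only [evS, LinearMap.coe_mk, AddHom.coe_mk, smul_eval, Pi.basisFun_apply]
    by_cases hu : u = s
    · subst hu; simp [h2]
    · rw [h3 u.1 (Finset.mem_erase.2 ⟨fun h => hu (Subtype.ext h), u.2⟩)]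
      simp [Pi.single_apply, hu]

def mulH (f : Po) (d t : ℕ) (hf : f.totalDegree ≤ d) : HH t →ₗ[ℝ] HH (t + d) where
  toFun p := ⟨p.1 * f, by
    rw [mem_HH]
    exact (totalDegree_mul _ _).trans (add_le_add (mem_HH.1 p.2) hf)⟩
  map_add' p q := by ext1; simp [add_mul]
  map_smul' c p := by ext1; simp

/-- Bezout (upper bound). -/
theorem bezout {f g : Po} (hf : Irreducible f) {d e : ℕ} (hd : f.totalDegree = d) (he : g.totalDegree ≤ e)
    (hfg : ¬ f ∣ g) (S : Finset (Fin 2 → ℝ)) (hS : ∀ s ∈ S, eval s f = 0 ∧ eval s g = 0) : S.card ≤ d * e := by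
  set s := S.card with hs
  have hprime : Prime f := hf.prime
  let A1 : HH (s + e) →ₗ[ℝ] HH (s + e + d) := mulH f d (s+e) hd.le
  have hg' : s + d + e = s + e + d := by ring
  let A2 : HH (s + d) →ₗ[ℝ] HH (s + e + d) := 
    (LinearEquiv.ofEq (HH (s+d+e)) (HH (s+e+d)) (by rw [hg'])).toLinearMap ∘ₗ mulH g e (s+d) he
  let Φ : (HH (s+e) × HH (s+d)) →ₗ[ℝ] HH (s+e+d) := A1.coprod A2
  have hΦ : ∀ u v, (Φ (u, v)).1 = u.1 * f + v.1 * g := by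
    intro u v; rfl
  let Ψ : HH s →ₗ[ℝ] (HH (s+e) × HH (s+d)) := (mulH (-g) e s (by simpa using he)).prod (mulH f d s hd.le)
  have hΨ : LinearMap.ker Φ ≤ LinearMap.range Ψ := by
    rintro ⟨u, v⟩ h
    rw [LinearMap.mem_ker] at h
    have h1 : u.1 * f + v.1 * g = 0 := by rw [← hΦ, h]; rfl
    have h2 : f ∣ v.1 * g := ⟨-u.1, by linear_combination h1⟩
    obtain ⟨w, hw⟩ := (hprime.dvd_or_dvd h2).resolve_right hfg
    have hw' : w.totalDegree ≤ s := by
      by_cases hw0 : w = 0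
      · simp [hw0]
      have := totalDegree_mul_of_isDomain hf.ne_zero hw0
      have h3 := mem_HH.1 v.2
      rw [hw, this] at h3
      omega
    refine ⟨⟨w, mem_HH.2 hw'⟩, ?_⟩
    ext1
    · apply Subtype.ext
      change w * (-g) = u.1
      have : f * (u.1 + w * g) = 0 := by rw [hw] at h1; linear_combination h1
      have := (mul_eq_zero.1 this).resolve_left hf.ne_zero
      linear_combination -this
    · apply Subtype.ext
      change w * f = v.1
      rw [hw, mul_comm]
  have hker : LinearMap.range Φ ≤ LinearMap.ker (evS S (s+e+d)) := by
    rintro _ ⟨⟨u, v⟩, rfl⟩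
    rw [LinearMap.mem_ker]
    ext x
    change eval x.1 (Φ (u, v)).1 = 0
    rw [hΦ]
    simp [(hS x.1 x.2).1, (hS x.1 x.2).2]
  have r1 := Φ.finrank_range_add_finrank_ker
  have r2 := (evS S (s+e+d)).finrank_range_add_finrank_ker
  have r3 := Submodule.finrank_mono hker
  have r4 := Submodule.finrank_mono hΨ
  have r5 := LinearMap.finrank_range_le Ψ
  rw [LinearMap.range_eq_top.2 (evS_surj S _ (by omega))] at r2
  rw [Module.finrank_prod] at r1
  simp only [finrank_top, Module.finrank_fintype_fun_eq_card, Fintype.card_coe] at r2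
  have n0 := finrank_HH s
  have n1 := finrank_HH (s+e)
  have n2 := finrank_HH (s+d)
  have n3 := finrank_HH (s+e+d)
  nlinarith

end
end WS

namespace WS
noncomputable section
open scoped Classical
open MvPolynomial

def lin (x y : ℝ) : Po := C x * X 0 - X 1 - C y

@[simp] lemma eval_lin (x y : ℝ) (v : Fin 2 → ℝ) : eval v (lin x y) = x * v 0 - v 1 - y := by
  simp [lin]

lemma irred_of_deg_one {f : Po} (h : f.totalDegree = 1) : Irreducible f := by
  have h0 : f ≠ 0 := by rintro rfl; simp at h
  refine ⟨fun hu => ?_, ?_⟩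
  · rw [MvPolynomial.isUnit_iff_totalDegree_of_isReduced] at hu
    omega
  · intro u v huv
    have hu : u ≠ 0 := by rintro rfl; simp at huv; exact h0 huv
    have hv : v ≠ 0 := by rintro rfl; simp at huv; exact h0 huv
    have := totalDegree_mul_of_isDomain hu hv
    rw [← huv, h] at this
    have key : ∀ w : Po, w ≠ 0 → w.totalDegree = 0 → IsUnit w := by
      intro w hw h1
      rw [totalDegree_eq_zero_iff_eq_C] at h1
      rw [h1] at hw ⊢
      refine IsUnit.map C (IsUnit.mk0 _ ?_)
      intro h2; rw [h2] at hw; simp at hw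
    rcases Nat.eq_zero_or_pos u.totalDegree with h1 | h1
    · exact Or.inl (key u hu h1)
    · exact Or.inr (key v hv (by omega))

lemma lin_ne_zero (x y : ℝ) : lin x y ≠ 0 := by
  intro h
  have h1 := eval_lin x y ![0, -y + 1]
  rw [h] at h1
  simp at h1

lemma lin_deg (x y : ℝ) : (lin x y).totalDegree = 1 := by
  apply le_antisymm
  · rw [lin]
    refine (totalDegree_sub _ _).trans (max_le ((totalDegree_sub _ _).trans (max_le ?_ ?_)) ?_)
    · refine (totalDegree_mul _ _).trans ?_
      simp
    · simp
    · simp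
  · by_contra h
    have h1 : (lin x y).totalDegree = 0 := by omega
    rw [totalDegree_eq_zero_iff_eq_C] at h1
    have h2 := eval_lin x y ![0, 0]
    have h3 := eval_lin x y ![0, 1]
    rw [h1] at h2 h3
    simp at h2 h3
    linarith

lemma lin_irred (x y : ℝ) : Irreducible (lin x y) := irred_of_deg_one (lin_deg x y)

/-- a polynomial of degree `≤ e` with more than `e` zeros on the line is divisible by its equation -/
lemma lin_dvd {x y : ℝ} {g : Po} {e : ℕ} (he : g.totalDegree ≤ e) (S : Finset (Fin 2 → ℝ))
    (hS : ∀ s ∈ S, eval s (lin x y) = 0 ∧ eval s g = 0) (hc : e < S.card) : lin x y ∣ g := by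
  by_contra h
  have := bezout (lin_irred x y) (lin_deg x y) he h S hS
  omega

lemma deg_quot {f g h : Po} {d e : ℕ} (hf : f ≠ 0) (hd : f.totalDegree = d) (hg : g.totalDegree ≤ d + e) (h1 : g = f * h) :
    h.totalDegree ≤ e := by
  by_cases h0 : h = 0
  · simp [h0]
  have := totalDegree_mul_of_isDomain hf h0
  rw [← h1] at this
  omega

theorem chasles (p : Fin 3 → Fin 3 → (Fin 2 → ℝ)) (r r' c c' : Fin 3 → ℝ)
    (hr : ∀ i j k, eval (p i j) (lin (r k) (r' k)) = 0 ↔ i = k)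
    (hc : ∀ i j k, eval (p i j) (lin (c k) (c' k)) = 0 ↔ j = k)
    (F : Po) (hF : F.totalDegree ≤ 3) (hv : ∀ i j, ¬ (i = 2 ∧ j = 2) → eval (p i j) F = 0) :
    eval (p 2 2) F = 0 := by
  have pinj : ∀ i j i' j', p i j = p i' j' → i = i' ∧ j = j' := by
    intro i j i' j' h
    refine ⟨((hr i' j' i).1 (by rw [← h]; exact (hr i j i).2 rfl)).symm,
      ((hc i' j' j).1 (by rw [← h]; exact (hc i j j).2 rfl)).symm⟩
  set M : Po := lin (c 0) (c' 0) * lin (c 1) (c' 1) * lin (c 2) (c' 2) with hM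
  have hMv : ∀ i j, eval (p i j) M = 0 := by
    intro i j
    have := (hc i j j).2 rfl
    rw [hM, eval_mul, eval_mul]
    fin_cases j <;> simp only [Fin.zero_eta, Fin.mk_one, Fin.reduceFinMk] at * <;> simp only [this, mul_zero, zero_mul]
  have hMd : M.totalDegree ≤ 3 := by
    rw [hM]
    refine (totalDegree_mul _ _).trans ?_
    have := totalDegree_mul (lin (c 0) (c' 0)) (lin (c 1) (c' 1))
    simp only [lin_deg] at *
    omega
  -- fourth point on row 0
  obtain ⟨t, ht⟩ := Infinite.exists_notMem_finset (Finset.image (fun j => p 0 j 0) Finset.univ)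
  set q : Fin 2 → ℝ := ![t, r 0 * t - r' 0] with hq
  have hq0 : eval q (lin (r 0) (r' 0)) = 0 := by simp [hq]
  have hqc : ∀ j, eval q (lin (c j) (c' j)) ≠ 0 := by
    intro j hj
    have h1 := (hr 0 j 0).2 rfl
    have h2 := (hc 0 j j).2 rfl
    rw [eval_lin] at h1 h2 hj
    simp only [hq, Matrix.cons_val_zero, Matrix.cons_val_one] at hj
    have hne : t - p 0 j 0 ≠ 0 := by
      intro h
      apply ht
      exact Finset.mem_image.2 ⟨j, Finset.mem_univ _, by linarith⟩
    have h3 : (c j - r 0) * (t - p 0 j 0) = 0 := by linear_combination hj - h2 + h1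
    have h4 : c j = r 0 := by
      have := (mul_eq_zero.1 h3).resolve_right hne
      linarith
    have h5 : c' j = r' 0 := by rw [h4] at h2; linarith
    have h6 := (hc 1 j j).2 rfl
    rw [h4, h5] at h6
    exact absurd ((hr 1 j 0).1 h6) (by decide)
  have hqM : eval q M ≠ 0 := by
    rw [hM, eval_mul, eval_mul]
    exact mul_ne_zero (mul_ne_zero (hqc _) (hqc _)) (hqc _)
  set G := F - C (eval q F / eval q M) * M with hG
  have hGd : G.totalDegree ≤ 1 + 2 := by
    refine (totalDegree_sub _ _).trans (max_le hF ?_)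
    refine (totalDegree_mul _ _).trans ?_
    simpa using hMd
  have hGv : ∀ i j, eval (p i j) G = eval (p i j) F := by
    intro i j; rw [hG, eval_sub, eval_mul, hMv]; simp
  have hGq : eval q G = 0 := by
    rw [hG, eval_sub, eval_mul, eval_C]; field_simp; ring
  rw [← hGv]
  have d1 : lin (r 0) (r' 0) ∣ G := by
    refine lin_dvd (e := 3) hGd {q, p 0 0, p 0 1, p 0 2} ?_ ?_
    · intro s hs
      simp only [Finset.mem_insert, Finset.mem_singleton] at hs
      have key : ∀ j, eval (p 0 j) (lin (r 0) (r' 0)) = 0 ∧ eval (p 0 j) G = 0 := fun j =>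
        ⟨(hr 0 j 0).2 rfl, by rw [hGv]; exact hv _ _ (by simp)⟩
      rcases hs with rfl | rfl | rfl | rfl
      · exact ⟨hq0, hGq⟩
      · exact key _
      · exact key _
      · exact key _
    · have hqp : ∀ j, q ≠ p 0 j := by
        intro j h
        apply hqc j
        rw [h]; exact (hc 0 j j).2 rfl
      rw [Finset.card_insert_of_notMem, Finset.card_insert_of_notMem, Finset.card_insert_of_notMem]
      · simp
      · simp only [Finset.mem_singleton]; intro h; exact absurd (pinj _ _ _ _ h).2 (by decide)
      · simp only [Finset.mem_insert, Finset.mem_singleton]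
        rintro (h | h)
        · exact absurd (pinj _ _ _ _ h).2 (by decide)
        · exact absurd (pinj _ _ _ _ h).2 (by decide)
      · simp only [Finset.mem_insert, Finset.mem_singleton]
        rintro (h | h | h) <;> exact hqp _ h
  obtain ⟨G2, hG2⟩ := d1
  have hG2d : G2.totalDegree ≤ 2 := deg_quot (lin_ne_zero _ _) (lin_deg _ _) hGd hG2
  have hG2v : ∀ i j, i ≠ 0 → eval (p i j) G = 0 → eval (p i j) G2 = 0 := by
    intro i j hi h
    rw [hG2, eval_mul] at h
    exact (mul_eq_zero.1 h).resolve_left (fun h => hi ((hr i j 0).1 h))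
  have d2 : lin (r 1) (r' 1) ∣ G2 := by
    refine lin_dvd (e := 2) hG2d {p 1 0, p 1 1, p 1 2} ?_ ?_
    · intro s hs
      simp only [Finset.mem_insert, Finset.mem_singleton] at hs
      have key : ∀ j, eval (p 1 j) (lin (r 1) (r' 1)) = 0 ∧ eval (p 1 j) G2 = 0 := fun j =>
        ⟨(hr 1 j 1).2 rfl, hG2v _ _ (by decide) (by rw [hGv]; exact hv _ _ (by simp))⟩
      rcases hs with rfl | rfl | rfl
      · exact key _
      · exact key _
      · exact key _
    · rw [Finset.card_insert_of_notMem, Finset.card_insert_of_notMem]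
      · simp
      · simp only [Finset.mem_singleton]; intro h; exact absurd (pinj _ _ _ _ h).2 (by decide)
      · simp only [Finset.mem_insert, Finset.mem_singleton]
        rintro (h | h)
        · exact absurd (pinj _ _ _ _ h).2 (by decide)
        · exact absurd (pinj _ _ _ _ h).2 (by decide)
  obtain ⟨G3, hG3⟩ := d2
  have hG3d : G3.totalDegree ≤ 1 := deg_quot (lin_ne_zero _ _) (lin_deg _ _) hG2d hG3
  have hG3v : ∀ j, eval (p 2 j) G = 0 → eval (p 2 j) G3 = 0 := by
    intro j h
    have h1 := hG2v 2 j (by decide) h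
    rw [hG3, eval_mul] at h1
    exact (mul_eq_zero.1 h1).resolve_left (fun h => absurd ((hr 2 j 1).1 h) (by decide))
  have d3 : lin (r 2) (r' 2) ∣ G3 := by
    refine lin_dvd (e := 1) hG3d {p 2 0, p 2 1} ?_ ?_
    · intro s hs
      simp only [Finset.mem_insert, Finset.mem_singleton] at hs
      have key : ∀ j, j ≠ 2 → eval (p 2 j) (lin (r 2) (r' 2)) = 0 ∧ eval (p 2 j) G3 = 0 := fun j hj =>
        ⟨(hr 2 j 2).2 rfl, hG3v _ (by rw [hGv]; exact hv _ _ (by simpa using hj))⟩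
      rcases hs with rfl | rfl
      · exact key _ (by decide)
      · exact key _ (by decide)
    · rw [Finset.card_insert_of_notMem]
      · simp
      · simp only [Finset.mem_singleton]; intro h; exact absurd (pinj _ _ _ _ h).2 (by decide)
  obtain ⟨G4, hG4⟩ := d3
  rw [hG2, hG3, hG4]
  simp only [eval_mul, (hr 2 2 2).2 rfl]
  simp

/-- point of the plane with index `a` -/
def pt (b : ℝ → ℝ) (a : ℝ) : Fin 2 → ℝ := ![a, b a]

lemma eval_lin_pt (b : ℝ → ℝ) (x y a : ℝ) : eval (pt b a) (lin x y) = 0 ↔ fl b a x = y := by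
  simp [pt, fl, sub_eq_zero, mul_comm]

lemma pt_inj {b : ℝ → ℝ} {a c : ℝ} (h : pt b a = pt b c) : a = c := by
  have := congrFun h 0
  simpa [pt] using this

theorem chasles_tri {A : Finset ℝ} {b : ℝ → ℝ} (p : Fin 3 → Fin 3 → ℝ)
    (hrow : ∀ i, Tri A b (p i 0) (p i 1) (p i 2)) (hcol : ∀ j, Tri A b (p 0 j) (p 1 j) (p 2 j))
    (hdis : ∀ i j k l, i ≠ k → j ≠ l → p i j ≠ p k l)
    (F : Po) (hF : F.totalDegree ≤ 3) (i0 j0 : Fin 3)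
    (hv : ∀ i j, ¬ (i = i0 ∧ j = j0) → eval (pt b (p i j)) F = 0) :
    eval (pt b (p i0 j0)) F = 0 := by
  have hA : ∀ i j, p i j ∈ A := by
    intro i j
    have := hrow i
    fin_cases j
    · exact this.1
    · exact this.2.1
    · exact this.2.2.1
  have hrow' : ∀ i j k, j ≠ k → p i j ≠ p i k := by
    intro i j k hjk
    obtain ⟨-, -, -, h1, h2, h3, -⟩ := hrow i
    fin_cases j <;> fin_cases k <;> first | exact absurd rfl hjk | assumption | exact Ne.symm ‹_›
  have hcol' : ∀ j i k, i ≠ k → p i j ≠ p k j := by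
    intro j i k hjk
    obtain ⟨-, -, -, h1, h2, h3, -⟩ := hcol j
    fin_cases i <;> fin_cases k <;> first | exact absurd rfl hjk | assumption | exact Ne.symm ‹_›
  have pinj : ∀ i j k l, p i j = p k l → i = k ∧ j = l := by
    intro i j k l h
    by_cases h1 : i = k
    · subst h1
      exact ⟨rfl, by by_contra h2; exact hrow' _ _ _ h2 h⟩
    · by_cases h2 : j = l
      · subst h2; exact absurd h (hcol' _ _ _ h1)
      · exact absurd h (hdis _ _ _ _ h1 h2)
  have hrl : ∀ k, ∃ x y, ∀ i j, eval (pt b (p i j)) (lin x y) = 0 ↔ i = k := by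
    intro k
    obtain ⟨-, -, -, -, -, -, x, y, hxy⟩ := hrow k
    refine ⟨x, y, fun i j => ?_⟩
    rw [eval_lin_pt, hxy _ (hA i j)]
    constructor
    · rintro (h | h | h) <;> exact (pinj _ _ _ _ h).1
    · rintro rfl
      fin_cases j
      · left; rfl
      · right; left; rfl
      · right; right; rfl
  have hcl : ∀ k, ∃ x y, ∀ i j, eval (pt b (p i j)) (lin x y) = 0 ↔ j = k := by
    intro k
    obtain ⟨-, -, -, -, -, -, x, y, hxy⟩ := hcol k
    refine ⟨x, y, fun i j => ?_⟩
    rw [eval_lin_pt, hxy _ (hA i j)]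
    constructor
    · rintro (h | h | h) <;> exact (pinj _ _ _ _ h).2
    · rintro rfl
      fin_cases i
      · left; rfl
      · right; left; rfl
      · right; right; rfl
  choose r r' hr using hrl
  choose c c' hc using hcl
  let s := Equiv.swap i0 (2 : Fin 3)
  let s' := Equiv.swap j0 (2 : Fin 3)
  have hs : s 2 = i0 := Equiv.swap_apply_right _ _
  have hs' : s' 2 = j0 := Equiv.swap_apply_right _ _
  have := chasles (fun i j => pt b (p (s i) (s' j))) (r ∘ s) (r' ∘ s) (c ∘ s') (c' ∘ s')
    (fun i j k => by rw [Function.comp, Function.comp, hr]; exact s.injective.eq_iff)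
    (fun i j k => by rw [Function.comp, Function.comp, hc]; exact s'.injective.eq_iff) F hF
    (fun i j h => hv _ _ (by
      rintro ⟨h1, h2⟩
      apply h
      rw [← hs] at h1; rw [← hs'] at h2
      exact ⟨s.injective h1, s'.injective h2⟩))
  simpa only [hs, hs'] using this

end
end WS

namespace WS
noncomputable section
open scoped Classical
open MvPolynomial

variable {A : Finset ℝ} {b : ℝ → ℝ}

lemma Tri.swap12 {u v w : ℝ} (h : Tri A b u v w) : Tri A b v u w := by
  obtain ⟨h1, h2, h3, h4, h5, h6, x, y, h⟩ := h
  refine ⟨h2, h1, h3, h4.symm, h6, h5, x, y, fun c hc => ?_⟩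
  rw [h c hc]; exact or_left_comm
lemma Tri.swap23 {u v w : ℝ} (h : Tri A b u v w) : Tri A b u w v := by
  obtain ⟨h1, h2, h3, h4, h5, h6, x, y, h⟩ := h
  refine ⟨h1, h3, h2, h5, h4, h6.symm, x, y, fun c hc => ?_⟩
  rw [h c hc]; exact or_congr_right or_comm

/-- `F` vanishes at the point with index `a` -/
def Van (b : ℝ → ℝ) (F : Po) (a : ℝ) : Prop := eval (pt b a) F = 0

def grid (X Y Z : ℕ → ℝ) (i c e g : ℕ) : Fin 3 → Fin 3 → ℝ :=
  ![![X (i+e), Y (i+e+c), Z c], ![Y (i+e+g), Z e, X (i+g)], ![Z g, X (i+c), Y (i+c+g)]]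

lemma run_grid {n : ℕ} {X Y Z : ℕ → ℝ} (R : Run A b n X Y Z) {i c e g : ℕ} (hi : 2 ≤ i) (hin : i + 6 ≤ n)
    (hc : c < 4) (he : e < 4) (hg : g < 4) (hce : c ≠ e) (hcg : c ≠ g) (heg : e ≠ g)
    {F : Po} (hF : F.totalDegree ≤ 3) (i0 j0 : Fin 3)
    (hv : ∀ k l, ¬ (k = i0 ∧ l = j0) → Van b F (grid X Y Z i c e g k l)) : Van b F (grid X Y Z i c e g i0 j0) := by
  refine chasles_tri (A := A) (grid X Y Z i c e g) ?_ ?_ ?_ F hF i0 j0 hv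
  · intro k
    fin_cases k
    · exact ((R.tri (i+e) (by omega) c hc).swap12).swap23
    · have := R.tri (i+g) (by omega) e he
      rw [show i + g + e = i + e + g by ring] at this
      exact this.swap23.swap12
    · exact R.tri (i+c) (by omega) g hg
  · intro k
    fin_cases k
    · exact ((R.tri (i+e) (by omega) g hg).swap12).swap23
    · have := R.tri (i+c) (by omega) e he
      rw [show i + c + e = i + e + c by ring] at this
      exact this.swap23.swap12
    · have := R.tri (i+g) (by omega) c hc
      rw [show i + g + c = i + c + g by ring] at this
      exact this
  · have hxz : ∀ k j, k < n → j < 4 → X k ≠ Z j := fun k j hk hj => (R.tri k hk j hj).2.2.2.1.symm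
    have hyz : ∀ k j, k < n → j < 4 → j ≤ k → Y k ≠ Z j := fun k j hk hj hjk => by
      have := (R.tri (k - j) (by omega) j hj).2.2.2.2.1.symm
      rwa [Nat.sub_add_cancel hjk] at this
    have hxx : ∀ k j, k < n → j < n → k ≠ j → X k ≠ X j := fun k j h1 h2 h3 h4 => h3 (R.Xinj _ h1 _ h2 h4)
    have hyy : ∀ k j, k < n → j < n → k ≠ j → Y k ≠ Y j := fun k j h1 h2 h3 h4 => h3 (R.Yinj _ h1 _ h2 h4)
    have hzz : ∀ k j, k < 4 → j < 4 → k ≠ j → Z k ≠ Z j := fun k j h1 h2 h3 h4 => h3 (R.Zinj _ h1 _ h2 h4)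
    intro k l k' l' h1 h2
    fin_cases k <;> fin_cases k' <;> first | exact absurd rfl h1 | skip
    all_goals
      fin_cases l <;> fin_cases l' <;> first | exact absurd rfl h2 | skip
    all_goals
      simp only [grid, Fin.zero_eta, Fin.mk_one, Fin.reduceFinMk, Matrix.cons_val_zero, Matrix.cons_val_one, Matrix.cons_val]
      first
      | (apply hxx <;> omega)
      | (apply hyy <;> omega)
      | (apply hzz <;> omega)
      | (apply hxz <;> omega)
      | (apply hyz <;> omega)
      | (apply Ne.symm; apply hxz <;> omega)
      | (apply Ne.symm; apply hyz <;> omega)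
      | (exact R.XY _ (by omega) _ (by omega))
      | (exact (R.XY _ (by omega) _ (by omega)).symm)

lemma run_y {n : ℕ} {X Y Z : ℕ → ℝ} (R : Run A b n X Y Z) (i c e g : ℕ) (hi : 2 ≤ i) (hin : i + 6 ≤ n)
    (hc : c < 4) (he : e < 4) (hg : g < 4) (hce : c ≠ e) (hcg : c ≠ g) (heg : e ≠ g)
    {F : Po} (hF : F.totalDegree ≤ 3) (z1 : Van b F (Z c)) (z2 : Van b F (Z e)) (z3 : Van b F (Z g))
    (x1 : Van b F (X (i+c))) (x2 : Van b F (X (i+e))) (x3 : Van b F (X (i+g)))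
    (y1 : Van b F (Y (i+e+c))) (y2 : Van b F (Y (i+e+g))) : Van b F (Y (i+c+g)) := by
  refine run_grid R hi hin hc he hg hce hcg heg hF 2 2 ?_
  intro k l h
  fin_cases k <;> fin_cases l <;> first | assumption | exact absurd ⟨rfl, rfl⟩ h

lemma run_x {n : ℕ} {X Y Z : ℕ → ℝ} (R : Run A b n X Y Z) (i c e g : ℕ) (hi : 2 ≤ i) (hin : i + 6 ≤ n)
    (hc : c < 4) (he : e < 4) (hg : g < 4) (hce : c ≠ e) (hcg : c ≠ g) (heg : e ≠ g)
    {F : Po} (hF : F.totalDegree ≤ 3) (z1 : Van b F (Z c)) (z2 : Van b F (Z e)) (z3 : Van b F (Z g))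
    (x2 : Van b F (X (i+e))) (x3 : Van b F (X (i+g)))
    (y1 : Van b F (Y (i+e+c))) (y2 : Van b F (Y (i+e+g))) (y3 : Van b F (Y (i+c+g))) : Van b F (X (i+c)) := by
  refine run_grid R hi hin hc he hg hce hcg heg hF 2 1 ?_
  intro k l h
  fin_cases k <;> fin_cases l <;> first | assumption | exact absurd ⟨rfl, rfl⟩ h

lemma run_z {n : ℕ} {X Y Z : ℕ → ℝ} (R : Run A b n X Y Z) (i c e g : ℕ) (hi : 2 ≤ i) (hin : i + 6 ≤ n)
    (hc : c < 4) (he : e < 4) (hg : g < 4) (hce : c ≠ e) (hcg : c ≠ g) (heg : e ≠ g)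
    {F : Po} (hF : F.totalDegree ≤ 3) (z2 : Van b F (Z e)) (z3 : Van b F (Z g))
    (x1 : Van b F (X (i+c))) (x2 : Van b F (X (i+e))) (x3 : Van b F (X (i+g)))
    (y1 : Van b F (Y (i+e+c))) (y2 : Van b F (Y (i+e+g))) (y3 : Van b F (Y (i+c+g))) : Van b F (Z c) := by
  refine run_grid R hi hin hc he hg hce hcg heg hF 0 2 ?_
  intro k l h
  fin_cases k <;> fin_cases l <;> first | assumption | exact absurd ⟨rfl, rfl⟩ h

/-- there is a nonzero cubic through any nine points -/
lemma exists_cubic (S : Finset (Fin 2 → ℝ)) (hS : S.card ≤ 9) :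
    ∃ F : Po, F ≠ 0 ∧ F.totalDegree ≤ 3 ∧ ∀ s ∈ S, eval s F = 0 := by
  have h1 : Module.finrank ℝ (S → ℝ) < Module.finrank ℝ (HH 3) := by
    have := finrank_HH 3
    simp only [Module.finrank_fintype_fun_eq_card, Fintype.card_coe]
    omega
  obtain ⟨F, hF, hF0⟩ := Submodule.exists_mem_ne_zero_of_ne_bot (LinearMap.ker_ne_bot_of_finrank_lt (f := evS S 3) h1)
  refine ⟨F.1, ?_, mem_HH.1 F.2, ?_⟩
  · simpa using hF0
  · intro s hs
    have := congrFun (LinearMap.mem_ker.1 hF) ⟨s, hs⟩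
    exact this

theorem run_cubic {n : ℕ} {X Y Z : ℕ → ℝ} (R : Run A b n X Y Z) (hn : 13 ≤ n) :
    ∃ F : Po, F ≠ 0 ∧ F.totalDegree ≤ 3 ∧ (∀ j < 4, Van b F (Z j)) ∧
      ∀ i, 3 ≤ i → i + 5 ≤ n → Van b F (X i) ∧ Van b F (Y i) := by
  obtain ⟨F, hF0, hF, hS⟩ := exists_cubic
    (((([Z 0, Z 1, Z 2, X 2, X 3, X 4, X 5, Y 3, Y 4] : List ℝ).map (pt b)).toFinset) )
    ((List.toFinset_card_le _).trans (by simp))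
  have key : ∀ a ∈ ([Z 0, Z 1, Z 2, X 2, X 3, X 4, X 5, Y 3, Y 4] : List ℝ), Van b F a := by
    intro a ha
    exact hS _ (List.mem_toFinset.2 (List.mem_map_of_mem ha))
  have hz0 := key (Z 0) (by simp)
  have hz1 := key (Z 1) (by simp)
  have hz2 := key (Z 2) (by simp)
  have hx2 := key (X 2) (by simp)
  have hx3 := key (X 3) (by simp)
  have hx4 := key (X 4) (by simp)
  have hx5 := key (X 5) (by simp)
  have hy3 := key (Y 3) (by simp)
  have hy4 := key (Y 4) (by simp)
  have hy5 : Van b F (Y 5) := run_y R 2 1 0 2 (by omega) (by omega) (by omega) (by omega) (by omega) (by omega)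
    (by omega) (by omega) hF hz1 hz0 hz2 hx3 hx2 hx4 hy3 hy4
  have hy6 : Van b F (Y 6) := run_y R 3 1 0 2 (by omega) (by omega) (by omega) (by omega) (by omega) (by omega)
    (by omega) (by omega) hF hz1 hz0 hz2 hx4 hx3 hx5 hy4 hy5
  have hz3 : Van b F (Z 3) := run_z R 2 3 0 1 (by omega) (by omega) (by omega) (by omega) (by omega) (by omega)
    (by omega) (by omega) hF hz0 hz1 hx5 hx2 hx3 hy5 hy3 hy6
  have main : ∀ m, m + 9 ≤ n → (∀ i, 2 ≤ i → i ≤ m + 5 → Van b F (X i)) ∧ (∀ i, 3 ≤ i → i ≤ m + 6 → Van b F (Y i)) := by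
    intro m
    induction m with
    | zero =>
      intro _
      refine ⟨fun i h1 h2 => ?_, fun i h1 h2 => ?_⟩
      · obtain rfl | rfl | rfl | rfl : i = 2 ∨ i = 3 ∨ i = 4 ∨ i = 5 := by omega
        all_goals assumption
      · obtain rfl | rfl | rfl | rfl : i = 3 ∨ i = 4 ∨ i = 5 ∨ i = 6 := by omega
        all_goals assumption
    | succ m ih =>
      intro hm
      obtain ⟨hX, hY⟩ := ih (by omega)
      have y7 : Van b F (Y (m + 7)) := by
        have := run_y R (m+2) 2 1 3 (by omega) (by omega) (by omega) (by omega) (by omega) (by omega)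
          (by omega) (by omega) hF hz2 hz1 hz3 (hX _ (by omega) (by omega)) (hX _ (by omega) (by omega)) (hX _ (by omega) (by omega))
          (hY _ (by omega) (by omega)) (hY _ (by omega) (by omega))
        exact this
      have hY' : ∀ i, 3 ≤ i → i ≤ m + 1 + 6 → Van b F (Y i) := by
        intro i h1 h2
        by_cases h3 : i ≤ m + 6
        · exact hY i h1 h3
        · obtain rfl : i = m + 7 := by omega
          exact y7
      have x6 : Van b F (X (m + 6)) := by
        by_cases hb : m + 4 + 6 ≤ n
        · have := run_x R (m+4) 2 1 0 (by omega) (by omega) (by omega) (by omega) (by omega) (by omega)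
            (by omega) (by omega) hF hz2 hz1 hz0 (hX _ (by omega) (by omega)) (hX _ (by omega) (by omega))
            (hY' _ (by omega) (by omega)) (hY' _ (by omega) (by omega)) (hY' _ (by omega) (by omega))
          exact this
        · omega
      refine ⟨fun i h1 h2 => ?_, hY'⟩
      by_cases h3 : i ≤ m + 5
      · exact hX i h1 h3
      · obtain rfl : i = m + 6 := by omega
        exact x6
  refine ⟨F, hF0, hF, ?_, ?_⟩
  · intro j hj
    interval_cases j <;> assumption
  · intro i h1 h2
    obtain ⟨hX, hY⟩ := main (n - 9) (by omega)
    exact ⟨hX i (by omega) (by omega), hY i (by omega) (by omega)⟩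

/-- P1 : every run together with its base point lies on a nonzero cubic -/
theorem inRun_cubic {a : ℝ} (ha : a ∈ A) (k : ℕ) :
    ∃ F : Po, F ≠ 0 ∧ F.totalDegree ≤ 3 ∧ Van b F a ∧ ∀ q, InRun A b a k q → Van b F q := by
  by_cases hne : ∃ q, InRun A b a k q
  · obtain ⟨n, X, Y, Z, R, hZ, hq⟩ := run_exists ha hne
    obtain ⟨q, hq0⟩ := hne
    obtain ⟨i, h1, h2, -⟩ := hq q hq0
    obtain ⟨F, h3, h4, h5, h6⟩ := run_cubic R (by omega)
    refine ⟨F, h3, h4, hZ ▸ h5 0 (by omega), fun q hq1 => ?_⟩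
    obtain ⟨i, h1, h2, h | h⟩ := hq q hq1
    · rw [h]; exact (h6 i (by omega) (by omega)).1
    · rw [h]; exact (h6 i (by omega) (by omega)).2
  · push Not at hne
    obtain ⟨F, h1, h2, h3⟩ := exists_cubic {pt b a} (by simp)
    exact ⟨F, h1, h2, h3 _ (by simp), fun q hq => absurd hq (hne q)⟩

end
end WS

namespace WS
noncomputable section
open scoped Classical
open MvPolynomial

variable {A : Finset ℝ} {b : ℝ → ℝ}

lemma irred_deg_pos {f : Po} (hf : Irreducible f) : 1 ≤ f.totalDegree := by
  by_contra h
  have h1 : f.totalDegree = 0 := by omega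
  rw [totalDegree_eq_zero_iff_eq_C] at h1
  apply hf.not_isUnit
  have h0 := hf.ne_zero
  rw [h1] at h0 ⊢
  refine IsUnit.map C (IsUnit.mk0 _ ?_)
  intro h2; rw [h2] at h0; simp at h0

lemma exists_factors (F : Po) (hF : F ≠ 0) : ∃ S : Finset Po, S.card ≤ F.totalDegree ∧
    (∀ f ∈ S, Irreducible f ∧ f.totalDegree ≤ F.totalDegree) ∧ ∀ v, eval v F = 0 → ∃ f ∈ S, eval v f = 0 := by
  revert hF
  refine WfDvdMonoid.induction_on_irreducible F ?_ ?_ ?_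
  · intro h; exact absurd rfl h
  · intro u hu _
    refine ⟨∅, by simp, by simp, fun v hv => ?_⟩
    have := hu.map (eval v)
    rw [hv] at this
    simp at this
  · intro a i ha hi ih _
    obtain ⟨S, h1, h2, h3⟩ := ih ha
    have hd := totalDegree_mul_of_isDomain hi.ne_zero ha
    have hp := irred_deg_pos hi
    refine ⟨insert i S, ?_, ?_, ?_⟩
    · refine (Finset.card_insert_le _ _).trans ?_
      omega
    · intro f hf
      rcases Finset.mem_insert.1 hf with rfl | hf
      · exact ⟨hi, by omega⟩
      · exact ⟨(h2 f hf).1, by have := (h2 f hf).2; omega⟩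
    · intro v hv
      rw [eval_mul] at hv
      rcases mul_eq_zero.1 hv with h | h
      · exact ⟨i, Finset.mem_insert_self _ _, h⟩
      · obtain ⟨f, hf, h'⟩ := h3 v h
        exact ⟨f, Finset.mem_insert_of_mem hf, h'⟩

variable (A b) in
def ZF (f : Po) : Finset ℝ := A.filter (fun q => Van b f q)

variable (A b) in
def bd (p : ℝ) : ℕ := (badS A b p).card

lemma mem_ZF {f : Po} {q : ℝ} : q ∈ ZF A b f ↔ q ∈ A ∧ Van b f q := Finset.mem_filter

/-- bezout for sets of indices -/
lemma bezout_idx {f g : Po} (hf : Irreducible f) {d e : ℕ} (hd : f.totalDegree = d) (he : g.totalDegree ≤ e)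
    (hfg : ¬ f ∣ g) (S : Finset ℝ) (hS : ∀ s ∈ S, Van b f s ∧ Van b g s) : S.card ≤ d * e := by
  have := bezout hf hd he hfg (S.image (pt b)) (by
    intro s hs
    obtain ⟨q, hq, rfl⟩ := Finset.mem_image.1 hs
    exact hS q hq)
  rwa [Finset.card_image_of_injective _ (fun x y h => pt_inj h)] at this

lemma van_lin {x y a : ℝ} : Van b (lin x y) a ↔ fl b a x = y := eval_lin_pt b x y a

/-- line of slope x through p -/
def lnp (b : ℝ → ℝ) (p x : ℝ) : Po := lin x (fl b p x)

lemma van_lnp {p x q : ℝ} : Van b (lnp b p x) q ↔ q = p ∨ slp b p q = x := by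
  rw [lnp, van_lin]
  by_cases h : q = p
  · simp [h]
  · rw [fl_eq_iff b h]; simp [h, eq_comm]

lemma irred_not_lin_dvd {f : Po} (hf : Irreducible f) (hd : 2 ≤ f.totalDegree) (x y : ℝ) : ¬ lin x y ∣ f := by
  intro h
  have h1 : Associated (lin x y) f := (lin_irred x y).associated_of_dvd hf h
  obtain ⟨g, hg⟩ := h
  obtain ⟨g', hg'⟩ := h1.symm.dvd
  have hg0 : g ≠ 0 := by rintro rfl; rw [mul_zero] at hg; exact hf.ne_zero hg
  have hg0' : g' ≠ 0 := by rintro rfl; rw [mul_zero] at hg'; exact lin_ne_zero _ _ hg'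
  have := totalDegree_mul_of_isDomain hf.ne_zero hg0'
  rw [← hg', lin_deg] at this
  omega

/-- cover of A by irreducible curves -/
theorem cover {p : ℝ} (hp : p ∈ A) : ∃ S : Finset Po, S.card ≤ 4 * bd A b p + 3 ∧
    (∀ f ∈ S, Irreducible f ∧ f.totalDegree ≤ 3) ∧ ∀ q ∈ A, ∃ f ∈ S, Van b f q := by
  choose F h1 h2 h3 h4 using fun k => inRun_cubic (b := b) hp k
  choose S s1 s2 s3 using fun k => exists_factors (F k) (h1 k)
  refine ⟨(Finset.range (bd A b p + 1)).biUnion S ∪ (badS A b p).image (lnp b p), ?_, ?_, ?_⟩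
  · refine (Finset.card_union_le _ _).trans ?_
    have e1 : ((Finset.range (bd A b p + 1)).biUnion S).card ≤ (bd A b p + 1) * 3 := by
      refine Finset.card_biUnion_le.trans ?_
      refine (Finset.sum_le_card_nsmul _ _ 3 (fun k _ => (s1 k).trans (h2 k))).trans ?_
      simp
    have e2 : ((badS A b p).image (lnp b p)).card ≤ bd A b p := Finset.card_image_le
    omega
  · intro f hf
    rcases Finset.mem_union.1 hf with hf | hf
    · obtain ⟨k, -, hk⟩ := Finset.mem_biUnion.1 hf
      exact ⟨(s2 k f hk).1, (s2 k f hk).2.trans (h2 k)⟩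
    · obtain ⟨x, -, rfl⟩ := Finset.mem_image.1 hf
      exact ⟨lin_irred _ _, by rw [lnp, lin_deg]; omega⟩
  · intro q hq
    by_cases hqp : q = p
    · obtain ⟨f, hf, hv⟩ := s3 0 _ (h3 0)
      exact ⟨f, Finset.mem_union_left _ (Finset.mem_biUnion.2 ⟨0, by simp, hf⟩), by rw [hqp]; exact hv⟩
    by_cases hb : slp b p q ∈ badS A b p
    · exact ⟨lnp b p (slp b p q), Finset.mem_union_right _ (Finset.mem_image_of_mem _ hb), van_lnp.2 (Or.inr rfl)⟩
    · obtain ⟨f, hf, hv⟩ := s3 _ _ (h4 (cnt A b p (slp b p q)) q ⟨hq, hqp, hb, rfl⟩)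
      refine ⟨f, Finset.mem_union_left _ (Finset.mem_biUnion.2 ⟨_, ?_, hf⟩), hv⟩
      rw [Finset.mem_range]
      have := cnt_le (A := A) (b := b) p (slp b p q)
      exact Nat.lt_succ_of_le this

/-- count by slopes/runs -/
lemma count_split {p : ℝ} (U : Finset ℝ) (hU : U ⊆ A) (hpU : p ∉ U) (c1 c2 : ℕ)
    (h1 : ∀ x ∈ badS A b p, (U.filter (fun q => slp b p q = x)).card ≤ c1)
    (h2 : ∀ k, (U.filter (fun q => InRun A b p k q)).card ≤ c2) :
    U.card ≤ c1 * bd A b p + c2 * (bd A b p + 1) := by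
  have hsub : U ⊆ (badS A b p).biUnion (fun x => U.filter (fun q => slp b p q = x)) ∪
      (Finset.range (bd A b p + 1)).biUnion (fun k => U.filter (fun q => InRun A b p k q)) := by
    intro q hq
    have hqp : q ≠ p := fun h => hpU (h ▸ hq)
    by_cases hb : slp b p q ∈ badS A b p
    · exact Finset.mem_union_left _ (Finset.mem_biUnion.2 ⟨_, hb, Finset.mem_filter.2 ⟨hq, rfl⟩⟩)
    · refine Finset.mem_union_right _ (Finset.mem_biUnion.2 ⟨cnt A b p (slp b p q), ?_, Finset.mem_filter.2 ⟨hq, hU hq, hqp, hb, rfl⟩⟩)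
      rw [Finset.mem_range]
      exact Nat.lt_succ_of_le (cnt_le (A := A) (b := b) p (slp b p q))
  refine (Finset.card_le_card hsub).trans ((Finset.card_union_le _ _).trans (add_le_add ?_ ?_))
  · refine Finset.card_biUnion_le.trans ((Finset.sum_le_card_nsmul _ _ c1 h1).trans ?_)
    simp [bd, mul_comm]
  · refine Finset.card_biUnion_le.trans ((Finset.sum_le_card_nsmul _ _ c2 (fun k _ => h2 k)).trans ?_)
    simp [mul_comm]

lemma slope_count {f : Po} (hf : Irreducible f) (hd : 2 ≤ f.totalDegree) {d : ℕ} (hd' : f.totalDegree ≤ d) (p x : ℝ) (S : Finset ℝ)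
    (hS : ∀ q ∈ S, Van b f q ∧ slp b p q = x) : S.card ≤ d := by
  have := bezout_idx (b := b) (lin_irred x (fl b p x)) (lin_deg _ _) hd' (irred_not_lin_dvd hf hd _ _) S
    (fun q hq => ⟨van_lnp.2 (Or.inr (hS q hq).2), (hS q hq).1⟩)
  omega

theorem caseA_pt {f : Po} (hf : Irreducible f) (hd : f.totalDegree = 3) {p : ℝ} (hp : p ∈ A) (hpf : ¬ Van b f p) :
    (ZF A b f).card ≤ 12 * bd A b p + 9 := by
  have := count_split (b := b) (p := p) (ZF A b f) (Finset.filter_subset _ _) (fun h => hpf (mem_ZF.1 h).2) 3 9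
    (fun x _ => slope_count hf (by omega) hd.le p x _ (fun q hq => ⟨(mem_ZF.1 (Finset.mem_filter.1 hq).1).2, (Finset.mem_filter.1 hq).2⟩))
    (fun k => by
      obtain ⟨g, h1, h2, h3, h4⟩ := inRun_cubic (b := b) hp k
      refine bezout_idx (b := b) (g := g) hf hd h2 ?_ _ (fun q hq => ?_)
      · rintro ⟨h, hh⟩
        have h5 : h.totalDegree ≤ 0 := deg_quot hf.ne_zero hd h2 hh
        have h6 : h = C (h.coeff 0) := totalDegree_eq_zero_iff_eq_C.1 (by omega)
        rw [Van, hh, h6, eval_mul, eval_C] at h3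
        rcases mul_eq_zero.1 h3 with h7 | h7
        · exact hpf h7
        · rw [h7] at h6; rw [h6] at hh; simp at hh; exact h1 hh
      · exact ⟨(mem_ZF.1 (Finset.mem_filter.1 hq).1).2, h4 q (Finset.mem_filter.1 hq).2⟩)
  omega

theorem caseA {f : Po} (hf : Irreducible f) (hd : f.totalDegree = 3) :
    (A \ ZF A b f).card * (ZF A b f).card ≤ 12 * (∑ a ∈ A, bd A b a) + 9 * A.card := by
  rw [← smul_eq_mul, ← Finset.sum_const]
  calc ∑ p ∈ A \ ZF A b f, (ZF A b f).card ≤ ∑ p ∈ A \ ZF A b f, (12 * bd A b p + 9) := by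
        refine Finset.sum_le_sum (fun p hp => ?_)
        have hp' := Finset.mem_sdiff.1 hp
        exact caseA_pt hf hd hp'.1 (fun h => hp'.2 (mem_ZF.2 ⟨hp'.1, h⟩))
    _ ≤ ∑ p ∈ A, (12 * bd A b p + 9) := Finset.sum_le_sum_of_subset Finset.sdiff_subset
    _ = _ := by rw [Finset.sum_add_distrib, ← Finset.mul_sum]; simp [mul_comm]

lemma tri_of_not_bad {p q : ℝ} (hqA : q ∈ A) (hqp : q ≠ p) (hqb : slp b p q ∉ badS A b p) : ∃ q', Tri A b p q q' := by
  have hgood := good_of_not_bad (slp_mem hqA hqp) hqb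
  have hqL : q ∈ Ln A b p (slp b p q) := by
    rw [mem_Ln]; exact ⟨hqA, (fl_eq_iff b hqp _).2 rfl⟩
  rcases hgood.mem_Ln hqL with h | h | h
  · exact absurd h hqp
  · have := hgood.tri
    rw [← h] at this
    exact ⟨_, this⟩
  · have := hgood.tri.swap23
    rw [← h] at this
    exact ⟨_, this⟩

/-- points of the conic which have no partner with respect to `p` -/
theorem caseB_pt {f : Po} (hf : Irreducible f) (hd : f.totalDegree = 2) {p : ℝ} (hp : p ∈ A) (hpf : ¬ Van b f p) :
    ((ZF A b f).filter (fun q => ¬ ∃ q', q' ∈ ZF A b f ∧ Tri A b p q q')).card ≤ 10 * bd A b p + 8 := by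
  set U := (ZF A b f).filter (fun q => ¬ ∃ q', q' ∈ ZF A b f ∧ Tri A b p q q') with hU
  have hUf : ∀ q ∈ U, q ∈ A ∧ Van b f q := fun q hq => mem_ZF.1 (Finset.mem_filter.1 hq).1
  have := count_split (b := b) (p := p) U (fun q hq => (hUf q hq).1) (fun h => hpf (hUf p h).2) 2 8
    (fun x _ => slope_count hf (by omega) hd.le p x _ (fun q hq => ⟨(hUf q (Finset.mem_filter.1 hq).1).2, (Finset.mem_filter.1 hq).2⟩))
    (fun k => by
      obtain ⟨g, h1, h2, h3, h4⟩ := inRun_cubic (b := b) hp k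
      set S := U.filter (fun q => InRun A b p k q) with hS
      by_cases hdvd : f ∣ g
      · obtain ⟨h, hh⟩ := hdvd
        have h5 : h.totalDegree ≤ 1 := deg_quot hf.ne_zero hd h2 hh
        have h0 : h ≠ 0 := by rintro rfl; rw [mul_zero] at hh; exact h1 hh
        have hhp : Van b h p := by
          rw [Van, hh, eval_mul] at h3
          exact (mul_eq_zero.1 h3).resolve_left hpf
        have hh' : ∀ q ∈ S, Van b h q := by
          intro q hq
          obtain ⟨hqU, hqR⟩ := Finset.mem_filter.1 hq
          obtain ⟨hqA, hqp, hqb, hqc⟩ := hqR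
          have htri := tri_of_not_bad hqA hqp hqb
          obtain ⟨q', htri⟩ := htri
          obtain ⟨t1, t2, t3, t4, t5, t6, x, y, ht⟩ := id htri
          have hq'f : ¬ Van b f q' := by
            intro hq'
            exact (Finset.mem_filter.1 hqU).2 ⟨q', mem_ZF.2 ⟨t3, hq'⟩, htri⟩
          have e1 := (ht p t1).2 (by simp)
          have e2 := (ht q t2).2 (by simp)
          have e3 := (ht q' t3).2 (by simp)
          have s1 : x = slp b p q := (fl_eq_iff b hqp x).1 (by rw [e1, e2])
          have s2 : x = slp b p q' := (fl_eq_iff b (Ne.symm t5) x).1 (by rw [e1, e3])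
          have hg' : Van b g q' := h4 q' ⟨t3, t5.symm, by rw [← s2, s1]; exact hqb, by rw [← s2, s1]; exact hqc⟩
          have hhq' : Van b h q' := by
            rw [Van, hh, eval_mul] at hg'
            exact (mul_eq_zero.1 hg').resolve_left hq'f
          have hdv : lin x y ∣ h := by
            by_contra hcon
            have := bezout_idx (b := b) (lin_irred x y) (lin_deg x y) h5 hcon {p, q'} (by
              intro s hs
              rcases Finset.mem_insert.1 hs with rfl | hs
              · exact ⟨van_lin.2 e1, hhp⟩
              · rw [Finset.mem_singleton] at hs; subst hs
                exact ⟨van_lin.2 e3, hhq'⟩)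
            rw [Finset.card_pair t5] at this
            omega
          obtain ⟨w, hw⟩ := hdv
          rw [Van, hw, eval_mul]
          have : eval (pt b q) (lin x y) = 0 := van_lin.2 e2
          rw [this, zero_mul]
        have := bezout_idx (b := b) hf hd h5 (by
          rintro ⟨w, hw⟩
          have hw0 : w ≠ 0 := by rintro rfl; rw [mul_zero] at hw; exact h0 hw
          have := totalDegree_mul_of_isDomain hf.ne_zero hw0
          rw [← hw] at this
          omega) S (fun q hq => ⟨(hUf q (Finset.mem_filter.1 hq).1).2, hh' q hq⟩)
        omega
      · have := bezout_idx (b := b) hf hd h2 hdvd S (fun q hq => ⟨(hUf q (Finset.mem_filter.1 hq).1).2, h4 q (Finset.mem_filter.1 hq).2⟩)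
        omega)
  omega

end
end WS

namespace WS
noncomputable section
open scoped Classical

/-- vectors of `ℝ³` -/
abbrev V3 := ℝ × ℝ × ℝ

def dot (a c : V3) : ℝ := a.1 * c.1 + a.2.1 * c.2.1 + a.2.2 * c.2.2
def cr (a c : V3) : V3 := (a.2.1 * c.2.2 - a.2.2 * c.2.1, a.2.2 * c.1 - a.1 * c.2.2, a.1 * c.2.1 - a.2.1 * c.1)
def det3 (a c d : V3) : ℝ := dot (cr a c) d

lemma ne_zero_comp {a : V3} (h : a ≠ 0) : a.1 ≠ 0 ∨ a.2.1 ≠ 0 ∨ a.2.2 ≠ 0 := by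
  by_contra hc
  push Not at hc
  exact h (Prod.ext hc.1 (Prod.ext hc.2.1 hc.2.2))

lemma cr_eq_zero {a c : V3} : cr a c = 0 ↔ a.2.1 * c.2.2 = a.2.2 * c.2.1 ∧ a.2.2 * c.1 = a.1 * c.2.2 ∧ a.1 * c.2.1 = a.2.1 * c.1 := by
  constructor
  · intro h
    have h1 := congrArg (fun v : V3 => v.1) h
    have h2 := congrArg (fun v : V3 => v.2.1) h
    have h3 := congrArg (fun v : V3 => v.2.2) h
    simp only [cr, Prod.fst_zero, Prod.snd_zero] at h1 h2 h3
    refine ⟨by linarith, by linarith, by linarith⟩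
  · rintro ⟨h1, h2, h3⟩
    refine Prod.ext ?_ (Prod.ext ?_ ?_) <;> simp [cr] <;> linarith

lemma cr_symm {a c : V3} (h : cr a c = 0) : cr c a = 0 := by
  rw [cr_eq_zero] at *
  refine ⟨by linarith [h.1], by linarith [h.2.1], by linarith [h.2.2]⟩

lemma cr_swap (a c : V3) : cr c a = - cr a c := by
  refine Prod.ext ?_ (Prod.ext ?_ ?_) <;> simp [cr] <;> ring

/-- if `cr a n = 0` and `n ≠ 0`, then `a` is a multiple of `n` -/
lemma exists_smul {a n : V3} (hn : n ≠ 0) (h : cr a n = 0) : ∃ k : ℝ, a = k • n := by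
  rw [cr_eq_zero] at h
  obtain ⟨h1, h2, h3⟩ := h
  rcases ne_zero_comp hn with h0 | h0 | h0
  · refine ⟨a.1 / n.1, Prod.ext ?_ (Prod.ext ?_ ?_)⟩ <;> simp <;> field_simp <;> linarith
  · refine ⟨a.2.1 / n.2.1, Prod.ext ?_ (Prod.ext ?_ ?_)⟩ <;> simp <;> field_simp <;> linarith
  · refine ⟨a.2.2 / n.2.2, Prod.ext ?_ (Prod.ext ?_ ?_)⟩ <;> simp <;> field_simp <;> linarith

lemma dot_smul (k : ℝ) (a c : V3) : dot (k • a) c = k * dot a c := by simp [dot]; ring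
lemma dot_comm (a c : V3) : dot a c = dot c a := by simp [dot]; ring

lemma cr_cr {a e e' : V3} (h1 : dot a e = 0) (h2 : dot a e' = 0) : cr a (cr e e') = 0 := by
  rw [cr_eq_zero]
  simp only [dot, cr] at *
  refine ⟨?_, ?_, ?_⟩
  · linear_combination e.1 * h2 - e'.1 * h1
  · linear_combination e.2.1 * h2 - e'.2.1 * h1
  · linear_combination e.2.2 * h2 - e'.2.2 * h1

/-- two vectors orthogonal to independent vectors are parallel -/
lemma par {a c e e' : V3} (hn : cr e e' ≠ 0) (h1 : dot a e = 0) (h2 : dot a e' = 0)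
    (h3 : dot c e = 0) (h4 : dot c e' = 0) : cr a c = 0 := by
  obtain ⟨k, hk⟩ := exists_smul hn (cr_cr h1 h2)
  obtain ⟨k', hk'⟩ := exists_smul hn (cr_cr h3 h4)
  rw [hk, hk', cr_eq_zero]
  simp
  refine ⟨by ring, by ring, by ring⟩

lemma dot_par {L h e : V3} (he : e ≠ 0) (hp : cr h e = 0) (hL : dot L e = 0) : dot L h = 0 := by
  obtain ⟨k, hk⟩ := exists_smul he hp
  rw [hk, dot_comm, dot_smul, dot_comm, hL, mul_zero]

/-- covector of the chord through the parameters `t`, `s` -/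
def cv (t s : ℝ) : V3 := (t * s, - (t + s), 1)
def cl (p : V3) (t s : ℝ) : Prop := dot p (cv t s) = 0
def Dl (p : V3) : ℝ := p.2.1 ^ 2 - p.1 * p.2.2
def uu (p : V3) (t : ℝ) : ℝ := p.1 * t - p.2.1

lemma cl_iff {p : V3} {t s : ℝ} : cl p t s ↔ p.1 * (t * s) - p.2.1 * (t + s) + p.2.2 = 0 := by
  simp only [cl, dot, cv]
  constructor <;> intro h <;> linarith

lemma cl_symm {p : V3} {t s : ℝ} (h : cl p t s) : cl p s t := by
  rw [cl_iff] at *; linarith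

lemma cl_uu {p : V3} {t s : ℝ} (h : cl p t s) : uu p t * uu p s = Dl p := by
  rw [cl_iff] at h
  simp only [uu, Dl]
  linear_combination p.1 * h

lemma cl_uu_ne {p : V3} (hp : Dl p ≠ 0) {t s : ℝ} (h : cl p t s) : uu p t ≠ 0 := by
  intro h0; apply hp; rw [← cl_uu h, h0, zero_mul]

lemma cl_uniq {p : V3} (hp : Dl p ≠ 0) {t s s' : ℝ} (h : cl p t s) (h' : cl p t s') : s = s' := by
  have h1 := cl_uu_ne hp h
  rw [cl_iff] at h h'
  have : uu p t * (s - s') = 0 := by simp only [uu]; linear_combination h - h'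
  have := (mul_eq_zero.1 this).resolve_left h1
  linarith

lemma cl_mono {p : V3} {t s t' s' : ℝ} (h : cl p t s) (h' : cl p t' s') :
    (s' - s) * (uu p t * uu p t') = - Dl p * (t' - t) := by
  rw [cl_iff] at h h'
  simp only [uu, Dl]
  linear_combination (p.1 * t - p.2.1) * h' - (p.1 * t' - p.2.1) * h

lemma cv_cr_ne {t s t' s' : ℝ} (h : t ≠ t') (h' : t ≠ s') : cr (cv t s) (cv t' s') ≠ 0 := by
  intro h0
  rw [cr_eq_zero] at h0
  simp only [cv] at h0
  obtain ⟨h1, h2, h3⟩ := h0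
  have : (t - t') * (t - s') = 0 := by
    linear_combination -t * h1 + h2
  rcases mul_eq_zero.1 this with h4 | h4
  · exact h (by linarith)
  · exact h' (by linarith)

lemma det_smul (k l m : ℝ) (a c d : V3) : det3 (k • a) (l • c) (m • d) = k * l * m * det3 a c d := by
  simp [det3, dot, cr]; ring

theorem pascal {p q r : V3} {t1 t2 t3 t4 t5 t6 : ℝ}
    (hp : cl p t1 t2) (hp' : cl p t4 t5) (hq : cl q t2 t3) (hq' : cl q t5 t6) (hr : cl r t3 t4) (hr' : cl r t6 t1)
    (h1 : cr (cv t1 t2) (cv t4 t5) ≠ 0) (h2 : cr (cv t2 t3) (cv t5 t6) ≠ 0) (h3 : cr (cv t3 t4) (cv t6 t1) ≠ 0) :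
    det3 p q r = 0 := by
  obtain ⟨k, hk⟩ := exists_smul h1 (cr_cr hp hp')
  obtain ⟨k', hk'⟩ := exists_smul h2 (cr_cr hq hq')
  obtain ⟨k'', hk''⟩ := exists_smul h3 (cr_cr hr hr')
  rw [hk, hk', hk'', det_smul]
  have : det3 (cr (cv t1 t2) (cv t4 t5)) (cr (cv t2 t3) (cv t5 t6)) (cr (cv t3 t4) (cv t6 t1)) = 0 := by
    simp only [det3, dot, cr, cv]; ring
  rw [this, mul_zero]

/-- polarity of the conic -/
def BB (p e : V3) : ℝ := p.1 * e.2.2 + p.2.2 * e.1 - 2 * p.2.1 * e.2.1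
def hh (p e : V3) : V3 := (-(Dl p) * e.1 - BB p e * p.1, -(Dl p) * e.2.1 - BB p e * p.2.1, -(Dl p) * e.2.2 - BB p e * p.2.2)

lemma dot_hh (L p e : V3) : dot L (hh p e) = -(Dl p) * dot L e - BB p e * dot L p := by
  simp only [dot, hh]; ring

lemma hh_cl {p e : V3} (hp : Dl p ≠ 0) {t s t' s' : ℝ} (he : cl e t s) (ht : cl p t t') (hs : cl p s s') :
    cl (hh p e) t' s' := by
  have u1 := cl_uu_ne hp ht
  have u2 := cl_uu_ne hp hs
  rw [cl_iff] at *
  have e1 : uu p t * t' = p.2.1 * t - p.2.2 := by simp only [uu]; linear_combination ht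
  have e2 : uu p s * s' = p.2.1 * s - p.2.2 := by simp only [uu]; linear_combination hs
  have key : (uu p t * uu p s) * ((hh p e).1 * (t' * s') - (hh p e).2.1 * (t' + s') + (hh p e).2.2) = 0 := by
    have : (uu p t * uu p s) * ((hh p e).1 * (t' * s') - (hh p e).2.1 * (t' + s') + (hh p e).2.2)
      = (hh p e).1 * ((uu p t * t') * (uu p s * s')) - (hh p e).2.1 * ((uu p t * t') * uu p s + uu p t * (uu p s * s'))
        + (hh p e).2.2 * (uu p t * uu p s) := by ring
    rw [this, e1, e2]
    simp only [hh, Dl, BB, uu]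
    have h0 : e.2.2 = e.2.1 * (t + s) - e.1 * (t * s) := by linarith
    rw [h0]
    ring
  exact (mul_eq_zero.1 key).resolve_left (mul_ne_zero u1 u2)

end
end WS

namespace WS
noncomputable section
open scoped Classical

lemma btw_pos {x y z : ℝ} (h : 0 < x * z) (h' : 0 ≤ (y - x) * (z - y)) : 0 < x * y ∧ 0 < y * z := by
  rcases lt_or_ge 0 x with hx | hx
  · have hz : 0 < z := by by_contra hc; push Not at hc; nlinarith
    have hy : 0 < y := by
      by_contra hc; push Not at hc
      nlinarith [mul_pos hx hz]
    exact ⟨mul_pos hx hy, mul_pos hy hz⟩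
  · have hz : z < 0 := by by_contra hc; push Not at hc; nlinarith
    have hx : x < 0 := by
      rcases hx.lt_or_eq with h1 | h1
      · exact h1
      · rw [h1, zero_mul] at h; exact absurd h (lt_irrefl _)
    have hy : y < 0 := by
      by_contra hc; push Not at hc
      nlinarith [mul_pos_of_neg_of_neg hx hz]
    exact ⟨mul_pos_of_neg_of_neg hx hy, mul_pos_of_neg_of_neg hy hz⟩

section perp
variable (a : ℕ) (t : ℕ → ℝ) (p : V3)

def HasP (i : ℕ) : Prop := ∃ j < a, cl p (t i) (t j)
def NBs : Finset ℕ := (Finset.range a).filter (fun i => ¬ HasP a t p i)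
def ptn (i : ℕ) : ℕ := if h : HasP a t p i then h.choose else 0
def Adj (i : ℕ) : Prop := i + 1 < a ∧ 0 < uu p (t i) * uu p (t (i+1)) ∧
  ∃ j < a, ∃ j' < a, (j' = j + 1 ∨ j = j' + 1) ∧ cl p (t i) (t j) ∧ cl p (t (i+1)) (t j')

variable {a t p}

lemma tinj (ht : ∀ i j, i < j → j < a → t i < t j) {i j : ℕ} (hi : i < a) (hj : j < a) (h : t i = t j) : i = j := by
  rcases lt_trichotomy i j with h1 | h1 | h1
  · have := ht i j h1 hj; linarith
  · exact h1
  · have := ht j i h1 hi; linarith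

lemma tlt (ht : ∀ i j, i < j → j < a → t i < t j) {i j : ℕ} (hi : i < a) (h : t i < t j) : i < j := by
  rcases lt_trichotomy i j with h1 | h1 | h1
  · exact h1
  · subst h1; linarith
  · have := ht j i h1 hi; linarith

lemma ptn_eq (ht : ∀ i j, i < j → j < a → t i < t j) (hp : Dl p ≠ 0) {i j : ℕ} (hj : j < a) (h : cl p (t i) (t j)) : ptn a t p i = j := by
  have hP : HasP a t p i := ⟨j, hj, h⟩
  rw [ptn, dif_pos hP]
  exact tinj ht hP.choose_spec.1 hj (cl_uniq hp hP.choose_spec.2 h)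

/-- the key adjacency claim -/
lemma adj_key (ht : ∀ i j, i < j → j < a → t i < t j) (hp : Dl p ≠ 0) {i j j' m : ℕ} (hi : i + 1 < a) (hj : j < a) (hj' : j' < a) (hm : m < a)
    (h1 : cl p (t i) (t j)) (h2 : cl p (t (i+1)) (t j')) (hu : 0 < uu p (t i) * uu p (t (i+1)))
    (hmm : (j < m ∧ m < j') ∨ (j' < m ∧ m < j)) : ¬ HasP a t p m := by
  rintro ⟨k, hk, hc⟩
  have e1 := cl_uu h1
  have e2 := cl_uu h2
  have e3 := cl_uu hc
  have hD2 : 0 < Dl p ^ 2 := by positivity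
  have huu : 0 < uu p (t j) * uu p (t j') := by
    have : (uu p (t i) * uu p (t (i+1))) * (uu p (t j) * uu p (t j')) = Dl p ^ 2 := by
      rw [sq]; nth_rewrite 1 [← e1]; rw [← e2]; ring
    by_contra hcon
    push Not at hcon
    nlinarith
  have hb : (t m - t j) * (t j' - t m) > 0 := by
    rcases hmm with ⟨x, y⟩ | ⟨x, y⟩
    · have := ht _ _ x hm; have := ht _ _ y hj'; nlinarith
    · have := ht _ _ x hm; have := ht _ _ y hj; nlinarith
  have hum : 0 < uu p (t j) * uu p (t m) ∧ 0 < uu p (t m) * uu p (t j') := by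
    refine btw_pos huu ?_
    have : (uu p (t m) - uu p (t j)) * (uu p (t j') - uu p (t m)) = p.1 ^ 2 * ((t m - t j) * (t j' - t m)) := by
      simp only [uu]; ring
    rw [this]; positivity
  have f1 := cl_mono (cl_symm h1) hc
  have f2 := cl_mono hc (cl_symm h2)
  have hpos : (t k - t i) * (t (i+1) - t k) > 0 := by
    have : ((t k - t i) * (t (i+1) - t k)) * ((uu p (t j) * uu p (t m)) * (uu p (t m) * uu p (t j'))) =
      Dl p ^ 2 * ((t m - t j) * (t j' - t m)) := by
      calc _ = ((t k - t i) * (uu p (t j) * uu p (t m))) * ((t (i+1) - t k) * (uu p (t m) * uu p (t j'))) := by ring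
        _ = _ := by rw [f1, f2]; ring
    have hr : 0 < Dl p ^ 2 * ((t m - t j) * (t j' - t m)) := mul_pos hD2 hb
    rw [← this] at hr
    exact pos_of_mul_pos_left hr (mul_pos hum.1 hum.2).le
  have hi1 := ht i (i+1) (Nat.lt_succ_self i) hi
  have g1 : t i < t k := by by_contra hcon; push Not at hcon; nlinarith
  have g2 : t k < t (i+1) := by by_contra hcon; push Not at hcon; nlinarith
  have := tlt ht (by omega) g1
  have := tlt ht hk g2
  omega

lemma card_notAdj (ht : ∀ i j, i < j → j < a → t i < t j) (hp : Dl p ≠ 0) : ((Finset.range a).filter (fun i => ¬ Adj a t p i)).card ≤ 4 * (NBs a t p).card + 2 := by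
  set N := NBs a t p with hN
  have memN : ∀ i, i < a → ¬ HasP a t p i → i ∈ N := fun i hi h => Finset.mem_filter.2 ⟨Finset.mem_range.2 hi, h⟩
  set SC := (Finset.range a).filter (fun i => i + 1 < a ∧ HasP a t p i ∧ HasP a t p (i+1) ∧ ¬ 0 < uu p (t i) * uu p (t (i+1))) with hSC
  have hsub : (Finset.range a).filter (fun i => ¬ Adj a t p i) ⊆
      ((((({a - 1} ∪ SC) ∪ N) ∪ N.image (fun k => k - 1)) ∪ N.image (fun k => ptn a t p (k-1))) ∪ N.image (fun k => ptn a t p (k+1))) := by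
    intro i hi
    obtain ⟨hia, hA⟩ := Finset.mem_filter.1 hi
    rw [Finset.mem_range] at hia
    simp only [Finset.mem_union, Finset.mem_singleton, Finset.mem_image]
    by_cases c1 : i + 1 < a
    swap
    · left; left; left; left; left; omega
    by_cases c2 : HasP a t p i
    swap
    · left; left; left; right; exact memN i hia c2
    by_cases c3 : HasP a t p (i+1)
    swap
    · left; left; right; exact ⟨i+1, memN _ c1 c3, by omega⟩
    by_cases c4 : 0 < uu p (t i) * uu p (t (i+1))
    swap
    · left; left; left; left; right
      exact Finset.mem_filter.2 ⟨Finset.mem_range.2 hia, c1, c2, c3, c4⟩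
    obtain ⟨j, hj, hc⟩ := id c2
    obtain ⟨j', hj', hc'⟩ := id c3
    have hne : j ≠ j' := by
      rintro rfl
      have := tinj ht hia c1 (cl_uniq hp (cl_symm hc) (cl_symm hc'))
      omega
    have key := fun m hm => adj_key ht hp c1 hj hj' (m := m) hm hc hc' c4
    rcases lt_or_gt_of_ne hne with h | h
    · by_cases h2 : j' = j + 1
      · exact absurd ⟨c1, c4, j, hj, j', hj', Or.inl h2, hc, hc'⟩ hA
      · left; right
        refine ⟨j + 1, memN _ (by omega) (key (j+1) (by omega) (Or.inl ⟨by omega, by omega⟩)), ?_⟩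
        exact ptn_eq ht hp hia (cl_symm hc)
    · by_cases h2 : j = j' + 1
      · exact absurd ⟨c1, c4, j, hj, j', hj', Or.inr h2, hc, hc'⟩ hA
      · right
        refine ⟨j - 1, memN _ (by omega) (key (j-1) (by omega) (Or.inr ⟨by omega, by omega⟩)), ?_⟩
        rw [show j - 1 + 1 = j by omega]
        exact ptn_eq ht hp hia (cl_symm hc)
  have hSC1 : SC.card ≤ 1 := by
    rw [Finset.card_le_one]
    have main : ∀ i ∈ SC, ∀ k ∈ SC, i < k → False := by
      intro i hi k hk hik
      obtain ⟨hia, c1, ⟨j1, -, b1⟩, ⟨j2, -, b2⟩, c4⟩ := Finset.mem_filter.1 hi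
      obtain ⟨hka, d1, ⟨j3, -, b3⟩, ⟨j4, -, b4⟩, d4⟩ := Finset.mem_filter.1 hk
      have n1 := cl_uu_ne hp b1
      have n2 := cl_uu_ne hp b2
      have n3 := cl_uu_ne hp b3
      have n4 := cl_uu_ne hp b4
      have o1 := ht i (i+1) (by omega) c1
      have o3 := ht k (k+1) (by omega) d1
      have o2 : t (i+1) ≤ t k := by
        rcases Nat.lt_or_ge (i+1) k with h | h
        · exact (ht _ _ h (by omega)).le
        · rw [show i + 1 = k by omega]
      push Not at c4 d4
      simp only [uu] at *
      rcases le_total 0 p.1 with h0 | h0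
      · have q1 := mul_nonneg h0 (sub_nonneg.2 o1.le)
        have q2 := mul_nonneg h0 (sub_nonneg.2 o2)
        have q3 := mul_nonneg h0 (sub_nonneg.2 o3.le)
        have r1 : 0 < p.1 * t (i+1) - p.2.1 := by
          rcases lt_or_gt_of_ne n2 with h | h
          · have : p.1 * t i - p.2.1 < 0 := by linarith
            nlinarith
          · exact h
        have r2 : 0 < p.1 * t k - p.2.1 := by linarith
        have r3 : 0 < p.1 * t (k+1) - p.2.1 := by linarith
        nlinarith
      · have q1 := mul_nonneg (neg_nonneg.2 h0) (sub_nonneg.2 o1.le)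
        have q2 := mul_nonneg (neg_nonneg.2 h0) (sub_nonneg.2 o2)
        have q3 := mul_nonneg (neg_nonneg.2 h0) (sub_nonneg.2 o3.le)
        have r1 : p.1 * t (i+1) - p.2.1 < 0 := by
          rcases lt_or_gt_of_ne n2 with h | h
          · exact h
          · have : 0 < p.1 * t i - p.2.1 := by linarith
            nlinarith
        have r2 : p.1 * t k - p.2.1 < 0 := by linarith
        have r3 : p.1 * t (k+1) - p.2.1 < 0 := by linarith
        nlinarith
    intro i hi k hk
    rcases lt_trichotomy i k with h | h | h
    · exact (main i hi k hk h).elim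
    · exact h
    · exact (main k hk i hi h).elim
  have i1 : (N.image (fun k => k - 1)).card ≤ N.card := Finset.card_image_le
  have i2 : (N.image (fun k => ptn a t p (k-1))).card ≤ N.card := Finset.card_image_le
  have i3 : (N.image (fun k => ptn a t p (k+1))).card ≤ N.card := Finset.card_image_le
  have u1 := Finset.card_le_card hsub
  have u2 := Finset.card_union_le ((((({a - 1} ∪ SC) ∪ N) ∪ N.image (fun k => k - 1)) ∪ N.image (fun k => ptn a t p (k-1)))) (N.image (fun k => ptn a t p (k+1)))
  have u3 := Finset.card_union_le (((({a - 1} ∪ SC) ∪ N) ∪ N.image (fun k => k - 1))) (N.image (fun k => ptn a t p (k-1)))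
  have u4 := Finset.card_union_le ((({a - 1} ∪ SC) ∪ N)) (N.image (fun k => k - 1))
  have u5 := Finset.card_union_le ({a - 1} ∪ SC) N
  have u6 := Finset.card_union_le {a - 1} SC
  rw [Finset.card_singleton] at u6
  omega

lemma adj_ext (ht : ∀ i j, i < j → j < a → t i < t j) (hp : Dl p ≠ 0) (hpos : 0 < Dl p) {i : ℕ} (h : Adj a t p i) :
    ∃ j, j + 1 < a ∧ cl p (t i) (t (j+1)) ∧ cl p (t (i+1)) (t j) := by
  obtain ⟨h1, h2, j, hj, j', hj', hor, hc, hc'⟩ := h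
  have hm := cl_mono hc hc'
  have ho := ht i (i+1) (by omega) h1
  rcases hor with rfl | rfl
  · have := ht j (j+1) (by omega) hj'
    nlinarith [mul_pos hpos (sub_pos.2 ho), mul_pos (sub_pos.2 this) h2]
  · exact ⟨j', hj, hc, hc'⟩

lemma adj_int (ht : ∀ i j, i < j → j < a → t i < t j) (hp : Dl p ≠ 0) (hneg : Dl p < 0) {i : ℕ} (h : Adj a t p i) :
    ∃ j, j + 1 < a ∧ cl p (t i) (t j) ∧ cl p (t (i+1)) (t (j+1)) := by
  obtain ⟨h1, h2, j, hj, j', hj', hor, hc, hc'⟩ := h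
  have hm := cl_mono hc hc'
  have ho := ht i (i+1) (by omega) h1
  rcases hor with rfl | rfl
  · exact ⟨j, hj', hc, hc'⟩
  · have := ht j' (j'+1) (by omega) hj
    nlinarith [mul_pos (neg_pos.2 hneg) (sub_pos.2 ho), mul_pos (sub_pos.2 this) h2]

/-- interior points exchange the inside and the outside -/
lemma int_swap (ht : ∀ i j, i < j → j < a → t i < t j) (hneg : Dl p < 0) {i j k m : ℕ} (h : cl p (t i) (t j)) (h' : cl p (t k) (t m)) :
    (t k - t i) * (t k - t j) * ((t m - t i) * (t m - t j)) ≤ 0 := by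
  have hp : Dl p ≠ 0 := hneg.ne
  have e1 := cl_mono h h'
  have e2 := cl_mono (cl_symm h) h'
  have e3 := cl_uu h
  have n1 := cl_uu_ne hp h'
  have key : (t m - t i) * (t m - t j) * (uu p (t k)) ^ 2 = Dl p * ((t k - t i) * (t k - t j)) := by
    have : ((t m - t i) * (t m - t j) * (uu p (t k)) ^ 2) * Dl p = Dl p * ((t k - t i) * (t k - t j)) * Dl p := by
      nth_rewrite 1 [← e3]
      linear_combination (t m - t i) * (uu p (t j) * uu p (t k)) * e1 - Dl p * (t k - t i) * e2
    exact mul_right_cancel₀ hp this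
  have hsq : 0 < (uu p (t k)) ^ 2 := by positivity
  by_contra hcon
  push Not at hcon
  have h5 : (t k - t i) * (t k - t j) * ((t m - t i) * (t m - t j)) * (uu p (t k))^2 = Dl p * ((t k - t i) * (t k - t j))^2 := by
    linear_combination ((t k - t i) * (t k - t j)) * key
  have h6 := mul_pos hcon hsq
  nlinarith [sq_nonneg ((t k - t i) * (t k - t j))]

lemma int_range (ht : ∀ i j, i < j → j < a → t i < t j) (hp : Dl p ≠ 0) (hneg : Dl p < 0) {i j : ℕ} (hij : i < j) (hj : j < a) (h : cl p (t i) (t j)) :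
    2 * (j - i) ≤ a + (NBs a t p).card ∧ a ≤ 2 * (j - i) + (NBs a t p).card := by
  set N := NBs a t p with hN
  set I := Finset.Ioo i j with hI
  set O := (Finset.range a) \ (Finset.Icc i j) with hO
  have hIc : I.card = j - i - 1 := Nat.card_Ioo _ _
  have hOc : O.card = a - (j + 1 - i) := by
    rw [hO, Finset.card_sdiff_of_subset, Finset.card_range, Nat.card_Icc]
    intro x hx
    rw [Finset.mem_Icc] at hx
    rw [Finset.mem_range]; omega
  have hptn : ∀ k, k < a → k ∉ N → ptn a t p k < a ∧ cl p (t k) (t (ptn a t p k)) := by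
    intro k hk hkN
    have : HasP a t p k := by
      by_contra hc
      exact hkN (Finset.mem_filter.2 ⟨Finset.mem_range.2 hk, hc⟩)
    obtain ⟨m, hm, hc⟩ := this
    rw [ptn_eq ht hp hm hc]
    exact ⟨hm, hc⟩
  have hne : ∀ k, k < a → k ∉ N → k ≠ i → k ≠ j → ptn a t p k ≠ i ∧ ptn a t p k ≠ j := by
    intro k hk hkN h1 h2
    obtain ⟨g1, g2⟩ := hptn k hk hkN
    constructor
    · intro h3; rw [h3] at g2
      exact h2 (tinj ht hk hj (cl_uniq hp (cl_symm g2) h))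
    · intro h3; rw [h3] at g2
      exact h1 (tinj ht hk (by omega) (cl_uniq hp (cl_symm g2) (cl_symm h)))
  have hinj : Set.InjOn (ptn a t p) {k | k < a ∧ k ∉ N} := by
    intro k hk k' hk' he
    obtain ⟨g1, g2⟩ := hptn k hk.1 hk.2
    obtain ⟨g3, g4⟩ := hptn k' hk'.1 hk'.2
    rw [← he] at g4
    exact tinj ht hk.1 hk'.1 (cl_uniq hp (cl_symm g2) (cl_symm g4))
  have m1 : (I \ N).card ≤ O.card := by
    refine Finset.card_le_card_of_injOn (ptn a t p) ?_ ?_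
    · intro k hk
      obtain ⟨hk1, hk2⟩ := Finset.mem_sdiff.1 (Finset.mem_coe.1 hk)
      rw [hI, Finset.mem_Ioo] at hk1
      obtain ⟨g1, g2⟩ := hptn k (by omega) hk2
      obtain ⟨n1, n2⟩ := hne k (by omega) hk2 (by omega) (by omega)
      refine Finset.mem_coe.2 (Finset.mem_sdiff.2 ⟨Finset.mem_range.2 g1, fun hc => ?_⟩)
      rw [Finset.mem_Icc] at hc
      have s := int_swap ht hneg h g2
      have o1 := ht i k hk1.1 (by omega)
      have o2 := ht k j hk1.2 (by omega)
      have o3 := ht i _ (show i < ptn a t p k by omega) (by omega)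
      have o4 := ht _ j (show ptn a t p k < j by omega) (by omega)
      have p1 : (t k - t i) * (t k - t j) < 0 := by nlinarith
      have p2 : (t (ptn a t p k) - t i) * (t (ptn a t p k) - t j) < 0 := by nlinarith
      nlinarith [mul_pos_of_neg_of_neg p1 p2]
    · intro k hk k' hk' he
      obtain ⟨hk1, hk2⟩ := Finset.mem_sdiff.1 (Finset.mem_coe.1 hk)
      obtain ⟨hk1', hk2'⟩ := Finset.mem_sdiff.1 (Finset.mem_coe.1 hk')
      rw [hI, Finset.mem_Ioo] at hk1 hk1'
      exact hinj ⟨by omega, hk2⟩ ⟨by omega, hk2'⟩ he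
  have m2 : (O \ N).card ≤ I.card := by
    refine Finset.card_le_card_of_injOn (ptn a t p) ?_ ?_
    · intro k hk
      obtain ⟨hk1, hk2⟩ := Finset.mem_sdiff.1 (Finset.mem_coe.1 hk)
      rw [hO, Finset.mem_sdiff, Finset.mem_range, Finset.mem_Icc] at hk1
      obtain ⟨g1, g2⟩ := hptn k (by omega) hk2
      obtain ⟨n1, n2⟩ := hne k (by omega) hk2 (by omega) (by omega)
      rw [hI]
      refine Finset.mem_coe.2 (Finset.mem_Ioo.2 ?_)
      by_contra hc
      have s := int_swap ht hneg h g2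
      have oij := ht i j hij hj
      have p1 : 0 < (t k - t i) * (t k - t j) := by
        rcases Nat.lt_or_ge k i with hh | hh
        · have := ht k i hh (by omega)
          nlinarith
        · have := ht j k (by omega) (by omega)
          nlinarith
      have p2 : 0 < (t (ptn a t p k) - t i) * (t (ptn a t p k) - t j) := by
        rcases Nat.lt_or_ge (ptn a t p k) i with hh | hh
        · have := ht _ i hh (by omega)
          nlinarith
        · have := ht j _ (show j < ptn a t p k by omega) (by omega)
          nlinarith
      nlinarith [mul_pos p1 p2]
    · intro k hk k' hk' he
      obtain ⟨hk1, hk2⟩ := Finset.mem_sdiff.1 (Finset.mem_coe.1 hk)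
      obtain ⟨hk1', hk2'⟩ := Finset.mem_sdiff.1 (Finset.mem_coe.1 hk')
      rw [hO, Finset.mem_sdiff, Finset.mem_range] at hk1 hk1'
      exact hinj ⟨by omega, hk2⟩ ⟨by omega, hk2'⟩ he
  have s1 := Finset.le_card_sdiff N I
  have s2 := Finset.le_card_sdiff N O
  omega

end perp
end
end WS

namespace WS
noncomputable section
open scoped Classical

structure Cfg (a : ℕ) (t : ℕ → ℝ) (Q : Finset ℝ) (V : ℝ → V3) : Prop where
  ht : ∀ i j, i < j → j < a → t i < t j
  hD : ∀ p ∈ Q, Dl (V p) ≠ 0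
  hinj : ∀ p ∈ Q, ∀ q ∈ Q, cr (V p) (V q) = 0 → p = q

/-- local chord grid structure -/
structure GP (a : ℕ) (t : ℕ → ℝ) (p : V3) (i j : ℕ) : Prop where
  i2 : 2 ≤ i
  j2 : 2 ≤ j
  ia : i + 2 < a
  ja : j + 2 < a
  far : i + 5 ≤ j ∨ j + 5 ≤ i
  c0 : cl p (t i) (t j)
  p1 : cl p (t (i+1)) (t (j-1))
  p2 : cl p (t (i+2)) (t (j-2))
  m1 : cl p (t (i-1)) (t (j+1))
  m2 : cl p (t (i-2)) (t (j+2))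

lemma GP.symm {a : ℕ} {t : ℕ → ℝ} {p : V3} {i j : ℕ} (h : GP a t p i j) : GP a t p j i :=
  ⟨h.j2, h.i2, h.ja, h.ia, h.far.symm, cl_symm h.c0, cl_symm h.m1, cl_symm h.m2, cl_symm h.p1, cl_symm h.p2⟩

def Gd (a : ℕ) (t : ℕ → ℝ) (Q : Finset ℝ) (V : ℝ → V3) (i j : ℕ) : Prop := ∃ p ∈ Q, GP a t (V p) i j
def rr (a : ℕ) (t : ℕ → ℝ) (Q : Finset ℝ) (V : ℝ → V3) (i j : ℕ) : ℝ :=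
  if h : Gd a t Q V i j then h.choose else 0

section
variable {a : ℕ} {t : ℕ → ℝ} {Q : Finset ℝ} {V : ℝ → V3}

lemma Gd.symm {i j : ℕ} (h : Gd a t Q V i j) : Gd a t Q V j i := by
  obtain ⟨p, hp, h⟩ := h; exact ⟨p, hp, h.symm⟩

lemma rr_spec {i j : ℕ} (h : Gd a t Q V i j) : rr a t Q V i j ∈ Q ∧ GP a t (V (rr a t Q V i j)) i j := by
  rw [rr, dif_pos h]; exact h.choose_spec

lemma Cfg.tne (c : Cfg a t Q V) {i j : ℕ} (hi : i < a) (hj : j < a) (h : i ≠ j) : t i ≠ t j :=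
  fun h' => h (tinj c.ht hi hj h')

lemma Cfg.nonpar (c : Cfg a t Q V) {p q : ℝ} (hp : p ∈ Q) (hq : q ∈ Q) {i j k : ℕ} (hj : j < a) (hk : k < a)
    (hjk : j ≠ k) (h1 : cl (V p) (t i) (t j)) (h2 : cl (V q) (t i) (t k)) : cr (V p) (V q) ≠ 0 := by
  intro h
  have := c.hinj p hp q hq h
  subst this
  exact c.tne hj hk hjk (cl_uniq (c.hD p hp) h1 h2)

/-- the Pascal step -/
lemma Cfg.pas (c : Cfg a t Q V) {u v w : ℕ} (h1 : Gd a t Q V u v) (h2 : Gd a t Q V v w)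
    (h3 : Gd a t Q V w (u+1)) (h4 : Gd a t Q V w (u+2)) :
    dot (cr (V (rr a t Q V w (u+1))) (V (rr a t Q V w (u+2)))) (V (rr a t Q V u v)) = 0 ∧
    dot (cr (V (rr a t Q V w (u+1))) (V (rr a t Q V w (u+2)))) (V (rr a t Q V v w)) = 0 := by
  obtain ⟨m1, g1⟩ := rr_spec h1
  obtain ⟨m2, g2⟩ := rr_spec h2
  obtain ⟨m3, g3⟩ := rr_spec h3
  obtain ⟨m4, g4⟩ := rr_spec h4
  set p := V (rr a t Q V u v)
  set q := V (rr a t Q V v w)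
  set r1 := V (rr a t Q V w (u+1))
  set r2 := V (rr a t Q V w (u+2))
  have b1 := g1.i2; have b2 := g1.j2; have b3 := g1.ia; have b4 := g1.ja; have b5 := g1.far
  have b6 := g2.j2; have b7 := g2.ja; have b8 := g2.far; have b9 := g3.far; have b10 := g3.ja
  have b11 := g4.far; have b12 := g4.ja
  have d1 : det3 p q r1 = 0 := by
    refine pascal (t1 := t u) (t2 := t v) (t3 := t w) (t4 := t (u+1)) (t5 := t (v-1)) (t6 := t (w+1))
      g1.c0 g1.p1 g2.c0 ?_ g3.c0 ?_ ?_ ?_ ?_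
    · exact cl_symm (g2.symm.p1)
    · exact g3.p1
    · exact cv_cr_ne (c.tne (by omega) (by omega) (by omega)) (c.tne (by omega) (by omega) (by omega))
    · exact cv_cr_ne (c.tne (by omega) (by omega) (by omega)) (c.tne (by omega) (by omega) (by omega))
    · exact cv_cr_ne (c.tne (by omega) (by omega) (by omega)) (c.tne (by omega) (by omega) (by omega))
  have d2 : det3 p q r2 = 0 := by
    refine pascal (t1 := t u) (t2 := t v) (t3 := t w) (t4 := t (u+2)) (t5 := t (v-2)) (t6 := t (w+2))
      g1.c0 g1.p2 g2.c0 ?_ g4.c0 ?_ ?_ ?_ ?_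
    · exact cl_symm (g2.symm.p2)
    · exact g4.p2
    · exact cv_cr_ne (c.tne (by omega) (by omega) (by omega)) (c.tne (by omega) (by omega) (by omega))
    · exact cv_cr_ne (c.tne (by omega) (by omega) (by omega)) (c.tne (by omega) (by omega) (by omega))
    · exact cv_cr_ne (c.tne (by omega) (by omega) (by omega)) (c.tne (by omega) (by omega) (by omega))
  have hm : cr p q ≠ 0 := c.nonpar m1 m2 (i := v) (j := u) (k := w) (by omega) (by omega) (by omega) (cl_symm g1.c0) g2.c0
  have hpar := cr_symm (cr_cr (a := cr p q) (e := r1) (e' := r2) d1 d2)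
  obtain ⟨k, hk⟩ := exists_smul hm hpar
  rw [hk, dot_smul, dot_smul]
  constructor
  · have : dot (cr p q) p = 0 := by simp only [dot, cr]; ring
    rw [this, mul_zero]
  · have : dot (cr p q) q = 0 := by simp only [dot, cr]; ring
    rw [this, mul_zero]

/-- the reflection step -/
lemma Cfg.refl (c : Cfg a t Q V) {L : V3} {p : ℝ} (hp : p ∈ Q) (hoff : dot L (V p) ≠ 0) {i j : ℕ}
    (h1 : Gd a t Q V i j) (hL : dot L (V (rr a t Q V i j)) = 0)
    (hi : Adj a t (V p) i) (hj : Adj a t (V p) (j-1))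
    (h2 : Gd a t Q V (ptn a t (V p) i) (ptn a t (V p) j))
    (hL2 : dot L (V (rr a t Q V (ptn a t (V p) i) (ptn a t (V p) j))) = 0) :
    BB (V p) (V (rr a t Q V i j)) = 0 := by
  have hD := c.hD p hp
  obtain ⟨m1, g1⟩ := rr_spec h1
  obtain ⟨m2, g2⟩ := rr_spec h2
  set e := V (rr a t Q V i j)
  set e' := V (rr a t Q V (ptn a t (V p) i) (ptn a t (V p) j))
  have hje : j - 1 + 1 = j := by have := g1.j2; omega
  have hgi := g1.ia
  have hgj := g1.ja
  have key : cr (hh (V p) e) e' = 0 := by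
    rcases lt_or_gt_of_ne hD with hneg | hpos
    · obtain ⟨x, hx, x1, x2⟩ := adj_int c.ht hD hneg hi
      obtain ⟨y, hy, y1, y2⟩ := adj_int c.ht hD hneg hj
      rw [hje] at y2
      have ei : ptn a t (V p) i = x := ptn_eq c.ht hD (by omega) x1
      have ej : ptn a t (V p) j = y + 1 := ptn_eq c.ht hD (by omega) y2
      rw [ei, ej] at g2
      have f1 := hh_cl hD g1.c0 x1 y2
      have f2 := hh_cl hD g1.p1 x2 y1
      have g2a := g2.p1
      rw [Nat.add_sub_cancel] at g2a
      have fa := g2.far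
      exact par (cv_cr_ne (c.tne (by omega) (by omega) (by omega)) (c.tne (by omega) (by omega) (by omega))) f1 f2 g2.c0 g2a
    · obtain ⟨x, hx, x1, x2⟩ := adj_ext c.ht hD hpos hi
      obtain ⟨y, hy, y1, y2⟩ := adj_ext c.ht hD hpos hj
      rw [hje] at y2
      have ei : ptn a t (V p) i = x + 1 := ptn_eq c.ht hD (by omega) x1
      have ej : ptn a t (V p) j = y := ptn_eq c.ht hD (by omega) y2
      rw [ei, ej] at g2
      have f1 := hh_cl hD g1.c0 x1 y2
      have f2 := hh_cl hD g1.p1 x2 y1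
      have g2a := g2.m1
      rw [Nat.add_sub_cancel] at g2a
      have fa := g2.far
      exact par (cv_cr_ne (c.tne (by omega) (by omega) (by omega)) (c.tne (by omega) (by omega) (by omega))) f1 f2 g2.c0 g2a
  have he' : e' ≠ 0 := by
    intro h0
    apply c.hD _ m2
    change Dl e' = 0
    rw [h0]; simp [Dl]
  have := dot_par he' key hL2
  rw [dot_hh, hL] at this
  have h3 : BB (V p) e * dot L (V p) = 0 := by linarith
  exact (mul_eq_zero.1 h3).resolve_right hoff

lemma Cfg.uniq (c : Cfg a t Q V) {L : V3} (hL0 : L ≠ 0) {p q : ℝ} (hp : p ∈ Q) (hq : q ∈ Q)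
    (h : ∀ x, x = p ∨ x = q → ∃ e e' : V3, cr e e' ≠ 0 ∧ dot L e = 0 ∧ dot L e' = 0 ∧ BB (V x) e = 0 ∧ BB (V x) e' = 0) : p = q := by
  have main : ∀ x, x = p ∨ x = q → ∃ k : ℝ, ((V x).2.2, -2 * (V x).2.1, (V x).1) = k • L := by
    intro x hx
    obtain ⟨e, e', h1, h2, h3, h4, h5⟩ := h x hx
    refine exists_smul hL0 (par h1 ?_ ?_ h2 h3)
    · rw [← h4]; simp only [dot, BB]; ring
    · rw [← h5]; simp only [dot, BB]; ring
  obtain ⟨k, hk⟩ := main p (Or.inl rfl)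
  obtain ⟨k', hk'⟩ := main q (Or.inr rfl)
  apply c.hinj p hp q hq
  simp only [Prod.ext_iff, Prod.smul_fst, Prod.smul_snd, smul_eq_mul] at hk hk'
  obtain ⟨a1, a2, a3⟩ := hk
  obtain ⟨b1, b2, b3⟩ := hk'
  have a2' : (V p).2.1 = - (k * L.2.1) / 2 := by linarith
  have b2' : (V q).2.1 = - (k' * L.2.1) / 2 := by linarith
  rw [cr_eq_zero, a1, a2', a3, b1, b2', b3]
  refine ⟨by ring, by ring, by ring⟩

end
end
end WS

namespace WS
noncomputable section
open scoped Classical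
open Finset

section
variable {a : ℕ} {t : ℕ → ℝ} {Q : Finset ℝ} {V : ℝ → V3}

def NG (a : ℕ) (t : ℕ → ℝ) (Q : Finset ℝ) (V : ℝ → V3) : Finset (ℕ × ℕ) :=
  (range a ×ˢ range a).filter (fun x => ¬ Gd a t Q V x.1 x.2)

lemma near_count (a : ℕ) : ((range a ×ˢ range a).filter
    (fun x : ℕ × ℕ => ¬ (2 ≤ x.1 ∧ 2 ≤ x.2 ∧ x.1 + 2 < a ∧ x.2 + 2 < a ∧ (x.1 + 5 ≤ x.2 ∨ x.2 + 5 ≤ x.1)))).card ≤ 17 * a := by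
  set B : Finset ℕ := {0, 1, a - 1, a - 2} with hB
  have hBc : B.card ≤ 4 := card_le_four
  have hsub : ((range a ×ˢ range a).filter
    (fun x : ℕ × ℕ => ¬ (2 ≤ x.1 ∧ 2 ≤ x.2 ∧ x.1 + 2 < a ∧ x.2 + 2 < a ∧ (x.1 + 5 ≤ x.2 ∨ x.2 + 5 ≤ x.1)))) ⊆
    (B ×ˢ range a) ∪ (range a ×ˢ B) ∪ (range a ×ˢ range 9).image (fun y => (y.1, y.1 + y.2 - 4)) := by
    rintro ⟨i, j⟩ h
    simp only [mem_filter, mem_product, mem_range] at h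
    simp only [mem_union, mem_product, mem_image, mem_range, Prod.mk.injEq, Prod.exists, hB, mem_insert, mem_singleton]
    by_cases c1 : 2 ≤ i ∧ i + 2 < a
    · by_cases c2 : 2 ≤ j ∧ j + 2 < a
      · right
        exact ⟨i, j + 4 - i, ⟨by omega, by omega⟩, rfl, by omega⟩
      · left; right; omega
    · left; left; omega
  have h1 := card_le_card hsub
  have h2 := card_union_le ((B ×ˢ range a) ∪ (range a ×ˢ B)) ((range a ×ˢ range 9).image (fun y => (y.1, y.1 + y.2 - 4)))
  have h3 := card_union_le (B ×ˢ range a) (range a ×ˢ B)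
  have h4 : ((range a ×ˢ range 9).image (fun y : ℕ × ℕ => (y.1, y.1 + y.2 - 4))).card ≤ a * 9 := by
    refine card_image_le.trans ?_
    rw [card_product, card_range, card_range]
  rw [card_product, card_product, card_range] at h3
  nlinarith

def mid (a : ℕ) : Finset (ℕ × ℕ) := (range a ×ˢ range a).filter (fun x : ℕ × ℕ =>
    (x.1 < x.2 ∧ 4000 * (2 * (x.2 - x.1)) ≤ 4001 * a ∧ 3999 * a ≤ 4000 * (2 * (x.2 - x.1))) ∨
    (x.2 < x.1 ∧ 4000 * (2 * (x.1 - x.2)) ≤ 4001 * a ∧ 3999 * a ≤ 4000 * (2 * (x.1 - x.2))))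

lemma mid_count (a : ℕ) : 4000 * (mid a).card ≤ 2 * a * a + 16000 * a := by
  set x := 3999 * a / 8000 with hx
  set y := 4001 * a / 8000 with hy
  have hsub : mid a ⊆ (range a).biUnion (fun i => ((Icc (i + x) (i + y)) ∪ (Icc (i - y) (i - x))).image (fun j => (i, j))) := by
    rintro ⟨i, j⟩ h
    simp only [mid, mem_filter, mem_product, mem_range] at h
    simp only [mem_biUnion, mem_image, mem_range, mem_union, mem_Icc, Prod.mk.injEq]
    refine ⟨i, by omega, j, ?_, rfl, rfl⟩
    omega
  have h1 := (card_le_card hsub).trans card_biUnion_le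
  have h2 : ∀ i ∈ range a, (((Icc (i + x) (i + y)) ∪ (Icc (i - y) (i - x))).image (fun j => (i, j))).card ≤ 2 * (y + 1 - x) := by
    intro i _
    refine card_image_le.trans ((card_union_le _ _).trans ?_)
    rw [Nat.card_Icc, Nat.card_Icc]
    omega
  have h3 := h1.trans (sum_le_card_nsmul _ _ _ h2)
  rw [card_range, smul_eq_mul] at h3
  have h4 : 4000 * (y + 1 - x) ≤ a + 8000 := by omega
  nlinarith

lemma fil_count (S : Finset ℕ) (f : ℕ → ℕ) : (S.image (fun i => (i, f i))).card ≤ S.card := card_image_le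

lemma Cfg.ng_count (c : Cfg a t Q V) {E1 E2 n : ℕ} (hn : Q.card ≤ n)
    (h1 : ((range a ×ˢ range a).filter (fun x => x.1 ≠ x.2 ∧ ¬ ∃ p ∈ Q, cl (V p) (t x.1) (t x.2))).card ≤ E1)
    (h2 : ∑ p ∈ Q, (NBs a t (V p)).card ≤ E2) :
    4000 * (NG a t Q V).card ≤ 4000 * (21 * a + E1 + 4016 * E2 + 8 * n) + 2 * a * a := by
  set N1 := ((range a ×ˢ range a).filter
    (fun x : ℕ × ℕ => ¬ (2 ≤ x.1 ∧ 2 ≤ x.2 ∧ x.1 + 2 < a ∧ x.2 + 2 < a ∧ (x.1 + 5 ≤ x.2 ∨ x.2 + 5 ≤ x.1))))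
  set N2 := ((range a ×ˢ range a).filter (fun x => x.1 ≠ x.2 ∧ ¬ ∃ p ∈ Q, cl (V p) (t x.1) (t x.2)))
  set Qb := Q.filter (fun p => a < 4000 * (NBs a t (V p)).card) with hQb
  set N3 := Qb.biUnion (fun p => (range a).image (fun i => (i, ptn a t (V p) i))) with hN3
  let nA : ℝ → Finset ℕ := fun p => (range a).filter (fun i => ¬ Adj a t (V p) i)
  let fS : ℝ → Finset ℕ := fun p => (nA p ∪ (nA p).image (fun i => i - 1)) ∪ ((nA p).image (fun i => i + 1) ∪ (nA p).image (fun i => i + 2))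
  set N4 := Q.biUnion (fun p => (fS p).image (fun i => (i, ptn a t (V p) i))) with hN4
  have hsub : NG a t Q V ⊆ N1 ∪ N2 ∪ N3 ∪ mid a ∪ N4 := by
    rintro ⟨i, j⟩ h
    simp only [NG, mem_filter, mem_product, mem_range] at h
    obtain ⟨⟨hi, hj⟩, hg⟩ := h
    simp only [mem_union]
    by_cases c1 : (2 ≤ i ∧ 2 ≤ j ∧ i + 2 < a ∧ j + 2 < a ∧ (i + 5 ≤ j ∨ j + 5 ≤ i))
    swap
    · left; left; left; left
      exact mem_filter.2 ⟨mem_product.2 ⟨mem_range.2 hi, mem_range.2 hj⟩, c1⟩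
    by_cases c2 : ∃ p ∈ Q, cl (V p) (t i) (t j)
    swap
    · left; left; left; right
      exact mem_filter.2 ⟨mem_product.2 ⟨mem_range.2 hi, mem_range.2 hj⟩, by simp only; omega, c2⟩
    obtain ⟨p, hp, hc⟩ := c2
    have hD := c.hD p hp
    have hpt := ptn_eq c.ht hD hj hc
    rcases lt_or_gt_of_ne hD with hneg | hpos
    · by_cases c3 : a < 4000 * (NBs a t (V p)).card
      · left; left; right
        refine mem_biUnion.2 ⟨p, mem_filter.2 ⟨hp, c3⟩, mem_image.2 ⟨i, mem_range.2 hi, ?_⟩⟩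
        rw [hpt]
      · left; right
        refine mem_filter.2 ⟨mem_product.2 ⟨mem_range.2 hi, mem_range.2 hj⟩, ?_⟩
        simp only
        rcases lt_or_gt_of_ne (show i ≠ j by omega) with h | h
        · obtain ⟨q1, q2⟩ := int_range c.ht hD hneg h hj hc
          left; omega
        · obtain ⟨q1, q2⟩ := int_range c.ht hD hneg h hi (cl_symm hc)
          right; omega
    · right
      refine mem_biUnion.2 ⟨p, hp, mem_image.2 ⟨i, ?_, by rw [hpt]⟩⟩
      by_contra hcon
      simp only [fS, mem_union, mem_image, not_or, not_exists, not_and] at hcon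
      obtain ⟨⟨k1, k2⟩, k3, k4⟩ := hcon
      have hA : ∀ k, k < a → k ∉ nA p → Adj a t (V p) k := by
        intro k hk hkn
        by_contra hh
        exact hkn (mem_filter.2 ⟨mem_range.2 hk, hh⟩)
      have A0 := hA i hi k1
      have A1 := hA (i+1) (by omega) (fun h => k2 _ h (by omega))
      have A2 := hA (i-1) (by omega) (fun h => k3 _ h (by omega))
      have A3 := hA (i-2) (by omega) (fun h => k4 _ h (by omega))
      obtain ⟨x0, b0, y0, z0⟩ := adj_ext c.ht hD hpos A0
      obtain ⟨x1, b1, y1, z1⟩ := adj_ext c.ht hD hpos A1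
      obtain ⟨x2, b2, y2, z2⟩ := adj_ext c.ht hD hpos A2
      obtain ⟨x3, b3, y3, z3⟩ := adj_ext c.ht hD hpos A3
      rw [show i - 1 + 1 = i by omega] at z2
      rw [show i - 2 + 1 = i - 1 by omega] at z3
      have e0 := tinj c.ht b0 hj (cl_uniq hD y0 hc)
      have e1 := tinj c.ht (by omega) (by omega) (cl_uniq hD y1 z0)
      have e2 := tinj c.ht (by omega) hj (cl_uniq hD z2 hc)
      have e3 := tinj c.ht (by omega) (by omega) (cl_uniq hD z3 y2)
      refine hg ⟨p, hp, c1.1, c1.2.1, c1.2.2.1, c1.2.2.2.1, c1.2.2.2.2, hc, ?_, ?_, ?_, ?_⟩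
      · rw [show j - 1 = x0 by omega]; exact z0
      · rw [show j - 2 = x1 by omega]; exact z1
      · rw [← e2]; exact y2
      · rw [show j + 2 = x3 + 1 by omega]; exact y3
  have u1 := card_le_card hsub
  have u2 := card_union_le (N1 ∪ N2 ∪ N3 ∪ mid a) N4
  have u3 := card_union_le (N1 ∪ N2 ∪ N3) (mid a)
  have u4 := card_union_le (N1 ∪ N2) N3
  have u5 := card_union_le N1 N2
  have n1 : N1.card ≤ 17 * a := near_count a
  have n3 : N3.card ≤ 4000 * E2 := by
    refine card_biUnion_le.trans ?_
    calc ∑ p ∈ Qb, ((range a).image (fun i => (i, ptn a t (V p) i))).card ≤ ∑ p ∈ Qb, 4000 * (NBs a t (V p)).card := by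
          refine sum_le_sum (fun p hp => ?_)
          refine card_image_le.trans ?_
          rw [card_range]
          exact (mem_filter.1 hp).2.le
      _ = 4000 * ∑ p ∈ Qb, (NBs a t (V p)).card := by rw [mul_sum]
      _ ≤ 4000 * ∑ p ∈ Q, (NBs a t (V p)).card := Nat.mul_le_mul_left _ (sum_le_sum_of_subset (filter_subset _ _))
      _ ≤ _ := Nat.mul_le_mul_left _ h2
  have n4 : N4.card ≤ 16 * E2 + 8 * n := by
    refine card_biUnion_le.trans ?_
    calc ∑ p ∈ Q, ((fS p).image (fun i => (i, ptn a t (V p) i))).card ≤ ∑ p ∈ Q, (16 * (NBs a t (V p)).card + 8) := by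
          refine sum_le_sum (fun p hp => ?_)
          refine card_image_le.trans ?_
          have w := card_notAdj c.ht (c.hD p hp)
          have w1 := card_union_le (nA p ∪ (nA p).image (fun i => i - 1)) ((nA p).image (fun i => i + 1) ∪ (nA p).image (fun i => i + 2))
          have w2 := card_union_le (nA p) ((nA p).image (fun i => i - 1))
          have w3 := card_union_le ((nA p).image (fun i => i + 1)) ((nA p).image (fun i => i + 2))
          have v1 : ((nA p).image (fun i => i - 1)).card ≤ _ := card_image_le
          have v2 : ((nA p).image (fun i => i + 1)).card ≤ _ := card_image_le
          have v3 : ((nA p).image (fun i => i + 2)).card ≤ _ := card_image_le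
          change (nA p).card ≤ _ at w
          change (fS p).card ≤ _ at w1
          omega
      _ = 16 * ∑ p ∈ Q, (NBs a t (V p)).card + Q.card * 8 := by rw [sum_add_distrib, mul_sum, sum_const, smul_eq_mul]
      _ ≤ _ := by omega
  have n5 := mid_count a
  nlinarith

end
end
end WS

namespace WS
noncomputable section
open scoped Classical
open Finset

lemma pick1 {a : ℕ} (U : Finset ℕ) (h : U.card < a) : ∃ i < a, i ∉ U := by
  by_contra hc
  push Not at hc
  have : range a ⊆ U := fun i hi => hc i (mem_range.1 hi)
  have := card_le_card this
  rw [card_range] at this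
  omega

lemma pick2 {a : ℕ} (U : Finset ℕ) (h : U.card + 1 < a) : ∃ i < a, ∃ j < a, i ≠ j ∧ i ∉ U ∧ j ∉ U := by
  obtain ⟨i, hi, hiU⟩ := pick1 (a := a) U (by omega)
  obtain ⟨j, hj, hjU⟩ := pick1 (a := a) (insert i U) ((card_insert_le _ _).trans_lt h)
  rw [mem_insert, not_or] at hjU
  exact ⟨i, hi, j, hj, fun h => hjU.1 h.symm, hiU, hjU.2⟩

section
variable {a : ℕ} {t : ℕ → ℝ} {Q : Finset ℝ} {V : ℝ → V3}

def row (a : ℕ) (t : ℕ → ℝ) (Q : Finset ℝ) (V : ℝ → V3) (i : ℕ) : Finset ℕ := (range a).filter (fun j => ¬ Gd a t Q V i j)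
lemma row_spec {i j : ℕ} (hj : j < a) (h : j ∉ row a t Q V i) : Gd a t Q V i j := by
  by_contra hc; exact h (mem_filter.2 ⟨mem_range.2 hj, hc⟩)

def Rb (a : ℕ) (t : ℕ → ℝ) (Q : Finset ℝ) (V : ℝ → V3) : Finset ℕ := (range a).filter (fun i => a < 100 * (row a t Q V i).card)

lemma row_le {i : ℕ} (hi : i < a) (h : i ∉ Rb a t Q V) : 100 * (row a t Q V i).card ≤ a := by
  by_contra hc; exact h (mem_filter.2 ⟨mem_range.2 hi, not_le.1 hc⟩)

lemma Rb_card (ha : 0 < a) (h : 1000 * (NG a t Q V).card ≤ a * a) : 10 * (Rb a t Q V).card ≤ a := by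
  have e : (NG a t Q V).card = ∑ i ∈ range a, (row a t Q V i).card := by
    rw [NG, card_filter, sum_product]
    refine sum_congr rfl (fun i _ => ?_)
    rw [row, card_filter]
  have h1 : (Rb a t Q V).card * a ≤ 100 * (NG a t Q V).card := by
    rw [e]
    calc (Rb a t Q V).card * a = ∑ i ∈ Rb a t Q V, a := by rw [sum_const, smul_eq_mul]
      _ ≤ ∑ i ∈ Rb a t Q V, 100 * (row a t Q V i).card := sum_le_sum (fun i hi => (mem_filter.1 hi).2.le)
      _ ≤ ∑ i ∈ range a, 100 * (row a t Q V i).card := sum_le_sum_of_subset (filter_subset _ _)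
      _ = _ := by rw [mul_sum]
  by_contra hc
  push Not at hc
  nlinarith

theorem Cfg.main (c : Cfg a t Q V) {E1 E2 n : ℕ} (hn : Q.card ≤ n)
    (h1 : ((range a ×ˢ range a).filter (fun x => x.1 ≠ x.2 ∧ ¬ ∃ p ∈ Q, cl (V p) (t x.1) (t x.2))).card ≤ E1)
    (h2 : ∑ p ∈ Q, (NBs a t (V p)).card ≤ E2) (ha : 0 < a) (hbig : 10 ^ 7 * (E1 + E2 + n + a) ≤ a * a) :
    ∃ p1 ∈ Q, ∃ p2 ∈ Q, p1 ≠ p2 ∧ (Q.filter (fun p => dot (cr (V p1) (V p2)) (V p) ≠ 0)).card * a ≤ 100 * E2 + a := by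
  have ha7 : 10 ^ 7 ≤ a := by
    by_contra hc
    push Not at hc
    have : a * a < 10 ^ 7 * a := Nat.mul_lt_mul_of_pos_right hc ha
    nlinarith
  have hNG := c.ng_count hn h1 h2
  have hNG' : 1000 * (NG a t Q V).card ≤ a * a := by nlinarith
  have hRb := Rb_card ha hNG'
  set R := Rb a t Q V with hR
  -- choose u
  obtain ⟨u, hu, huU⟩ := pick1 (a := a) (((R ∪ R.image (fun i => i - 1)) ∪ R.image (fun i => i - 2)) ∪ {a - 1, a - 2}) (by
    have w1 := card_union_le ((R ∪ R.image (fun i => i - 1)) ∪ R.image (fun i => i - 2)) {a - 1, a - 2}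
    have w2 := card_union_le (R ∪ R.image (fun i => i - 1)) (R.image (fun i => i - 2))
    have w3 := card_union_le R (R.image (fun i => i - 1))
    have v1 : (R.image (fun i => i - 1)).card ≤ _ := card_image_le
    have v2 : (R.image (fun i => i - 2)).card ≤ _ := card_image_le
    have v3 : ({a - 1, a - 2} : Finset ℕ).card ≤ 2 := card_le_two
    omega)
  simp only [mem_union, mem_image, mem_insert, mem_singleton, not_or, not_exists, not_and] at huU
  obtain ⟨⟨⟨u0, u1⟩, u2⟩, u3, u4⟩ := huU
  have uR1 : u + 1 ∉ R := fun h => u1 _ h (by omega)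
  have uR2 : u + 2 ∉ R := fun h => u2 _ h (by omega)
  have r0 := row_le hu u0
  have r1 := row_le (show u + 1 < a by omega) uR1
  have r2 := row_le (show u + 2 < a by omega) uR2
  set X := row a t Q V u with hX
  obtain ⟨v, hv, v', hv', hvv, hvU, hvU'⟩ := pick2 (a := a) (X ∪ R) (by
    have w1 := card_union_le X R
    omega)
  rw [mem_union, not_or] at hvU hvU'
  have gv := row_spec hv hvU.1
  have gv' := row_spec hv' hvU'.1
  have rv := row_le hv hvU.2
  have rv' := row_le hv' hvU'.2
  set W := (row a t Q V v ∪ row a t Q V v') ∪ (row a t Q V (u+1) ∪ row a t Q V (u+2)) with hW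
  have hWc : 100 * W.card ≤ 4 * a := by
    have w1 : W.card ≤ _ := card_union_le _ _
    have w2 := card_union_le (row a t Q V v) (row a t Q V v')
    have w3 := card_union_le (row a t Q V (u+1)) (row a t Q V (u+2))
    omega
  obtain ⟨m1, g1⟩ := rr_spec gv
  obtain ⟨m2, g2⟩ := rr_spec gv'
  set P1 := rr a t Q V u v with hP1
  set P2 := rr a t Q V u v' with hP2
  set L := cr (V P1) (V P2) with hL
  have hL0 : L ≠ 0 := c.nonpar m1 m2 hv hv' hvv g1.c0 g2.c0
  have onL : ∀ x < a, x ∉ X → ∀ w < a, w ∉ W → Gd a t Q V x w → dot L (V (rr a t Q V x w)) = 0 := by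
    intro x hx hxX w hw hwW hg
    simp only [hW, mem_union, not_or] at hwW
    have k1 := row_spec hw hwW.1.1
    have k2 := row_spec hw hwW.1.2
    have k3 := (row_spec hw hwW.2.1).symm
    have k4 := (row_spec hw hwW.2.2).symm
    have a1 := (c.pas gv k1 k3 k4).1
    have a2 := (c.pas gv' k2 k3 k4).1
    have a3 := (c.pas (row_spec hx hxX) hg k3 k4).2
    have hl : cr (cr (V (rr a t Q V w (u+1))) (V (rr a t Q V w (u+2)))) L = 0 := cr_cr a1 a2
    have hlam : cr (V (rr a t Q V w (u+1))) (V (rr a t Q V w (u+2))) ≠ 0 := by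
      obtain ⟨q1, q2⟩ := rr_spec k3
      obtain ⟨q3, q4⟩ := rr_spec k4
      exact c.nonpar q1 q3 (i := w) (j := u+1) (k := u+2) (by omega) (by omega) (by omega) q2.c0 q4.c0
    obtain ⟨k, hk⟩ := exists_smul hlam (cr_symm hl)
    rw [hk, dot_smul, a3, mul_zero]
  refine ⟨P1, m1, P2, m2, ?_, ?_⟩
  · intro h
    apply hL0
    rw [hL, h]
    rw [cr_eq_zero]; exact ⟨by ring, by ring, by ring⟩
  set O := Q.filter (fun p => dot L (V p) ≠ 0) with hO
  set Ob := O.filter (fun p => a < 100 * (NBs a t (V p)).card) with hOb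
  set Og := O.filter (fun p => ¬ a < 100 * (NBs a t (V p)).card) with hOg
  have hsplit : O.card = Ob.card + Og.card := (card_filter_add_card_filter_not _).symm
  have hObc : Ob.card * a ≤ 100 * E2 := by
    calc Ob.card * a = ∑ i ∈ Ob, a := by rw [sum_const, smul_eq_mul]
      _ ≤ ∑ p ∈ Ob, 100 * (NBs a t (V p)).card := sum_le_sum (fun i hi => (mem_filter.1 hi).2.le)
      _ ≤ ∑ p ∈ Q, 100 * (NBs a t (V p)).card := sum_le_sum_of_subset ((filter_subset _ _).trans (filter_subset _ _))
      _ = 100 * ∑ p ∈ Q, (NBs a t (V p)).card := by rw [mul_sum]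
      _ ≤ _ := Nat.mul_le_mul_left _ h2
  have hOgc : Og.card ≤ 1 := by
    rw [card_le_one]
    have key : ∀ p ∈ Og, ∃ e e' : V3, cr e e' ≠ 0 ∧ dot L e = 0 ∧ dot L e' = 0 ∧ BB (V p) e = 0 ∧ BB (V p) e' = 0 := by
      intro p hp
      obtain ⟨hpO, hsm⟩ := mem_filter.1 hp
      obtain ⟨hpQ, hoff⟩ := mem_filter.1 hpO
      have hD := c.hD p hpQ
      have hnA := card_notAdj c.ht hD
      set nA := (range a).filter (fun i => ¬ Adj a t (V p) i) with hnAdef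
      have pt := ptn a t (V p)
      -- `ptn` is an involution where defined
      have adjP : ∀ i, i < a → i ∉ nA → Adj a t (V p) i := by
        intro i hi h
        by_contra hh
        exact h (mem_filter.2 ⟨mem_range.2 hi, hh⟩)
      have inv : ∀ i, i < a → HasP a t (V p) i → ptn a t (V p) i < a ∧ ptn a t (V p) (ptn a t (V p) i) = i := by
        rintro i hi ⟨j, hj, hc⟩
        rw [ptn_eq c.ht hD hj hc]
        exact ⟨hj, ptn_eq c.ht hD hi (cl_symm hc)⟩
      have img : ∀ (S : Finset ℕ) i, i < a → HasP a t (V p) i → i ∉ S.image (ptn a t (V p)) → ptn a t (V p) i ∉ S := by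
        intro S i hi hP hS hh
        exact hS (mem_image.2 ⟨_, hh, (inv i hi hP).2⟩)
      have imc : ∀ S : Finset ℕ, (S.image (ptn a t (V p))).card ≤ S.card := fun S => card_image_le
      obtain ⟨i, hi, hiU⟩ := pick1 (a := a) ((nA ∪ (X ∪ R)) ∪ (X ∪ R).image (ptn a t (V p))) (by
        have w1 := card_union_le (nA ∪ (X ∪ R)) ((X ∪ R).image (ptn a t (V p)))
        have w2 := card_union_le nA (X ∪ R)
        have w3 := card_union_le X R
        have w4 := imc (X ∪ R)
        omega)
      simp only [mem_union (a := i), not_or] at hiU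
      obtain ⟨⟨i1, i2, i3⟩, i4⟩ := hiU
      have Ai := adjP i hi i1
      have Pi : HasP a t (V p) i := by
        obtain ⟨-, -, j, hj, -, -, -, hc, -⟩ := Ai
        exact ⟨j, hj, hc⟩
      have i5 := img _ i hi Pi i4
      rw [mem_union, not_or] at i5
      obtain ⟨hia, -⟩ := inv i hi Pi
      set i' := ptn a t (V p) i with hi'
      have q1 := row_le hi i3
      have q2 := row_le hia i5.2
      obtain ⟨j, hj, k, hk, hjk, hjU, hkU⟩ := pick2 (a := a) ((nA.image (fun x => x + 1) ∪ (W ∪ row a t Q V i)) ∪ (W ∪ row a t Q V i' ).image (ptn a t (V p))) (by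
        have w1 := card_union_le (nA.image (fun x => x + 1) ∪ (W ∪ row a t Q V i)) ((W ∪ row a t Q V i').image (ptn a t (V p)))
        have w2 := card_union_le (nA.image (fun x => x + 1)) (W ∪ row a t Q V i)
        have w3 := card_union_le W (row a t Q V i)
        have w4 := card_union_le W (row a t Q V i')
        have w5 := imc (W ∪ row a t Q V i')
        have w6 : (nA.image (fun x => x + 1)).card ≤ _ := card_image_le
        omega)
      have fin : ∀ y, y < a → y ∉ ((nA.image (fun x => x + 1) ∪ (W ∪ row a t Q V i)) ∪ (W ∪ row a t Q V i' ).image (ptn a t (V p))) →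
          Gd a t Q V i y ∧ dot L (V (rr a t Q V i y)) = 0 ∧ BB (V p) (V (rr a t Q V i y)) = 0 := by
        intro y hy hyU
        simp only [mem_union (a := y), not_or] at hyU
        obtain ⟨⟨y1, y2, y3⟩, y4⟩ := hyU
        have gy := row_spec hy y3
        have y2' := (rr_spec gy).2.j2
        have Ay := adjP (y-1) (by omega) (fun h => y1 (mem_image.2 ⟨_, h, by omega⟩))
        have Py : HasP a t (V p) y := by
          obtain ⟨-, -, -, -, j', hj', -, -, hc'⟩ := Ay
          rw [show y - 1 + 1 = y by omega] at hc'
          exact ⟨j', hj', hc'⟩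
        have y5 := img _ y hy Py y4
        rw [mem_union, not_or] at y5
        obtain ⟨hya, -⟩ := inv y hy Py
        have gy' := row_spec hya y5.2
        have l1 := onL i hi i2 y hy y2 gy
        exact ⟨gy, l1, c.refl hpQ hoff gy l1 Ai Ay gy' (onL _ hia i5.1 _ hya y5.1 gy')⟩
      obtain ⟨f1, f2, f3⟩ := fin j hj hjU
      obtain ⟨f1', f2', f3'⟩ := fin k hk hkU
      obtain ⟨s1, s2⟩ := rr_spec f1
      obtain ⟨s1', s2'⟩ := rr_spec f1'
      exact ⟨_, _, c.nonpar s1 s1' hj hk hjk s2.c0 s2'.c0, f2, f2', f3, f3'⟩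
    intro p hp q hq
    refine c.uniq hL0 (mem_filter.1 (mem_filter.1 hp).1).1 (mem_filter.1 (mem_filter.1 hq).1).1 ?_
    rintro x (rfl | rfl)
    · exact key _ hp
    · exact key _ hq
  rw [hsplit]
  nlinarith

end
end
end WS

namespace WS
noncomputable section
open scoped Classical
open MvPolynomial

lemma quad_expand (f : Po) (hf : f.totalDegree ≤ 2) : ∃ c0 c1 c2 c3 c4 c5 : ℝ, ∀ v : Fin 2 → ℝ,
    eval v f = c0 + c1 * v 0 + c2 * v 1 + c3 * v 0 ^ 2 + c4 * (v 0 * v 1) + c5 * v 1 ^ 2 := by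
  have main : ∀ S : Finset (Fin 2 →₀ ℕ), S ⊆ f.support → ∃ c0 c1 c2 c3 c4 c5 : ℝ, ∀ v : Fin 2 → ℝ,
      ∑ d ∈ S, coeff d f * ∏ i ∈ Finset.univ, v i ^ d i = c0 + c1 * v 0 + c2 * v 1 + c3 * v 0 ^ 2 + c4 * (v 0 * v 1) + c5 * v 1 ^ 2 := by
    intro S
    induction S using Finset.induction_on with
    | empty => intro _; exact ⟨0, 0, 0, 0, 0, 0, fun v => by simp⟩
    | insert d S hd ih =>
      intro hS
      obtain ⟨c0, c1, c2, c3, c4, c5, h⟩ := ih ((Finset.subset_insert _ _).trans hS)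
      have hdeg : d 0 + d 1 ≤ 2 := by
        have := le_totalDegree (hS (Finset.mem_insert_self d S))
        rw [Finsupp.sum_fintype _ _ (by simp), Fin.sum_univ_two] at this
        omega
      set k := coeff d f
      have key : ∃ e0 e1 e2 e3 e4 e5 : ℝ, ∀ v : Fin 2 → ℝ, k * (v 0 ^ d 0 * v 1 ^ d 1) = e0 + e1 * v 0 + e2 * v 1 + e3 * v 0 ^ 2 + e4 * (v 0 * v 1) + e5 * v 1 ^ 2 := by
        have hc : (d 0 = 0 ∧ d 1 = 0) ∨ (d 0 = 1 ∧ d 1 = 0) ∨ (d 0 = 0 ∧ d 1 = 1) ∨ (d 0 = 2 ∧ d 1 = 0) ∨ (d 0 = 1 ∧ d 1 = 1) ∨ (d 0 = 0 ∧ d 1 = 2) := by omega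
        rcases hc with ⟨h0, h1⟩ | ⟨h0, h1⟩ | ⟨h0, h1⟩ | ⟨h0, h1⟩ | ⟨h0, h1⟩ | ⟨h0, h1⟩ <;> rw [h0, h1]
        · exact ⟨k, 0, 0, 0, 0, 0, fun v => by ring⟩
        · exact ⟨0, k, 0, 0, 0, 0, fun v => by ring⟩
        · exact ⟨0, 0, k, 0, 0, 0, fun v => by ring⟩
        · exact ⟨0, 0, 0, k, 0, 0, fun v => by ring⟩
        · exact ⟨0, 0, 0, 0, k, 0, fun v => by ring⟩
        · exact ⟨0, 0, 0, 0, 0, k, fun v => by ring⟩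
      obtain ⟨e0, e1, e2, e3, e4, e5, he⟩ := key
      refine ⟨c0 + e0, c1 + e1, c2 + e2, c3 + e3, c4 + e4, c5 + e5, fun v => ?_⟩
      rw [Finset.sum_insert hd, h v, Fin.prod_univ_two, he v]
      ring
  obtain ⟨c0, c1, c2, c3, c4, c5, h⟩ := main f.support subset_rfl
  exact ⟨c0, c1, c2, c3, c4, c5, fun v => by rw [eval_eq']; exact h v⟩

def aff (k0 k1 k2 : ℝ) : Po := C k0 + C k1 * X 0 + C k2 * X 1
lemma aff_eval (k0 k1 k2 : ℝ) (v : Fin 2 → ℝ) : eval v (aff k0 k1 k2) = k0 + k1 * v 0 + k2 * v 1 := by simp [aff]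
lemma aff_deg (k0 k1 k2 : ℝ) : (aff k0 k1 k2).totalDegree ≤ 1 := by
  rw [aff]
  refine (totalDegree_add _ _).trans (max_le ((totalDegree_add _ _).trans (max_le ?_ ?_)) ?_)
  · simp
  · refine (totalDegree_mul _ _).trans ?_; simp
  · refine (totalDegree_mul _ _).trans ?_; simp

lemma aff_ne {k0 k1 k2 : ℝ} (h : k0 ≠ 0 ∨ k1 ≠ 0 ∨ k2 ≠ 0) : aff k0 k1 k2 ≠ 0 := by
  intro h0
  have e := fun v => aff_eval k0 k1 k2 v
  rw [h0] at e
  have e1 := e ![0, 0]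
  have e2 := e ![1, 0]
  have e3 := e ![0, 1]
  simp at e1 e2 e3
  rcases h with h | h | h
  · exact h e1.symm
  · exact h (by rw [← e1] at e2; linarith)
  · exact h (by rw [← e1] at e3; linarith)

lemma aff_count {b : ℝ → ℝ} {f : Po} (hf : Irreducible f) (hd : f.totalDegree = 2) {k0 k1 k2 : ℝ} (h : k0 ≠ 0 ∨ k1 ≠ 0 ∨ k2 ≠ 0)
    (S : Finset ℝ) (hS : ∀ q ∈ S, Van b f q ∧ k0 + k1 * q + k2 * b q = 0) : S.card ≤ 2 := by
  have hnd : ¬ f ∣ aff k0 k1 k2 := by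
    rintro ⟨g, hg⟩
    have hg0 : g ≠ 0 := by rintro rfl; rw [mul_zero] at hg; exact aff_ne h hg
    have h1 := aff_deg k0 k1 k2
    rw [hg, totalDegree_mul_of_isDomain hf.ne_zero hg0] at h1
    omega
  have := bezout_idx (b := b) hf hd (aff_deg k0 k1 k2) hnd S (fun s hs => ⟨(hS s hs).1, by
    have := (hS s hs).2
    rw [Van, aff_eval]; simpa [pt] using this⟩)
  omega

lemma line3 {b : ℝ → ℝ} {f : Po} (hf : Irreducible f) (hd : f.totalDegree = 2) {q1 q2 q3 x y : ℝ} (h12 : q1 ≠ q2) (h13 : q1 ≠ q3)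
    (h23 : q2 ≠ q3) (v1 : Van b f q1) (v2 : Van b f q2) (v3 : Van b f q3) (l1 : fl b q1 x = y) (l2 : fl b q2 x = y)
    (l3 : fl b q3 x = y) : False := by
  have := aff_count (b := b) hf hd (k0 := -y) (k1 := x) (k2 := -1) (Or.inr (Or.inr (by norm_num))) {q1, q2, q3} (by
    intro q hq
    simp only [Finset.mem_insert, Finset.mem_singleton] at hq
    simp only [fl] at l1 l2 l3
    rcases hq with rfl | rfl | rfl
    · exact ⟨v1, by linarith⟩
    · exact ⟨v2, by linarith⟩
    · exact ⟨v3, by linarith⟩)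
  rw [Finset.card_eq_three.2 ⟨q1, q2, q3, h12, h13, h23, rfl⟩] at this
  omega

/-- nondegeneracy -/
lemma conic_nondeg {A : Finset ℝ} {b : ℝ → ℝ} {f : Po} (hf : Irreducible f) (hd : f.totalDegree = 2) {q0 α β γ δ ε : ℝ}
    (h0 : q0 ∈ ZF A b f) (hc : 5 ≤ (ZF A b f).card)
    (he : ∀ v : Fin 2 → ℝ, eval v f = α * (v 0 - q0) + β * (v 1 - b q0) + γ * (v 0 - q0) ^ 2 + δ * ((v 0 - q0) * (v 1 - b q0)) + ε * (v 1 - b q0) ^ 2) :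
    γ * β ^ 2 - δ * α * β + ε * α ^ 2 ≠ 0 := by
  intro hD
  have hv : ∀ q, Van b f q → α * (q - q0) + β * (b q - b q0) + γ * (q - q0) ^ 2 + δ * ((q - q0) * (b q - b q0)) + ε * (b q - b q0) ^ 2 = 0 := by
    intro q hq
    have := he (pt b q)
    rw [show eval (pt b q) f = 0 from hq] at this
    simpa [pt] using this.symm
  have split : ∀ k0 k1 k2 l0 l1 l2 : ℝ, (k0 ≠ 0 ∨ k1 ≠ 0 ∨ k2 ≠ 0) → (l0 ≠ 0 ∨ l1 ≠ 0 ∨ l2 ≠ 0) →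
      (∀ q, Van b f q → (k0 + k1 * q + k2 * b q) * (l0 + l1 * q + l2 * b q) = 0) → False := by
    intro k0 k1 k2 l0 l1 l2 hk hl h
    have c1 := aff_count (b := b) hf hd hk ((ZF A b f).filter (fun q => k0 + k1 * q + k2 * b q = 0))
      (fun q hq => ⟨(mem_ZF.1 (Finset.mem_filter.1 hq).1).2, (Finset.mem_filter.1 hq).2⟩)
    have c2 := aff_count (b := b) hf hd hl ((ZF A b f).filter (fun q => ¬ k0 + k1 * q + k2 * b q = 0))
      (fun q hq => ⟨(mem_ZF.1 (Finset.mem_filter.1 hq).1).2, by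
        have := h q (mem_ZF.1 (Finset.mem_filter.1 hq).1).2
        exact (mul_eq_zero.1 this).resolve_left (Finset.mem_filter.1 hq).2⟩)
    have := Finset.card_filter_add_card_filter_not (s := ZF A b f) (fun q => k0 + k1 * q + k2 * b q = 0)
    omega
  by_cases hb : β = 0
  · by_cases ha : α = 0
    · subst hb ha
      have h3 : 2 < ((ZF A b f).erase q0).card := by rw [Finset.card_erase_of_mem h0]; omega
      obtain ⟨q1, q2, q3, m1, m2, m3, h12, h13, h23⟩ := Finset.two_lt_card_iff.1 h3
      rw [Finset.mem_erase, mem_ZF] at m1 m2 m3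
      have hsl : ∀ q q', q ≠ q0 → q' ≠ q0 → q ≠ q' → Van b f q → Van b f q' → slp b q0 q ≠ slp b q0 q' := by
        intro q q' n1 n2 n3 w1 w2 hs
        refine line3 (b := b) hf hd (x := slp b q0 q) (y := fl b q0 (slp b q0 q)) n1.symm n2.symm n3 (mem_ZF.1 h0).2 w1 w2 rfl ?_ ?_
        · exact (fl_eq_iff b n1 _).2 rfl
        · exact (fl_eq_iff b n2 _).2 hs
      have hq : ∀ q, q ≠ q0 → Van b f q → γ + δ * slp b q0 q + ε * slp b q0 q ^ 2 = 0 := by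
        intro q n w
        have hx : q - q0 ≠ 0 := sub_ne_zero.2 n
        have := hv q w
        rw [slp]
        field_simp
        linarith
      have e1 := hq q1 m1.1 m1.2.2
      have e2 := hq q2 m2.1 m2.2.2
      have e3 := hq q3 m3.1 m3.2.2
      have s12 := sub_ne_zero.2 (hsl q1 q2 m1.1 m2.1 h12 m1.2.2 m2.2.2)
      have s13 := sub_ne_zero.2 (hsl q1 q3 m1.1 m3.1 h13 m1.2.2 m3.2.2)
      have s23 := sub_ne_zero.2 (hsl q2 q3 m2.1 m3.1 h23 m2.2.2 m3.2.2)
      generalize slp b q0 q1 = s1 at *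
      generalize slp b q0 q2 = s2 at *
      generalize slp b q0 q3 = s3 at *
      have d1 : δ + ε * (s1 + s2) = 0 := by
        have : (s1 - s2) * (δ + ε * (s1 + s2)) = 0 := by linear_combination e1 - e2
        exact (mul_eq_zero.1 this).resolve_left s12
      have d2 : δ + ε * (s1 + s3) = 0 := by
        have : (s1 - s3) * (δ + ε * (s1 + s3)) = 0 := by linear_combination e1 - e3
        exact (mul_eq_zero.1 this).resolve_left s13
      have d3 : ε = 0 := by
        have : (s2 - s3) * ε = 0 := by linear_combination d1 - d2
        exact (mul_eq_zero.1 this).resolve_left s23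
      subst d3
      have d4 : δ = 0 := by linarith
      subst d4
      have d5 : γ = 0 := by linarith
      subst d5
      apply hf.ne_zero
      apply MvPolynomial.funext
      intro v
      rw [he v]; simp
    · subst hb
      have hε : ε = 0 := by
        have : ε * α ^ 2 = 0 := by linarith
        exact (mul_eq_zero.1 this).resolve_right (pow_ne_zero 2 ha)
      subst hε
      refine split (-q0) 1 0 (α - γ * q0 - δ * b q0) γ δ (Or.inr (Or.inl one_ne_zero)) ?_ ?_
      · by_contra hcon
        push Not at hcon
        obtain ⟨x1, x2, x3⟩ := hcon
        rw [x2, x3] at x1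
        exact ha (by linarith)
      · intro q hq
        linear_combination hv q hq
  · set l := ε / β with hl
    set κ := (δ - α * l) / β with hκ
    have e1 : ε = β * l := by rw [hl]; field_simp
    have e2 : δ = α * l + β * κ := by rw [hκ]; field_simp; ring
    have e3 : γ = α * κ := by
      have : β ^ 2 * (γ - α * κ) = 0 := by rw [e1, e2] at hD; linear_combination hD
      have := (mul_eq_zero.1 this).resolve_left (pow_ne_zero 2 hb)
      linarith
    refine split (- α * q0 - β * b q0) α β (1 - κ * q0 - l * b q0) κ l (Or.inr (Or.inr hb)) ?_ ?_
    · by_contra hcon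
      push Not at hcon
      obtain ⟨x1, x2, x3⟩ := hcon
      rw [x2, x3] at x1
      linarith
    · intro q hq
      have := hv q hq
      rw [e1, e2, e3] at this
      linear_combination this

/-- coordinates adapted to the conic -/
def Vc (α β γ δ ε X W : ℝ) : V3 :=
  (β ^ 2 + (δ * β - ε * α) * X + ε * β * W, - (α * β) - γ * β * X - ε * α * W, α ^ 2 + γ * α * X + (δ * α - γ * β) * W)

lemma Vc_Dl (α β γ δ ε X W : ℝ) : Dl (Vc α β γ δ ε X W) =
    (γ * β ^ 2 - δ * α * β + ε * α ^ 2) * (α * X + β * W + γ * X ^ 2 + δ * (X * W) + ε * W ^ 2) := by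
  simp only [Dl, Vc]; ring

lemma Vc_inj {α β γ δ ε X W X' W' : ℝ} (hD : γ * β ^ 2 - δ * α * β + ε * α ^ 2 ≠ 0)
    (h0 : Vc α β γ δ ε X' W' ≠ 0)
    (h : cr (Vc α β γ δ ε X W) (Vc α β γ δ ε X' W') = 0) : X = X' := by
  obtain ⟨k, hk⟩ := exists_smul h0 h
  simp only [Vc, Prod.ext_iff, Prod.smul_fst, Prod.smul_snd, smul_eq_mul] at hk
  obtain ⟨h1, h2, h3⟩ := hk
  have k1 : (γ * β ^ 2 - δ * α * β + ε * α ^ 2) * (1 - k) = 0 := by linear_combination γ * h1 + δ * h2 + ε * h3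
  have hk1 := (mul_eq_zero.1 k1).resolve_left hD
  have hk2 : k = 1 := by linarith
  subst hk2
  have : (γ * β ^ 2 - δ * α * β + ε * α ^ 2) * (X - X') = 0 := by linear_combination -α * h1 - β * h2
  have := (mul_eq_zero.1 this).resolve_left hD
  linarith

lemma Vc_det (α β γ δ ε X W X' W' X'' W'' : ℝ) :
    det3 (Vc α β γ δ ε X W) (Vc α β γ δ ε X' W') (Vc α β γ δ ε X'' W'') =
    (γ * β ^ 2 - δ * α * β + ε * α ^ 2) ^ 2 * ((X' - X) * (W'' - W) - (X'' - X) * (W' - W)) := by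
  simp only [det3, dot, cr, Vc]; ring

/-- collinearity implies the chord relation -/
lemma Vc_cl {α β γ δ ε X W k0 k1 t s x x' : ℝ} (hD : γ * β ^ 2 - δ * α * β + ε * α ^ 2 ≠ 0) (hts : t ≠ s)
    (ht : (α + β * t) + x * (γ + δ * t + ε * t ^ 2) = 0) (hs : (α + β * s) + x' * (γ + δ * s + ε * s ^ 2) = 0)
    (hp : k0 + k1 * X - W = 0) (hq : k0 + k1 * x - t * x = 0) (hq' : k0 + k1 * x' - s * x' = 0) :
    cl (Vc α β γ δ ε X W) t s := by
  set e0 := k0 * γ - k1 * α with he0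
  set e1 := k0 * δ - k1 * β + α with he1
  set e2 := k0 * ε + β with he2
  have r1 : e0 + e1 * t + e2 * t ^ 2 = 0 := by
    rw [he0, he1, he2]; linear_combination (γ + δ * t + ε * t ^ 2) * hq + (t - k1) * ht
  have r2 : e0 + e1 * s + e2 * s ^ 2 = 0 := by
    rw [he0, he1, he2]; linear_combination (γ + δ * s + ε * s ^ 2) * hq' + (s - k1) * hs
  have f1 : e1 = - e2 * (t + s) := by
    have : (t - s) * (e1 + e2 * (t + s)) = 0 := by linear_combination r1 - r2
    have := (mul_eq_zero.1 this).resolve_left (sub_ne_zero.2 hts)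
    linarith
  have f0 : e0 = e2 * (t * s) := by rw [f1] at r1; linear_combination r1
  have hdot : e0 * (Vc α β γ δ ε X W).1 + e1 * (Vc α β γ δ ε X W).2.1 + e2 * (Vc α β γ δ ε X W).2.2 = 0 := by
    rw [he0, he1, he2]; simp only [Vc]
    linear_combination (γ * β ^ 2 - δ * α * β + ε * α ^ 2) * hp
  have hne : e2 ≠ 0 := by
    intro h0
    rw [h0] at f1 f0
    have f1' : k0 * δ - k1 * β + α = 0 := by rw [← he1, f1]; ring
    have f0' : k0 * γ - k1 * α = 0 := by rw [← he0, f0]; ring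
    have f2' : k0 * ε + β = 0 := by rw [← he2, h0]
    apply hD
    linear_combination (-(ε * β)) * f0' + (ε * α) * f1' - (δ * α - γ * β) * f2'
  rw [cl_iff]
  rw [f0, f1] at hdot
  have : e2 * ((Vc α β γ δ ε X W).1 * (t * s) - (Vc α β γ δ ε X W).2.1 * (t + s) + (Vc α β γ δ ε X W).2.2) = 0 := by
    linear_combination hdot
  exact (mul_eq_zero.1 this).resolve_left hne

end
end WS

namespace WS
noncomputable section
open scoped Classical
open MvPolynomial Finset

/-- increasing enumeration of a finite set of reals -/
def enu (S : Finset ℝ) (i : ℕ) : ℝ := if h : i < S.card then S.orderEmbOfFin rfl ⟨i, h⟩ else 0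
lemma enu_lt (S : Finset ℝ) (i j : ℕ) (hij : i < j) (hj : j < S.card) : enu S i < enu S j := by
  rw [enu, dif_pos (by omega), enu, dif_pos hj]
  exact (S.orderEmbOfFin rfl).lt_iff_lt.2 (by simpa using hij)
lemma enu_mem (S : Finset ℝ) (i : ℕ) (hi : i < S.card) : enu S i ∈ S := by
  rw [enu, dif_pos hi]; exact orderEmbOfFin_mem _ _ _
lemma enu_surj (S : Finset ℝ) (x : ℝ) (hx : x ∈ S) : ∃ i < S.card, enu S i = x := by
  have : x ∈ Set.range (S.orderEmbOfFin rfl) := by rw [range_orderEmbOfFin]; exact hx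
  obtain ⟨i, hi⟩ := this
  exact ⟨i.1, i.2, by rw [enu, dif_pos i.2]; exact hi⟩

theorem caseB {A : Finset ℝ} {b : ℝ → ℝ} {f : Po} (hf : Irreducible f) (hd : f.totalDegree = 2)
    (hbig : 10 ^ 9 * ((∑ a ∈ A, bd A b a) + A.card) ≤ (ZF A b f).card * (ZF A b f).card) :
    ∃ g : Po, g ≠ 0 ∧ g.totalDegree ≤ 3 ∧ (A.filter (fun q => ¬ Van b g q)).card * (ZF A b f).card ≤
      4000 * ((∑ a ∈ A, bd A b a) + A.card) := by
  set T := ∑ a ∈ A, bd A b a with hT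
  set σ := ZF A b f with hσ
  have hσA : σ ⊆ A := filter_subset _ _
  have hσn : σ.card ≤ A.card := card_le_card hσA
  by_cases hσ0 : σ.card = 0
  · exact ⟨f, hf.ne_zero, by omega, by rw [hσ0]; omega⟩
  have hσ4 : 10 ^ 4 ≤ σ.card := by
    by_contra hc
    push Not at hc
    have : σ.card * σ.card < 10 ^ 8 := by nlinarith
    omega
  obtain ⟨q0, hq0⟩ := card_pos.1 (Nat.pos_of_ne_zero hσ0)
  have v0 : Van b f q0 := (mem_ZF.1 hq0).2
  -- expansion
  obtain ⟨c0, c1, c2, c3, c4, c5, hexp⟩ := quad_expand f hd.le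
  obtain ⟨α, β, γ, δ, ε, he⟩ : ∃ α β γ δ ε : ℝ, ∀ v : Fin 2 → ℝ, eval v f = α * (v 0 - q0) + β * (v 1 - b q0) + γ * (v 0 - q0) ^ 2 + δ * ((v 0 - q0) * (v 1 - b q0)) + ε * (v 1 - b q0) ^ 2 := by
    refine ⟨c1 + 2 * c3 * q0 + c4 * b q0, c2 + c4 * q0 + 2 * c5 * b q0, c3, c4, c5, fun v => ?_⟩
    have h0 := hexp (pt b q0)
    rw [show eval (pt b q0) f = 0 from v0] at h0
    simp [pt] at h0
    rw [hexp v]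
    linear_combination -h0
  have hD := conic_nondeg hf hd hq0 (by rw [← hσ]; omega) he
  have hev : ∀ q, eval (pt b q) f = α * (q - q0) + β * (b q - b q0) + γ * (q - q0) ^ 2 + δ * ((q - q0) * (b q - b q0)) + ε * (b q - b q0) ^ 2 := by
    intro q; rw [he]; simp [pt]
  let V : ℝ → V3 := fun p => Vc α β γ δ ε (p - q0) (b p - b q0)
  set Q := A \ σ with hQ
  have hQv : ∀ p ∈ Q, p ∈ A ∧ ¬ Van b f p := by
    intro p hp
    obtain ⟨h1, h2⟩ := mem_sdiff.1 hp
    exact ⟨h1, fun h => h2 (mem_ZF.2 ⟨h1, h⟩)⟩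
  set σ' := σ.erase q0 with hσ'
  have mem' : ∀ q, q ∈ σ' → q ≠ q0 ∧ q ∈ A ∧ Van b f q := by
    intro q hq
    rw [hσ', mem_erase, hσ, mem_ZF] at hq; exact hq
  have slinj : Set.InjOn (slp b q0) σ' := by
    intro q hq q' hq' hs
    by_contra hne
    obtain ⟨n1, -, w1⟩ := mem' q hq
    obtain ⟨n2, -, w2⟩ := mem' q' hq'
    exact line3 (b := b) hf hd (x := slp b q0 q) (y := fl b q0 (slp b q0 q)) n1.symm n2.symm hne v0 w1 w2 rfl
      ((fl_eq_iff b n1 _).2 rfl) ((fl_eq_iff b n2 _).2 hs)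
  set S := σ'.image (slp b q0) with hS
  have hSc : S.card = σ.card - 1 := by rw [hS, card_image_of_injOn slinj, hσ', card_erase_of_mem hq0]
  set a := S.card with ha
  set t := enu S with ht
  have hlift : ∀ i, ∃ q, i < a → q ∈ σ' ∧ slp b q0 q = t i := by
    intro i
    by_cases hi : i < a
    · obtain ⟨q, h1, h2⟩ := mem_image.1 (enu_mem S i hi)
      exact ⟨q, fun _ => ⟨h1, h2⟩⟩
    · exact ⟨0, fun h => absurd h hi⟩
  choose qq hqq using hlift
  have hidx : ∀ q ∈ σ', ∃ i < a, t i = slp b q0 q := fun q hq => enu_surj S _ (mem_image.2 ⟨q, hq, rfl⟩)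
  have tlt' : ∀ i j, i < j → j < a → t i < t j := enu_lt S
  -- the parametrization equation
  have par_eq : ∀ q ∈ σ', (α + β * slp b q0 q) + (q - q0) * (γ + δ * slp b q0 q + ε * slp b q0 q ^ 2) = 0 := by
    intro q hq
    obtain ⟨n1, -, w1⟩ := mem' q hq
    have hx : q - q0 ≠ 0 := sub_ne_zero.2 n1
    have h1 := hev q
    rw [show eval (pt b q) f = 0 from w1] at h1
    have h2 : b q - b q0 = slp b q0 q * (q - q0) := by rw [slp]; field_simp
    rw [h2] at h1
    have : (q - q0) * ((α + β * slp b q0 q) + (q - q0) * (γ + δ * slp b q0 q + ε * slp b q0 q ^ 2)) = 0 := by linear_combination -h1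
    exact (mul_eq_zero.1 this).resolve_left hx
  have key_cl : ∀ p q q' x y, q ∈ σ' → q' ∈ σ' → q ≠ q' → fl b p x = y → fl b q x = y → fl b q' x = y →
      cl (V p) (slp b q0 q) (slp b q0 q') := by
    intro p q q' x y hq hq' hne l1 l2 l3
    have n1 := (mem' q hq).1
    have n2 := (mem' q' hq').1
    have h2 : slp b q0 q * (q - q0) = b q - b q0 := by
      have hx : q - q0 ≠ 0 := sub_ne_zero.2 n1
      rw [slp]; field_simp
    have h3 : slp b q0 q' * (q' - q0) = b q' - b q0 := by
      have hx : q' - q0 ≠ 0 := sub_ne_zero.2 n2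
      rw [slp]; field_simp
    simp only [fl] at l1 l2 l3
    refine Vc_cl (k0 := x * q0 - b q0 - y) (k1 := x) (x := q - q0) (x' := q' - q0) hD (fun h => hne (slinj hq hq' h)) (par_eq q hq) (par_eq q' hq') ?_ ?_ ?_
    · linarith
    · rw [h2]; linarith
    · rw [h3]; linarith
  have hDl : ∀ p ∈ Q, Dl (V p) ≠ 0 := by
    intro p hp
    change Dl (Vc _ _ _ _ _ _ _) ≠ 0
    rw [Vc_Dl, ← hev p]
    exact mul_ne_zero hD (hQv p hp).2
  have cfg : Cfg a t Q V := by
    refine ⟨tlt', hDl, ?_⟩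
    intro p hp q hq h
    have h0 : V q ≠ 0 := by
      intro h0; apply hDl q hq; rw [h0]; simp [Dl]
    have := Vc_inj hD h0 h
    linarith
  have hE1 : ((range a ×ˢ range a).filter (fun x => x.1 ≠ x.2 ∧ ¬ ∃ p ∈ Q, cl (V p) (t x.1) (t x.2))).card ≤ 2 * T := by
    set E := (σ ×ˢ σ).filter (fun x => x.2 ≠ x.1 ∧ slp b x.1 x.2 ∈ badS A b x.1) with hE
    have hle : ((range a ×ˢ range a).filter (fun x => x.1 ≠ x.2 ∧ ¬ ∃ p ∈ Q, cl (V p) (t x.1) (t x.2))).card ≤ E.card := by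
      refine card_le_card_of_injOn (fun x => (qq x.1, qq x.2)) ?_ ?_
      · intro x hx
        obtain ⟨hxm, hne, hno⟩ := mem_filter.1 (mem_coe.1 hx)
        obtain ⟨hi, hj⟩ := mem_product.1 hxm
        rw [mem_range] at hi hj
        obtain ⟨m1, s1⟩ := hqq x.1 hi
        obtain ⟨m2, s2⟩ := hqq x.2 hj
        have hnq : qq x.2 ≠ qq x.1 := by
          intro h; rw [h, s1] at s2
          exact hne (tinj tlt' hi hj s2)
        refine mem_coe.2 (mem_filter.2 ⟨mem_product.2 ⟨(mem_erase.1 m1).2, (mem_erase.1 m2).2⟩, hnq, ?_⟩)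
        by_contra hnb
        obtain ⟨q', hq'⟩ := tri_of_not_bad (mem' _ m2).2.1 hnq hnb
        obtain ⟨-, -, k3, k4, k5, k6, X, Y, hXY⟩ := hq'
        have l1 := (hXY (qq x.1) (mem' _ m1).2.1).2 (Or.inl rfl)
        have l2 := (hXY (qq x.2) (mem' _ m2).2.1).2 (Or.inr (Or.inl rfl))
        have l3 := (hXY q' k3).2 (Or.inr (Or.inr rfl))
        refine hno ⟨q', mem_sdiff.2 ⟨k3, fun h => ?_⟩, ?_⟩
        · exact line3 (b := b) hf hd k4 k5 k6 (mem' _ m1).2.2 (mem' _ m2).2.2 (mem_ZF.1 h).2 l1 l2 l3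
        · rw [← s1, ← s2]
          exact key_cl q' _ _ X Y m1 m2 hnq.symm l3 l1 l2
      · intro x hx y hy hxy
        obtain ⟨hi, hj⟩ := mem_product.1 (mem_filter.1 (mem_coe.1 hx)).1
        obtain ⟨hi', hj'⟩ := mem_product.1 (mem_filter.1 (mem_coe.1 hy)).1
        rw [mem_range] at hi hj hi' hj'
        simp only [Prod.mk.injEq] at hxy
        refine Prod.ext (tinj tlt' hi hi' ?_) (tinj tlt' hj hj' ?_)
        · rw [← (hqq _ hi).2, ← (hqq _ hi').2, hxy.1]
        · rw [← (hqq _ hj).2, ← (hqq _ hj').2, hxy.2]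
    refine hle.trans ?_
    have hsub : E ⊆ σ.biUnion (fun q => ((badS A b q).biUnion (fun x => σ.filter (fun q' => slp b q q' = x))).image (fun q' => (q, q'))) := by
      rintro ⟨q, q'⟩ h
      obtain ⟨h1, h2, h3⟩ := mem_filter.1 h
      obtain ⟨h4, h5⟩ := mem_product.1 h1
      exact mem_biUnion.2 ⟨q, h4, mem_image.2 ⟨q', mem_biUnion.2 ⟨_, h3, mem_filter.2 ⟨h5, rfl⟩⟩, rfl⟩⟩
    refine (card_le_card hsub).trans (card_biUnion_le.trans ?_)
    calc _ ≤ ∑ q ∈ σ, 2 * bd A b q := by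
          refine sum_le_sum (fun q _ => card_image_le.trans (card_biUnion_le.trans ?_))
          refine (sum_le_card_nsmul _ _ 2 (fun x _ => ?_)).trans ?_
          · exact slope_count hf (by omega) hd.le q x _ (fun q' hq' => ⟨(mem_ZF.1 (mem_filter.1 hq').1).2, (mem_filter.1 hq').2⟩)
          · rw [smul_eq_mul, mul_comm]; rfl
      _ = 2 * ∑ q ∈ σ, bd A b q := by rw [mul_sum]
      _ ≤ 2 * T := Nat.mul_le_mul_left _ (sum_le_sum_of_subset hσA)
  have hE2 : ∑ p ∈ Q, (NBs a t (V p)).card ≤ 10 * T + 9 * A.card := by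
    have hpt : ∀ p ∈ Q, (NBs a t (V p)).card ≤ 10 * bd A b p + 9 := by
      intro p hp
      obtain ⟨hpA, hpf⟩ := hQv p hp
      have hB := caseB_pt (b := b) hf hd hpA hpf
      set U := (ZF A b f).filter (fun q => ¬ ∃ q', q' ∈ ZF A b f ∧ Tri A b p q q') with hU
      set U0 := σ'.filter (fun q => ∃ x, fl b q x = fl b q0 x ∧ fl b p x = fl b q0 x) with hU0
      have hU0c : U0.card ≤ 1 := by
        rw [card_le_one]
        intro q hq q' hq'
        obtain ⟨m1, x, e1, e2⟩ := mem_filter.1 hq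
        obtain ⟨m2, y, e3, e4⟩ := mem_filter.1 hq'
        have hp0 : p ≠ q0 := by rintro rfl; exact hpf v0
        rw [fl_eq_iff b hp0] at e2 e4
        rw [fl_eq_iff b (mem' _ m1).1] at e1
        rw [fl_eq_iff b (mem' _ m2).1] at e3
        exact slinj m1 m2 (by rw [← e1, ← e3, e2, e4])
      have hle : (NBs a t (V p)).card ≤ (U ∪ U0).card := by
        refine card_le_card_of_injOn qq ?_ ?_
        · intro i hi
          obtain ⟨hia, hno⟩ := mem_filter.1 (mem_coe.1 hi)
          rw [mem_range] at hia
          obtain ⟨m1, s1⟩ := hqq i hia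
          refine mem_coe.2 (mem_union.2 ?_)
          by_contra hcon
          rw [not_or] at hcon
          have hex : ∃ q', q' ∈ ZF A b f ∧ Tri A b p (qq i) q' := by
            by_contra hh
            exact hcon.1 (mem_filter.2 ⟨(mem_erase.1 m1).2, hh⟩)
          obtain ⟨q', hq', hTri⟩ := hex
          obtain ⟨-, -, k3, k4, k5, k6, X, Y, hXY⟩ := hTri
          have l1 := (hXY p hpA).2 (Or.inl rfl)
          have l2 := (hXY (qq i) (mem' _ m1).2.1).2 (Or.inr (Or.inl rfl))
          have l3 := (hXY q' k3).2 (Or.inr (Or.inr rfl))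
          by_cases h0 : q' = q0
          · subst h0
            exact hcon.2 (mem_filter.2 ⟨m1, X, by rw [l2, l3], by rw [l1, l3]⟩)
          · have m2 : q' ∈ σ' := mem_erase.2 ⟨h0, hq'⟩
            obtain ⟨j, hj, hjs⟩ := hidx q' m2
            refine hno ⟨j, hj, ?_⟩
            rw [← s1, hjs]
            exact key_cl p _ _ X Y m1 m2 k6 l1 l2 l3
        · intro i hi j hj hij
          have hia := mem_range.1 (mem_filter.1 (mem_coe.1 hi)).1
          have hja := mem_range.1 (mem_filter.1 (mem_coe.1 hj)).1
          refine tinj tlt' hia hja ?_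
          rw [← (hqq _ hia).2, ← (hqq _ hja).2, hij]
      have := card_union_le U U0
      omega
    calc _ ≤ ∑ p ∈ Q, (10 * bd A b p + 9) := sum_le_sum hpt
      _ ≤ ∑ p ∈ A, (10 * bd A b p + 9) := sum_le_sum_of_subset sdiff_subset
      _ = _ := by rw [sum_add_distrib, mul_sum, sum_const, smul_eq_mul, mul_comm A.card]
  have ha1 : a + 1 = σ.card := by omega
  have hbig' : 10 ^ 7 * (2 * T + (10 * T + 9 * A.card) + A.card + a) ≤ a * a := by
    have h1 : σ.card * σ.card ≤ 2 * (a * a) := by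
      rw [← ha1]; nlinarith
    nlinarith
  obtain ⟨p1, hp1, p2, hp2, hne, hfin⟩ := cfg.main (card_le_card sdiff_subset) hE1 hE2 (by omega) hbig'
  refine ⟨f * lnp b p1 (slp b p1 p2), mul_ne_zero hf.ne_zero (lin_ne_zero _ _), ?_, ?_⟩
  · refine (totalDegree_mul _ _).trans ?_
    rw [hd, lnp, lin_deg]
  · have hsub : A.filter (fun q => ¬ Van b (f * lnp b p1 (slp b p1 p2)) q) ⊆ Q.filter (fun p => dot (cr (V p1) (V p2)) (V p) ≠ 0) := by
      intro q hq
      obtain ⟨hqA, hqv⟩ := mem_filter.1 hq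
      have hq1 : ¬ Van b f q ∧ ¬ Van b (lnp b p1 (slp b p1 p2)) q := by
        rw [Van, eval_mul, mul_eq_zero, not_or] at hqv; exact hqv
      refine mem_filter.2 ⟨mem_sdiff.2 ⟨hqA, fun h => hq1.1 (mem_ZF.1 h).2⟩, fun h => hq1.2 ?_⟩
      rw [van_lnp]
      by_cases hqp : q = p1
      · exact Or.inl hqp
      right
      have h' : det3 (V p1) (V p2) (V q) = 0 := h
      change det3 (Vc _ _ _ _ _ _ _) (Vc _ _ _ _ _ _ _) (Vc _ _ _ _ _ _ _) = 0 at h'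
      rw [Vc_det] at h'
      have h2 := (mul_eq_zero.1 h').resolve_left (pow_ne_zero 2 hD)
      have n1 : q - p1 ≠ 0 := sub_ne_zero.2 hqp
      have n2 : p2 - p1 ≠ 0 := sub_ne_zero.2 hne.symm
      rw [slp, slp, div_eq_div_iff n1 n2]
      linear_combination h2
    have h3 := card_le_card hsub
    have h4 : (A.filter (fun q => ¬ Van b (f * lnp b p1 (slp b p1 p2)) q)).card * a ≤ 100 * (10 * T + 9 * A.card) + a :=
      (Nat.mul_le_mul_right _ h3).trans hfin
    have h5 : σ.card ≤ 2 * a := by omega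
    nlinarith

end
end WS

namespace WS
noncomputable section
open scoped Classical
open Finset

theorem dcount {α β : Type*} [DecidableEq α] (S : Finset α) (N : Finset β) (g : β → α) (c : ℕ)
    (h : ∀ a ∈ S, c ≤ (N.filter (fun b => g b = a)).card) : S.card * c ≤ N.card := by
  calc S.card * c = ∑ a ∈ S, c := by rw [sum_const, smul_eq_mul]
    _ ≤ ∑ a ∈ S, (N.filter (fun b => g b = a)).card := sum_le_sum h
    _ = (N.filter (fun b => g b ∈ S)).card := sum_card_fiberwise_eq_card_filter _ _ _
    _ ≤ N.card := card_filter_le _ _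

theorem cover3 {α : Type*} (I : Finset α) (e1 e2 e3 : α → Prop) [DecidablePred e1] [DecidablePred e2] [DecidablePred e3] (c1 c2 c3 : ℕ)
    (h : ∀ m ∈ I, e1 m ∨ e2 m ∨ e3 m) (h1 : (I.filter e1).card ≤ c1) (h2 : (I.filter e2).card ≤ c2)
    (h3 : (I.filter e3).card ≤ c3) : I.card ≤ c1 + c2 + c3 := by
  have hs : I ⊆ (I.filter e1 ∪ I.filter e2) ∪ I.filter e3 := by
    intro m hm
    rcases h m hm with h | h | h
    · exact mem_union_left _ (mem_union_left _ (mem_filter.2 ⟨hm, h⟩))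
    · exact mem_union_left _ (mem_union_right _ (mem_filter.2 ⟨hm, h⟩))
    · exact mem_union_right _ (mem_filter.2 ⟨hm, h⟩)
  have w1 := card_le_card hs
  have w2 := card_union_le (I.filter e1 ∪ I.filter e2) (I.filter e3)
  have w3 := card_union_le (I.filter e1) (I.filter e2)
  omega

/-- Inject a filtered index set into a finset. -/
theorem inj_le {α β : Type*} (I : Finset α) (e : α → Prop) [DecidablePred e] (φ : α → β) (N : Finset β)
    (hm : ∀ m ∈ I, e m → φ m ∈ N) (hi : ∀ m ∈ I, ∀ m' ∈ I, φ m = φ m' → m = m') :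
    (I.filter e).card ≤ N.card := by
  refine card_le_card_of_injOn φ ?_ ?_
  · intro m h
    obtain ⟨h1, h2⟩ := mem_filter.1 (mem_coe.1 h)
    exact mem_coe.2 (hm m h1 h2)
  · intro m h m' h' e
    exact hi m (mem_filter.1 (mem_coe.1 h)).1 m' (mem_filter.1 (mem_coe.1 h')).1 e

theorem le_of_mul {c h w B : ℕ} (hw : 0 < w) (h1 : c * w ≤ B) (h2 : B ≤ h * w) : c ≤ h :=
  Nat.le_of_mul_le_mul_right (h1.trans h2) hw

/-- The window-propagation lemma. -/
theorem win (x v : ℕ → Prop) (W1 : ℕ → Prop) (W2 : ℤ → Prop) (N1 N2 : Finset (ℕ × ℕ)) (w B h M : ℕ)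
    (hw : 4 * h < w) (hB : 4 * B ≤ h * w) (hN1 : N1.card ≤ B) (hN2 : N2.card ≤ B)
    (Hx0 : ∀ i, 1 ≤ i → i < 8 * w → x i)
    (H1 : ∀ k j : ℕ, 1 ≤ k → 1 ≤ j → j < 8 * w → v k → (k, j) ∉ N2 → (k + j, j) ∉ N1 → ¬ W2 ((k:ℤ) - j) → x (k + j))
    (H1' : ∀ k j : ℕ, 1 ≤ k → 1 ≤ j → j < 8 * w → W2 ((k:ℤ) - j) → v k → x (k + j) → (k, j) ∈ N2)
    (H2 : ∀ k j, 1 ≤ k → 1 ≤ j → j < 8 * w → x (k + j) → (k + j, j) ∉ N1 → (k, j) ∉ N2 → ¬ W1 (k + 2 * j) → v k)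
    (H2' : ∀ k j, 1 ≤ k → 1 ≤ j → j < 8 * w → W1 (k + 2 * j) → x (k + j) → v k → (k + j, j) ∈ N1)
    (H3 : ∀ l, 2 ≤ l → l < 8 * w → ¬ W1 l)
    (hfin : ∀ i, x i → i < M) : False := by
  set HX : ℕ → Finset ℕ := fun N => (range N).filter (fun i => 1 ≤ i ∧ ¬ x i) with hHX
  set HV : ℕ → Finset ℕ := fun N => (range N).filter (fun k => 1 ≤ k ∧ k + 2 * w ≤ N ∧ ¬ v k) with hHV
  have mX : ∀ N i, i ∈ HX N ↔ i < N ∧ 1 ≤ i ∧ ¬ x i := by intro N i; simp [hHX]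
  have mV : ∀ N k, k ∈ HV N ↔ k < N ∧ 1 ≤ k ∧ k + 2 * w ≤ N ∧ ¬ v k := by intro N k; simp [hHV]
  have hw0 : 0 < w := by omega
  have stepV : ∀ N, (HX N).card ≤ h → (HV (N-1)).card ≤ h → (HV N).card ≤ h := by
    intro N hX hV
    -- few W1
    set Λ := (range (4 * N + 4 * w)).filter (fun l => ∃ k j, l = k + 2 * j ∧ 1 ≤ k ∧ k + 2 * w ≤ N ∧ 1 ≤ j ∧ j ≤ w ∧ W1 l) with hΛ
    have hΛc : Λ.card ≤ h := by
      have key : Λ.card * (w - 2 * h) ≤ N1.card := by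
        refine dcount Λ N1 (fun y => y.1 + y.2) _ ?_
        intro l hl
        obtain ⟨-, k, j, rfl, hk, hkN, hj, hjw, hW⟩ := mem_filter.1 hl
        have hl8 : 8 * w ≤ k + 2 * j := by
          by_contra hc
          exact H3 _ (by omega) (by omega) hW
        have := cover3 (Icc 1 w) (fun m => ¬ x (k + j - m)) (fun m => ¬ v (k - 2 * m)) (fun m => (k + j - m, j + m) ∈ N1) h h
          ((N1.filter (fun y => y.1 + y.2 = k + 2 * j)).card) ?_ ?_ ?_ ?_
        · rw [Nat.card_Icc] at this; omega
        · intro m hm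
          obtain ⟨m1, m2⟩ := mem_Icc.1 hm
          by_contra hc
          simp only [not_or, not_not] at hc
          have h1 := H2' (k - 2 * m) (j + m) (by omega) (by omega) (by omega)
            (by rw [show k - 2 * m + 2 * (j + m) = k + 2 * j by omega]; exact hW)
            (by rw [show k - 2 * m + (j + m) = k + j - m by omega]; exact hc.1) hc.2.1
          rw [show k - 2 * m + (j + m) = k + j - m by omega] at h1
          exact hc.2.2 h1
        · refine le_trans (inj_le _ _ (fun m => k + j - m) (HX N) ?_ ?_) hX
          · intro m hm he
            obtain ⟨m1, m2⟩ := mem_Icc.1 hm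
            exact (mX _ _).2 ⟨by omega, by omega, he⟩
          · intro m hm m' hm' he
            obtain ⟨m1, m2⟩ := mem_Icc.1 hm
            obtain ⟨m1, m2⟩ := mem_Icc.1 hm'
            omega
        · refine le_trans (inj_le _ _ (fun m => k - 2 * m) (HV (N-1)) ?_ ?_) hV
          · intro m hm he
            obtain ⟨m1, m2⟩ := mem_Icc.1 hm
            exact (mV _ _).2 ⟨by omega, by omega, by omega, he⟩
          · intro m hm m' hm' he
            obtain ⟨m1, m2⟩ := mem_Icc.1 hm
            obtain ⟨m1, m2⟩ := mem_Icc.1 hm'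
            omega
        · refine inj_le _ _ (fun m => (k + j - m, j + m)) _ ?_ ?_
          · intro m hm he
            obtain ⟨m1, m2⟩ := mem_Icc.1 hm
            exact mem_filter.2 ⟨he, by simp only; omega⟩
          · intro m hm m' hm' he
            simp only [Prod.mk.injEq] at he; omega
      refine le_of_mul (w := w) (B := 4 * B) hw0 ?_ hB
      have : Λ.card * w ≤ Λ.card * (2 * (w - 2 * h)) := Nat.mul_le_mul_left _ (by omega)
      nlinarith
    have key : (HV N).card * (w - 2 * h) ≤ (N1.image (fun y => (y.1 - y.2, y.2)) ∪ N2).card := by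
      refine dcount _ _ (fun y => y.1) _ ?_
      intro k hk
      obtain ⟨hk1, hk2, hk3, hk4⟩ := (mV _ _).1 hk
      have := cover3 (Icc 1 w) (fun j => ¬ x (k + j)) (fun j => W1 (k + 2 * j)) (fun j => (k + j, j) ∈ N1 ∨ (k, j) ∈ N2) h h
          (((N1.image (fun y => (y.1 - y.2, y.2)) ∪ N2).filter (fun y => y.1 = k)).card) ?_ ?_ ?_ ?_
      · rw [Nat.card_Icc] at this; omega
      · intro j hj
        obtain ⟨j1, j2⟩ := mem_Icc.1 hj
        by_contra hc
        simp only [not_or, not_not] at hc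
        exact hk4 (H2 k j hk2 j1 (by omega) hc.1 hc.2.2.1 hc.2.2.2 hc.2.1)
      · refine le_trans (inj_le _ _ (fun j => k + j) (HX N) ?_ ?_) hX
        · intro j hj he
          obtain ⟨j1, j2⟩ := mem_Icc.1 hj
          exact (mX _ _).2 ⟨by omega, by omega, he⟩
        · intro m hm m' hm' he
          omega
      · refine le_trans (inj_le _ _ (fun j => k + 2 * j) Λ ?_ ?_) hΛc
        · intro j hj he
          obtain ⟨j1, j2⟩ := mem_Icc.1 hj
          exact mem_filter.2 ⟨mem_range.2 (by omega), k, j, rfl, hk2, hk3, j1, j2, he⟩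
        · intro m hm m' hm' he
          omega
      · refine inj_le _ _ (fun j => (k, j)) _ ?_ ?_
        · intro j hj he
          refine mem_filter.2 ⟨?_, rfl⟩
          rcases he with he | he
          · exact mem_union_left _ (mem_image.2 ⟨_, he, by simp⟩)
          · exact mem_union_right _ he
        · intro m hm m' hm' he
          simp only [Prod.mk.injEq] at he; exact he.2
    have u1 := card_union_le (N1.image (fun y => (y.1 - y.2, y.2))) N2
    have u2 : (N1.image (fun y => (y.1 - y.2, y.2))).card ≤ N1.card := card_image_le
    refine le_of_mul (w := w) (B := 4 * B) hw0 ?_ hB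
    have : (HV N).card * w ≤ (HV N).card * (2 * (w - 2 * h)) := Nat.mul_le_mul_left _ (by omega)
    nlinarith
  have stepX : ∀ N, (HX N).card ≤ h → (HV N).card ≤ h → (HX (N+1)).card ≤ h := by
    intro N hX hV
    have hge : ∀ i ∈ HX (N+1), 8 * w ≤ i := by
      intro i hi
      obtain ⟨i1, i2, i3⟩ := (mX _ _).1 hi
      by_contra hc
      exact i3 (Hx0 i i2 (by omega))
    set Λ := (Icc (-(8 * w + N : ℤ)) (8 * w + N)).filter (fun l => ∃ i j : ℕ, l = (i:ℤ) - 2 * j ∧ 8 * w ≤ i ∧ i ≤ N ∧ 2 * w ≤ j ∧ j < 4 * w ∧ W2 l) with hΛ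
    have hΛc : Λ.card ≤ h := by
      have key : Λ.card * (w - 2 * h) ≤ N2.card := by
        refine dcount Λ N2 (fun y => (y.1:ℤ) - y.2) _ ?_
        intro l hl
        obtain ⟨-, i, j, rfl, hi, hiN, hj, hjw, hW⟩ := mem_filter.1 hl
        have := cover3 (Icc 1 w) (fun m => ¬ x (i - 2 * m)) (fun m => ¬ v (i - j - m)) (fun m => (i - j - m, j - m) ∈ N2) h h
          ((N2.filter (fun y => (y.1:ℤ) - y.2 = (i:ℤ) - 2 * j)).card) ?_ ?_ ?_ ?_
        · rw [Nat.card_Icc] at this; omega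
        · intro m hm
          obtain ⟨m1, m2⟩ := mem_Icc.1 hm
          by_contra hc
          simp only [not_or, not_not] at hc
          refine hc.2.2 (H1' (i - j - m) (j - m) (by omega) (by omega) (by omega) ?_ hc.2.1 ?_)
          · rw [show (((i - j - m : ℕ) : ℤ) - ((j - m : ℕ) : ℤ)) = (i:ℤ) - 2 * j by omega]; exact hW
          · rw [show i - j - m + (j - m) = i - 2 * m by omega]; exact hc.1
        · refine le_trans (inj_le _ _ (fun m => i - 2 * m) (HX N) ?_ ?_) hX
          · intro m hm he
            obtain ⟨m1, m2⟩ := mem_Icc.1 hm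
            exact (mX _ _).2 ⟨by omega, by omega, he⟩
          · intro m hm m' hm' he
            obtain ⟨m1, m2⟩ := mem_Icc.1 hm
            obtain ⟨m1, m2⟩ := mem_Icc.1 hm'
            omega
        · refine le_trans (inj_le _ _ (fun m => i - j - m) (HV N) ?_ ?_) hV
          · intro m hm he
            obtain ⟨m1, m2⟩ := mem_Icc.1 hm
            exact (mV _ _).2 ⟨by omega, by omega, by omega, he⟩
          · intro m hm m' hm' he
            obtain ⟨m1, m2⟩ := mem_Icc.1 hm
            obtain ⟨m1, m2⟩ := mem_Icc.1 hm'
            omega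
        · refine inj_le _ _ (fun m => (i - j - m, j - m)) _ ?_ ?_
          · intro m hm he
            obtain ⟨m1, m2⟩ := mem_Icc.1 hm
            exact mem_filter.2 ⟨he, by simp only; omega⟩
          · intro m hm m' hm' he
            obtain ⟨m1, m2⟩ := mem_Icc.1 hm
            obtain ⟨m1, m2⟩ := mem_Icc.1 hm'
            simp only [Prod.mk.injEq] at he; omega
      refine le_of_mul (w := w) (B := 4 * B) hw0 ?_ hB
      have : Λ.card * w ≤ Λ.card * (2 * (w - 2 * h)) := Nat.mul_le_mul_left _ (by omega)
      nlinarith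
    have key : (HX (N+1)).card * (w - 2 * h) ≤ (N1 ∪ N2.image (fun y => (y.1 + y.2, y.2))).card := by
      refine dcount _ _ (fun y => y.1) _ ?_
      intro i hi
      obtain ⟨hi1, hi2, hi3⟩ := (mX _ _).1 hi
      have hi8 := hge i hi
      have := cover3 (Ico (2 * w) (4 * w)) (fun j => ¬ v (i - j)) (fun j : ℕ => W2 ((i:ℤ) - 2 * j)) (fun j => (i, j) ∈ N1 ∨ (i - j, j) ∈ N2) h h
          (((N1 ∪ N2.image (fun y => (y.1 + y.2, y.2))).filter (fun y => y.1 = i)).card) ?_ ?_ ?_ ?_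
      · rw [Nat.card_Ico] at this; omega
      · intro j hj
        obtain ⟨j1, j2⟩ := mem_Ico.1 hj
        by_contra hc
        simp only [not_or, not_not] at hc
        have h1 := H1 (i - j) j (by omega) (by omega) (by omega) hc.1 hc.2.2.2
          (by rw [show i - j + j = i by omega]; exact hc.2.2.1)
          (by rw [show (((i - j : ℕ) : ℤ) - (j : ℤ)) = (i:ℤ) - 2 * j by omega]; exact hc.2.1)
        rw [show i - j + j = i by omega] at h1
        exact hi3 h1
      · refine le_trans (inj_le _ _ (fun j => i - j) (HV N) ?_ ?_) hV
        · intro j hj he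
          obtain ⟨j1, j2⟩ := mem_Ico.1 hj
          exact (mV _ _).2 ⟨by omega, by omega, by omega, he⟩
        · intro m hm m' hm' he
          obtain ⟨m1, m2⟩ := mem_Ico.1 hm
          obtain ⟨m1, m2⟩ := mem_Ico.1 hm'
          omega
      · refine le_trans (inj_le _ _ (fun j : ℕ => (i:ℤ) - 2 * j) Λ ?_ ?_) hΛc
        · intro j hj he
          obtain ⟨j1, j2⟩ := mem_Ico.1 hj
          exact mem_filter.2 ⟨mem_Icc.2 ⟨by omega, by omega⟩, i, j, rfl, hi8, by omega, j1, j2, he⟩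
        · intro m hm m' hm' he
          omega
      · refine inj_le _ _ (fun j => (i, j)) _ ?_ ?_
        · intro j hj he
          obtain ⟨j1, j2⟩ := mem_Ico.1 hj
          refine mem_filter.2 ⟨?_, rfl⟩
          rcases he with he | he
          · exact mem_union_left _ he
          · refine mem_union_right _ (mem_image.2 ⟨_, he, ?_⟩)
            simp only [Prod.mk.injEq, and_true]; omega
        · intro m hm m' hm' he
          simp only [Prod.mk.injEq] at he; exact he.2
    have u1 := card_union_le N1 (N2.image (fun y => (y.1 + y.2, y.2)))
    have u2 : (N2.image (fun y => (y.1 + y.2, y.2))).card ≤ N2.card := card_image_le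
    refine le_of_mul (w := w) (B := 4 * B) hw0 ?_ hB
    have : (HX (N+1)).card * w ≤ (HX (N+1)).card * (2 * (w - 2 * h)) := Nat.mul_le_mul_left _ (by omega)
    nlinarith
  have main : ∀ N, (HX N).card ≤ h ∧ (HV N).card ≤ h := by
    intro N
    induction N with
    | zero => simp [hHX, hHV]
    | succ N ih =>
      have h1 := stepX N ih.1 ih.2
      exact ⟨h1, stepV (N+1) h1 ih.2⟩
  have h1 := (main (M + h + 2)).1
  have h2 : (Icc (M+1) (M+h+1)).card ≤ (HX (M+h+2)).card := by
    refine card_le_card ?_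
    intro i hi
    obtain ⟨i1, i2⟩ := mem_Icc.1 hi
    exact (mX _ _).2 ⟨by omega, by omega, fun hx => by have := hfin i hx; omega⟩
  rw [Nat.card_Icc] at h2
  omega

end
end WS

namespace WS
noncomputable section
open scoped Classical
open Finset MvPolynomial

variable {A : Finset ℝ} {b : ℝ → ℝ}

variable (A b) in
/-- the points on the line with equation `(x, y)` -/
def Lp (x y : ℝ) : Finset ℝ := A.filter (fun c => fl b c x = y)

lemma mem_Lp {x y c : ℝ} : c ∈ Lp A b x y ↔ c ∈ A ∧ fl b c x = y := mem_filter

lemma line_two {x y x' y' a c : ℝ} (h : a ≠ c) (h1 : fl b a x = y) (h2 : fl b c x = y) (h3 : fl b a x' = y')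
    (h4 : fl b c x' = y') : x = x' ∧ y = y' := by
  have e1 := (fl_eq_iff b h x).1 (h1.trans h2.symm)
  have e2 := (fl_eq_iff b h x').1 (h3.trans h4.symm)
  have : x = x' := e1.trans e2.symm
  subst this
  exact ⟨rfl, h1.symm.trans h3⟩

lemma line_third {x y z q q' : ℝ} (h : q ≠ q') (hq : q ≠ z) (hq' : q' ≠ z) (h1 : fl b q x = y) (h2 : fl b q' x = y)
    (hs : slp b z q = slp b z q') : fl b z x = y := by
  have e1 := (fl_eq_iff b hq _).2 rfl
  have e2 := (fl_eq_iff b hq' _).2 rfl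
  rw [← hs] at e2
  obtain ⟨rfl, h4⟩ := line_two h h1 h2 e1 e2
  exact h4.symm

lemma Tri.line {u v w x y : ℝ} (h : Tri A b u v w) (h1 : fl b u x = y) (h2 : fl b v x = y) :
    ∀ c ∈ A, fl b c x = y ↔ (c = u ∨ c = v ∨ c = w) := by
  obtain ⟨hu, hv, hw, huv, huw, hvw, x', y', hxy⟩ := h
  obtain ⟨rfl, rfl⟩ := line_two huv h1 h2 ((hxy u hu).2 (Or.inl rfl)) ((hxy v hv).2 (Or.inr (Or.inl rfl)))
  exact hxy

lemma Tri.slp_eq {z u v : ℝ} (h : Tri A b z u v) : slp b z u = slp b z v := by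
  obtain ⟨hz, hu, hv, hzu, hzv, huv, x', y', hxy⟩ := h
  have e0 := (hxy z hz).2 (Or.inl rfl)
  have e1 := (hxy u hu).2 (Or.inr (Or.inl rfl))
  have e2 := (hxy v hv).2 (Or.inr (Or.inr rfl))
  rw [← (fl_eq_iff b hzu.symm _).1 (e1.trans e0.symm), ← (fl_eq_iff b hzv.symm _).1 (e2.trans e0.symm)]

lemma Tri.not_line {u v w x y : ℝ} (h : Tri A b u v w) (hc : 4 ≤ (Lp A b x y).card) :
    ¬ (fl b u x = y ∧ fl b v x = y) := by
  rintro ⟨h1, h2⟩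
  have hs : Lp A b x y ⊆ {u, v, w} := by
    intro c hc
    obtain ⟨h3, h4⟩ := mem_Lp.1 hc
    have := (h.line h1 h2 c h3).1 h4
    simpa using this
  have := card_le_card hs
  have h3 : ({u, v, w} : Finset ℝ).card ≤ 3 := card_le_three
  omega

/-- cyclic neighbours -/
def Nb (S : Finset ℝ) (q q' : ℝ) : Prop := q ∈ S ∧ q' ∈ S ∧ q' ≠ q ∧
  ((∀ s ∈ S, (s - q) * (q' - s) ≤ 0) ∨ (∀ s ∈ S, 0 ≤ (s - q) * (q' - s)))

lemma Nb.symm {S : Finset ℝ} {q q' : ℝ} (h : Nb S q q') : Nb S q' q := by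
  obtain ⟨h1, h2, h3, h4⟩ := h
  refine ⟨h2, h1, h3.symm, ?_⟩
  rcases h4 with h | h
  · left; intro s hs; have := h s hs; linarith
  · right; intro s hs; have := h s hs; linarith

lemma btw_le {q s q' : ℝ} (h : (s - q) * (q' - s) ≤ 0) : ¬ (q < s ∧ s < q') ∧ ¬ (q' < s ∧ s < q) := by
  constructor
  · rintro ⟨h1, h2⟩; nlinarith [mul_pos (sub_pos.2 h1) (sub_pos.2 h2)]
  · rintro ⟨h1, h2⟩; nlinarith [mul_pos (sub_pos.2 h1) (sub_pos.2 h2)]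

lemma btw_ge {q s q' : ℝ} (h : 0 ≤ (s - q) * (q' - s)) : ¬ (q < s ∧ q' < s) ∧ ¬ (s < q ∧ s < q') := by
  constructor
  · rintro ⟨h1, h2⟩; nlinarith [mul_pos (sub_pos.2 h1) (sub_pos.2 h2)]
  · rintro ⟨h1, h2⟩; nlinarith [mul_pos (sub_pos.2 h1) (sub_pos.2 h2)]

lemma nb_unique {S : Finset ℝ} {q a c d : ℝ} (ha : Nb S q a) (hc : Nb S q c) (hd : Nb S q d) (hac : a ≠ c) :
    d = a ∨ d = c := by
  by_contra hcon
  rw [not_or] at hcon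
  obtain ⟨hda, hdc⟩ := hcon
  obtain ⟨-, a1, a2, a3⟩ := ha
  obtain ⟨-, c1, c2, c3⟩ := hc
  obtain ⟨-, d1, d2, d3⟩ := hd
  have A1 : (¬ (q < c ∧ c < a) ∧ ¬ (a < c ∧ c < q)) ∧ (¬ (q < d ∧ d < a) ∧ ¬ (a < d ∧ d < q)) ∨
      (¬ (q < c ∧ a < c) ∧ ¬ (c < q ∧ c < a)) ∧ (¬ (q < d ∧ a < d) ∧ ¬ (d < q ∧ d < a)) := by
    rcases a3 with h | h
    · exact Or.inl ⟨btw_le (h c c1), btw_le (h d d1)⟩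
    · exact Or.inr ⟨btw_ge (h c c1), btw_ge (h d d1)⟩
  have C1 : (¬ (q < a ∧ a < c) ∧ ¬ (c < a ∧ a < q)) ∧ (¬ (q < d ∧ d < c) ∧ ¬ (c < d ∧ d < q)) ∨
      (¬ (q < a ∧ c < a) ∧ ¬ (a < q ∧ a < c)) ∧ (¬ (q < d ∧ c < d) ∧ ¬ (d < q ∧ d < c)) := by
    rcases c3 with h | h
    · exact Or.inl ⟨btw_le (h a a1), btw_le (h d d1)⟩
    · exact Or.inr ⟨btw_ge (h a a1), btw_ge (h d d1)⟩
  have D1 : (¬ (q < a ∧ a < d) ∧ ¬ (d < a ∧ a < q)) ∧ (¬ (q < c ∧ c < d) ∧ ¬ (d < c ∧ c < q)) ∨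
      (¬ (q < a ∧ d < a) ∧ ¬ (a < q ∧ a < d)) ∧ (¬ (q < c ∧ d < c) ∧ ¬ (c < q ∧ c < d)) := by
    rcases d3 with h | h
    · exact Or.inl ⟨btw_le (h a a1), btw_le (h c c1)⟩
    · exact Or.inr ⟨btw_ge (h a a1), btw_ge (h c c1)⟩
  clear a3 c3 d3 a1 c1 d1
  rcases lt_or_gt_of_ne a2 with h1 | h1 <;> rcases lt_or_gt_of_ne c2 with h2 | h2 <;>
    rcases lt_or_gt_of_ne d2 with h3 | h3 <;> rcases lt_or_gt_of_ne hac with h4 | h4 <;>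
    rcases lt_or_gt_of_ne hda with h5 | h5 <;> rcases lt_or_gt_of_ne hdc with h6 | h6 <;>
    first
    | (exfalso; linarith)
    | (simp only [h1, h2, h3, h4, h5, h6, h1.not_gt, h2.not_gt, h3.not_gt, h4.not_gt, h5.not_gt, h6.not_gt, and_true, true_and,
        and_false, false_and, not_true_eq_false, not_false_eq_true, or_false, false_or, and_self] at A1 C1 D1)

/-- points on a line with consecutive slopes at `z` are cyclic neighbours -/
lemma nb_of_nxt {x y z q q' : ℝ} (hz : fl b z x ≠ y) (hq : q ∈ Lp A b x y) (hq' : q' ∈ Lp A b x y)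
    (hlt : slp b z q < slp b z q') (hn : slp b z q' = nxt (Ms A b z) (slp b z q)) : Nb (Lp A b x y) q q' := by
  have hform : ∀ s ∈ Lp A b x y, s - z ≠ 0 ∧ slp b z s = x + (fl b z x - y) / (s - z) := by
    intro s hs
    obtain ⟨h1, h2⟩ := mem_Lp.1 hs
    have h3 : s - z ≠ 0 := by
      intro h; rw [sub_eq_zero.1 h] at h2; exact hz h2
    refine ⟨h3, ?_⟩
    rw [slp]; unfold fl at *; field_simp; linarith
  have hc : fl b z x - y ≠ 0 := sub_ne_zero.2 hz
  obtain ⟨q0, qs⟩ := hform q hq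
  obtain ⟨q1, qs'⟩ := hform q' hq'
  have hspec := nxt_spec (S := Ms A b z) (x := slp b z q) ⟨slp b z q', slp_mem (mem_Lp.1 hq').1 (sub_ne_zero.1 q1), hlt⟩
  have hno : ∀ s ∈ Lp A b x y, ¬ 0 < (slp b z s - slp b z q) * (slp b z q' - slp b z s) := by
    intro s hs hpos
    have h1 : slp b z q < slp b z s ∧ slp b z s < slp b z q' := by
      constructor
      · by_contra hcon
        have : slp b z q' - slp b z s > 0 := by linarith
        nlinarith
      · by_contra hcon
        have : slp b z s - slp b z q > 0 := by linarith
        nlinarith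
    have := hspec.2.2 _ (slp_mem (mem_Lp.1 hs).1 (sub_ne_zero.1 (hform s hs).1)) h1.1
    rw [← hn] at this; linarith
  have hid : ∀ s ∈ Lp A b x y, (slp b z s - slp b z q) * (slp b z q' - slp b z s) =
      ((fl b z x - y) ^ 2 / ((s - z)^2 * ((q - z)^2 * (q' - z)^2))) * (((s - q) * (q' - s)) * ((q - z) * (q' - z))) := by
    intro s hs
    obtain ⟨s0, ss⟩ := hform s hs
    rw [ss, qs, qs']
    field_simp
    ring
  refine ⟨hq, hq', fun h => by rw [h] at hlt; exact lt_irrefl _ hlt, ?_⟩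
  rcases lt_or_gt_of_ne (mul_ne_zero q0 q1) with h | h
  · right
    intro s hs
    by_contra hcon
    refine hno s hs ?_
    rw [hid s hs]
    have s0 := (hform s hs).1
    exact mul_pos (by positivity) (mul_pos_of_neg_of_neg (not_le.1 hcon) h)
  · left
    intro s hs
    by_contra hcon
    refine hno s hs ?_
    rw [hid s hs]
    have s0 := (hform s hs).1
    exact mul_pos (by positivity) (mul_pos (not_le.1 hcon) h)

end
end WS

namespace WS
noncomputable section
open scoped Classical
open Finset MvPolynomial

variable {A : Finset ℝ} {b : ℝ → ℝ}

/-- the pair `u, v` is split between the two lines -/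
def Spl (b : ℝ → ℝ) (x y x' y' u v : ℝ) : Prop :=
  (fl b u x = y ∧ fl b v x' = y') ∨ (fl b v x = y ∧ fl b u x' = y')

lemma van_deg_one {G : Po} (h0 : G ≠ 0) (hd : G.totalDegree ≤ 1) {z c c' : ℝ} (hc : c ≠ z) (hc' : c' ≠ z)
    (vz : Van b G z) (vc : Van b G c) (vc' : Van b G c') : slp b z c = slp b z c' := by
  have hdvd : lnp b z (slp b z c) ∣ G := by
    by_contra h
    have := bezout_idx (b := b) (lin_irred _ _) (lin_deg _ _) hd h {z, c} (by
      intro s hs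
      rcases mem_insert.1 hs with rfl | hs
      · exact ⟨van_lnp.2 (Or.inl rfl), vz⟩
      · rw [mem_singleton.1 hs]; exact ⟨van_lnp.2 (Or.inr rfl), vc⟩)
    rw [card_pair hc.symm] at this
    omega
  obtain ⟨H, hH⟩ := hdvd
  have h5 : H.totalDegree ≤ 0 := deg_quot (lin_ne_zero _ _) (lin_deg _ _) hd hH
  have h6 : H = C (H.coeff 0) := totalDegree_eq_zero_iff_eq_C.1 (by omega)
  rw [Van, hH, h6, eval_mul, eval_C] at vc'
  rcases mul_eq_zero.1 vc' with h7 | h7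
  · exact ((van_lnp.1 h7).resolve_left hc').symm
  · rw [h7] at h6; rw [h6] at hH; simp at hH; exact absurd hH h0

lemma Run.slp_lt {n : ℕ} {X Y Z : ℕ → ℝ} (R : Run A b n X Y Z) : ∀ j i, i < j → j < n →
    slp b (Z 0) (X i) < slp b (Z 0) (X j) := by
  intro j
  induction j with
  | zero => intro i h; omega
  | succ j ih =>
    intro i hij hj
    have h1 := (R.cons j hj).2
    rcases Nat.lt_succ_iff_lt_or_eq.1 hij with h | rfl
    · exact (ih i h (by omega)).trans h1
    · exact h1

lemma Run.slp_inj {n : ℕ} {X Y Z : ℕ → ℝ} (R : Run A b n X Y Z) {i j : ℕ} (hi : i < n) (hj : j < n)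
    (h : slp b (Z 0) (X i) = slp b (Z 0) (X j)) : i = j := by
  rcases lt_trichotomy i j with h1 | h1 | h1
  · exact absurd h (R.slp_lt j i h1 hj).ne
  · exact h1
  · exact absurd h.symm (R.slp_lt i j h1 hi).ne

lemma Run.ne {n : ℕ} {X Y Z : ℕ → ℝ} (R : Run A b n X Y Z) {i : ℕ} (hi : i < n) :
    X i ≠ Z 0 ∧ Y i ≠ Z 0 ∧ X i ∈ A ∧ Y i ∈ A ∧ Z 0 ∈ A := by
  obtain ⟨h1, h2, h3, h4, h5, -⟩ := R.tri i hi 0 (by omega)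
  exact ⟨h4.symm, h5.symm, h2, h3, h1⟩

lemma run_dvd {n : ℕ} {X Y Z : ℕ → ℝ} (R : Run A b n X Y Z) {F : Po} (hF : F.totalDegree ≤ 3)
    (hXY : ∀ i, 3 ≤ i → i + 5 ≤ n → Van b F (X i) ∧ Van b F (Y i)) (x y : ℝ) (I : Finset ℕ)
    (hI : ∀ i ∈ I, 3 ≤ i ∧ i + 5 ≤ n ∧ (fl b (X i) x = y ∨ fl b (Y i) x = y)) (hc : 4 ≤ I.card) : lin x y ∣ F := by
  by_contra h
  set s : ℕ → ℝ := fun i => if fl b (X i) x = y then X i else Y i with hs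
  have h1 := bezout_idx (b := b) (lin_irred x y) (lin_deg _ _) hF h (I.image s) (by
    intro c hc
    obtain ⟨i, hi, rfl⟩ := mem_image.1 hc
    obtain ⟨i1, i2, i3⟩ := hI i hi
    obtain ⟨v1, v2⟩ := hXY i i1 i2
    simp only [hs]
    split_ifs with hif
    · exact ⟨van_lin.2 hif, v1⟩
    · exact ⟨van_lin.2 (i3.resolve_left hif), v2⟩)
  rw [card_image_of_injOn] at h1
  · omega
  · intro i hi j hj hij
    obtain ⟨i1, i2, i3⟩ := hI i (mem_coe.1 hi)
    obtain ⟨j1, j2, j3⟩ := hI j (mem_coe.1 hj)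
    simp only [hs] at hij
    split_ifs at hij
    · exact R.Xinj i (by omega) j (by omega) hij
    · exact absurd hij (R.XY i (by omega) j (by omega))
    · exact absurd hij.symm (R.XY j (by omega) i (by omega))
    · exact R.Yinj i (by omega) j (by omega) hij

theorem run_split {n : ℕ} {X Y Z : ℕ → ℝ} (R : Run A b n X Y Z) (hn : 13 ≤ n) {x y x' y' : ℝ}
    (hne : ¬ (x = x' ∧ y = y')) (hz : fl b (Z 0) x ≠ y) (hz' : fl b (Z 0) x' ≠ y') (I : Finset ℕ)
    (hI : ∀ i ∈ I, 3 ≤ i ∧ i + 5 ≤ n ∧ Spl b x y x' y' (X i) (Y i)) (hc : 4 ≤ I.card) :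
    ∃ i0, ∀ i, 3 ≤ i → i + 5 ≤ n → i ≠ i0 → Spl b x y x' y' (X i) (Y i) := by
  obtain ⟨F, hF0, hF, hFZ, hFX⟩ := run_cubic R hn
  have d1 : lin x y ∣ F := run_dvd R hF hFX x y I (fun i hi => ⟨(hI i hi).1, (hI i hi).2.1, (hI i hi).2.2.imp And.left And.left⟩) hc
  have d2 : lin x' y' ∣ F := run_dvd R hF hFX x' y' I (fun i hi => ⟨(hI i hi).1, (hI i hi).2.1, (hI i hi).2.2.symm.imp And.right And.right⟩) hc
  obtain ⟨F1, hF1⟩ := d1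
  have hndvd : ¬ lin x' y' ∣ lin x y := by
    rintro ⟨H, hH⟩
    apply hne
    have e0 : ∀ u, x * u - (x' * u - y') - y = 0 := by
      intro u
      have := congrArg (eval ![u, x' * u - y']) hH
      rw [eval_mul, eval_lin, eval_lin] at this
      simp at this
      linarith
    have e1 := e0 0
    have e2 := e0 1
    exact ⟨by linarith, by linarith⟩
  have d3 : lin x' y' ∣ F1 := by
    rw [hF1] at d2
    exact ((lin_irred x' y').prime.dvd_or_dvd d2).resolve_left hndvd
  obtain ⟨G, hG⟩ := d3
  have g1 : F1.totalDegree ≤ 2 := deg_quot (lin_ne_zero _ _) (lin_deg _ _) hF hF1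
  have g2 : G.totalDegree ≤ 1 := deg_quot (lin_ne_zero _ _) (lin_deg _ _) g1 hG
  have g0 : G ≠ 0 := by rintro rfl; rw [mul_zero] at hG; rw [hG, mul_zero] at hF1; exact hF0 hF1
  have hfac : ∀ c, Van b F c → fl b c x = y ∨ fl b c x' = y' ∨ Van b G c := by
    intro c hc
    rw [Van, hF1, hG, eval_mul, eval_mul, mul_eq_zero, mul_eq_zero] at hc
    rcases hc with h | h | h
    · exact Or.inl ((eval_lin_pt b _ _ _).1 h)
    · exact Or.inr (Or.inl ((eval_lin_pt b _ _ _).1 h))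
    · exact Or.inr (Or.inr h)
  have gz : Van b G (Z 0) := ((hfac _ (hFZ 0 (by omega))).resolve_left hz).resolve_left hz'
  have hspl : ∀ i, 3 ≤ i → i + 5 ≤ n → ¬ Van b G (X i) → ¬ Van b G (Y i) → Spl b x y x' y' (X i) (Y i) := by
    intro i i1 i2 hX hY
    obtain ⟨n1, n2, -, -, -⟩ := R.ne (i := i) (by omega)
    have hs := (R.slpY i (by omega)).symm
    have hxy := R.XY i (by omega) i (by omega)
    obtain ⟨v1, v2⟩ := hFX i i1 i2
    rcases hfac _ v1 with a1 | a1 | a1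
    · rcases hfac _ v2 with a2 | a2 | a2
      · exact absurd (line_third hxy n1 n2 a1 a2 hs) hz
      · exact Or.inl ⟨a1, a2⟩
      · exact absurd a2 hY
    · rcases hfac _ v2 with a2 | a2 | a2
      · exact Or.inr ⟨a2, a1⟩
      · exact absurd (line_third hxy n1 n2 a1 a2 hs) hz'
      · exact absurd a2 hY
    · exact absurd a1 hX
  by_cases hex : ∃ i, 3 ≤ i ∧ i + 5 ≤ n ∧ (Van b G (X i) ∨ Van b G (Y i))
  · obtain ⟨i0, k1, k2, k3⟩ := hex
    refine ⟨i0, fun i i1 i2 hne' => ?_⟩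
    obtain ⟨n1, n2, -, -, -⟩ := R.ne (i := i) (by omega)
    obtain ⟨m1, m2, -, -, -⟩ := R.ne (i := i0) (by omega)
    have s1 := R.slpY i (by omega)
    have s2 := R.slpY i0 (by omega)
    have hno : ∀ c, c ≠ Z 0 → slp b (Z 0) c = slp b (Z 0) (X i) → ¬ Van b G c := by
      intro c hcz hcs hcv
      apply hne'
      refine R.slp_inj (by omega) (by omega) ?_
      rw [← hcs]
      rcases k3 with k3 | k3
      · exact van_deg_one g0 g2 hcz m1 gz hcv k3
      · rw [← s2]; exact van_deg_one g0 g2 hcz m2 gz hcv k3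
    exact hspl i i1 i2 (hno _ n1 rfl) (hno _ n2 s1)
  · refine ⟨0, fun i i1 i2 _ => hspl i i1 i2 (fun h => hex ⟨i, i1, i2, Or.inl h⟩) (fun h => hex ⟨i, i1, i2, Or.inr h⟩)⟩

variable (A b) in
/-- good pair with apex `z` -/
def GdP (S S' : Finset ℝ) (q q' : ℝ) : Prop := ∃ z q1 q2 q1' q2', Tri A b z q q' ∧
  Nb S q q1 ∧ Nb S q q2 ∧ q1 ≠ q2 ∧ Nb S' q' q1' ∧ Nb S' q' q2' ∧ q1' ≠ q2' ∧
  slp b z q1 = slp b z q1' ∧ slp b z q2 = slp b z q2' ∧ z ∉ S ∧ z ∉ S'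

lemma spl_pick {x y x' y' u v : ℝ} (h : Spl b x y x' y' u v) : ∃ q q', fl b q x = y ∧ fl b q' x' = y' ∧
    ((q = u ∧ q' = v) ∨ (q = v ∧ q' = u)) := by
  rcases h with ⟨h1, h2⟩ | ⟨h1, h2⟩
  · exact ⟨u, v, h1, h2, Or.inl ⟨rfl, rfl⟩⟩
  · exact ⟨v, u, h1, h2, Or.inr ⟨rfl, rfl⟩⟩

lemma run_pick {n : ℕ} {X Y Z : ℕ → ℝ} (R : Run A b n X Y Z) {x y x' y' : ℝ} {i : ℕ} (hi : i < n)
    (h : Spl b x y x' y' (X i) (Y i)) : ∃ q q', q ∈ Lp A b x y ∧ q' ∈ Lp A b x' y' ∧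
    slp b (Z 0) q = slp b (Z 0) (X i) ∧ slp b (Z 0) q' = slp b (Z 0) (X i) := by
  obtain ⟨q, q', h1, h2, h3⟩ := spl_pick h
  obtain ⟨-, -, m1, m2, -⟩ := R.ne hi
  have hs := R.slpY i hi
  rcases h3 with ⟨rfl, rfl⟩ | ⟨rfl, rfl⟩
  · exact ⟨_, _, mem_Lp.2 ⟨m1, h1⟩, mem_Lp.2 ⟨m2, h2⟩, rfl, hs⟩
  · exact ⟨_, _, mem_Lp.2 ⟨m2, h1⟩, mem_Lp.2 ⟨m1, h2⟩, hs, rfl⟩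

lemma gd_of_run {n : ℕ} {X Y Z : ℕ → ℝ} (R : Run A b n X Y Z) {x y x' y' : ℝ}
    (hz : fl b (Z 0) x ≠ y) (hz' : fl b (Z 0) x' ≠ y') {i : ℕ} (hi : i + 2 < n)
    (h0 : Spl b x y x' y' (X i) (Y i)) (h2 : Spl b x y x' y' (X (i+2)) (Y (i+2))) {q q' : ℝ}
    (hq : q ∈ Lp A b x y) (hq' : q' ∈ Lp A b x' y') (hs : slp b (Z 0) q = slp b (Z 0) (X (i+1)))
    (hs' : slp b (Z 0) q' = slp b (Z 0) (X (i+1))) (hT : Tri A b (Z 0) q q') :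
    GdP A b (Lp A b x y) (Lp A b x' y') q q' := by
  obtain ⟨p, p', p1, p2, p3, p4⟩ := run_pick R (by omega) h0
  obtain ⟨r, r', r1, r2, r3, r4⟩ := run_pick R (by omega) h2
  obtain ⟨c1, c2⟩ := R.cons i (by omega)
  obtain ⟨d1, d2⟩ := R.cons (i+1) (by omega)
  have hlt := c2.trans d2
  refine ⟨Z 0, r, p, r', p', hT, ?_, ?_, ?_, ?_, ?_, ?_, ?_, ?_, fun h => hz (mem_Lp.1 h).2, fun h => hz' (mem_Lp.1 h).2⟩
  · exact nb_of_nxt hz hq r1 (by rw [hs, r3]; exact d2) (by rw [hs, r3]; exact d1)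
  · exact (nb_of_nxt hz p1 hq (by rw [hs, p3]; exact c2) (by rw [hs, p3]; exact c1)).symm
  · rintro rfl; rw [r3] at p3; exact hlt.ne p3.symm
  · exact nb_of_nxt hz' hq' r2 (by rw [hs', r4]; exact d2) (by rw [hs', r4]; exact d1)
  · exact (nb_of_nxt hz' p2 hq' (by rw [hs', p4]; exact c2) (by rw [hs', p4]; exact c1)).symm
  · rintro rfl; rw [r4] at p4; exact hlt.ne p4.symm
  · rw [r3, r4]
  · rw [p3, p4]

end
end WS

namespace WS
noncomputable section
open scoped Classical
open Finset MvPolynomial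

variable {A : Finset ℝ} {b : ℝ → ℝ}

lemma slp_det {x y z q q' : ℝ} (hz : fl b z x ≠ y) (h1 : fl b q x = y) (h2 : fl b q' x = y)
    (hs : slp b z q = slp b z q') : q = q' := by
  by_contra h
  exact hz (line_third h (fun e => hz (e ▸ h1)) (fun e => hz (e ▸ h2)) h1 h2 hs)

lemma Tri.rot {u v w : ℝ} (h : Tri A b u v w) : Tri A b w u v := (h.swap23).swap12

variable (A b) in
/-- the pairs belonging to a given run -/
def PR (Q : Finset (ℝ × ℝ)) (z : ℝ) (k : ℕ) : Finset (ℝ × ℝ) :=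
  Q.filter (fun p => Tri A b z p.1 p.2 ∧ InRun A b z k p.1)

variable (A b) in
/-- pairs between two lines -/
def PQ (x y x' y' : ℝ) : Finset (ℝ × ℝ) :=
  (Lp A b x y ×ˢ Lp A b x' y').filter (fun p => p.1 ∉ Lp A b x' y' ∧ p.2 ∉ Lp A b x y)

lemma mem_PQ {x y x' y' : ℝ} {p : ℝ × ℝ} : p ∈ PQ A b x y x' y' ↔
    (p.1 ∈ A ∧ fl b p.1 x = y ∧ fl b p.1 x' ≠ y') ∧ (p.2 ∈ A ∧ fl b p.2 x' = y' ∧ fl b p.2 x ≠ y) := by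
  simp only [PQ, mem_filter, mem_product, mem_Lp]
  tauto

lemma PQ_tri {x y x' y' : ℝ} {p : ℝ × ℝ} (hp : p ∈ PQ A b x y x' y') {z : ℝ} (h : Tri A b z p.1 p.2)
    (hc : 4 ≤ (Lp A b x y).card) (hc' : 4 ≤ (Lp A b x' y').card) : fl b z x ≠ y ∧ fl b z x' ≠ y' := by
  obtain ⟨⟨a1, a2, a3⟩, ⟨b1, b2, b3⟩⟩ := mem_PQ.1 hp
  exact ⟨fun e => h.not_line hc ⟨e, a2⟩, fun e => h.swap23.not_line hc' ⟨e, b2⟩⟩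

theorem class_bound {x y x' y' : ℝ} (hc : 4 ≤ (Lp A b x y).card) (hc' : 4 ≤ (Lp A b x' y').card)
    {Q : Finset (ℝ × ℝ)} (hQ : Q ⊆ PQ A b x y x' y') :
    Q.card ≤ 2 * (∑ a ∈ A, bd A b a) + ∑ z ∈ A, ∑ k ∈ range (bd A b z + 1), (PR A b Q z k).card := by
  set B1 := Q.filter (fun p => slp b p.1 p.2 ∈ badS A b p.1) with hB1
  have key : ∀ p ∈ Q, p ∉ B1 → ∃ z, Tri A b z p.1 p.2 := by
    intro p hp hb
    obtain ⟨⟨a1, a2, a3⟩, ⟨b1, b2, b3⟩⟩ := mem_PQ.1 (hQ hp)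
    have hb' : slp b p.1 p.2 ∉ badS A b p.1 := fun h => hb (mem_filter.2 ⟨hp, h⟩)
    obtain ⟨z, hz⟩ := tri_of_not_bad b1 (fun e => b3 (e ▸ a2)) hb'
    exact ⟨z, hz.rot⟩
  choose! z hz using key
  set B2 := Q.filter (fun p => p ∉ B1 ∧ slp b (z p) p.1 ∈ badS A b (z p)) with hB2
  have c1 : B1.card ≤ ∑ a ∈ A, bd A b a := by
    have : B1.card ≤ (A.sigma (badS A b)).card := by
      refine card_le_card_of_injOn (fun p => (⟨p.1, slp b p.1 p.2⟩ : Σ _ : ℝ, ℝ)) ?_ ?_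
      · intro p hp
        obtain ⟨h1, h2⟩ := mem_filter.1 (mem_coe.1 hp)
        exact mem_coe.2 (mem_sigma.2 ⟨(mem_PQ.1 (hQ h1)).1.1, h2⟩)
      · intro p hp p' hp' h
        obtain ⟨h1, h2⟩ := mem_filter.1 (mem_coe.1 hp)
        obtain ⟨h1', h2'⟩ := mem_filter.1 (mem_coe.1 hp')
        simp only [Sigma.mk.injEq, heq_eq_eq] at h
        obtain ⟨e1, e2⟩ := h
        rw [← e1] at e2
        exact Prod.ext e1 (slp_det (mem_PQ.1 (hQ h1)).1.2.2 (mem_PQ.1 (hQ h1)).2.2.1 (mem_PQ.1 (hQ h1')).2.2.1 e2)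
    rwa [card_sigma] at this
  have c2 : B2.card ≤ ∑ a ∈ A, bd A b a := by
    have : B2.card ≤ (A.sigma (badS A b)).card := by
      refine card_le_card_of_injOn (fun p => (⟨z p, slp b (z p) p.1⟩ : Σ _ : ℝ, ℝ)) ?_ ?_
      · intro p hp
        obtain ⟨h1, h2, h3⟩ := mem_filter.1 (mem_coe.1 hp)
        exact mem_coe.2 (mem_sigma.2 ⟨(hz p h1 h2).1, h3⟩)
      · intro p hp p' hp' h
        obtain ⟨h1, h2, h3⟩ := mem_filter.1 (mem_coe.1 hp)
        obtain ⟨h1', h2', h3'⟩ := mem_filter.1 (mem_coe.1 hp')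
        simp only [Sigma.mk.injEq, heq_eq_eq] at h
        obtain ⟨e1, e2⟩ := h
        have t1 := hz p h1 h2
        have t2 := hz p' h1' h2'
        rw [← e1] at e2 t2
        obtain ⟨o1, o2⟩ := PQ_tri (hQ h1) t1 hc hc'
        refine Prod.ext (slp_det o1 (mem_PQ.1 (hQ h1)).1.2.1 (mem_PQ.1 (hQ h1')).1.2.1 e2)
          (slp_det o2 (mem_PQ.1 (hQ h1)).2.2.1 (mem_PQ.1 (hQ h1')).2.2.1 ?_)
        rw [← t1.slp_eq, ← t2.slp_eq, e2]
    rwa [card_sigma] at this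
  have hsub : Q ⊆ B1 ∪ (B2 ∪ A.biUnion (fun z => (range (bd A b z + 1)).biUnion (fun k => PR A b Q z k))) := by
    intro p hp
    by_cases h1 : p ∈ B1
    · exact mem_union_left _ h1
    refine mem_union_right _ ?_
    by_cases h2 : slp b (z p) p.1 ∈ badS A b (z p)
    · exact mem_union_left _ (mem_filter.2 ⟨hp, h1, h2⟩)
    refine mem_union_right _ ?_
    have t := hz p hp h1
    refine mem_biUnion.2 ⟨z p, t.1, mem_biUnion.2 ⟨cnt A b (z p) (slp b (z p) p.1), ?_, ?_⟩⟩
    · rw [mem_range]; have := cnt_le (A := A) (b := b) (z p) (slp b (z p) p.1); rw [bd]; omega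
    · exact mem_filter.2 ⟨hp, t, t.2.1, t.2.2.2.1.symm, h2, rfl⟩
  have e1 := (card_le_card hsub).trans (card_union_le _ _)
  have e2 := card_union_le B2 (A.biUnion (fun z => (range (bd A b z + 1)).biUnion (fun k => PR A b Q z k)))
  have e3 : (A.biUnion (fun z => (range (bd A b z + 1)).biUnion (fun k => PR A b Q z k))).card ≤ 
     ∑ z ∈ A, ∑ k ∈ range (bd A b z + 1), (PR A b Q z k).card :=
    card_biUnion_le.trans (sum_le_sum fun z _ => card_biUnion_le)
  omega

lemma pair_idx {n : ℕ} {X Y Z : ℕ → ℝ} (R : Run A b n X Y Z) {q q' : ℝ} {i : ℕ} (hi : i < n)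
    (h : Tri A b (Z 0) q q') (hq : q = X i ∨ q = Y i) : (q = X i ∧ q' = Y i) ∨ (q = Y i ∧ q' = X i) := by
  have hT := R.tri i hi 0 (by omega)
  rw [add_zero] at hT
  obtain ⟨hz, hu, hv, hzu, hzv, huv, x', y', hxy⟩ := hT
  have e0 := (hxy _ hz).2 (Or.inl rfl)
  have eq : fl b q x' = y' := by
    rcases hq with rfl | rfl
    · exact (hxy _ hu).2 (Or.inr (Or.inl rfl))
    · exact (hxy _ hv).2 (Or.inr (Or.inr rfl))
  have eq' : fl b q' x' = y' := (h.line e0 eq q' h.2.2.1).2 (Or.inr (Or.inr rfl))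
  have := (hxy q' h.2.2.1).1 eq'
  have n1 := h.2.2.2.2.1
  have n2 := h.2.2.2.2.2.1
  rcases hq with rfl | rfl
  · rcases this with e | e | e
    · exact absurd e.symm n1
    · exact absurd e.symm n2
    · exact Or.inl ⟨rfl, e⟩
  · rcases this with e | e | e
    · exact absurd e.symm n1
    · exact Or.inr ⟨rfl, e⟩
    · exact absurd e.symm n2

/-- A run with at least four split pairs -/
theorem pr_run {x y x' y' : ℝ} (hne : ¬ (x = x' ∧ y = y')) (hc : 4 ≤ (Lp A b x y).card) (hc' : 4 ≤ (Lp A b x' y').card)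
    {Q : Finset (ℝ × ℝ)} (hQ : Q ⊆ PQ A b x y x' y') {z : ℝ} {k : ℕ} (h4 : 4 ≤ (PR A b Q z k).card) :
    ∃ n X Y Z, Run A b n X Y Z ∧ Z 0 = z ∧ 13 ≤ n ∧ fl b z x ≠ y ∧ fl b z x' ≠ y' ∧
      (PR A b Q z k).card + 12 ≤ n ∧
      (∃ ix : ℝ × ℝ → ℕ, Set.InjOn ix (PR A b Q z k) ∧ ∀ p ∈ PR A b Q z k, 4 ≤ ix p ∧ ix p + 9 ≤ n ∧
        ((p.1 = X (ix p) ∧ p.2 = Y (ix p)) ∨ (p.1 = Y (ix p) ∧ p.2 = X (ix p)))) ∧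
      ∃ i0, ∀ i, 3 ≤ i → i + 5 ≤ n → i ≠ i0 → Spl b x y x' y' (X i) (Y i) := by
  obtain ⟨p0, hp0⟩ : (PR A b Q z k).Nonempty := card_pos.1 (by omega)
  obtain ⟨p0Q, p0T, p0R⟩ := mem_filter.1 hp0
  obtain ⟨n, X, Y, Z, R, hZ, hall⟩ := run_exists p0T.1 ⟨_, p0R⟩
  obtain ⟨o1, o2⟩ := PQ_tri (hQ p0Q) p0T hc hc'
  have hi : ∀ p ∈ PR A b Q z k, ∃ i, 4 ≤ i ∧ i + 9 ≤ n ∧ ((p.1 = X i ∧ p.2 = Y i) ∨ (p.1 = Y i ∧ p.2 = X i)) := by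
    intro p hp
    obtain ⟨pQ, pT, pR⟩ := mem_filter.1 hp
    obtain ⟨i, i1, i2, i3⟩ := hall _ pR
    rw [← hZ] at pT
    exact ⟨i, i1, i2, pair_idx R (by omega) pT i3⟩
  choose! ix h1 h2 h3 using hi
  have hspl : ∀ p ∈ PR A b Q z k, Spl b x y x' y' (X (ix p)) (Y (ix p)) := by
    intro p hp
    have hpQ := mem_PQ.1 (hQ (mem_filter.1 hp).1)
    rcases h3 p hp with ⟨e1, e2⟩ | ⟨e1, e2⟩
    · rw [← e1, ← e2]; exact Or.inl ⟨hpQ.1.2.1, hpQ.2.2.1⟩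
    · rw [← e1, ← e2]; exact Or.inr ⟨hpQ.1.2.1, hpQ.2.2.1⟩
  have hinj : Set.InjOn ix (PR A b Q z k) := by
    intro p hp p' hp' he
    have hpQ := mem_PQ.1 (hQ (mem_filter.1 (mem_coe.1 hp)).1)
    have hpQ' := mem_PQ.1 (hQ (mem_filter.1 (mem_coe.1 hp')).1)
    have a1 := h3 p hp
    have a2 := h3 p' hp'
    rw [← he] at a2
    rcases a1 with ⟨e1, e2⟩ | ⟨e1, e2⟩ <;> rcases a2 with ⟨f1, f2⟩ | ⟨f1, f2⟩
    · exact Prod.ext (e1.trans f1.symm) (e2.trans f2.symm)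
    · exfalso; have := e1.trans f2.symm
      exact hpQ.1.2.2 (this ▸ hpQ'.2.2.1)
    · exfalso; have := e1.trans f2.symm
      exact hpQ.1.2.2 (this ▸ hpQ'.2.2.1)
    · exact Prod.ext (e1.trans f1.symm) (e2.trans f2.symm)
  have hn : 13 ≤ n := by have := h1 p0 hp0; have := h2 p0 hp0; omega
  have hIc : ((PR A b Q z k).image ix).card = (PR A b Q z k).card := card_image_of_injOn hinj
  have hcard : (PR A b Q z k).card + 12 ≤ n := by
    have : (PR A b Q z k).image ix ⊆ Finset.Ico 4 (n - 8) := by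
      intro i hi
      obtain ⟨p, hp, rfl⟩ := mem_image.1 hi
      have := h1 p hp; have := h2 p hp
      rw [Finset.mem_Ico]; omega
    have := card_le_card this
    rw [hIc, Nat.card_Ico] at this
    omega
  refine ⟨n, X, Y, Z, R, hZ, hn, o1, o2, hcard, ⟨ix, hinj, fun p hp => ⟨h1 p hp, h2 p hp, h3 p hp⟩⟩, ?_⟩
  refine run_split R hn hne (by rw [hZ]; exact o1) (by rw [hZ]; exact o2) ((PR A b Q z k).image ix) ?_ (by rw [hIc]; exact h4)
  intro i hi
  obtain ⟨p, hp, rfl⟩ := mem_image.1 hi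
  have := h1 p hp; have := h2 p hp
  exact ⟨by omega, by omega, hspl p hp⟩

theorem nongood {x y x' y' : ℝ} (hne : ¬ (x = x' ∧ y = y')) (hc : 4 ≤ (Lp A b x y).card) (hc' : 4 ≤ (Lp A b x' y').card) :
    ((PQ A b x y x' y').filter (fun p => ¬ GdP A b (Lp A b x y) (Lp A b x' y') p.1 p.2)).card ≤
      5 * (∑ a ∈ A, bd A b a) + 3 * A.card := by
  set Q := (PQ A b x y x' y').filter (fun p => ¬ GdP A b (Lp A b x y) (Lp A b x' y') p.1 p.2) with hQd
  have hQ : Q ⊆ PQ A b x y x' y' := filter_subset _ _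
  have h3 : ∀ z k, (PR A b Q z k).card ≤ 3 := by
    intro z k
    by_contra hcon
    obtain ⟨n, X, Y, Z, R, rfl, hn, o1, o2, hcard, ⟨ix, hinj, hix⟩, i0, hi0⟩ := pr_run hne hc hc' hQ (z := z) (k := k) (by omega)
    have hsub : (PR A b Q (Z 0) k).image ix ⊆ {i0 - 1, i0 + 1} := by
      intro i hi
      obtain ⟨p, hp, rfl⟩ := mem_image.1 hi
      obtain ⟨a1, a2, a3⟩ := hix p hp
      obtain ⟨pQ, pT, pR⟩ := mem_filter.1 hp
      obtain ⟨pQ1, pG⟩ := mem_filter.1 pQ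
      by_contra hno
      simp only [mem_insert, mem_singleton, not_or] at hno
      apply pG
      have s1 := hi0 (ix p - 1) (by omega) (by omega) (by omega)
      have s2 := hi0 (ix p - 1 + 2) (by omega) (by omega) (by omega)
      have hpq := mem_PQ.1 pQ1
      have he : ix p - 1 + 1 = ix p := by omega
      have hs := R.slpY (ix p) (by omega)
      refine gd_of_run R o1 o2 (by omega) s1 s2 (mem_Lp.2 ⟨hpq.1.1, hpq.1.2.1⟩) (mem_Lp.2 ⟨hpq.2.1, hpq.2.2.1⟩) ?_ ?_ pT
      · rw [he]; rcases a3 with ⟨e1, e2⟩ | ⟨e1, e2⟩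
        · rw [e1]
        · rw [e1, hs]
      · rw [he]; rcases a3 with ⟨e1, e2⟩ | ⟨e1, e2⟩
        · rw [e2, hs]
        · rw [e2]
    have := card_le_card hsub
    rw [card_image_of_injOn hinj] at this
    have h2 : ({i0 - 1, i0 + 1} : Finset ℕ).card ≤ 2 := card_le_two
    omega
  have h1 := class_bound hc hc' hQ
  have h2 : ∑ z ∈ A, ∑ k ∈ range (bd A b z + 1), (PR A b Q z k).card ≤ 3 * (∑ a ∈ A, bd A b a) + 3 * A.card := by
    calc _ ≤ ∑ z ∈ A, ∑ k ∈ range (bd A b z + 1), 3 := sum_le_sum fun z _ => sum_le_sum fun k _ => h3 z k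
      _ = ∑ z ∈ A, (3 * bd A b z + 3) := by
        refine sum_congr rfl fun z _ => ?_
        rw [sum_const, card_range, smul_eq_mul]; ring
      _ = _ := by rw [sum_add_distrib, ← mul_sum, sum_const, smul_eq_mul]; ring
  omega

/-- a long run with apex `z` all split between the two lines -/
theorem long_run {x y x' y' : ℝ} (hne : ¬ (x = x' ∧ y = y')) (hc : 4 ≤ (Lp A b x y).card) (hc' : 4 ≤ (Lp A b x' y').card)
    {N : ℕ} (hN : 4 ≤ N) (hbig : 2 * (∑ a ∈ A, bd A b a) + N * ((∑ a ∈ A, bd A b a) + A.card) < (PQ A b x y x' y').card) :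
    ∃ n X Y Z, Run A b n X Y Z ∧ fl b (Z 0) x ≠ y ∧ fl b (Z 0) x' ≠ y' ∧ N + 12 ≤ n ∧
      ∃ i0, ∀ i, 3 ≤ i → i + 5 ≤ n → i ≠ i0 → Spl b x y x' y' (X i) (Y i) := by
  by_cases h : ∃ z k, N ≤ (PR A b (PQ A b x y x' y') z k).card
  · obtain ⟨z, k, hzk⟩ := h
    obtain ⟨n, X, Y, Z, R, rfl, hn, o1, o2, hcard, -, h0⟩ := pr_run hne hc hc' (Subset.refl _) (hN.trans hzk)
    exact ⟨n, X, Y, Z, R, o1, o2, by omega, h0⟩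
  · exfalso
    push Not at h
    have h1 := class_bound hc hc' (Subset.refl (PQ A b x y x' y'))
    have h2 : ∑ z ∈ A, ∑ k ∈ range (bd A b z + 1), (PR A b (PQ A b x y x' y') z k).card ≤ N * ((∑ a ∈ A, bd A b a) + A.card) := by
      calc _ ≤ ∑ z ∈ A, ∑ k ∈ range (bd A b z + 1), N := sum_le_sum fun z _ => sum_le_sum fun k _ => (h z k).le
        _ = ∑ z ∈ A, (N * bd A b z + N) := by
          refine sum_congr rfl fun z _ => ?_
          rw [sum_const, card_range, smul_eq_mul]; ring
        _ = _ := by rw [sum_add_distrib, ← mul_sum, sum_const, smul_eq_mul]; ring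
    omega

end
end WS

namespace WS
noncomputable section
open scoped Classical
open Finset MvPolynomial

variable {A : Finset ℝ} {b : ℝ → ℝ}

variable (A b) in
/-- the initial configuration -/
structure Ini (u v u' v' : ℝ) (len : ℕ) (X Y Z : ℕ → ℝ) : Prop where
  tri : ∀ j k, k < 4 → j + k < len → Tri A b (Z k) (X j) (Y (j + k))
  onX : ∀ j < len, fl b (X j) u = v
  onY : ∀ j < len, fl b (Y j) u' = v'
  nbX : ∀ j, j + 1 < len → Nb (Lp A b u v) (X j) (X (j + 1))
  nbY : ∀ j, j + 1 < len → Nb (Lp A b u' v') (Y j) (Y (j + 1))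
  Zinj : ∀ i < 4, ∀ j < 4, Z i = Z j → i = j
  Xinj : ∀ i < len, ∀ j < len, X i = X j → i = j

lemma ini_of_run {n : ℕ} {X Y Z : ℕ → ℝ} (R : Run A b n X Y Z) {x y x' y' : ℝ} (hz : fl b (Z 0) x ≠ y) (hz' : fl b (Z 0) x' ≠ y')
    {s len : ℕ} (hs : s + len ≤ n)
    (h : ∀ i < len, fl b (X (s + i)) x = y ∧ fl b (Y (s + i)) x' = y') :
    Ini A b x y x' y' len (fun i => X (s + i)) (fun i => Y (s + i)) Z := by
  refine ⟨?_, fun j hj => (h j hj).1, fun j hj => (h j hj).2, ?_, ?_, R.Zinj, fun i hi j hj h => by have := R.Xinj _ (by omega) _ (by omega) h; omega⟩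
  · intro j k hk hjk
    have := R.tri (s + j) (by omega) k hk
    rwa [add_assoc] at this
  · intro j hj
    obtain ⟨c1, c2⟩ := R.cons (s + j) (by omega)
    obtain ⟨-, -, m1, m2, -⟩ := R.ne (i := s + j) (by omega)
    obtain ⟨-, -, m3, m4, -⟩ := R.ne (i := s + (j + 1)) (by omega)
    exact nb_of_nxt hz (mem_Lp.2 ⟨m1, (h j (by omega)).1⟩) (mem_Lp.2 ⟨m3, (h (j+1) (by omega)).1⟩) c2 c1
  · intro j hj
    obtain ⟨c1, c2⟩ := R.cons (s + j) (by omega)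
    obtain ⟨-, -, m1, m2, -⟩ := R.ne (i := s + j) (by omega)
    obtain ⟨-, -, m3, m4, -⟩ := R.ne (i := s + (j + 1)) (by omega)
    have e1 := R.slpY (s + j) (by omega)
    have e2 := R.slpY (s + j + 1) (by omega)
    rw [← e1, ← e2] at c1 c2
    exact nb_of_nxt hz' (mem_Lp.2 ⟨m2, (h j (by omega)).2⟩) (mem_Lp.2 ⟨m4, (h (j+1) (by omega)).2⟩) c2 c1

lemma Spl.prop {n : ℕ} {X Y Z : ℕ → ℝ} (R : Run A b n X Y Z) {x y x' y' : ℝ} (hc : 4 ≤ (Lp A b x y).card) (hc' : 4 ≤ (Lp A b x' y').card)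
    {s len : ℕ} (hs : s + len ≤ n) (h : ∀ i < len, Spl b x y x' y' (X (s + i)) (Y (s + i)))
    (h0 : fl b (X s) x = y) : ∀ i < len, fl b (X (s + i)) x = y ∧ fl b (Y (s + i)) x' = y' := by
  have hX : ∀ i < len, fl b (X (s + i)) x = y := by
    intro i
    induction i with
    | zero => intro _; exact h0
    | succ i ih =>
      intro hi
      have h1 := ih (by omega)
      have ht := R.tri (s + i) (by omega) 1 (by omega)
      rcases h (i + 1) hi with h2 | h2
      · exact h2.1
      · exact absurd ⟨h1, h2.1⟩ (ht.rot.rot.not_line hc)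
  intro i hi
  refine ⟨hX i hi, ?_⟩
  rcases h i hi with h2 | h2
  · exact h2.2
  · have ht := R.tri (s + i) (by omega) 0 (by omega)
    exact absurd ⟨hX i hi, h2.1⟩ (ht.rot.rot.not_line hc)

theorem init {x y x' y' : ℝ} (hne : ¬ (x = x' ∧ y = y')) (hc : 4 ≤ (Lp A b x y).card) (hc' : 4 ≤ (Lp A b x' y').card)
    {len : ℕ} (hlen : 2 ≤ len)
    (hbig : 2 * (∑ a ∈ A, bd A b a) + (2 * len) * ((∑ a ∈ A, bd A b a) + A.card) < (PQ A b x y x' y').card) :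
    (∃ X Y Z, Ini A b x y x' y' len X Y Z) ∨ (∃ X Y Z, Ini A b x' y' x y len X Y Z) := by
  obtain ⟨n, X, Y, Z, R, hz, hz', hn, i0, hi0⟩ := long_run hne hc hc' (N := 2 * len) (by omega) hbig
  obtain ⟨s, hs1, hs2⟩ : ∃ s, s + len ≤ n ∧ ∀ i < len, Spl b x y x' y' (X (s + i)) (Y (s + i)) := by
    by_cases h : i0 < 3 + len
    · exact ⟨3 + len, by omega, fun i hi => hi0 _ (by omega) (by omega) (by omega)⟩
    · exact ⟨3, by omega, fun i hi => hi0 _ (by omega) (by omega) (by omega)⟩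
  rcases hs2 0 (by omega) with h0 | h0
  · left
    exact ⟨_, _, _, ini_of_run R hz hz' hs1 (Spl.prop R hc hc' hs1 hs2 h0.1)⟩
  · right
    exact ⟨_, _, _, ini_of_run R hz' hz hs1 (Spl.prop R hc' hc hs1 (fun i hi => (hs2 i hi).symm.imp And.symm And.symm) h0.2)⟩

/-- linear functionals -/
def IsFn (b p : ℝ → ℝ) : Prop := ∃ c0 c1 c2 : ℝ, ∀ a, p a = c0 + c1 * a + c2 * b a

lemma IsFn.comb {p q r : ℝ → ℝ} (hp : IsFn b p) (hq : IsFn b q) (hr : IsFn b r) (c d e : ℝ) :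
    IsFn b (fun a => c * p a + d * q a + e * r a) := by
  obtain ⟨p0, p1, p2, hp⟩ := hp
  obtain ⟨q0, q1, q2, hq⟩ := hq
  obtain ⟨r0, r1, r2, hr⟩ := hr
  refine ⟨c * p0 + d * q0 + e * r0, c * p1 + d * q1 + e * r1, c * p2 + d * q2 + e * r2, fun a => ?_⟩
  show c * p a + d * q a + e * r a = _
  rw [hp, hq, hr]; ring

lemma isFn_fl (x y : ℝ) : IsFn b (fun a => fl b a x - y) := ⟨-y, x, -1, fun a => by simp only [fl]; ring⟩

lemma IsFn.line {p : ℝ → ℝ} (hp : IsFn b p) {x y a c : ℝ} (hac : a ≠ c) (h1 : fl b a x = y) (h2 : fl b c x = y) (pa : p a = 0)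
    (pc : p c = 0) : (∀ e, p e = 0 ↔ fl b e x = y) ∨ ∀ e, p e = 0 := by
  obtain ⟨c0, c1, c2, hp⟩ := hp
  rw [hp] at pa pc
  unfold fl at *
  have e1 : (c1 + c2 * x) * (a - c) = 0 := by linear_combination pa - pc + c2 * h1 - c2 * h2
  have e2 : c1 + c2 * x = 0 := (mul_eq_zero.1 e1).resolve_right (sub_ne_zero.2 hac)
  have e3 : c0 = c2 * y := by linear_combination pa + c2 * h1 - e2 * a
  by_cases hc : c2 = 0
  · right; intro e; rw [hp, e3, hc]; rw [hc] at e2; simp at e2; rw [e2]; simp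
  · left; intro e
    have : p e = -c2 * ((e * x - b e) - y) := by rw [hp, e3]; linear_combination e * e2
    rw [this, mul_eq_zero, sub_eq_zero]
    simp [hc]

lemma IsFn.tri {p : ℝ → ℝ} (hp : IsFn b p) {u v w : ℝ} (h : Tri A b u v w) (pv : p v = 0) (pw : p w = 0) : p u = 0 := by
  obtain ⟨hu, hv, hw, huv, huw, hvw, x, y, hxy⟩ := h
  have e0 := (hxy u hu).2 (Or.inl rfl)
  have e1 := (hxy v hv).2 (Or.inr (Or.inl rfl))
  have e2 := (hxy w hw).2 (Or.inr (Or.inr rfl))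
  rcases hp.line hvw e1 e2 pv pw with h | h
  · exact (h u).2 e0
  · exact h u

/-- functionals and equal slopes -/
lemma IsFn.slp {p : ℝ → ℝ} (hp : IsFn b p) {z u v : ℝ} (hu : u ≠ z) (hv : v ≠ z) (huv : u ≠ v) (h : slp b z u = slp b z v) :
    (p u = 0 → p v = 0 → p z = 0) ∧ (p z = 0 → p u = 0 → p v = 0) := by
  have e1 := (fl_eq_iff b hu _).2 rfl
  have e2 := (fl_eq_iff b hv _).2 rfl
  rw [← h] at e2
  constructor
  · intro h1 h2
    rcases hp.line huv e1 e2 h1 h2 with h | h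
    · exact (h z).2 rfl
    · exact h z
  · intro h1 h2
    rcases hp.line hu.symm rfl e1 h1 h2 with h | h
    · exact (h v).2 e2
    · exact h v

/-- incidence with the line `L(j,i)` -/
def On (p q r : ℝ → ℝ) (f g : ℕ → ℝ) (a : ℝ) (j i : ℕ) : Prop := r a = p a * f j + q a * g i

variable (A b) in
structure Frame (x y x' y' : ℝ) (len : ℕ) (X Y : ℕ → ℝ) (p q r t : ℝ → ℝ) (f g : ℕ → ℝ) : Prop where
  fp : IsFn b p
  fq : IsFn b q
  fr : IsFn b r
  ft : IsFn b t
  p0 : ∀ a, p a = 0 ↔ fl b a x' = y'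
  q0 : ∀ a, q a = 0 ↔ fl b a x = y
  finj : ∀ i j, f i = f j → i = j
  ginj : ∀ i j, g i = g j → i = j
  noz : ∀ a, p a = 0 → q a = 0 → r a = 0 → False
  hX : ∀ j < len, r (X j) = p (X j) * f j
  hY : ∀ j < len, r (Y j) = q (Y j) * g j
  ht : ∀ a j k, On p q r f g a j (j + k) → On p q r f g a (j + 1) (j + 1 + k) → t a = 0
  hb : ∀ a j k, t a = 0 → On p q r f g a j (j + k) → ∀ j', On p q r f g a j' (j' + k)
  hc1 : ∀ a j i, On p q r f g a (j + 1) (i + 1) → On p q r f g a (j + 2) i → On p q r f g a j (i + 2) →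
    ∀ j' i', j' + i' = j + i + 2 → On p q r f g a j' i'
  hc2 : ∀ a j i, On p q r f g a j i → On p q r f g a (j + 1) (i + 2) → On p q r f g a (j + 2) (i + 4) →
    ∀ j' i' : ℕ, (i' : ℤ) - 2 * j' = i - 2 * j → On p q r f g a j' i'
  htX : ∀ j < len, t (X j) ≠ 0

lemma exists_r0 {x y x' y' : ℝ} (hne : ¬ (x = x' ∧ y = y')) : ∃ r, IsFn b r ∧
    (∀ a, fl b a x' - y' = 0 → fl b a x - y = 0 → r a ≠ 0) ∧
    (∀ a c, fl b a x - y = 0 → fl b c x - y = 0 → fl b a x' - y' ≠ 0 → fl b c x' - y' ≠ 0 →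
       r a * (fl b c x' - y') = r c * (fl b a x' - y') → a = c) ∧
    (∀ a c, fl b a x' - y' = 0 → fl b c x' - y' = 0 → fl b a x - y ≠ 0 → fl b c x - y ≠ 0 →
       r a * (fl b c x - y) = r c * (fl b a x - y) → a = c) := by
  by_cases hx : x = x'
  · subst hx
    have hy : y ≠ y' := fun h => hne ⟨rfl, h⟩
    refine ⟨fun a => a, ⟨0, 1, 0, fun a => by ring⟩, ?_, ?_, ?_⟩
    · intro a h1 h2; exfalso; apply hy; linarith
    · intro a c h1 h2 h3 h4 h5
      have h6 : (a - c) * (y - y') = 0 := by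
        linear_combination h5 - a * h2 + c * h1
      exact sub_eq_zero.1 ((mul_eq_zero.1 h6).resolve_right (sub_ne_zero.2 hy))
    · intro a c h1 h2 h3 h4 h5
      have h6 : (a - c) * (y - y') = 0 := by
        linear_combination -h5 + a * h2 - c * h1
      exact sub_eq_zero.1 ((mul_eq_zero.1 h6).resolve_right (sub_ne_zero.2 hy))
  · refine ⟨fun _ => 1, ⟨1, 0, 0, fun a => by ring⟩, fun _ _ _ => one_ne_zero, ?_, ?_⟩
    · intro a c h1 h2 h3 h4 h5
      unfold fl at *
      have h6 : (a - c) * (x - x') = 0 := by linear_combination h1 - h2 + h5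
      exact sub_eq_zero.1 ((mul_eq_zero.1 h6).resolve_right (sub_ne_zero.2 hx))
    · intro a c h1 h2 h3 h4 h5
      unfold fl at *
      have h6 : (a - c) * (x - x') = 0 := by linear_combination -h1 + h2 - h5
      exact sub_eq_zero.1 ((mul_eq_zero.1 h6).resolve_right (sub_ne_zero.2 hx))

end
end WS

namespace WS
noncomputable section
open scoped Classical
open Finset MvPolynomial

variable {A : Finset ℝ} {b : ℝ → ℝ}

lemma seq_form {η ξ : ℕ → ℝ} {len : ℕ} (hlen : 3 ≤ len) {p0 q0 r0 p1 q1 r1 : ℝ} (hp0 : p0 ≠ 0) (hq0 : q0 ≠ 0)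
    (hp1 : p1 ≠ 0) (hq1 : q1 ≠ 0) (h0 : ∀ j < len, r0 = η j * p0 + ξ j * q0)
    (h1 : ∀ j, j + 1 < len → r1 = η j * p1 + ξ (j + 1) * q1)
    (hinj : ∀ i < len, ∀ j < len, η i = η j → i = j) :
    ∃ c d α β, α ≠ 0 ∧ β ≠ 0 ∧ ((∃ μ : ℝ, μ ≠ 0 ∧ μ ^ 2 ≠ 1 ∧ ∀ j < len, η j = c + α * μ ^ j ∧ ξ j = d + β * μ ^ j) ∨
      (∀ j < len, η j = c + α * j ∧ ξ j = d - β * j)) := by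
  set μ := p1 * q0 / (q1 * p0) with hμ
  set ν := (r0 * q1 - r1 * q0) / (q1 * p0) with hν
  have hμ0 : μ ≠ 0 := div_ne_zero (mul_ne_zero hp1 hq0) (mul_ne_zero hq1 hp0)
  have hrec : ∀ j, j + 1 < len → η (j + 1) = μ * η j + ν := by
    intro j hj
    have e1 := h0 (j + 1) hj
    have e2 := h1 j hj
    rw [hμ, hν]
    field_simp
    rw [e2]; linear_combination (-q1) * e1
  have hξ : ∀ j < len, ξ j = (r0 - η j * p0) / q0 := by
    intro j hj
    rw [eq_div_iff hq0]; linarith [h0 j hj]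
  by_cases hm : μ = 1
  · have hν0 : ν ≠ 0 := by
      intro h
      have := hrec 0 (by omega)
      rw [hm, h] at this
      have := hinj 1 (by omega) 0 (by omega) (by simpa using this)
      omega
    have hη : ∀ j < len, η j = η 0 + ν * j := by
      intro j
      induction j with
      | zero => intro; simp
      | succ j ih => intro hj; rw [hrec j hj, ih (by omega), hm]; push_cast; ring
    refine ⟨η 0, (r0 - η 0 * p0) / q0, ν, p0 * ν / q0, hν0, div_ne_zero (mul_ne_zero hp0 hν0) hq0, Or.inr fun j hj => ⟨hη j hj, ?_⟩⟩
    rw [hξ j hj, hη j hj]; field_simp; ring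
  · have hm1 : 1 - μ ≠ 0 := sub_ne_zero.2 (Ne.symm hm)
    set c := ν / (1 - μ) with hc
    have hcf : c = μ * c + ν := by rw [hc]; field_simp; ring
    have hη : ∀ j < len, η j = c + (η 0 - c) * μ ^ j := by
      intro j
      induction j with
      | zero => intro; simp
      | succ j ih => intro hj; rw [hrec j hj, ih (by omega)]; rw [pow_succ]; linear_combination -hcf
    have hα : η 0 - c ≠ 0 := by
      intro h
      have e := hη 1 (by omega)
      rw [h] at e
      have := hinj 1 (by omega) 0 (by omega) (by linarith)
      omega
    have hsq : μ ^ 2 ≠ 1 := by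
      intro h
      have e := hη 2 (by omega)
      rw [h] at e
      have := hinj 2 (by omega) 0 (by omega) (by linarith)
      omega
    refine ⟨c, (r0 - c * p0) / q0, η 0 - c, -(p0 * (η 0 - c) / q0), hα, neg_ne_zero.2 (div_ne_zero (mul_ne_zero hp0 hα) hq0),
      Or.inl ⟨μ, hμ0, hsq, fun j hj => ⟨hη j hj, ?_⟩⟩⟩
    rw [hξ j hj, hη j hj]; field_simp; ring

lemma pow_inj_of {μ : ℝ} (h0 : μ ≠ 0) (h2 : μ ^ 2 ≠ 1) : ∀ i j, μ ^ i = μ ^ j → i = j := by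
  have key : ∀ i d, μ ^ i = μ ^ (i + d) → d = 0 := by
    intro i d h
    rw [pow_add] at h
    have h1 : μ ^ d = 1 := by
      have : μ ^ i * (μ ^ d - 1) = 0 := by linear_combination -h
      have := (mul_eq_zero.1 this).resolve_left (pow_ne_zero _ h0)
      linarith
    rcases pow_eq_one_iff_cases.1 h1 with h | h | h
    · exact h
    · rw [h] at h2; norm_num at h2
    · rw [h.1] at h2; norm_num at h2
  intro i j h
  rcases Nat.le_total i j with hij | hij
  · obtain ⟨d, rfl⟩ := Nat.exists_eq_add_of_le hij
    rw [key i d h]; rfl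
  · obtain ⟨d, rfl⟩ := Nat.exists_eq_add_of_le hij
    rw [key j d h.symm]; rfl

theorem frame_exists {x y x' y' : ℝ} (hne : ¬ (x = x' ∧ y = y')) (hc : 4 ≤ (Lp A b x y).card) (hc' : 4 ≤ (Lp A b x' y').card)
    {len : ℕ} (hlen : 3 ≤ len) {X Y Z : ℕ → ℝ} (I : Ini A b x y x' y' len X Y Z) :
    ∃ p q r t f g, Frame b x y x' y' len X Y p q r t f g := by
  obtain ⟨r0, fr0, hr1, hr2, hr3⟩ := exists_r0 (b := b) hne
  set p1 : ℝ → ℝ := fun a => fl b a x' - y' with hp1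
  set q1 : ℝ → ℝ := fun a => fl b a x - y with hq1
  have fp1 : IsFn b p1 := isFn_fl _ _
  have fq1 : IsFn b q1 := isFn_fl _ _
  have Xq : ∀ j < len, q1 (X j) = 0 := fun j hj => sub_eq_zero.2 (I.onX j hj)
  have Yp : ∀ j < len, p1 (Y j) = 0 := fun j hj => sub_eq_zero.2 (I.onY j hj)
  have Xp : ∀ j < len, p1 (X j) ≠ 0 := fun j hj h =>
    (I.tri j 0 (by omega) (by omega)).rot.rot.not_line hc' ⟨sub_eq_zero.1 h, I.onY j hj⟩
  have Yq : ∀ j < len, q1 (Y j) ≠ 0 := fun j hj h =>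
    (I.tri j 0 (by omega) (by omega)).rot.rot.not_line hc ⟨I.onX j hj, sub_eq_zero.1 h⟩
  have Zq : ∀ k < 2, q1 (Z k) ≠ 0 := fun k hk h =>
    (I.tri 0 k (by omega) (by omega)).not_line hc ⟨sub_eq_zero.1 h, I.onX 0 (by omega)⟩
  have Zp : ∀ k < 2, p1 (Z k) ≠ 0 := fun k hk h =>
    (I.tri 0 k (by omega) (by omega)).swap23.not_line hc' ⟨sub_eq_zero.1 h, I.onY _ (by omega)⟩
  have rel : ∀ j k, k < 4 → j + k < len → r0 (Z k) = r0 (X j) / p1 (X j) * p1 (Z k) + r0 (Y (j+k)) / q1 (Y (j+k)) * q1 (Z k) := by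
    intro j k hk hjk
    have := (fr0.comb fp1 fq1 1 (-(r0 (X j) / p1 (X j))) (-(r0 (Y (j+k)) / q1 (Y (j+k))))).tri (I.tri j k hk hjk)
      (by rw [Xq j (by omega)]; have := Xp j (by omega); field_simp; ring)
      (by rw [Yp _ hjk]; have := Yq _ hjk; field_simp; ring)
    linarith
  obtain ⟨c, d, α, β, hα, hβ, hform⟩ := seq_form (η := fun j => r0 (X j) / p1 (X j)) (ξ := fun j => r0 (Y j) / q1 (Y j)) hlen
    (Zp 0 (by omega)) (Zq 0 (by omega)) (Zp 1 (by omega)) (Zq 1 (by omega)) (fun j hj => rel j 0 (by omega) hj)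
    (fun j hj => rel j 1 (by omega) hj) (by
      intro i hi j hj h
      refine I.Xinj i hi j hj (hr2 _ _ (Xq i hi) (Xq j hj) (Xp i hi) (Xp j hj) ?_)
      have := (div_eq_div_iff (Xp i hi) (Xp j hj)).1 h
      exact this)
  set p : ℝ → ℝ := fun a => α * p1 a with hp
  set q : ℝ → ℝ := fun a => β * q1 a with hq
  set r : ℝ → ℝ := fun a => r0 a - c * p1 a - d * q1 a with hr
  have fp : IsFn b p := by
    have := fp1.comb fq1 fr0 α 0 0
    convert this using 2; rw [hp]; ring
  have fq : IsFn b q := by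
    have := fp1.comb fq1 fr0 0 β 0
    convert this using 2; rw [hq]; ring
  have fr : IsFn b r := by
    have := fp1.comb fq1 fr0 (-c) (-d) 1
    convert this using 2; rw [hr]; ring
  have hp0 : ∀ a, p a = 0 ↔ fl b a x' = y' := by
    intro a; simp only [hp, hp1, mul_eq_zero, hα, false_or, sub_eq_zero]
  have hq0 : ∀ a, q a = 0 ↔ fl b a x = y := by
    intro a; simp only [hq, hq1, mul_eq_zero, hβ, false_or, sub_eq_zero]
  have noz : ∀ a, p a = 0 → q a = 0 → r a = 0 → False := by
    intro a h1 h2 h3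
    have k1 : p1 a = 0 := sub_eq_zero.2 ((hp0 a).1 h1)
    have k2 : q1 a = 0 := sub_eq_zero.2 ((hq0 a).1 h2)
    refine hr1 a k1 k2 ?_
    simp only [hr, k1, k2] at h3
    linarith
  have XpN : ∀ j < len, p (X j) ≠ 0 := fun j hj => mul_ne_zero hα (Xp j hj)
  have hXf : ∀ (f : ℕ → ℝ), (∀ j < len, r0 (X j) / p1 (X j) = c + α * f j) → ∀ j < len, r (X j) = p (X j) * f j := by
    intro f hf j hj
    have h1 := hf j hj
    rw [div_eq_iff (Xp j hj)] at h1
    simp only [hr, hp, Xq j hj, h1]; ring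
  have hYf : ∀ (g : ℕ → ℝ), (∀ j < len, r0 (Y j) / q1 (Y j) = d + β * g j) → ∀ j < len, r (Y j) = q (Y j) * g j := by
    intro g hg j hj
    have h1 := hg j hj
    rw [div_eq_iff (Yq j hj)] at h1
    simp only [hr, hq, Yp j hj, h1]; ring
  rcases hform with ⟨μ, hμ0, hμ2, hform⟩ | hform
  · have hμ1 : μ - 1 ≠ 0 := by intro h; apply hμ2; rw [sub_eq_zero.1 h]; norm_num
    have hμ2' : μ ^ 2 - 1 ≠ 0 := sub_ne_zero.2 hμ2
    have hXr := hXf (fun j => μ ^ j) (fun j hj => (hform j hj).1)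
    refine ⟨p, q, r, r, fun j => μ ^ j, fun j => μ ^ j, fp, fq, fr, fr, hp0, hq0, pow_inj_of hμ0 hμ2, pow_inj_of hμ0 hμ2, noz,
      hXr, hYf _ (fun j hj => (hform j hj).2), ?_, ?_, ?_, ?_, ?_⟩
    · intro a j k h1 h2
      simp only [On] at h1 h2
      have : r a * (μ - 1) = 0 := by
        rw [show j + 1 + k = (j + k) + 1 by ring, pow_succ, pow_succ] at h2
        linear_combination μ * h1 - h2
      exact (mul_eq_zero.1 this).resolve_right hμ1
    · intro a j k h1 h2 j'
      simp only [On] at h2 ⊢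
      rw [h1] at h2 ⊢
      rw [pow_add] at h2 ⊢
      have : μ ^ j * (p a + q a * μ ^ k) = 0 := by linear_combination -h2
      have := (mul_eq_zero.1 this).resolve_left (pow_ne_zero _ hμ0)
      linear_combination -(μ ^ j') * this
    · intro a j i h1 h2 h3
      exfalso
      simp only [On] at h1 h2 h3
      simp only [pow_succ] at h1 h2 h3
      have e1 : (p a * μ ^ j - q a * μ ^ i) * (μ ^ 2 - 1) = 0 := by linear_combination h3 - h2
      have e2 := (mul_eq_zero.1 e1).resolve_right hμ2'
      have e3 : (p a * μ ^ j) * ((μ - 1) * (μ - 1)) = 0 := by linear_combination h1 - h2 + (1 - μ) * e2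
      have e4 := (mul_eq_zero.1 e3).resolve_right (mul_ne_zero hμ1 hμ1)
      have e5 : q a * μ ^ i = 0 := by linarith
      refine noz a ((mul_eq_zero.1 e4).resolve_right (pow_ne_zero _ hμ0)) ((mul_eq_zero.1 e5).resolve_right (pow_ne_zero _ hμ0)) ?_
      linear_combination h1 + μ * e4 + μ * e5
    · intro a j i h1 h2 h3
      exfalso
      simp only [On] at h1 h2 h3
      simp only [pow_succ] at h1 h2 h3
      set P := p a * μ ^ j with hP
      set Q := q a * μ ^ i with hQ
      have g1 : r a = P + Q := by linear_combination h1
      have g2 : r a = P * μ + Q * μ ^ 2 := by linear_combination h2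
      have g3 : r a = P * μ ^ 2 + Q * μ ^ 4 := by linear_combination h3
      have e1 : P + Q * (μ + 1) = 0 := by
        have : (P + Q * (μ + 1)) * (μ - 1) = 0 := by linear_combination g1 - g2
        exact (mul_eq_zero.1 this).resolve_right hμ1
      have e2 : P + Q * (μ ^ 2 + 1) = 0 := by
        have : (P + Q * (μ ^ 2 + 1)) * (μ ^ 2 - 1) = 0 := by linear_combination g1 - g3
        exact (mul_eq_zero.1 this).resolve_right hμ2'
      have e3 : Q = 0 := by
        have : Q * (μ * (μ - 1)) = 0 := by linear_combination e2 - e1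
        exact (mul_eq_zero.1 this).resolve_right (mul_ne_zero hμ0 hμ1)
      have e4 : P = 0 := by rw [e3] at e1; linarith
      exact noz a ((mul_eq_zero.1 e4).resolve_right (pow_ne_zero _ hμ0)) ((mul_eq_zero.1 e3).resolve_right (pow_ne_zero _ hμ0)) (by rw [g1, e3, e4]; ring)
    · intro j hj
      rw [hXr j hj]; exact mul_ne_zero (XpN j hj) (pow_ne_zero _ hμ0)
  · have ft : IsFn b (fun a => p a - q a) := by
      have := fp.comb fq fr 1 (-1) 0
      convert this using 2; ring
    refine ⟨p, q, r, fun a => p a - q a, fun j => (j : ℝ), fun j => -(j : ℝ), fp, fq, fr, ft, hp0, hq0, fun i j h => by exact_mod_cast h,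
      fun i j h => by exact_mod_cast neg_injective h, noz,
      hXf _ (fun j hj => (hform j hj).1), hYf _ (fun j hj => by rw [(hform j hj).2]; ring), ?_, ?_, ?_, ?_, ?_⟩
    · intro a j k h1 h2
      simp only [On] at h1 h2
      push_cast at h1 h2
      show p a - q a = 0
      linear_combination h1 - h2
    · intro a j k h1 h2 j'
      simp only [On] at h2 ⊢
      have h1 : p a - q a = 0 := h1
      push_cast at h2 ⊢
      linear_combination h2 + ((j:ℝ) - j') * h1
    · intro a j i h1 h2 h3 j' i' h
      simp only [On] at *
      push_cast at h1 h2 h3 ⊢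
      have e : p a + q a = 0 := by linear_combination h1 - h2
      have h' : (j' : ℝ) + i' = j + i + 2 := by exact_mod_cast h
      linear_combination h1 - p a * h' + ((i':ℝ) - i - 1) * e
    · intro a j i h1 h2 h3 j' i' h
      simp only [On] at *
      push_cast at h1 h2 h3 ⊢
      have e : p a - 2 * q a = 0 := by linear_combination h1 - h2
      have h' : (i' : ℝ) - 2 * j' = i - 2 * j := by exact_mod_cast h
      linear_combination h1 + q a * h' + ((j:ℝ) - j') * e
    · intro j hj
      show p (X j) - q (X j) ≠ 0
      have : q (X j) = 0 := by simp only [hq, Xq j hj, mul_zero]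
      rw [this, sub_zero]; exact XpN j hj

end
end WS

namespace WS
noncomputable section
open scoped Classical
open Finset MvPolynomial

variable {A : Finset ℝ} {b : ℝ → ℝ}

lemma tri_three {z c d e w : ℝ} {φ : ℝ → ℝ} (hφ : IsFn b φ) (h : Tri A b z c d) (hw : φ w ≠ 0) (hc : φ c = 0) (hd : φ d = 0)
    (he : φ e = 0) (heA : e ∈ A) : e = z ∨ e = c ∨ e = d := by
  obtain ⟨hu, hv, hw', huv, huw, hvw, x, y, hxy⟩ := h
  have e1 := (hxy c hv).2 (Or.inr (Or.inl rfl))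
  have e2 := (hxy d hw').2 (Or.inr (Or.inr rfl))
  rcases hφ.line hvw e1 e2 hc hd with h | h
  · exact (hxy e heA).1 ((h e).1 he)
  · exact absurd (h w) hw

lemma tri_unique {z z' c d : ℝ} (h : Tri A b z c d) (h' : Tri A b z' c d) : z = z' := by
  obtain ⟨hu, hv, hw, huv, huw, hvw, x, y, hxy⟩ := h
  have e1 := (hxy c hv).2 (Or.inr (Or.inl rfl))
  have e2 := (hxy d hw).2 (Or.inr (Or.inr rfl))
  have e3 := (h'.swap12.swap23.line e1 e2 z hu).1 ((hxy z hu).2 (Or.inl rfl))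
  rcases e3 with e | e | e
  · exact absurd e huv
  · exact absurd e huw
  · exact e

/-- good pair with known neighbours -/
lemma gd_known {S2 S : Finset ℝ} {a c a1 a2 c1 c2 : ℝ} (h : GdP A b S2 S a c) (h1 : Nb S2 a a1) (h2 : Nb S2 a a2) (h12 : a1 ≠ a2)
    (k1 : Nb S c c1) (k2 : Nb S c c2) (k12 : c1 ≠ c2) : ∃ z, Tri A b z a c ∧ z ∉ S2 ∧ z ∉ S ∧
      ((slp b z a1 = slp b z c1 ∧ slp b z a2 = slp b z c2) ∨ (slp b z a1 = slp b z c2 ∧ slp b z a2 = slp b z c1)) := by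
  obtain ⟨z, q1, q2, q1', q2', hT, n1, n2, n12, m1, m2, m12, s1, s2, z1, z2⟩ := h
  refine ⟨z, hT, z1, z2, ?_⟩
  have A1 := nb_unique n1 n2 h1 n12
  have A2 := nb_unique n1 n2 h2 n12
  have C1 := nb_unique m1 m2 k1 m12
  have C2 := nb_unique m1 m2 k2 m12
  rcases A1 with rfl | rfl <;> rcases A2 with rfl | rfl <;> rcases C1 with rfl | rfl <;> rcases C2 with rfl | rfl <;>
    simp_all

lemma gd_apex {S2 S : Finset ℝ} {a c c1 c2 v : ℝ} (h : GdP A b S2 S a c) (hv : Tri A b v a c)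
    (k1 : Nb S c c1) (k2 : Nb S c c2) (k12 : c1 ≠ c2) : v ∉ S2 ∧ v ∉ S ∧ ∃ a1 a2, Nb S2 a a1 ∧ Nb S2 a a2 ∧
      slp b v a1 = slp b v c1 ∧ slp b v a2 = slp b v c2 := by
  obtain ⟨z, q1, q2, q1', q2', hT, n1, n2, n12, m1, m2, m12, s1, s2, z1, z2⟩ := h
  obtain rfl := tri_unique hT hv
  refine ⟨z1, z2, ?_⟩
  have C1 := nb_unique m1 m2 k1 m12
  have C2 := nb_unique m1 m2 k2 m12
  rcases C1 with rfl | rfl <;> rcases C2 with rfl | rfl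
  · exact absurd rfl k12
  · exact ⟨q1, q2, n1, n2, s1, s2⟩
  · exact ⟨q2, q1, n2, n1, s2, s1⟩
  · exact absurd rfl k12

section fr
variable {x y x' y' : ℝ} {len : ℕ} {X Y Z : ℕ → ℝ} {p q r t : ℝ → ℝ} {f g : ℕ → ℝ}

variable (A) in
def isG (p q r : ℝ → ℝ) (g : ℕ → ℝ) (i : ℕ) (a : ℝ) : Prop := a ∈ A ∧ p a = 0 ∧ r a = q a * g i

variable (A) in
def isV (p q r t : ℝ → ℝ) (f g : ℕ → ℝ) (k : ℕ) (a : ℝ) : Prop := a ∈ A ∧ t a = 0 ∧ ∀ j, On p q r f g a j (j + k)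

lemma Frame.onfn (F : Frame b x y x' y' len X Y p q r t f g) (j i : ℕ) : ∃ φ, IsFn b φ ∧ ∀ a, φ a = 0 ↔ On p q r f g a j i := by
  refine ⟨_, F.fr.comb F.fp F.fq 1 (-f j) (-g i), fun a => ?_⟩
  simp only [On]
  constructor <;> intro h <;> linarith

lemma Frame.Gq (F : Frame b x y x' y' len X Y p q r t f g) {i : ℕ} {a : ℝ} (h : isG A p q r g i a) : q a ≠ 0 := by
  intro h0
  exact F.noz a h.2.1 h0 (by rw [h.2.2, h0, zero_mul])

lemma Frame.Gon (_F : Frame b x y x' y' len X Y p q r t f g) {i : ℕ} {a : ℝ} (h : isG A p q r g i a) (j : ℕ) : On p q r f g a j i := by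
  rw [On, h.2.1, h.2.2]; ring

lemma Frame.G_of_on (_F : Frame b x y x' y' len X Y p q r t f g) {i j : ℕ} {a : ℝ} (hA : a ∈ A) (hp : p a = 0) (h : On p q r f g a j i) :
    isG A p q r g i a := by
  rw [On, hp] at h
  exact ⟨hA, hp, by rw [h]; ring⟩

lemma Frame.Vq (F : Frame b x y x' y' len X Y p q r t f g) {k : ℕ} {a : ℝ} (h : isV A p q r t f g k a) : q a ≠ 0 := by
  intro h0
  have h1 := h.2.2 0
  have h2 := h.2.2 1
  rw [On, h0] at h1 h2
  have h3 : p a * (f 0 - f 1) = 0 := by linarith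
  have h4 : p a = 0 := (mul_eq_zero.1 h3).resolve_right (fun h => by have := F.finj 0 1 (by linarith); omega)
  rw [h4] at h1
  exact F.noz a h4 h0 (by linarith)

lemma Frame.Xq (F : Frame b x y x' y' len X Y p q r t f g) (I : Ini A b x y x' y' len X Y Z) {j : ℕ} (hj : j < len) : q (X j) = 0 :=
  (F.q0 _).2 (I.onX j hj)

lemma Frame.Xp (F : Frame b x y x' y' len X Y p q r t f g) (I : Ini A b x y x' y' len X Y Z) {j : ℕ} (hj : j < len) : p (X j) ≠ 0 := by
  intro h
  exact F.noz _ h (F.Xq I hj) (by rw [F.hX j hj, h, zero_mul])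

lemma Frame.Xon (F : Frame b x y x' y' len X Y p q r t f g) (I : Ini A b x y x' y' len X Y Z) {j : ℕ} (hj : j < len) (i : ℕ) :
    On p q r f g (X j) j i := by
  rw [On, F.Xq I hj, F.hX j hj]; ring

lemma Frame.Yg (F : Frame b x y x' y' len X Y p q r t f g) (I : Ini A b x y x' y' len X Y Z) {j : ℕ} (hj : j < len) :
    isG A p q r g j (Y j) :=
  ⟨(I.tri j 0 (by omega) (by omega)).2.2.1, (F.p0 _).2 (I.onY j hj), F.hY j hj⟩

lemma Frame.XA (_F : Frame b x y x' y' len X Y p q r t f g) (I : Ini A b x y x' y' len X Y Z) {j : ℕ} (hj : j < len) : X j ∈ A :=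
  (I.tri j 0 (by omega) (by omega)).2.1

lemma Frame.Zv (F : Frame b x y x' y' len X Y p q r t f g) (I : Ini A b x y x' y' len X Y Z) (hlen : 5 ≤ len) {k : ℕ} (hk : k < 4) :
    isV A p q r t f g k (Z k) := by
  have h : ∀ j, j < 2 → On p q r f g (Z k) j (j + k) := by
    intro j hj
    obtain ⟨φ, h1, h2⟩ := F.onfn j (j + k)
    have hjk : j + k < len := by omega
    rw [← h2]
    exact h1.tri (I.tri j k hk hjk) ((h2 _).2 (F.Xon I (by omega) _)) ((h2 _).2 (F.Gon (F.Yg I hjk) _))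
  have ht := F.ht _ 0 k (h 0 (by omega)) (h 1 (by omega))
  exact ⟨(I.tri 0 k hk (by omega)).1, ht, F.hb _ 0 k ht (h 0 (by omega))⟩

/-- `φ` for `L(j,i)` is nontrivial -/
lemma Frame.nontriv (F : Frame b x y x' y' len X Y p q r t f g) (I : Ini A b x y x' y' len X Y Z) (hlen : 5 ≤ len) (j i : ℕ) :
    ∃ w, ¬ On p q r f g w j i := by
  by_cases h : j = 0
  · refine ⟨X 1, fun h1 => ?_⟩
    rw [On, F.Xq I (by omega), F.hX 1 (by omega)] at h1
    have h3 : p (X 1) * (f 1 - f j) = 0 := by linarith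
    have := F.finj 1 j (sub_eq_zero.1 ((mul_eq_zero.1 h3).resolve_left (F.Xp I (by omega))))
    omega
  · refine ⟨X 0, fun h1 => ?_⟩
    rw [On, F.Xq I (by omega), F.hX 0 (by omega)] at h1
    have h3 : p (X 0) * (f 0 - f j) = 0 := by linarith
    have := F.finj 0 j (sub_eq_zero.1 ((mul_eq_zero.1 h3).resolve_left (F.Xp I (by omega))))
    omega

/-- transport of incidence along equal slopes -/
lemma Frame.see (F : Frame b x y x' y' len X Y p q r t f g) {z u v : ℝ} (hu : u ≠ z) (hv : v ≠ z) (huv : u ≠ v)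
    (h : slp b z u = slp b z v) {j i : ℕ} :
    (On p q r f g u j i → On p q r f g v j i → On p q r f g z j i) ∧ (On p q r f g z j i → On p q r f g v j i → On p q r f g u j i) := by
  obtain ⟨φ, h1, h2⟩ := F.onfn j i
  rw [← h2, ← h2, ← h2]
  exact ⟨(h1.slp hu hv huv h).1, (h1.slp hv hu huv.symm h.symm).2⟩

lemma Frame.see_tri (F : Frame b x y x' y' len X Y p q r t f g) {z u v : ℝ} (h : Tri A b z u v) {j i : ℕ}
    (hu : On p q r f g u j i) (hv : On p q r f g v j i) : On p q r f g z j i := by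
  obtain ⟨φ, h1, h2⟩ := F.onfn j i
  rw [← h2]
  exact h1.tri h ((h2 _).2 hu) ((h2 _).2 hv)

lemma Frame.dist (F : Frame b x y x' y' len X Y p q r t f g) (I : Ini A b x y x' y' len X Y Z) {j i i2 : ℕ} (hj : j < len) {a : ℝ}
    (h1 : On p q r f g a (j + 1) i2) (n1 : i2 ≠ i) (n2 : i2 ≠ i + 1) : a ≠ X j ∧ (∀ c, isG A p q r g i c → a ≠ c) ∧
      ∀ c k, i = j + k → isV A p q r t f g k c → a ≠ c := by
  refine ⟨?_, ?_, ?_⟩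
  · rintro rfl
    rw [On, F.Xq I hj, F.hX j hj] at h1
    have h3 : p (X j) * (f j - f (j + 1)) = 0 := by linarith
    have := F.finj _ _ (sub_eq_zero.1 ((mul_eq_zero.1 h3).resolve_left (F.Xp I hj)))
    omega
  · rintro c hc rfl
    rw [On, hc.2.1, hc.2.2] at h1
    have h3 : q a * (g i - g i2) = 0 := by linarith
    have := F.ginj _ _ (sub_eq_zero.1 ((mul_eq_zero.1 h3).resolve_left (F.Gq hc)))
    omega
  · rintro c k hk hc rfl
    have h2 := hc.2.2 (j + 1)
    rw [On] at h1 h2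
    have h3 : q a * (g (j + 1 + k) - g i2) = 0 := by linarith
    have := F.ginj _ _ (sub_eq_zero.1 ((mul_eq_zero.1 h3).resolve_left (F.Vq hc)))
    omega

lemma Frame.Gu (F : Frame b x y x' y' len X Y p q r t f g) {i i' : ℕ} {a : ℝ} (h : isG A p q r g i a) (h' : isG A p q r g i' a) : i = i' := by
  have h3 : q a * (g i - g i') = 0 := by rw [mul_sub, ← h.2.2, ← h'.2.2, sub_self]
  exact F.ginj _ _ (sub_eq_zero.1 ((mul_eq_zero.1 h3).resolve_left (F.Gq h)))

lemma Frame.Vu (F : Frame b x y x' y' len X Y p q r t f g) {i i' : ℕ} {a : ℝ} (h : isV A p q r t f g i a) (h' : isV A p q r t f g i' a) : i = i' := by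
  have h1 := h.2.2 0
  have h2 := h'.2.2 0
  rw [On, zero_add] at h1 h2
  have h3 : q a * (g i - g i') = 0 := by linarith
  exact F.ginj _ _ (sub_eq_zero.1 ((mul_eq_zero.1 h3).resolve_left (F.Vq h)))

/-- index sets for nongood pairs -/
lemma idx_set {α : Type*} {len : ℕ} {X : ℕ → α} (hX : ∀ i < len, ∀ j < len, X i = X j → i = j) (D : ℕ → α → Prop)
    (hD : ∀ i i' a, D i a → D i' a → i = i') (NG : Finset (α × α)) : ∃ N : Finset (ℕ × ℕ), N.card ≤ NG.card ∧
      (∀ i a j, D i a → j < len → (a, X j) ∈ NG → (i, j) ∈ N) := by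
  refine ⟨NG.image (fun c => (if h : ∃ i, D i c.1 then h.choose else 0, if h : ∃ j, j < len ∧ c.2 = X j then h.choose else 0)), card_image_le, ?_⟩
  intro i a j hi hj h
  refine mem_image.2 ⟨_, h, ?_⟩
  have e1 : ∃ i, D i a := ⟨i, hi⟩
  have e2 : ∃ j', j' < len ∧ X j = X j' := ⟨j, hj, rfl⟩
  simp only [dif_pos e1, dif_pos e2, Prod.mk.injEq]
  exact ⟨hD _ _ _ e1.choose_spec hi, (hX j hj _ e2.choose_spec.1 e2.choose_spec.2).symm⟩

end fr
end
end WS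

namespace WS
noncomputable section
open scoped Classical
open Finset MvPolynomial

variable {A : Finset ℝ} {b : ℝ → ℝ}

theorem caseC_core {x y x' y' : ℝ} (hne : ¬ (x = x' ∧ y = y')) (hc : 4 ≤ (Lp A b x y).card) (hc' : 4 ≤ (Lp A b x' y').card)
    {w h : ℕ} (hw : 4 * h < w) (hB : 4 * (5 * (∑ a ∈ A, bd A b a) + 3 * A.card) ≤ h * w)
    {X Y Z : ℕ → ℝ} (I : Ini A b x y x' y' (8 * w + 5) X Y Z) : False := by
  set len := 8 * w + 5 with hlen
  have hlen5 : 5 ≤ len := by omega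
  obtain ⟨p, q, r, t, f, g, F⟩ := frame_exists hne hc hc' (by omega) I
  set x1 := slp b (Z 0) (Z 1) with hx1
  set y1 := fl b (Z 0) x1 with hy1
  have hZ01 : Z 1 ≠ Z 0 := fun e => by have := I.Zinj 1 (by omega) 0 (by omega) e; omega
  have ht0 : ∀ a, t a = 0 ↔ fl b a x1 = y1 := by
    rcases F.ft.line hZ01 ((fl_eq_iff b hZ01 _).2 rfl) rfl (F.Zv I hlen5 (k := 1) (by omega)).2.1 (F.Zv I hlen5 (k := 0) (by omega)).2.1 with h | h
    · exact h
    · exact absurd (h (X 0)) (F.htX 0 (by omega))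
  have hc1 : 4 ≤ (Lp A b x1 y1).card := by
    have : (range 4).image Z ⊆ Lp A b x1 y1 := by
      intro a ha
      obtain ⟨k, hk, rfl⟩ := mem_image.1 ha
      have := F.Zv I hlen5 (k := k) (mem_range.1 hk)
      exact mem_Lp.2 ⟨this.1, (ht0 _).1 this.2.1⟩
    have h2 := card_le_card this
    rwa [card_image_of_injOn, card_range] at h2
    intro i hi j hj e
    exact I.Zinj i (by simpa using hi) j (by simpa using hj) e
  have hne1 : ¬ (x1 = x ∧ y1 = y) := by
    rintro ⟨e1, e2⟩
    have := I.onX 0 (by omega)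
    rw [← e1, ← e2] at this
    exact F.htX 0 (by omega) ((ht0 _).2 this)
  set S := Lp A b x y with hS
  set S' := Lp A b x' y' with hS'
  set S1 := Lp A b x1 y1 with hS1
  have hne' : ¬ (x' = x ∧ y' = y) := fun e => hne ⟨e.1.symm, e.2.symm⟩
  obtain ⟨N1, hN1c, hN1⟩ := idx_set I.Xinj (isG A p q r g) (fun i i' a => F.Gu)
    ((PQ A b x' y' x y).filter (fun p => ¬ GdP A b S' S p.1 p.2))
  obtain ⟨N2, hN2c, hN2⟩ := idx_set I.Xinj (isV A p q r t f g) (fun i i' a => F.Vu)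
    ((PQ A b x1 y1 x y).filter (fun p => ¬ GdP A b S1 S p.1 p.2))
  have hN1c' := hN1c.trans (nongood hne' hc' hc)
  have hN2c' := hN2c.trans (nongood hne1 hc1 hc)
  clear hN1c hN2c
  have hN1' : ∀ i a j, isG A p q r g i a → j < len → ¬ GdP A b S' S a (X j) → (i, j) ∈ N1 := by
    intro i a j hi hj hg
    refine hN1 i a j hi hj (mem_filter.2 ⟨mem_PQ.2 ⟨⟨hi.1, (F.p0 _).1 hi.2.1, fun e => F.Gq hi ((F.q0 _).2 e)⟩,
      F.XA I hj, I.onX j hj, fun e => F.Xp I hj ((F.p0 _).2 e)⟩, hg⟩)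
  have hN2' : ∀ k a j, isV A p q r t f g k a → j < len → ¬ GdP A b S1 S a (X j) → (k, j) ∈ N2 := by
    intro i a j hi hj hg
    refine hN2 i a j hi hj (mem_filter.2 ⟨mem_PQ.2 ⟨⟨hi.1, (ht0 _).1 hi.2.1, fun e => F.Vq hi ((F.q0 _).2 e)⟩,
      F.XA I hj, I.onX j hj, fun e => F.htX j hj ((ht0 _).2 e)⟩, hg⟩)
  clear hN1 hN2
  have memS' : ∀ i a, isG A p q r g i a → a ∈ S' := fun i a h => mem_Lp.2 ⟨h.1, (F.p0 _).1 h.2.1⟩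
  have memS1 : ∀ i a, isV A p q r t f g i a → a ∈ S1 := fun i a h => mem_Lp.2 ⟨h.1, (ht0 _).1 h.2.1⟩
  have memS : ∀ j, j < len → X j ∈ S := fun j hj => mem_Lp.2 ⟨F.XA I hj, I.onX j hj⟩
  have neqX : ∀ a j, j < len → q a ≠ 0 → a ≠ X j := by
    rintro a j hj h rfl; exact h (F.Xq I hj)
  have qS' : ∀ a ∈ S', p a = 0 := fun a ha => (F.p0 _).2 (mem_Lp.1 ha).2
  have qS1 : ∀ a ∈ S1, t a = 0 := fun a ha => (ht0 _).2 (mem_Lp.1 ha).2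
  have nbs : ∀ j, 1 ≤ j → j < 8 * w → Nb S (X j) (X (j + 1)) ∧ Nb S (X j) (X (j - 1)) ∧ X (j + 1) ≠ X (j - 1) := by
    intro j h1 h2
    refine ⟨I.nbX j (by omega), ?_, fun e => ?_⟩
    · have := (I.nbX (j - 1) (by omega)).symm
      rwa [show j - 1 + 1 = j by omega] at this
    · have := I.Xinj _ (by omega) _ (by omega) e; omega
  -- the four predicates
  set xx : ℕ → Prop := fun i => ∃ a a1 a2, isG A p q r g i a ∧ isG A p q r g (i + 1) a1 ∧ isG A p q r g (i - 1) a2 ∧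
    Nb S' a a1 ∧ Nb S' a a2 with hxx
  set vv : ℕ → Prop := fun k => ∃ a a1 a2, isV A p q r t f g k a ∧ isV A p q r t f g (k + 1) a1 ∧ isV A p q r t f g (k - 1) a2 ∧
    Nb S1 a a1 ∧ Nb S1 a a2 with hvv
  set W1 : ℕ → Prop := fun l => ∃ a ∈ A, ∀ j i, j + i = l → On p q r f g a j i with hW1
  set W2 : ℤ → Prop := fun l => ∃ a ∈ A, ∀ j i : ℕ, (i : ℤ) - 2 * j = l → On p q r f g a j i with hW2
  have hfin : ∃ M, ∀ i, xx i → i < M := by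
    have hf : {i | xx i}.Finite := by
      have : ∀ i, xx i → ∃ a, isG A p q r g i a := fun i ⟨a, _, _, h, _⟩ => ⟨a, h⟩
      choose! G hG using this
      refine Set.Finite.of_injOn (f := G) (t := (A : Set ℝ)) (fun i hi => mem_coe.2 (hG i hi).1) ?_ A.finite_toSet
      intro i hi j hj e
      have h1 := hG i hi
      rw [e] at h1
      exact F.Gu h1 (hG j hj)
    obtain ⟨M, hM⟩ := hf.bddAbove
    exact ⟨M + 1, fun i hi => Nat.lt_succ_of_le (hM hi)⟩
  obtain ⟨M, hM⟩ := hfin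
  refine win xx vv W1 W2 N1 N2 w _ h M hw hB hN1c' hN2c' ?_ ?_ ?_ ?_ ?_ ?_ hM
  · -- Hx0
    intro i h1 h2
    refine ⟨Y i, Y (i + 1), Y (i - 1), F.Yg I (by omega), F.Yg I (by omega), F.Yg I (by omega), I.nbY i (by omega), ?_⟩
    have := (I.nbY (i - 1) (by omega)).symm
    rwa [show i - 1 + 1 = i by omega] at this
  · -- H1
    rintro k j hk hj hjw ⟨a, a1, a2, ha, ha1, ha2, nb1, nb2⟩ hn2 hn1 hW
    obtain ⟨m1, m2, m12⟩ := nbs j hj hjw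
    have gd : GdP A b S1 S a (X j) := by
      by_contra hg; exact hn2 (hN2' k a j ha (by omega) hg)
    have a12 : a1 ≠ a2 := by rintro rfl; have := F.Vu ha1 ha2; omega
    obtain ⟨z, hT, z1, z2, hcase⟩ := gd_known gd nb1 nb2 a12 m1 m2 m12
    have ze : ∀ c ∈ S1, c ≠ z := by rintro c hc rfl; exact z1 hc
    have ze' : ∀ c ∈ S, c ≠ z := by rintro c hc rfl; exact z2 hc
    have o0 : On p q r f g z j (j + k) := F.see_tri hT (ha.2.2 j) (F.Xon I (by omega) _)
    rcases hcase with ⟨s1, s2⟩ | ⟨s1, s2⟩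
    · exfalso
      apply hW
      have o1 := (F.see (ze a1 (memS1 _ _ ha1)) (ze' _ (memS (j+1) (by omega))) (neqX _ _ (by omega) (F.Vq ha1)) s1).1
        (ha1.2.2 (j + 1)) (F.Xon I (by omega) _)
      have o2 := (F.see (ze a2 (memS1 _ _ ha2)) (ze' _ (memS (j-1) (by omega))) (neqX _ _ (by omega) (F.Vq ha2)) s2).1
        (ha2.2.2 (j - 1)) (F.Xon I (by omega) _)
      refine ⟨z, hT.1, fun j' i' hji => F.hc2 z (j - 1) (j - 1 + (k - 1)) o2 ?_ ?_ j' i' ?_⟩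
      · rwa [show j - 1 + 1 = j by omega, show j - 1 + (k - 1) + 2 = j + k by omega]
      · rwa [show j - 1 + 2 = j + 1 by omega, show j - 1 + (k - 1) + 4 = j + 1 + (k + 1) by omega]
      · rw [hji]; push_cast [hj, hk]; ring
    · have o1 := (F.see (ze a1 (memS1 _ _ ha1)) (ze' _ (memS (j-1) (by omega))) (neqX _ _ (by omega) (F.Vq ha1)) s1).1
        (ha1.2.2 (j - 1)) (F.Xon I (by omega) _)
      have o2 := (F.see (ze a2 (memS1 _ _ ha2)) (ze' _ (memS (j+1) (by omega))) (neqX _ _ (by omega) (F.Vq ha2)) s2).1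
        (ha2.2.2 (j + 1)) (F.Xon I (by omega) _)
      rw [show j - 1 + (k + 1) = j + k by omega] at o1
      rw [show j + 1 + (k - 1) = j + k by omega] at o2
      have hpz : p z = 0 := by
        rw [On] at o1 o2
        have h3 : p z * (f (j - 1) - f (j + 1)) = 0 := by linarith
        refine (mul_eq_zero.1 h3).resolve_right (fun e => ?_)
        have := F.finj _ _ (sub_eq_zero.1 e)
        omega
      have hz : isG A p q r g (k + j) z := by rw [add_comm]; exact F.G_of_on hT.1 hpz o0
      have gd' : GdP A b S' S z (X j) := by
        by_contra hg; exact hn1 (hN1' _ z j hz (by omega) hg)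
      obtain ⟨v1, v2, c1, c2, nc1, nc2, t1, t2⟩ := gd_apex gd' hT.swap12 m1 m2 m12
      have ve : ∀ c ∈ S', c ≠ a := by rintro c hc rfl; exact v1 hc
      have ve' : ∀ c ∈ S, c ≠ a := by rintro c hc rfl; exact v2 hc
      have hc12 : ∀ c i', c ∈ S' → i' < len → c ≠ X i' := by
        rintro c i' hc hi' rfl; exact F.Xp I hi' (qS' _ hc)
      have u1 := (F.see (ve c1 nc1.2.1) (ve' _ (memS (j+1) (by omega))) (hc12 c1 _ nc1.2.1 (by omega)) t1).2
        (ha.2.2 (j + 1)) (F.Xon I (by omega) _)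
      have u2 := (F.see (ve c2 nc2.2.1) (ve' _ (memS (j-1) (by omega))) (hc12 c2 _ nc2.2.1 (by omega)) t2).2
        (ha.2.2 (j - 1)) (F.Xon I (by omega) _)
      refine ⟨z, c1, c2, hz, ?_, ?_, nc1, nc2⟩
      · rw [show k + j + 1 = j + 1 + k by omega]; exact F.G_of_on (mem_Lp.1 nc1.2.1).1 (qS' _ nc1.2.1) u1
      · rw [show k + j - 1 = j - 1 + k by omega]; exact F.G_of_on (mem_Lp.1 nc2.2.1).1 (qS' _ nc2.2.1) u2
  · -- H1'
    rintro k j hk hj hjw ⟨e, heA, he⟩ ⟨a, -, -, ha, -⟩ ⟨c, -, -, hc, -⟩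
    refine hN2' k a j ha (by omega) ?_
    rintro ⟨z, -, -, -, -, hT, -⟩
    obtain ⟨φ, h1, h2⟩ := F.onfn j (j + k)
    obtain ⟨w0, hw0⟩ := F.nontriv I hlen5 j (j + k)
    rw [← h2] at hw0
    obtain ⟨d1, d2, d3⟩ := F.dist I (j := j) (i := j + k) (i2 := j + k + 2) (by omega) (a := e) (he _ _ (by push_cast; ring)) (by omega) (by omega)
    rw [add_comm] at hc
    have f1 := tri_three h1 hT hw0 ((h2 _).2 (ha.2.2 j)) ((h2 _).2 (F.Xon I (by omega) _)) ((h2 _).2 (he _ _ (by push_cast; ring))) heA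
    have f2 := tri_three h1 hT hw0 ((h2 _).2 (ha.2.2 j)) ((h2 _).2 (F.Xon I (by omega) _)) ((h2 _).2 (F.Gon hc j)) hc.1
    have g1 := (f1.resolve_right (by rw [not_or]; exact ⟨d3 a k rfl ha, d1⟩))
    rcases f2 with e1 | e1 | e1
    · exact d2 c hc (g1.trans e1.symm)
    · have h5 := ha.2.2 (j + 1)
      rw [← e1, On, hc.2.1, hc.2.2] at h5
      have h3 : q c * (g (j + k) - g (j + 1 + k)) = 0 := by linarith
      have := F.ginj _ _ (sub_eq_zero.1 ((mul_eq_zero.1 h3).resolve_left (F.Gq hc)))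
      omega
    · exact neqX _ _ (by omega) (F.Gq hc) e1
  · -- H2
    rintro k j hk hj hjw ⟨a, a1, a2, ha, ha1, ha2, nb1, nb2⟩ hn1 hn2 hW
    obtain ⟨m1, m2, m12⟩ := nbs j hj hjw
    have gd : GdP A b S' S a (X j) := by
      by_contra hg; exact hn1 (hN1' _ a j ha (by omega) hg)
    have a12 : a1 ≠ a2 := by rintro rfl; have := F.Gu ha1 ha2; omega
    obtain ⟨z, hT, z1, z2, hcase⟩ := gd_known gd nb1 nb2 a12 m1 m2 m12
    have ze : ∀ c ∈ S', c ≠ z := by rintro c hc rfl; exact z1 hc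
    have ze' : ∀ c ∈ S, c ≠ z := by rintro c hc rfl; exact z2 hc
    have o0 : On p q r f g z j (k + j) := F.see_tri hT (F.Gon ha j) (F.Xon I (by omega) _)
    rw [add_comm] at o0
    rcases hcase with ⟨s1, s2⟩ | ⟨s1, s2⟩
    · have o1 := (F.see (ze a1 (memS' _ _ ha1)) (ze' _ (memS (j+1) (by omega))) (neqX _ _ (by omega) (F.Gq ha1)) s1).1
        (F.Gon ha1 (j + 1)) (F.Xon I (by omega) _)
      rw [show k + j + 1 = j + 1 + k by omega] at o1
      have htz := F.ht z j k o0 o1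
      have hz : isV A p q r t f g k z := ⟨hT.1, htz, F.hb z j k htz o0⟩
      have gd' : GdP A b S1 S z (X j) := by
        by_contra hg; exact hn2 (hN2' _ z j hz (by omega) hg)
      obtain ⟨v1, v2, c1, c2, nc1, nc2, t1, t2⟩ := gd_apex gd' hT.swap12 m1 m2 m12
      have ve : ∀ c ∈ S1, c ≠ a := by rintro c hc rfl; exact v1 hc
      have ve' : ∀ c ∈ S, c ≠ a := by rintro c hc rfl; exact v2 hc
      have hc12 : ∀ c i', c ∈ S1 → i' < len → c ≠ X i' := by
        rintro c i' hc hi' rfl; exact F.htX i' hi' (qS1 _ hc)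
      have u1 := (F.see (ve c1 nc1.2.1) (ve' _ (memS (j+1) (by omega))) (hc12 c1 _ nc1.2.1 (by omega)) t1).2
        (F.Gon ha (j + 1)) (F.Xon I (by omega) _)
      have u2 := (F.see (ve c2 nc2.2.1) (ve' _ (memS (j-1) (by omega))) (hc12 c2 _ nc2.2.1 (by omega)) t2).2
        (F.Gon ha (j - 1)) (F.Xon I (by omega) _)
      rw [show k + j = j + 1 + (k - 1) by omega] at u1
      rw [show k + j = j - 1 + (k + 1) by omega] at u2
      exact ⟨z, c2, c1, hz, ⟨(mem_Lp.1 nc2.2.1).1, qS1 _ nc2.2.1, F.hb _ _ _ (qS1 _ nc2.2.1) u2⟩,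
        ⟨(mem_Lp.1 nc1.2.1).1, qS1 _ nc1.2.1, F.hb _ _ _ (qS1 _ nc1.2.1) u1⟩, nc2, nc1⟩
    · exfalso
      apply hW
      have o1 := (F.see (ze a1 (memS' _ _ ha1)) (ze' _ (memS (j-1) (by omega))) (neqX _ _ (by omega) (F.Gq ha1)) s1).1
        (F.Gon ha1 (j - 1)) (F.Xon I (by omega) _)
      have o2 := (F.see (ze a2 (memS' _ _ ha2)) (ze' _ (memS (j+1) (by omega))) (neqX _ _ (by omega) (F.Gq ha2)) s2).1
        (F.Gon ha2 (j + 1)) (F.Xon I (by omega) _)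
      refine ⟨z, hT.1, fun j' i' hji => F.hc1 z (j - 1) (k + j - 1) ?_ ?_ ?_ j' i' ?_⟩
      · rwa [show j - 1 + 1 = j by omega, show k + j - 1 + 1 = j + k by omega]
      · rwa [show j - 1 + 2 = j + 1 by omega]
      · rwa [show k + j - 1 + 2 = k + j + 1 by omega]
      · rw [hji]; omega
  · -- H2'
    rintro k j hk hj hjw ⟨e, heA, he⟩ ⟨c, -, -, hc, -⟩ ⟨a, -, -, ha, -⟩
    refine hN1' _ c j hc (by omega) ?_
    rintro ⟨z, -, -, -, -, hT, -⟩
    rw [add_comm] at hc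
    obtain ⟨φ, h1, h2⟩ := F.onfn j (j + k)
    obtain ⟨w0, hw0⟩ := F.nontriv I hlen5 j (j + k)
    rw [← h2] at hw0
    obtain ⟨d1, d2, d3⟩ := F.dist I (j := j) (i := j + k) (i2 := j + k - 1) (by omega) (a := e) (he _ _ (by omega)) (by omega) (by omega)
    have f1 := tri_three h1 hT hw0 ((h2 _).2 (F.Gon hc j)) ((h2 _).2 (F.Xon I (by omega) _)) ((h2 _).2 (he _ _ (by omega))) heA
    have f2 := tri_three h1 hT hw0 ((h2 _).2 (F.Gon hc j)) ((h2 _).2 (F.Xon I (by omega) _)) ((h2 _).2 (ha.2.2 j)) ha.1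
    have g1 := (f1.resolve_right (by rw [not_or]; exact ⟨d2 c hc, d1⟩))
    rcases f2 with e1 | e1 | e1
    · exact d3 a k rfl ha (g1.trans e1.symm)
    · have h5 := ha.2.2 (j + 1)
      rw [e1, On, hc.2.1, hc.2.2] at h5
      have h3 : q c * (g (j + k) - g (j + 1 + k)) = 0 := by linarith
      have := F.ginj _ _ (sub_eq_zero.1 ((mul_eq_zero.1 h3).resolve_left (F.Gq hc)))
      omega
    · exact neqX _ _ (by omega) (F.Vq ha) e1
  · -- H3
    rintro l hl hlw ⟨e, heA, he⟩
    have hT := I.tri (l / 2) (l % 2) (by omega) (by omega)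
    have hZ := F.Zv I hlen5 (k := l % 2) (by omega)
    have hY := F.Yg I (j := l / 2 + l % 2) (by omega)
    obtain ⟨φ, h1, h2⟩ := F.onfn (l / 2) (l / 2 + l % 2)
    obtain ⟨w0, hw0⟩ := F.nontriv I hlen5 (l / 2) (l / 2 + l % 2)
    rw [← h2] at hw0
    obtain ⟨d1, d2, d3⟩ := F.dist I (j := l / 2) (i := l / 2 + l % 2) (i2 := l / 2 + l % 2 - 1) (by omega) (a := e) (he _ _ (by omega)) (by omega) (by omega)
    rcases tri_three h1 hT hw0 ((h2 _).2 (F.Xon I (by omega) _)) ((h2 _).2 (F.Gon hY _)) ((h2 _).2 (he _ _ (by omega))) heA with e1 | e1 | e1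
    · exact d3 _ _ rfl hZ e1
    · exact d1 e1
    · exact d2 _ hY e1

theorem caseC {x y x' y' : ℝ} (hne : ¬ (x = x' ∧ y = y')) (hc : 4 ≤ (Lp A b x y).card) (hc' : 4 ≤ (Lp A b x' y').card)
    {w h : ℕ} (hw : 4 * h < w) (hB : 4 * (5 * (∑ a ∈ A, bd A b a) + 3 * A.card) ≤ h * w)
    (hbig : 2 * (∑ a ∈ A, bd A b a) + (2 * (8 * w + 5)) * ((∑ a ∈ A, bd A b a) + A.card) < (PQ A b x y x' y').card) : False := by
  rcases init hne hc hc' (len := 8 * w + 5) (by omega) hbig with ⟨X, Y, Z, I⟩ | ⟨X, Y, Z, I⟩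
  · exact caseC_core hne hc hc' hw hB I
  · exact caseC_core (fun e => hne ⟨e.1.symm, e.2.symm⟩) hc' hc hw hB I

end
end WS

namespace WS
noncomputable section
open scoped Classical
open Finset MvPolynomial
variable {A : Finset ℝ} {b : ℝ → ℝ}

lemma nonlin {f : Po} (hf : Irreducible f) (hd : 2 ≤ f.totalDegree) (hd3 : f.totalDegree ≤ 3) {M Q : ℕ}
    (hT : (∑ a ∈ A, bd A b a) + A.card ≤ M * A.card) (hA : 0 < A.card) (hZ : A.card ≤ Q * (ZF A b f).card)
    (hn : 10 ^ 9 * M * Q ^ 2 ≤ A.card) :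
    ∃ g : Po, g ≠ 0 ∧ g.totalDegree ≤ 3 ∧ (A.filter (fun q => ¬ Van b g q)).card ≤ 4000 * M * Q := by
  set T := ∑ a ∈ A, bd A b a with hTd
  have hs : 0 < (ZF A b f).card := by
    rcases Nat.eq_zero_or_pos (ZF A b f).card with h | h
    · rw [h] at hZ; omega
    · exact h
  have key : ∀ u : ℕ, u * (ZF A b f).card ≤ 4000 * (T + A.card) → u ≤ 4000 * M * Q := by
    intro u hu
    refine Nat.le_of_mul_le_mul_right (c := (ZF A b f).card) ?_ hs
    calc u * (ZF A b f).card ≤ 4000 * (T + A.card) := hu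
      _ ≤ 4000 * (M * A.card) := Nat.mul_le_mul le_rfl hT
      _ ≤ 4000 * (M * (Q * (ZF A b f).card)) := by gcongr
      _ = _ := by ring
  rcases (show f.totalDegree = 3 ∨ f.totalDegree = 2 by omega) with h3 | h2
  · refine ⟨f, hf.ne_zero, hd3, key _ ?_⟩
    have := caseA (A := A) (b := b) hf h3
    rw [← hTd] at this
    have e : A.filter (fun q => ¬ Van b f q) = A \ ZF A b f := by
      ext q; simp only [mem_filter, mem_sdiff, mem_ZF]; tauto
    rw [e]; omega
  · obtain ⟨g, g1, g2, g3⟩ := caseB (A := A) (b := b) hf h2 (by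
      rw [← hTd]
      refine Nat.le_of_mul_le_mul_left (c := Q ^ 2) ?_ ?_
      · calc Q ^ 2 * (10 ^ 9 * (T + A.card)) ≤ Q ^ 2 * (10 ^ 9 * (M * A.card)) := by gcongr
          _ = (10 ^ 9 * M * Q ^ 2) * A.card := by ring
          _ ≤ A.card * A.card := by gcongr
          _ ≤ (Q * (ZF A b f).card) * (Q * (ZF A b f).card) := by gcongr
          _ = _ := by ring
      · have : Q ≠ 0 := by rintro rfl; omega
        positivity)
    exact ⟨g, g1, g2, key _ g3⟩

lemma line_of {f : Po} (hf : Irreducible f) (hd : f.totalDegree = 1) (h2 : 2 ≤ (ZF A b f).card) :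
    ∃ x y, ZF A b f = Lp A b x y := by
  obtain ⟨a, ha, c, hc, hac⟩ := one_lt_card.1 h2
  have ha' := mem_ZF.1 ha
  have hc' := mem_ZF.1 hc
  have e := (fl_eq_iff b hac (slp b c a)).2 rfl
  set x := slp b c a
  have hcard : ({a, c} : Finset ℝ).card = 2 := card_pair hac
  have hv : ∀ s ∈ ({a, c} : Finset ℝ), Van b f s ∧ Van b (lin x (fl b a x)) s := by
    intro s hs
    simp only [mem_insert, mem_singleton] at hs
    rcases hs with rfl | rfl
    · exact ⟨ha'.2, van_lin.2 rfl⟩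
    · exact ⟨hc'.2, van_lin.2 e.symm⟩
  refine ⟨x, fl b a x, ?_⟩
  have d1 : f ∣ lin x (fl b a x) := by
    by_contra hn
    have := bezout_idx (b := b) hf hd (lin_deg _ _).le hn _ hv
    omega
  have d2 : lin x (fl b a x) ∣ f := by
    by_contra hn
    have := bezout_idx (b := b) (lin_irred _ _) (lin_deg _ _) hd.le hn _ (fun s hs => (hv s hs).symm)
    omega
  ext q
  rw [mem_ZF, mem_Lp, ← van_lin (b := b)]
  refine and_congr_right (fun _ => ?_)
  unfold Van
  constructor
  · intro h; obtain ⟨k, hk⟩ := d1; rw [hk, map_mul]; rw [h]; simp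
  · intro h; obtain ⟨k, hk⟩ := d2; rw [hk, map_mul]; rw [h]; simp

lemma PQ_card {x y x' y' : ℝ} (hne : ¬ (x = x' ∧ y = y')) :
    ((Lp A b x y).card - 1) * ((Lp A b x' y').card - 1) ≤ (PQ A b x y x' y').card := by
  have h1 : (Lp A b x y ∩ Lp A b x' y').card ≤ 1 := by
    rw [card_le_one]
    intro u hu v hv
    by_contra huv
    simp only [mem_inter, mem_Lp] at hu hv
    exact hne (line_two huv hu.1.2 hv.1.2 hu.2.2 hv.2.2)
  have e : (Lp A b x y \ Lp A b x' y') ×ˢ (Lp A b x' y' \ Lp A b x y) ⊆ PQ A b x y x' y' := by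
    intro p hp
    simp only [mem_product, mem_sdiff] at hp
    simp only [PQ, mem_filter, mem_product]
    tauto
  refine le_trans ?_ (card_le_card e)
  rw [card_product]
  have e1 := card_sdiff_add_card_inter (Lp A b x y) (Lp A b x' y')
  have e2 := card_sdiff_add_card_inter (Lp A b x' y') (Lp A b x y)
  rw [inter_comm] at e2
  exact Nat.mul_le_mul (by omega) (by omega)

lemma two_lines {x y x' y' : ℝ} (hne : ¬ (x = x' ∧ y = y')) {M Q : ℕ} (hM : 1 ≤ M)
    (hT : (∑ a ∈ A, bd A b a) + A.card ≤ M * A.card) 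
    (hZ : A.card ≤ Q * (Lp A b x y).card) (hZ' : A.card ≤ Q * (Lp A b x' y').card)
    (hn : 10 ^ 7 * M ^ 3 * Q ^ 4 < A.card) : False := by
  set T := ∑ a ∈ A, bd A b a with hTd
  set n := A.card with hnd
  set m := (Lp A b x y).card with hm
  set m' := (Lp A b x' y').card with hm'
  have hQ : 1 ≤ Q := by
    rcases Nat.eq_zero_or_pos Q with h | h
    · rw [h] at hZ; omega
    · exact h
  have hlow : 4 * Q ≤ n := by
    have : 1 ≤ M ^ 3 := Nat.one_le_pow _ _ hM
    have h4 : Q ≤ Q ^ 4 := by nlinarith [Nat.one_le_pow 3 Q hQ]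
    nlinarith
  have hc : 4 ≤ m := by
    refine Nat.le_of_mul_le_mul_left (c := Q) ?_ hQ
    linarith
  have hc' : 4 ≤ m' := by
    refine Nat.le_of_mul_le_mul_left (c := Q) ?_ hQ
    linarith
  set h := Nat.sqrt (5 * (M * n)) + 1 with hh
  have s1 : 5 * (M * n) ≤ h * h := (Nat.lt_succ_sqrt _).le
  have hMn : 1 ≤ M * n := Nat.mul_pos hM (by omega)
  have s2 : h * h ≤ 20 * (M * n) := by
    have a1 := Nat.sqrt_le (5 * (M * n))
    have a2 : 1 ≤ Nat.sqrt (5 * (M * n)) := Nat.le_sqrt.2 (by omega)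
    rw [hh]; nlinarith
  have hcard := PQ_card (A := A) (b := b) hne
  refine caseC (A := A) (b := b) hne hc hc' (w := 4 * h + 1) (h := h) (by omega) ?_ ?_
  · rw [← hTd, ← hnd]
    nlinarith
  · rw [← hTd, ← hnd]
    refine lt_of_lt_of_le ?_ hcard
    rw [← hm, ← hm']
    have b1 : n * n ≤ 4 * Q ^ 2 * ((m - 1) * (m' - 1)) := by
      calc n * n ≤ (Q * m) * (Q * m') := Nat.mul_le_mul hZ hZ'
        _ ≤ (Q * (2 * (m - 1))) * (Q * (2 * (m' - 1))) := by gcongr <;> omega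
        _ = _ := by ring
    have b2 : 2 * T + 2 * (8 * (4 * h + 1) + 5) * (T + n) ≤ 92 * h * (M * n) := by
      have : 1 ≤ h := by omega
      have c1 : 2 * T ≤ 2 * (M * n) := by omega
      have c2 : 2 * (8 * (4 * h + 1) + 5) * (T + n) ≤ 2 * (8 * (4 * h + 1) + 5) * (M * n) := by gcongr
      have c3 : (2 + 2 * (8 * (4 * h + 1) + 5)) * (M * n) ≤ 92 * h * (M * n) := by gcongr; omega
      linarith
    refine lt_of_le_of_lt b2 ?_
    have b3 : 368 * h * M * Q ^ 2 < n := by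
      refine lt_of_pow_lt_pow_left₀ 2 (Nat.zero_le _) ?_
      calc (368 * h * M * Q ^ 2) ^ 2 = 135424 * M ^ 2 * Q ^ 4 * (h * h) := by ring
        _ ≤ 135424 * M ^ 2 * Q ^ 4 * (20 * (M * n)) := by gcongr
        _ = (2708480 * M ^ 3 * Q ^ 4) * n := by ring
        _ ≤ (10 ^ 7 * M ^ 3 * Q ^ 4) * n := by gcongr; norm_num
        _ < n * n := Nat.mul_lt_mul_of_pos_right hn (by omega)
        _ = n ^ 2 := by ring
    refine Nat.lt_of_mul_lt_mul_left (a := 4 * Q ^ 2) (lt_of_lt_of_le ?_ b1)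
    calc 4 * Q ^ 2 * (92 * h * (M * n)) = (368 * h * M * Q ^ 2) * n := by ring
      _ < n * n := Nat.mul_lt_mul_of_pos_right b3 (by omega)

lemma off_line_pt {x y : ℝ} {z : ℝ} (hz : z ∈ A) (hzl : fl b z x ≠ y) :
    (Lp A b x y).card ≤ bd A b z + (A \ Lp A b x y).card := by
  have hne : ∀ q ∈ Lp A b x y, q ≠ z := by
    rintro q hq rfl
    exact hzl (mem_Lp.1 hq).2
  have hinj : ∀ q ∈ Lp A b x y, ∀ q' ∈ Lp A b x y, slp b z q = slp b z q' → q = q' := by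
    intro q hq q' hq' he
    by_contra hqq
    have e1 := (fl_eq_iff b (hne q hq) _).2 rfl
    have e2 := (fl_eq_iff b (hne q' hq') _).2 rfl
    rw [← he] at e2
    obtain ⟨r1, r2⟩ := line_two hqq (mem_Lp.1 hq).2 (mem_Lp.1 hq').2 e1 e2
    exact hzl (by rw [r1, r2])
  rw [← card_filter_add_card_filter_not (s := Lp A b x y) (p := fun q => slp b z q ∈ badS A b z)]
  refine Nat.add_le_add ?_ ?_
  · refine card_le_card_of_injOn (slp b z) (fun q hq => (mem_filter.1 hq).2) ?_
    intro q hq q' hq' he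
    exact hinj q (mem_filter.1 hq).1 q' (mem_filter.1 hq').1 he
  · have ht : ∀ q, ∃ q', q ∈ (Lp A b x y).filter (fun q => slp b z q ∉ badS A b z) → Tri A b z q q' := by
      intro q
      by_cases hq : q ∈ (Lp A b x y).filter (fun q => slp b z q ∉ badS A b z)
      · obtain ⟨q', hq'⟩ := tri_of_not_bad (mem_Lp.1 (mem_filter.1 hq).1).1 (hne q (mem_filter.1 hq).1) (mem_filter.1 hq).2
        exact ⟨q', fun _ => hq'⟩
      · exact ⟨0, fun h => absurd h hq⟩
    choose φ hφ using ht
    have key : ∀ q ∈ (Lp A b x y).filter (fun q => slp b z q ∉ badS A b z), φ q ∈ A ∧ φ q ≠ z ∧ φ q ≠ q ∧ slp b z (φ q) = slp b z q := by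
      intro q hq
      obtain ⟨t1, t2, t3, t4, t5, t6, u, v, ht⟩ := hφ q hq
      have e1 := (ht z t1).2 (by simp)
      have e2 := (ht q t2).2 (by simp)
      have e3 := (ht _ t3).2 (by simp)
      refine ⟨t3, t5.symm, t6.symm, ?_⟩
      rw [← (fl_eq_iff b t4.symm u).1 (e2.trans e1.symm), ← (fl_eq_iff b t5.symm u).1 (e3.trans e1.symm)]
    refine card_le_card_of_injOn φ ?_ ?_
    · intro q hq
      have k := key q hq
      simp only [coe_sdiff, Set.mem_sdiff, mem_coe]
      exact ⟨k.1, fun h => k.2.2.1 (hinj _ h _ (mem_filter.1 hq).1 k.2.2.2)⟩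
    · intro q hq q' hq' he
      have k := key q hq
      have k' := key q' hq'
      refine hinj q (mem_filter.1 hq).1 q' (mem_filter.1 hq').1 ?_
      rw [← k.2.2.2, ← k'.2.2.2, he]

lemma off_line (x y : ℝ) : (A \ Lp A b x y).card * (Lp A b x y).card ≤
    (∑ a ∈ A, bd A b a) + (A \ Lp A b x y).card * (A \ Lp A b x y).card := by
  rw [← smul_eq_mul, ← sum_const]
  calc ∑ z ∈ A \ Lp A b x y, (Lp A b x y).card ≤ ∑ z ∈ A \ Lp A b x y, (bd A b z + (A \ Lp A b x y).card) := by
        refine sum_le_sum (fun z hz => ?_)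
        rw [mem_sdiff] at hz
        exact off_line_pt hz.1 (fun h => hz.2 (mem_Lp.2 ⟨hz.1, h⟩))
    _ ≤ _ := by
        rw [sum_add_distrib, sum_const, smul_eq_mul]
        exact Nat.add_le_add (sum_le_sum_of_subset sdiff_subset) le_rfl

theorem affine_main {M : ℕ} (hM : 1 ≤ M) (hT : (∑ a ∈ A, bd A b a) + A.card ≤ M * A.card)
    (hn : 10 ^ 17 * M ^ 11 ≤ A.card) :
    ∃ g : Po, g ≠ 0 ∧ g.totalDegree ≤ 3 ∧ (A.filter (fun q => ¬ Van b g q)).card ≤ 10 ^ 6 * M ^ 3 := by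
  have hM11 : 1 ≤ M ^ 11 := Nat.one_le_pow _ _ hM
  have hn0 : 0 < A.card := by omega
  -- choose a good point
  obtain ⟨p, hp, hpM⟩ : ∃ p ∈ A, bd A b p ≤ M := by
    by_contra hcon
    push Not at hcon
    have : ∑ a ∈ A, M ≤ ∑ a ∈ A, bd A b a := sum_le_sum (fun a ha => (hcon a ha).le)
    rw [sum_const, smul_eq_mul, mul_comm] at this
    omega
  obtain ⟨S, c1, c2, c3⟩ := cover (b := b) hp
  set R := 7 * M with hR
  have hSR : S.card ≤ R := by omega
  set Q := 4 * R ^ 2 with hQ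
  have hRQ : R ≤ Q := by rw [hQ]; nlinarith
  have hsub : ∀ S' : Finset Po, ∀ B : Finset ℝ, B ⊆ A → (∀ q ∈ B, ∃ f ∈ S', Van b f q) → B.card ≤ ∑ f ∈ S', (ZF A b f).card := by
    intro S' B hB h
    refine le_trans (card_le_card ?_) card_biUnion_le
    intro q hq
    obtain ⟨f, hf, hv⟩ := h q hq
    exact mem_biUnion.2 ⟨f, hf, mem_ZF.2 ⟨hB hq, hv⟩⟩
  obtain ⟨f, hf, hfR⟩ : ∃ f ∈ S, A.card ≤ R * (ZF A b f).card := by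
    by_contra hcon
    push Not at hcon
    have h1 := hsub S A (Subset.refl _) c3
    have h2 : ∑ f ∈ S, R * (ZF A b f).card < ∑ f ∈ S, A.card := by
      refine sum_lt_sum_of_nonempty ?_ hcon
      obtain ⟨q, hq⟩ := card_pos.1 hn0
      obtain ⟨f, hf, _⟩ := c3 q hq
      exact ⟨f, hf⟩
    rw [← mul_sum, sum_const, smul_eq_mul] at h2
    have := Nat.mul_le_mul (le_refl R) h1
    have := Nat.mul_le_mul hSR (le_refl A.card)
    omega
  have hQM : Q = 196 * M ^ 2 := by rw [hQ, hR]; ring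
  have hfin : 4000 * M * Q ≤ 10 ^ 6 * M ^ 3 := by
    rw [hQM]
    calc 4000 * M * (196 * M ^ 2) = 784000 * M ^ 3 := by ring
      _ ≤ _ := by gcongr; norm_num
  have hnb : 10 ^ 9 * M * Q ^ 2 ≤ A.card := by
    refine le_trans ?_ hn
    rw [hQM]
    calc 10 ^ 9 * M * (196 * M ^ 2) ^ 2 = (10 ^ 9 * 196 ^ 2) * M ^ 5 := by ring
      _ ≤ 10 ^ 17 * M ^ 11 := by gcongr <;> norm_num
  have hnc : 10 ^ 7 * M ^ 3 * Q ^ 4 < A.card := by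
    refine lt_of_lt_of_le ?_ hn
    rw [hQM]
    calc 10 ^ 7 * M ^ 3 * (196 * M ^ 2) ^ 4 = (10 ^ 7 * 196 ^ 4) * M ^ 11 := by ring
      _ < 10 ^ 17 * M ^ 11 := by
        apply Nat.mul_lt_mul_of_pos_right (by norm_num) hM11
  -- nonlinear rich curves finish
  by_cases hnl : ∃ f ∈ S, 2 ≤ f.totalDegree ∧ A.card ≤ Q * (ZF A b f).card
  · obtain ⟨f, hf, h2, hQf⟩ := hnl
    obtain ⟨g, g1, g2, g3⟩ := nonlin (c2 f hf).1 h2 (c2 f hf).2 hT hn0 hQf hnb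
    exact ⟨g, g1, g2, g3.trans hfin⟩
  push Not at hnl
  have hfQ : A.card ≤ Q * (ZF A b f).card := hfR.trans (Nat.mul_le_mul hRQ le_rfl)
  have hdeg1 : ∀ f ∈ S, A.card ≤ Q * (ZF A b f).card → f.totalDegree = 1 := by
    intro f hf h
    have h1 := irred_deg_pos (c2 f hf).1
    by_contra h2
    have := hnl f hf (by omega)
    omega
  have htwo : ∀ f, A.card ≤ Q * (ZF A b f).card → 2 ≤ (ZF A b f).card := by
    intro f h
    by_contra hlt
    have : Q * (ZF A b f).card ≤ Q * 1 := Nat.mul_le_mul le_rfl (by omega)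
    have h3 : 1 ≤ M ^ 3 := Nat.one_le_pow _ _ hM
    have h4 : Q ≤ Q ^ 4 := by
      rcases Nat.eq_zero_or_pos Q with h | h
      · simp [h]
      · nlinarith [Nat.one_le_pow 3 Q h]
    nlinarith
  obtain ⟨x, y, hxy⟩ := line_of (A := A) (b := b) (c2 f hf).1 (hdeg1 f hf hfQ) (htwo f hfQ)
  have hsame : ∀ f' ∈ S, A.card ≤ Q * (ZF A b f').card → ZF A b f' = Lp A b x y := by
    intro f' hf' h'
    obtain ⟨x', y', hxy'⟩ := line_of (A := A) (b := b) (c2 f' hf').1 (hdeg1 f' hf' h') (htwo f' h')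
    by_contra hneq
    rw [hxy'] at h' hneq
    rw [hxy] at hfQ
    refine two_lines (A := A) (b := b) (x := x) (y := y) (x' := x') (y' := y') ?_ hM hT hfQ h' hnc
    rintro ⟨rfl, rfl⟩
    exact hneq rfl
  set β := (A \ Lp A b x y).card with hβ
  rw [hxy] at hfR
  set m := (Lp A b x y).card with hm
  have hbnd : Q * β ≤ R * A.card := by
    have h1 := hsub (S.filter (fun f' => ¬ A.card ≤ Q * (ZF A b f').card)) (A \ Lp A b x y) sdiff_subset (by
      intro q hq
      rw [mem_sdiff] at hq
      obtain ⟨f', hf', hv⟩ := c3 q hq.1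
      refine ⟨f', mem_filter.2 ⟨hf', fun h => hq.2 ?_⟩, hv⟩
      rw [← hsame f' hf' h]
      exact mem_ZF.2 ⟨hq.1, hv⟩)
    calc Q * β ≤ Q * ∑ f ∈ S.filter (fun f' => ¬ A.card ≤ Q * (ZF A b f').card), (ZF A b f).card := Nat.mul_le_mul le_rfl h1
      _ = ∑ f ∈ S.filter (fun f' => ¬ A.card ≤ Q * (ZF A b f').card), Q * (ZF A b f).card := mul_sum _ _ _
      _ ≤ ∑ f ∈ S.filter (fun f' => ¬ A.card ≤ Q * (ZF A b f').card), A.card := by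
          refine sum_le_sum (fun f hf => ?_)
          have := (mem_filter.1 hf).2
          omega
      _ ≤ R * A.card := by
          rw [sum_const, smul_eq_mul]
          exact Nat.mul_le_mul ((card_le_card (filter_subset _ _)).trans hSR) le_rfl
  have hRpos : 0 < R := by omega
  have h4 : 4 * β ≤ m := by
    refine Nat.le_of_mul_le_mul_left (c := R ^ 2) ?_ (by positivity)
    calc R ^ 2 * (4 * β) = Q * β := by rw [hQ]; ring
      _ ≤ R * A.card := hbnd
      _ ≤ R * (R * m) := by gcongr
      _ = R ^ 2 * m := by ring
  have hoff := off_line (A := A) (b := b) x y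
  rw [← hβ, ← hm] at hoff
  have hmpos : 0 < m := by
    rcases Nat.eq_zero_or_pos m with h | h
    · rw [h] at hfR; omega
    · exact h
  refine ⟨lin x y, lin_ne_zero _ _, by rw [lin_deg]; norm_num, ?_⟩
  have e : A.filter (fun q => ¬ Van b (lin x y) q) = A \ Lp A b x y := by
    ext q; simp only [mem_filter, mem_sdiff, mem_Lp, van_lin]; tauto
  rw [e, ← hβ]
  have h5 : β ≤ 2 * M * R := by
    refine Nat.le_of_mul_le_mul_right (c := m) ?_ hmpos
    have i1 : β * (4 * β) ≤ β * m := Nat.mul_le_mul le_rfl h4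
    have i2 : 3 * (β * m) ≤ 4 * ((M * R) * m) := by
      calc 3 * (β * m) ≤ 4 * (M * A.card) := by nlinarith
        _ ≤ 4 * (M * (R * m)) := by gcongr
        _ = _ := by ring
    nlinarith
  refine h5.trans ?_
  rw [hR]
  calc 2 * M * (7 * M) = 14 * M ^ 2 := by ring
    _ ≤ _ := by gcongr <;> norm_num

theorem affine_main2 {k : ℕ} (hk : 1 ≤ k) (hN : N2 A b ≤ k * A.card)
    (hn : 10 ^ 17 * (3 ^ 104 * k) ^ 11 ≤ A.card) :
    ∃ g : Po, g ≠ 0 ∧ g.totalDegree ≤ 3 ∧ (A.filter (fun q => ¬ Van b g q)).card ≤ 10 ^ 6 * (3 ^ 104 * k) ^ 3 := by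
  refine affine_main (A := A) (b := b) (M := 3 ^ 104 * k) (Nat.mul_pos (by norm_num) hk) ?_ hn
  have h : ∑ a ∈ A, bd A b a ≤ 3 ^ 100 * (12 * N2 A b + 48 * A.card) := sum_badS
  have h1 : 3 ^ 100 * (12 * N2 A b + 48 * A.card) ≤ 3 ^ 100 * (12 * (k * A.card) + 48 * (k * A.card)) := by
    gcongr
    exact Nat.le_mul_of_pos_left _ hk
  have h2 : A.card ≤ k * A.card := Nat.le_mul_of_pos_left _ hk
  calc _ ≤ 3 ^ 100 * (12 * (k * A.card) + 48 * (k * A.card)) + k * A.card := Nat.add_le_add (h.trans h1) h2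
    _ = (3 ^ 100 * 60 + 1) * (k * A.card) := by ring
    _ ≤ 3 ^ 104 * (k * A.card) := by gcongr; norm_num
    _ = _ := by ring
end
end WS

namespace WS
noncomputable section
open scoped Classical
open Finset MvPolynomial

/-- moment functional -/
def mf (t : ℝ) : (Fin 3 → ℝ) →ₗ[ℝ] ℝ where
  toFun v := v 0 + t * v 1 + t ^ 2 * v 2
  map_add' u v := by simp; ring
  map_smul' c v := by simp; ring

lemma mf_apply (t : ℝ) (v : Fin 3 → ℝ) : mf t v = v 0 + t * v 1 + t ^ 2 * v 2 := rfl

lemma mf_roots {v : Fin 3 → ℝ} (hv : v ≠ 0) : {t : ℝ | mf t v = 0}.Finite := by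
  set p : Polynomial ℝ := Polynomial.C (v 0) + Polynomial.C (v 1) * Polynomial.X + Polynomial.C (v 2) * Polynomial.X ^ 2 with hp
  have hp0 : p ≠ 0 := by
    intro h
    apply hv
    have c0 : p.coeff 0 = v 0 := by simp [hp]
    have c1 : p.coeff 1 = v 1 := by simp [hp, Polynomial.coeff_X, Polynomial.coeff_one]
    have c2 : p.coeff 2 = v 2 := by simp [hp, Polynomial.coeff_X, Polynomial.coeff_C]
    rw [h] at c0 c1 c2
    funext i
    fin_cases i
    · simpa using c0.symm
    · simpa using c1.symm
    · simpa using c2.symm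
  refine (Polynomial.finite_setOf_isRoot hp0).subset ?_
  intro t ht
  simp only [Set.mem_ofPred_eq, mf_apply] at ht
  simp only [Set.mem_ofPred_eq, Polynomial.IsRoot, hp, Polynomial.eval_add, Polynomial.eval_mul, Polynomial.eval_C, Polynomial.eval_pow, Polynomial.eval_X]
  linarith

lemma exists_generic (W : Set (Fin 3 → ℝ)) (hW : W.Finite) (h0 : ∀ v ∈ W, v ≠ 0) (B : Set ℝ) (hB : B.Finite) :
    ∃ t : ℝ, t ∉ B ∧ ∀ v ∈ W, mf t v ≠ 0 := by
  obtain ⟨t, ht⟩ := (hB.union (hW.biUnion (fun v hv => mf_roots (h0 v hv)))).exists_notMem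
  refine ⟨t, fun h => ht (Or.inl h), fun v hv h => ht (Or.inr ?_)⟩
  exact Set.mem_biUnion hv h

lemma mf_surj {t s r : ℝ} (h1 : t ≠ s) (h2 : t ≠ r) (h3 : s ≠ r) (c1 c2 c3 : ℝ) :
    ∃ w, mf t w = c1 ∧ mf s w = c2 ∧ mf r w = c3 := by
  have hdet : (Matrix.vandermonde ![t, s, r]).det ≠ 0 := by
    rw [Matrix.det_vandermonde_ne_zero_iff]
    intro i j hij
    fin_cases i <;> fin_cases j <;> simp_all
  have hm := Matrix.mulVec_mulVec ![c1, c2, c3] (Matrix.vandermonde ![t, s, r]) (Matrix.vandermonde ![t, s, r])⁻¹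
  rw [Matrix.mul_nonsing_inv _ (isUnit_iff_ne_zero.2 hdet), Matrix.one_mulVec] at hm
  refine ⟨(Matrix.vandermonde ![t, s, r])⁻¹.mulVec ![c1, c2, c3], ?_, ?_, ?_⟩
  · have := congrFun hm 0
    rw [mf_apply]
    simpa [Matrix.mulVec, dotProduct, Fin.sum_univ_three, Matrix.vandermonde_apply] using this
  · have := congrFun hm 1
    rw [mf_apply]
    simpa [Matrix.mulVec, dotProduct, Fin.sum_univ_three, Matrix.vandermonde_apply] using this
  · have := congrFun hm 2
    rw [mf_apply]
    simpa [Matrix.mulVec, dotProduct, Fin.sum_univ_three, Matrix.vandermonde_apply] using this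

lemma ordinary_finite {P : Set RP2} (hP : P.Finite) : {L : Set RP2 | IsProjLine L ∧ (P ∩ L).ncard = 2}.Finite := by
  refine ((hP.prod hP).image (fun q : RP2 × RP2 => {x : RP2 | x.submodule ≤ q.1.submodule ⊔ q.2.submodule})).subset ?_
  rintro L ⟨⟨W, hW, rfl⟩, h2⟩
  rw [Set.ncard_eq_two] at h2
  obtain ⟨p, q, hpq, he⟩ := h2
  have hp : p ∈ P ∩ {x : RP2 | x.submodule ≤ W} := by rw [he]; simp
  have hq : q ∈ P ∩ {x : RP2 | x.submodule ≤ W} := by rw [he]; simp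
  refine ⟨(p, q), ⟨hp.1, hq.1⟩, ?_⟩
  have hle : p.submodule ⊔ q.submodule ≤ W := sup_le hp.2 hq.2
  have hlt : p.submodule < p.submodule ⊔ q.submodule := by
    refine lt_of_le_of_ne le_sup_left (fun h => hpq ?_)
    have h1 : q.submodule ≤ p.submodule := by rw [h]; exact le_sup_right
    have h2 := Submodule.eq_of_le_of_finrank_eq h1 (by rw [Projectivization.finrank_submodule, Projectivization.finrank_submodule])
    exact (Projectivization.submodule_injective h2).symm
  have h3 := Submodule.finrank_lt_finrank_of_lt hlt
  rw [Projectivization.finrank_submodule] at h3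
  have h4 := Submodule.eq_of_le_of_finrank_le hle (by omega)
  simp only [h4]

/-- the coordinate charts -/
def ca (t s : ℝ) (x : RP2) : ℝ := mf s x.rep / mf t x.rep

lemma ca_inj {P : Set RP2} (hP : P.Finite) : ∃ t s r : ℝ, t ≠ s ∧ t ≠ r ∧ s ≠ r ∧
    (∀ x ∈ P, mf t x.rep ≠ 0) ∧ Set.InjOn (ca t s) P := by
  obtain ⟨t, -, ht⟩ := exists_generic ((fun x : RP2 => x.rep) '' P) (hP.image _) (by
    rintro _ ⟨x, _, rfl⟩; exact x.rep_nonzero) ∅ Set.finite_empty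
  have ht' : ∀ x ∈ P, mf t x.rep ≠ 0 := fun x hx => ht _ ⟨x, hx, rfl⟩
  obtain ⟨s, hs, hs'⟩ := exists_generic
    ((fun q : RP2 × RP2 => mf t q.1.rep • q.2.rep - mf t q.2.rep • q.1.rep) '' ((P ×ˢ P) ∩ {q | q.1 ≠ q.2}))
    (((hP.prod hP).inter_of_left _).image _) (by
      rintro _ ⟨⟨x, y⟩, ⟨⟨hx, hy⟩, hne⟩, rfl⟩ h0
      apply hne
      simp only at h0 hx hy ⊢
      rw [← x.mk_rep, ← y.mk_rep, Projectivization.mk_eq_mk_iff']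
      refine ⟨(mf t y.rep)⁻¹ * mf t x.rep, ?_⟩
      rw [mul_smul, sub_eq_zero.1 h0, smul_smul, inv_mul_cancel₀ (ht' y hy), one_smul]) {t} (Set.finite_singleton t)
  obtain ⟨r, hr⟩ := (Set.toFinite ({t, s} : Set ℝ)).exists_notMem
  simp only [Set.mem_insert_iff, Set.mem_singleton_iff, not_or] at hr hs
  refine ⟨t, s, r, Ne.symm hs, Ne.symm hr.1, Ne.symm hr.2, ht', ?_⟩
  intro x hx y hy hxy
  by_contra hne
  refine hs' _ ⟨(x, y), ⟨⟨hx, hy⟩, hne⟩, rfl⟩ ?_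
  simp only [ca] at hxy
  rw [div_eq_div_iff (ht' x hx) (ht' y hy)] at hxy
  simp only [map_sub, map_smul, smul_eq_mul]
  linarith

/-- linear form as polynomial -/
def lf (t : ℝ) : MvPolynomial (Fin 3) ℝ := X 0 + C t * X 1 + C (t ^ 2) * X 2

lemma eval_lf (t : ℝ) (v : Fin 3 → ℝ) : eval v (lf t) = mf t v := by
  simp [lf, mf_apply]

lemma lf_hom (t : ℝ) : (lf t).IsHomogeneous 1 := by
  have h : ∀ (c : ℝ) (i : Fin 3), (C c * X i : MvPolynomial (Fin 3) ℝ).IsHomogeneous 1 := by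
    intro c i
    simpa using (isHomogeneous_C (Fin 3) c).mul (isHomogeneous_X ℝ i)
  exact ((isHomogeneous_X ℝ 0).add (h _ _)).add (h _ _)

/-- homogenization -/
def hg (t s r : ℝ) (g : Po) : MvPolynomial (Fin 3) ℝ :=
  ∑ m ∈ g.support, C (coeff m g) * (lf t ^ (3 - (m 0 + m 1)) * lf s ^ m 0 * lf r ^ m 1)

lemma supp_deg {g : Po} (hd : g.totalDegree ≤ 3) {m} (hm : m ∈ g.support) : m 0 + m 1 ≤ 3 := by
  have := (le_totalDegree hm).trans hd
  rwa [Finsupp.sum_fintype _ _ (fun _ => rfl), Fin.sum_univ_two] at this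

lemma hg_hom {t s r : ℝ} {g : Po} (hd : g.totalDegree ≤ 3) : (hg t s r g).IsHomogeneous 3 := by
  refine IsHomogeneous.sum _ _ _ (fun m hm => ?_)
  have h := supp_deg hd hm
  have := (isHomogeneous_C (Fin 3) (coeff m g)).mul
    ((((lf_hom t).pow (3 - (m 0 + m 1))).mul ((lf_hom s).pow (m 0))).mul ((lf_hom r).pow (m 1)))
  convert this using 1
  omega

lemma hg_eval {t s r : ℝ} {g : Po} (hd : g.totalDegree ≤ 3) {v : Fin 3 → ℝ} (hv : mf t v ≠ 0) :
    eval v (hg t s r g) = mf t v ^ 3 * eval ![mf s v / mf t v, mf r v / mf t v] g := by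
  rw [hg, map_sum, eval_eq', mul_sum]
  refine sum_congr rfl (fun m hm => ?_)
  have h := supp_deg hd hm
  simp only [map_mul, map_pow, eval_C, eval_lf, Fin.prod_univ_two, Matrix.cons_val_zero, Matrix.cons_val_one, div_pow]
  have e : mf t v ^ 3 = mf t v ^ (3 - (m 0 + m 1)) * mf t v ^ (m 0) * mf t v ^ (m 1) := by
    rw [← pow_add, ← pow_add]; congr 1; omega
  rw [e]
  field_simp

lemma hg_ne_zero {t s r : ℝ} (h1 : t ≠ s) (h2 : t ≠ r) (h3 : s ≠ r) {g : Po} (hg0 : g ≠ 0) (hd : g.totalDegree ≤ 3) :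
    hg t s r g ≠ 0 := by
  intro h
  apply hg0
  refine MvPolynomial.funext (fun c => ?_)
  obtain ⟨w, w1, w2, w3⟩ := mf_surj h1 h2 h3 1 (c 0) (c 1)
  have := hg_eval (t := t) (s := s) (r := r) hd (v := w) (by rw [w1]; exact one_ne_zero)
  rw [h, w1, w2, w3] at this
  simp only [map_zero, one_pow, one_mul, div_one] at this
  rw [map_zero, this]
  congr 2
  funext i
  fin_cases i <;> rfl

/-- line in the plane with given affine equation -/
def Lam (t s r x y : ℝ) : Module.Dual ℝ (Fin 3 → ℝ) := x • mf s - mf r - y • mf t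

lemma Lam_ne {t s r : ℝ} (h1 : t ≠ s) (h2 : t ≠ r) (h3 : s ≠ r) (x y : ℝ) : Lam t s r x y ≠ 0 := by
  intro h
  obtain ⟨w, w1, w2, w3⟩ := mf_surj h1 h2 h3 0 0 1
  have := LinearMap.congr_fun h w
  simp [Lam, w1, w2, w3] at this

def PL (t s r x y : ℝ) : Set RP2 := {p : RP2 | p.submodule ≤ LinearMap.ker (Lam t s r x y)}

lemma PL_line {t s r : ℝ} (h1 : t ≠ s) (h2 : t ≠ r) (h3 : s ≠ r) (x y : ℝ) : IsProjLine (PL t s r x y) := by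
  refine ⟨_, ?_, rfl⟩
  have := Module.Dual.finrank_ker_add_one_of_ne_zero (Lam_ne h1 h2 h3 x y)
  simp at this
  omega

lemma mem_PL {t s r x y : ℝ} {p : RP2} (hp : mf t p.rep ≠ 0) :
    p ∈ PL t s r x y ↔ ca t s p * x - ca t r p = y := by
  rw [PL, Set.mem_ofPred_eq, Projectivization.submodule_eq, Submodule.span_singleton_le_iff_mem, LinearMap.mem_ker]
  simp only [Lam, LinearMap.sub_apply, LinearMap.smul_apply, smul_eq_mul, ca]
  rw [← sub_eq_zero (b := y)]
  have : x * mf s p.rep - mf r p.rep - y * mf t p.rep = mf t p.rep * (mf s p.rep / mf t p.rep * x - mf r p.rep / mf t p.rep - y) := by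
    field_simp
  rw [this, mul_eq_zero, or_iff_right hp]

theorem transfer {P : Set RP2} (hP : P.Finite) : ∃ (A : Finset ℝ) (b : ℝ → ℝ), A.card = P.ncard ∧
    N2 A b ≤ numOrdinaryLines P ∧
    ∀ g : Po, g ≠ 0 → g.totalDegree ≤ 3 → ∃ Z : Set RP2, IsCurveDegLE3 Z ∧
      (P \ Z).ncard ≤ (A.filter (fun q => ¬ Van b g q)).card := by
  obtain ⟨t, s, r, h1, h2, h3, ht, hinj⟩ := ca_inj hP
  have hb : ∃ b : ℝ → ℝ, ∀ p ∈ P, b (ca t s p) = ca t r p := by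
    refine ⟨fun a => if h : ∃ p ∈ P, ca t s p = a then ca t r h.choose else 0, fun p hp => ?_⟩
    have h : ∃ p' ∈ P, ca t s p' = ca t s p := ⟨p, hp, rfl⟩
    simp only [dif_pos h]
    rw [hinj h.choose_spec.1 hp h.choose_spec.2]
  obtain ⟨b, hb⟩ := hb
  set A := (hP.image (ca t s)).toFinset with hA
  have memA : ∀ a, a ∈ A ↔ ∃ p ∈ P, ca t s p = a := by
    intro a; rw [hA, Set.Finite.mem_toFinset]; rfl
  have hLn : ∀ a x, (Ln A b a x : Set ℝ) = ca t s '' (P ∩ PL t s r x (fl b a x)) := by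
    intro a x
    ext c
    rw [mem_coe, mem_Ln, memA]
    constructor
    · rintro ⟨⟨p, hp, rfl⟩, h⟩
      refine ⟨p, ⟨hp, (mem_PL (ht p hp)).2 ?_⟩, rfl⟩
      rw [← h, ← hb p hp]; rfl
    · rintro ⟨p, ⟨hp, h⟩, rfl⟩
      refine ⟨⟨p, hp, rfl⟩, ?_⟩
      rw [← (mem_PL (ht p hp)).1 h, ← hb p hp]; rfl
  refine ⟨A, b, ?_, ?_, ?_⟩
  · rw [← hinj.ncard_image, Set.ncard_eq_toFinset_card _ (hP.image _)]
  · rw [N2, numOrdinaryLines, ← Set.ncard_coe_finset]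
    refine Set.ncard_le_ncard_of_injOn (fun d => PL t s r d.2.1 (fl b d.1 d.2.1)) ?_ ?_ (ordinary_finite hP)
    · rintro ⟨a, x, e⟩ hd
      have hk := (mem_filter.1 (mem_coe.1 hd)).2
      refine ⟨PL_line h1 h2 h3 _ _, ?_⟩
      rw [← Set.InjOn.ncard_image (hinj.mono Set.inter_subset_left), ← hLn, Set.ncard_coe_finset]
      exact hk
    · rintro ⟨a, x, e⟩ hd ⟨a', x', e'⟩ hd' heq
      rw [mem_coe, mem_filter, Vm, mem_filter, mem_DR] at hd hd'
      obtain ⟨⟨⟨d1, d2, d3⟩, d4⟩, d5⟩ := hd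
      obtain ⟨⟨⟨d1', d2', d3'⟩, d4'⟩, d5'⟩ := hd'
      simp only at heq d4 d4'
      have hL : Ln A b a x = Ln A b a' x' := by
        rw [← coe_inj, hLn, hLn, heq]
      have ha : a ∈ Ln A b a x := mem_Ln.2 ⟨d1, rfl⟩
      have ha' : a' ∈ Ln A b a' x' := mem_Ln.2 ⟨d1', rfl⟩
      have haa : a = a' := le_antisymm (d4 a' (by rw [hL]; exact ha')) (d4' a (by rw [← hL]; exact ha))
      subst haa
      subst d3 d3'
      have hcard : 1 < (Ln A b a x).card := by
        have : (Ln A b a x).card = 2 := d5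
        omega
      obtain ⟨c, hc, hca⟩ := exists_mem_ne hcard a
      have e1 := (fl_eq_iff b hca x).1 (mem_Ln.1 hc).2
      rw [hL] at hc
      have e2 := (fl_eq_iff b hca x').1 (mem_Ln.1 hc).2
      rw [e1, e2]
  · intro g g0 gd
    refine ⟨{x : RP2 | eval x.rep (hg t s r g) = 0}, ⟨hg t s r g, 3, hg_ne_zero h1 h2 h3 g0 gd, by norm_num, le_rfl, hg_hom gd, rfl⟩, ?_⟩
    rw [← Set.ncard_coe_finset]
    refine Set.ncard_le_ncard_of_injOn (ca t s) ?_ (hinj.mono Set.diff_subset) (Finset.finite_toSet _)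
    rintro p ⟨hp, hpZ⟩
    rw [mem_coe, mem_filter]
    refine ⟨(memA _).2 ⟨p, hp, rfl⟩, fun hv => hpZ ?_⟩
    rw [Set.mem_ofPred_eq, hg_eval gd (ht p hp)]
    have hv' : eval (pt b (ca t s p)) g = 0 := hv
    rw [pt, hb p hp] at hv'
    rw [show (![mf s p.rep / mf t p.rep, mf r p.rep / mf t p.rep] : Fin 2 → ℝ) = ![ca t s p, ca t r p] from rfl, hv', mul_zero]
end
end WS

theorem weak_structure :
    ∃ C : ℝ, 0 < C ∧ ∀ K : ℝ, 1 ≤ K → ∀ (n : ℕ) (P : Set RP2),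
      P.Finite → P.ncard = n →
      (numOrdinaryLines P : ℝ) ≤ K * n →
      Real.exp (Real.exp (C * K ^ C)) ≤ (n : ℝ) →
      ∃ Z : Set RP2, IsCurveDegLE3 Z ∧ ((P \ Z).ncard : ℝ) ≤ C * K ^ C := by
  obtain ⟨C, hC1, hC2, hC3⟩ : ∃ C : ℝ, 11 ≤ C ∧ 10 ^ 17 * (3 ^ 105) ^ 11 ≤ C ∧ 10 ^ 6 * (3 ^ 105) ^ 3 ≤ C :=
    ⟨10 ^ 17 * (3 ^ 105) ^ 11, by norm_num, le_rfl, by norm_num⟩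
  refine ⟨C, by linarith, ?_⟩
  intro K hK n P hP hPn hord hn
  obtain ⟨A, b, hA, hN, hg⟩ := WS.transfer hP
  have hk1 : 1 ≤ ⌈K⌉₊ := Nat.one_le_ceil_iff.2 (by linarith)
  have hkK : K ≤ (⌈K⌉₊ : ℝ) := Nat.le_ceil K
  have hk3 : (⌈K⌉₊ : ℝ) ≤ 3 * K := by
    have := Nat.ceil_lt_add_one (show (0 : ℝ) ≤ K by linarith)
    linarith
  set k := ⌈K⌉₊ with hk
  have hKC : ∀ j : ℕ, j ≤ 11 → K ^ j ≤ K ^ C := by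
    intro j hj
    rw [← Real.rpow_natCast]
    refine Real.rpow_le_rpow_of_exponent_le hK ?_
    have : (j : ℝ) ≤ 11 := by exact_mod_cast hj
    linarith
  have hkj : ∀ j : ℕ, ((3 : ℝ) ^ 104 * k) ^ j ≤ (3 ^ 105) ^ j * K ^ j := by
    intro j
    rw [← mul_pow]
    refine pow_le_pow_left₀ (by positivity) ?_ j
    calc (3 : ℝ) ^ 104 * k ≤ 3 ^ 104 * (3 * K) := by gcongr
      _ = 3 ^ 105 * K := by ring
  have hbig : 10 ^ 17 * (3 ^ 104 * k) ^ 11 ≤ A.card := by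
    rw [hA, hPn]
    have : (10 : ℝ) ^ 17 * (3 ^ 104 * k) ^ 11 ≤ n := by
      refine le_trans ?_ hn
      calc (10 : ℝ) ^ 17 * (3 ^ 104 * k) ^ 11 ≤ 10 ^ 17 * ((3 ^ 105) ^ 11 * K ^ 11) :=
            mul_le_mul_of_nonneg_left (hkj 11) (by positivity)
        _ = (10 ^ 17 * (3 ^ 105) ^ 11) * K ^ 11 := by rw [mul_assoc]
        _ ≤ C * K ^ C := mul_le_mul hC2 (hKC 11 le_rfl) (by positivity) (by linarith)
        _ ≤ Real.exp (C * K ^ C) := by linarith [Real.add_one_le_exp (C * K ^ C)]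
        _ ≤ _ := by linarith [Real.add_one_le_exp (Real.exp (C * K ^ C))]
    exact_mod_cast this
  have hN2 : WS.N2 A b ≤ k * A.card := by
    refine hN.trans ?_
    rw [hA, hPn]
    have : (numOrdinaryLines P : ℝ) ≤ k * n := hord.trans (by gcongr)
    exact_mod_cast this
  obtain ⟨g, g0, gd, gc⟩ := WS.affine_main2 hk1 hN2 hbig
  obtain ⟨Z, hZ, hZc⟩ := hg g g0 gd
  refine ⟨Z, hZ, ?_⟩
  calc ((P \ Z).ncard : ℝ) ≤ ((10 ^ 6 * (3 ^ 104 * k) ^ 3 : ℕ) : ℝ) := by exact_mod_cast hZc.trans gc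
    _ = 10 ^ 6 * (3 ^ 104 * k) ^ 3 := by push_cast; ring
    _ ≤ 10 ^ 6 * ((3 ^ 105) ^ 3 * K ^ 3) := mul_le_mul_of_nonneg_left (hkj 3) (by positivity)
    _ = (10 ^ 6 * (3 ^ 105) ^ 3) * K ^ 3 := by rw [mul_assoc]
    _ ≤ C * K ^ C := mul_le_mul hC3 (hKC 3 (by norm_num)) (by positivity) (by linarith)
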